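/- Suppose the two-sided sequence λ ∈ {−1,1}^ℤ (the Liouville function extended symmetrically by λ(−n) := λ(n) and λ(0) := 0) is generic under the left shift S for a Borel probability measure κ on {−1,0,1}^ℤ, i.e., (1/N) Σ_{n≤N} δ_{S^n λ} → κ in the weak-* topology, and that κ is ergodic for S. Then the Chowla conjecture holds for λ: for every r ≥ 0 and all integers 0 ≤ k_0 < k_1 < ... < k_r, lim_{N→∞} (1/N) Σ_{n≤N} ∏_{i=0}^{r} λ(n+k_i) = 0. -/

import Mathlib

open Filter Topology MeasureTheory

/-- The Liouville function `λ(n) = (-1)^Ω(n)`. -/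
def liouville (n : ℕ) : ℤ := (-1) ^ (ArithmeticFunction.cardFactors n)

/-- The sequence space `{-1,0,1}^ℤ`. -/
abbrev SymbolSpace : Type := ℤ → ({-1, 0, 1} : Set ℤ)

/-- The left shift on a two-sided sequence space. -/
def shift {α : Type*} (x : ℤ → α) : ℤ → α := fun n => x (n + 1)

/-- The Liouville function extended to `ℤ` symmetrically by `λ(−n) := λ(n)` and
`λ(0) := 0`, viewed as a point of `{-1,0,1}^ℤ`. -/
def liouvillePoint : SymbolSpace := fun n =>
  ⟨if n = 0 then 0 else liouville n.natAbs, by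
    unfold liouville
    split_ifs
    · simp
    · rcases Nat.even_or_odd (ArithmeticFunction.cardFactors n.natAbs) with h | h
      · simp [h.neg_one_pow]
      · simp [h.neg_one_pow]⟩

set_option linter.unusedSectionVars false

open Finset

section FiniteInequalities

open Real

theorem negMulLog_sum_le {ι : Type*} (s : Finset ι) (p : ι → ℝ) (hp : ∀ i ∈ s, 0 ≤ p i) :
    negMulLog (∑ i ∈ s, p i) ≤ ∑ i ∈ s, negMulLog (p i) := by
  have h : negMulLog (∑ i ∈ s, p i) = ∑ i ∈ s, -(p i) * log (∑ j ∈ s, p j) := by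
    rw [negMulLog, ← sum_neg_distrib, sum_mul]
  rw [h]
  refine sum_le_sum fun i hi => ?_
  rw [negMulLog]
  rcases (hp i hi).eq_or_lt with h0 | h0
  · simp [← h0]
  · have := log_le_log h0 (single_le_sum hp hi)
    nlinarith

theorem strong_subadditivity_aux {p a b c : ℝ} (hp : 0 ≤ p) (ha : p ≤ a) (hb : p ≤ b) (hc : a ≤ c) :
    p * (log a + log b - log p - log c) ≤ a * b / c - p := by
  rcases hp.eq_or_lt with h0 | h0
  · subst h0
    have hc' := ha.trans hc
    simp only [zero_mul, sub_zero]; positivity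
  · have ha' : 0 < a := h0.trans_le ha
    have hb' : 0 < b := h0.trans_le hb
    have hc' : 0 < c := ha'.trans_le hc
    have h1 : log (a * b / (p * c)) ≤ a * b / (p * c) - 1 := log_le_sub_one_of_pos (by positivity)
    have h2 : log (a * b / (p * c)) = log a + log b - log p - log c := by
      rw [log_div (by positivity) (by positivity), log_mul (by positivity) (by positivity),
        log_mul (by positivity) (by positivity)]; ring
    rw [h2] at h1
    calc _ ≤ p * (a * b / (p * c) - 1) := by gcongr
      _ = _ := by field_simp

theorem strong_subadditivity_finite {α β γ : Type*} [Fintype α] [Fintype β] [Fintype γ]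
    (p : α → β → γ → ℝ) (hp : ∀ a b c, 0 ≤ p a b c) :
    (∑ a, ∑ b, ∑ c, negMulLog (p a b c)) + ∑ c, negMulLog (∑ a, ∑ b, p a b c) ≤
      (∑ a, ∑ c, negMulLog (∑ b, p a b c)) + ∑ b, ∑ c, negMulLog (∑ a, p a b c) := by
  set A : α → γ → ℝ := fun a c => ∑ b, p a b c with hA
  set B : β → γ → ℝ := fun b c => ∑ a, p a b c with hB
  set C : γ → ℝ := fun c => ∑ a, ∑ b, p a b c with hC
  have hCA : ∀ c, C c = ∑ a, A a c := fun c => rfl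
  have hCB : ∀ c, C c = ∑ b, B b c := fun c => sum_comm
  have hA0 : ∀ a c, 0 ≤ A a c := fun a c => sum_nonneg fun b _ => hp a b c
  have hAC : ∀ a c, A a c ≤ C c := fun a c =>
    (hCA c) ▸ single_le_sum (f := fun a => A a c) (fun a _ => hA0 a c) (mem_univ a)
  have hpA : ∀ a b c, p a b c ≤ A a c := fun a b c =>
    single_le_sum (f := fun b => p a b c) (fun b _ => hp a b c) (mem_univ b)
  have hpB : ∀ a b c, p a b c ≤ B b c := fun a b c =>
    single_le_sum (f := fun a => p a b c) (fun a _ => hp a b c) (mem_univ a)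
  have e1 : ∑ c, negMulLog (C c) = ∑ a, ∑ b, ∑ c, -(p a b c * log (C c)) := by
    rw [sum_congr rfl fun a _ => sum_comm, sum_comm]
    refine sum_congr rfl fun c _ => ?_
    simp only [negMulLog, sum_neg_distrib, ← sum_mul]
    simp [hC]
  have e2 : ∑ a, ∑ c, negMulLog (A a c) = ∑ a, ∑ b, ∑ c, -(p a b c * log (A a c)) := by
    refine sum_congr rfl fun a _ => ?_
    rw [sum_comm]
    refine sum_congr rfl fun c _ => ?_
    simp only [negMulLog, sum_neg_distrib, ← sum_mul]
    simp [hA]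
  have e3 : ∑ b, ∑ c, negMulLog (B b c) = ∑ a, ∑ b, ∑ c, -(p a b c * log (B b c)) := by
    rw [sum_comm (f := fun a b => ∑ c, -(p a b c * log (B b c)))]
    refine sum_congr rfl fun b _ => ?_
    rw [sum_comm]
    refine sum_congr rfl fun c _ => ?_
    simp only [negMulLog, sum_neg_distrib, ← sum_mul]
    simp [hB]
  have e4 : ∑ a, ∑ b, ∑ c, (A a c * B b c / C c - p a b c) ≤ 0 := by
    have : ∑ a, ∑ b, ∑ c, (A a c * B b c / C c - p a b c) =
        ∑ c, (C c * C c / C c - C c) := by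
      rw [sum_congr rfl fun a _ => sum_comm, sum_comm]
      refine sum_congr rfl fun c _ => ?_
      simp only [sum_sub_distrib, ← sum_div, ← mul_sum, ← sum_mul,
        ← hCB, ← hCA]
      rfl
    rw [this]
    refine sum_nonpos fun c _ => ?_
    by_cases h : C c = 0
    · simp [h]
    · rw [mul_div_assoc, div_self h]; simp
  have e5 : ∑ a, ∑ b, ∑ c, p a b c * (log (A a c) + log (B b c) - log (p a b c) - log (C c)) ≤
      ∑ a, ∑ b, ∑ c, (A a c * B b c / C c - p a b c) :=
    sum_le_sum fun a _ => sum_le_sum fun b _ => sum_le_sum fun c _ =>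
      strong_subadditivity_aux (hp a b c) (hpA a b c) (hpB a b c) (hAC a c)
  change _ + ∑ c, negMulLog (C c) ≤ ∑ a, ∑ c, negMulLog (A a c) + ∑ b, ∑ c, negMulLog (B b c)
  rw [e1, e2, e3]
  have e6 : ∑ a, ∑ b, ∑ c, p a b c * (log (A a c) + log (B b c) - log (p a b c) - log (C c)) =
      (∑ a, ∑ b, ∑ c, negMulLog (p a b c)) + (∑ a, ∑ b, ∑ c, -(p a b c * log (C c)))
      - (∑ a, ∑ b, ∑ c, -(p a b c * log (A a c))) - ∑ a, ∑ b, ∑ c, -(p a b c * log (B b c)) := by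
    simp only [← sum_add_distrib, ← sum_sub_distrib]
    refine sum_congr rfl fun a _ => sum_congr rfl fun b _ =>
      sum_congr rfl fun c _ => ?_
    rw [negMulLog]; ring
  linarith

theorem hellinger_aux {p q : ℝ} (hp : 0 ≤ p) (hq : 0 < p → 0 < q) :
    2 * p - 2 * (√p * √q) ≤ p * (log p - log q) := by
  rcases hp.eq_or_lt with h0 | h0
  · subst h0; simp
  · have hq' := hq h0
    have h1 : log (√q / √p) ≤ √q / √p - 1 := log_le_sub_one_of_pos (by positivity)
    rw [log_div (by positivity) (by positivity), log_sqrt hq'.le, log_sqrt h0.le] at h1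
    have h2 : p * (√q / √p) = √p * √q := by
      have : p = √p * √p := (mul_self_sqrt h0.le).symm
      have h3 : √p ≠ 0 := by positivity
      calc p * (√q / √p) = (√p * √p) * (√q / √p) := by rw [← this]
        _ = _ := by field_simp
    nlinarith [mul_le_mul_of_nonneg_left h1 hp]

theorem total_variation_le_of_entropy {α β : Type*} [Fintype α] [Fintype β] (p : α → β → ℝ)
    (hp : ∀ a b, 0 ≤ p a b) (hsum : ∑ a, ∑ b, p a b = 1) {I : ℝ}
    (hI : (∑ a, negMulLog (∑ b, p a b)) + (∑ b, negMulLog (∑ a, p a b))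
      - ∑ a, ∑ b, negMulLog (p a b) ≤ I) :
    ∑ a, ∑ b, |p a b - (∑ b', p a b') * ∑ a', p a' b| ≤ 2 * √I := by
  set A : α → ℝ := fun a => ∑ b, p a b with hA
  set B : β → ℝ := fun b => ∑ a, p a b with hB
  have hA0 : ∀ a, 0 ≤ A a := fun a => sum_nonneg fun b _ => hp a b
  have hB0 : ∀ b, 0 ≤ B b := fun b => sum_nonneg fun a _ => hp a b
  have hpA : ∀ a b, p a b ≤ A a := fun a b =>
    single_le_sum (f := fun b => p a b) (fun b _ => hp a b) (mem_univ b)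
  have hpB : ∀ a b, p a b ≤ B b := fun a b =>
    single_le_sum (f := fun a => p a b) (fun a _ => hp a b) (mem_univ a)
  have hAs : ∑ a, A a = 1 := hsum
  have hBs : ∑ b, B b = 1 := by rw [← hsum, sum_comm]
  have hABs : ∑ a, ∑ b, A a * B b = 1 := by simp [← mul_sum, hBs, hAs]
  have e1 : ∑ a, negMulLog (A a) = ∑ a, ∑ b, -(p a b * log (A a)) := by
    refine sum_congr rfl fun a _ => ?_
    simp only [negMulLog, sum_neg_distrib, ← sum_mul]; simp [hA]
  have e2 : ∑ b, negMulLog (B b) = ∑ a, ∑ b, -(p a b * log (B b)) := by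
    rw [sum_comm]
    refine sum_congr rfl fun b _ => ?_
    simp only [negMulLog, sum_neg_distrib, ← sum_mul]; simp [hB]
  have e3 : ∑ a, ∑ b, (√(p a b) - √(A a * B b)) ^ 2 ≤ I := by
    refine le_trans ?_ hI
    change _ ≤ ∑ a, negMulLog (A a) + ∑ b, negMulLog (B b) - _
    have e4 : ∑ a, ∑ b, (√(p a b) - √(A a * B b)) ^ 2
        = ∑ a, ∑ b, (2 * p a b - 2 * (√(p a b) * √(A a * B b))) := by
      have : ∑ a, ∑ b, (√(p a b) - √(A a * B b)) ^ 2
        = ∑ a, ∑ b, (2 * p a b - 2 * (√(p a b) * √(A a * B b))) +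
          (∑ a, ∑ b, A a * B b - ∑ a, ∑ b, p a b) := by
        simp only [← sum_add_distrib, ← sum_sub_distrib]
        refine sum_congr rfl fun a _ => sum_congr rfl fun b _ => ?_
        rw [sub_sq, sq_sqrt (hp a b), sq_sqrt (mul_nonneg (hA0 a) (hB0 b))]; ring
      rw [this, hABs, hsum]; simp
    rw [e4, e1, e2]
    simp only [← sum_add_distrib, ← sum_sub_distrib]
    refine sum_le_sum fun a _ => sum_le_sum fun b _ => ?_
    rcases (hp a b).eq_or_lt with h0 | h0
    · simp [← h0]
    · have ha := h0.trans_le (hpA a b)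
      have hb := h0.trans_le (hpB a b)
      refine (hellinger_aux (hp a b) fun _ => mul_pos ha hb).trans (le_of_eq ?_)
      rw [log_mul ha.ne' hb.ne', negMulLog]; ring
  have hI0 : 0 ≤ I := le_trans (by positivity) e3
  have e5 : (∑ x : α × β, |p x.1 x.2 - A x.1 * B x.2|) ^ 2 ≤ I * 4 := by
    have h1 : ∀ x : α × β, |p x.1 x.2 - A x.1 * B x.2| =
        |√(p x.1 x.2) - √(A x.1 * B x.2)| * (√(p x.1 x.2) + √(A x.1 * B x.2)) := by
      intro x
      rw [← abs_of_nonneg (a := √(p x.1 x.2) + √(A x.1 * B x.2)) (by positivity), ← abs_mul]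
      congr 1
      have h2 := mul_self_sqrt (hp x.1 x.2)
      have h3 := mul_self_sqrt (mul_nonneg (hA0 x.1) (hB0 x.2))
      linear_combination -h2 + h3
    rw [sum_congr rfl fun x _ => h1 x]
    refine (sum_mul_sq_le_sq_mul_sq _ _ _).trans ?_
    have h4 : ∑ x : α × β, (√(p x.1 x.2) + √(A x.1 * B x.2)) ^ 2 ≤ 4 := by
      calc _ ≤ ∑ x : α × β, (2 * p x.1 x.2 + 2 * (A x.1 * B x.2)) := by
            refine sum_le_sum fun x _ => ?_
            have h2 := sq_sqrt (hp x.1 x.2)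
            have h3 := sq_sqrt (mul_nonneg (hA0 x.1) (hB0 x.2))
            nlinarith [sq_nonneg (√(p x.1 x.2) - √(A x.1 * B x.2))]
        _ = 4 := by
            rw [Fintype.sum_prod_type]
            simp only [sum_add_distrib, ← mul_sum]
            rw [hBs, show (∑ i, ∑ j, p i j) = 1 from hsum]; simp only [mul_one, hAs]
            norm_num
    have h5 : ∑ x : α × β, |√(p x.1 x.2) - √(A x.1 * B x.2)| ^ 2 ≤ I := by
      rw [Fintype.sum_prod_type]; simpa only [sq_abs] using e3
    exact mul_le_mul h5 h4 (sum_nonneg fun _ _ => sq_nonneg _) hI0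
  rw [← Fintype.sum_prod_type (f := fun x : α × β => |p x.1 x.2 - A x.1 * B x.2|)]
  refine (abs_le_of_sq_le_sq' (b := 2 * √I) ?_ (by positivity)).2
  rw [mul_pow, sq_sqrt hI0]; linarith

end FiniteInequalities

section Entropy

variable {Ω : Type*} [MeasurableSpace Ω] {α β γ : Type*}

/-- A map into a discrete space whose fibres are measurable. -/
def FiberMeasurable (A : Ω → α) : Prop := ∀ a, MeasurableSet (A ⁻¹' {a})

theorem FiberMeasurable.prodMk {A : Ω → α} {B : Ω → β} (hA : FiberMeasurable A)
    (hB : FiberMeasurable B) : FiberMeasurable fun ω => (A ω, B ω) := by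
  rintro ⟨a, b⟩
  have : (fun ω => (A ω, B ω)) ⁻¹' {(a, b)} = A ⁻¹' {a} ∩ B ⁻¹' {b} := by
    ext; simp [Prod.ext_iff]
  rw [this]; exact (hA a).inter (hB b)

theorem FiberMeasurable.pi {ι : Type*} [Fintype ι] {π : ι → Type*} {A : ∀ i, Ω → π i}
    (hA : ∀ i, FiberMeasurable (A i)) : FiberMeasurable fun ω i => A i ω := by
  intro a
  have : (fun ω i => A i ω) ⁻¹' {a} = ⋂ i, A i ⁻¹' {a i} := by
    ext; simp [funext_iff]
  rw [this]; exact MeasurableSet.iInter fun i => hA i _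

theorem FiberMeasurable.comp {T : Ω → Ω} {A : Ω → α} (hA : FiberMeasurable A)
    (hT : Measurable T) : FiberMeasurable (A ∘ T) := fun a => hT (hA a)

theorem FiberMeasurable.preimage [Finite α] {A : Ω → α} (hA : FiberMeasurable A) (s : Set α) :
    MeasurableSet (A ⁻¹' s) := by
  have : A ⁻¹' s = ⋃ a ∈ s, A ⁻¹' {a} := by ext; simp
  rw [this]; exact MeasurableSet.biUnion (Set.to_countable s) fun a _ => hA a

theorem FiberMeasurable.map [Finite α] {A : Ω → α} (hA : FiberMeasurable A) (g : α → β) :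
    FiberMeasurable (fun ω => g (A ω)) := fun b => hA.preimage (g ⁻¹' {b})

theorem FiberMeasurable.measurable [Finite α] {A : Ω → α} (hA : FiberMeasurable A) [MeasurableSpace β]
    (g : α → β) : Measurable (fun ω => g (A ω)) := fun s _ => hA.preimage (g ⁻¹' s)

variable (μ : Measure Ω)

/-- Shannon entropy of a finite-valued random variable. -/
noncomputable def entropy [Fintype α] (A : Ω → α) : ℝ :=
  ∑ a, Real.negMulLog (μ.real (A ⁻¹' {a}))

noncomputable def mutualInfo [Fintype α] [Fintype β] (A : Ω → α) (B : Ω → β) : ℝ :=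
  entropy μ A + entropy μ B - entropy μ fun ω => (A ω, B ω)

variable {μ}

theorem entropy_congr [Fintype α] {A A' : Ω → α} (h : A =ᵐ[μ] A') : entropy μ A = entropy μ A' := by
  refine sum_congr rfl fun a _ => ?_
  congr 1
  exact measureReal_congr (h.preimage {a})

theorem entropy_comp_measurePreserving [Fintype α] {T : Ω → Ω} (hT : MeasurePreserving T μ μ)
    {A : Ω → α} (hA : FiberMeasurable A) : entropy μ (fun ω => A (T ω)) = entropy μ A := by
  refine sum_congr rfl fun a _ => ?_
  congr 1
  exact hT.measureReal_preimage (hA a).nullMeasurableSet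

variable [IsProbabilityMeasure μ]

theorem sum_measureReal_inter_fiber [Fintype β] {B : Ω → β} (hB : FiberMeasurable B)
    {S : Set Ω} (hS : MeasurableSet S) : ∑ b, μ.real (S ∩ B ⁻¹' {b}) = μ.real S := by
  rw [← measureReal_biUnion_finset]
  · congr 1; ext; simp
  · intro b _ b' _ h
    refine Set.disjoint_left.2 fun ω h1 h2 => h ?_
    simp only [Set.mem_inter_iff, Set.mem_preimage, Set.mem_singleton_iff] at h1 h2
    exact h1.2.symm.trans h2.2
  · intro b _; exact hS.inter (hB b)

theorem sum_measureReal_fiber [Fintype β] {B : Ω → β} (hB : FiberMeasurable B) :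
    ∑ b, μ.real (B ⁻¹' {b}) = 1 := by
  simpa using sum_measureReal_inter_fiber (μ := μ) hB MeasurableSet.univ

theorem entropy_le_of_eq_comp [Fintype α] [Fintype β] {A : Ω → α} {B : Ω → β}
    (hB : FiberMeasurable B) (g : β → α) (h : A =ᵐ[μ] fun ω => g (B ω)) :
    entropy μ A ≤ entropy μ B := by
  classical
  rw [entropy_congr h]
  have h1 : ∀ a, μ.real ((fun ω => g (B ω)) ⁻¹' {a}) = ∑ b with g b = a, μ.real (B ⁻¹' {b}) := by
    intro a
    rw [← measureReal_biUnion_finset]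
    · congr 1; ext; simp
    · intro b _ b' _ h
      exact Set.disjoint_left.2 fun ω h1 h2 => h (by
        simp only [Set.mem_preimage, Set.mem_singleton_iff] at h1 h2; exact h1.symm.trans h2)
    · intro b _; exact hB b
  calc entropy μ (fun ω => g (B ω)) ≤ ∑ a, ∑ b with g b = a, Real.negMulLog (μ.real (B ⁻¹' {b})) := by
        refine sum_le_sum fun a _ => ?_
        rw [h1]; exact negMulLog_sum_le _ _ fun _ _ => measureReal_nonneg
    _ = _ := sum_fiberwise _ _ _

theorem entropy_strong_subadditivity [Fintype α] [Fintype β] [Fintype γ] {A : Ω → α} {B : Ω → β}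
    {C : Ω → γ} (hA : FiberMeasurable A) (hB : FiberMeasurable B) (hC : FiberMeasurable C) :
    entropy μ (fun ω => (A ω, B ω, C ω)) + entropy μ C ≤
      entropy μ (fun ω => (A ω, C ω)) + entropy μ fun ω => (B ω, C ω) := by
  set p : α → β → γ → ℝ := fun a b c => μ.real ((A ⁻¹' {a} ∩ B ⁻¹' {b}) ∩ C ⁻¹' {c})
  have h := strong_subadditivity_finite p fun _ _ _ => measureReal_nonneg
  have h1 : ∀ a c, ∑ b, p a b c = μ.real (A ⁻¹' {a} ∩ C ⁻¹' {c}) := fun a c => by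
    rw [← sum_measureReal_inter_fiber hB ((hA a).inter (hC c))]
    exact sum_congr rfl fun b _ => by
      show μ.real _ = _; congr 1; rw [Set.inter_right_comm]
  have h2 : ∀ b c, ∑ a, p a b c = μ.real (B ⁻¹' {b} ∩ C ⁻¹' {c}) := fun b c => by
    rw [← sum_measureReal_inter_fiber hA ((hB b).inter (hC c))]
    exact sum_congr rfl fun a _ => by
      show μ.real _ = _; congr 1; rw [Set.inter_assoc, Set.inter_comm]
  have h3 : ∀ c, ∑ a, ∑ b, p a b c = μ.real (C ⁻¹' {c}) := fun c => by
    simp only [h1]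
    rw [← sum_measureReal_inter_fiber hA (hC c)]
    exact sum_congr rfl fun a _ => by rw [Set.inter_comm]
  simp only [h3] at h
  simp only [h1, h2] at h
  have k1 : entropy μ (fun ω => (A ω, B ω, C ω)) =
      ∑ a, ∑ b, ∑ c, Real.negMulLog (p a b c) := by
    simp only [entropy, Fintype.sum_prod_type]
    refine sum_congr rfl fun a _ => sum_congr rfl fun b _ =>
      sum_congr rfl fun c _ => ?_
    congr 2; ext; simp [and_assoc]
  have k2 : entropy μ (fun ω => (A ω, C ω)) =
      ∑ a, ∑ c, Real.negMulLog (μ.real (A ⁻¹' {a} ∩ C ⁻¹' {c})) := by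
    simp only [entropy, Fintype.sum_prod_type]
    refine sum_congr rfl fun a _ => sum_congr rfl fun b _ => ?_
    congr 2; ext; simp
  have k3 : entropy μ (fun ω => (B ω, C ω)) =
      ∑ b, ∑ c, Real.negMulLog (μ.real (B ⁻¹' {b} ∩ C ⁻¹' {c})) := by
    simp only [entropy, Fintype.sum_prod_type]
    refine sum_congr rfl fun a _ => sum_congr rfl fun b _ => ?_
    congr 2; ext; simp
  rw [k1, k2, k3]; exact h

theorem entropy_prod_of_indep [Fintype α] [Fintype β] {A : Ω → α} {B : Ω → β}
    (hA : FiberMeasurable A) (hB : FiberMeasurable B)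
    (h : ∀ a b, μ.real (A ⁻¹' {a} ∩ B ⁻¹' {b}) = μ.real (A ⁻¹' {a}) * μ.real (B ⁻¹' {b})) :
    entropy μ (fun ω => (A ω, B ω)) = entropy μ A + entropy μ B := by
  have k2 : entropy μ (fun ω => (A ω, B ω)) =
      ∑ a, ∑ b, Real.negMulLog (μ.real (A ⁻¹' {a}) * μ.real (B ⁻¹' {b})) := by
    simp only [entropy, Fintype.sum_prod_type]
    refine sum_congr rfl fun a _ => sum_congr rfl fun b _ => ?_
    rw [← h]
    congr 2; ext; simp
  rw [k2]
  simp only [Real.negMulLog_mul, sum_add_distrib, ← sum_mul, ← mul_sum]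
  rw [sum_measureReal_fiber hB, sum_measureReal_fiber hA, one_mul, one_mul]
  rfl

theorem mutualInfo_le_of_eq_comp [Fintype α] [Fintype β] [Fintype γ] {A : Ω → α} {B : Ω → β}
    {C : Ω → γ} (hA : FiberMeasurable A) (hB : FiberMeasurable B) (hC : FiberMeasurable C)
    (g : α → γ) (h : C =ᵐ[μ] fun ω => g (A ω)) : mutualInfo μ C B ≤ mutualInfo μ A B := by
  have h1 := entropy_strong_subadditivity (μ := μ) hA hB hC
  have h2 : entropy μ (fun ω => (A ω, C ω)) ≤ entropy μ A :=
    entropy_le_of_eq_comp hA (fun a => (a, g a)) (by filter_upwards [h] with ω hω; simp [hω])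
  have h3 : entropy μ (fun ω => (A ω, B ω)) ≤ entropy μ (fun ω => (A ω, B ω, C ω)) :=
    entropy_le_of_eq_comp (hA.prodMk (hB.prodMk hC)) (fun a => (a.1, a.2.1)) (ae_of_all _ fun _ => rfl)
  have h4 : entropy μ (fun ω => (B ω, C ω)) ≤ entropy μ (fun ω => (C ω, B ω)) :=
    entropy_le_of_eq_comp (hC.prodMk hB) (fun a => (a.2, a.1)) (ae_of_all _ fun _ => rfl)
  unfold mutualInfo
  linarith

/-- Closeness of a joint distribution to the product distribution in terms of the mutual
information. -/
theorem norm_integral_sub_sum_le_of_mutualInfo [Fintype α] [Fintype β] {A : Ω → α} {B : Ω → β}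
    (hA : FiberMeasurable A) (hB : FiberMeasurable B) {I : ℝ} (hI : mutualInfo μ A B ≤ I)
    (F : α → β → ℂ) (hF : ∀ a b, ‖F a b‖ ≤ 1) :
    ‖∫ ω, F (A ω) (B ω) ∂μ -
      ∑ a, ∑ b, (μ.real (A ⁻¹' {a}) : ℂ) * (μ.real (B ⁻¹' {b}) : ℂ) * F a b‖ ≤ 2 * √I := by
  classical
  set p : α → β → ℝ := fun a b => μ.real (A ⁻¹' {a} ∩ B ⁻¹' {b})
  have h1 : ∀ a, ∑ b, p a b = μ.real (A ⁻¹' {a}) := fun a => sum_measureReal_inter_fiber hB (hA a)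
  have h2 : ∀ b, ∑ a, p a b = μ.real (B ⁻¹' {b}) := fun b => by
    rw [← sum_measureReal_inter_fiber hA (hB b)]
    exact sum_congr rfl fun a _ => by show μ.real _ = _; rw [Set.inter_comm]
  have k2 : entropy μ (fun ω => (A ω, B ω)) = ∑ a, ∑ b, Real.negMulLog (p a b) := by
    simp only [entropy, Fintype.sum_prod_type]
    refine sum_congr rfl fun a _ => sum_congr rfl fun b _ => ?_
    congr 2; ext; simp
  have h3 := total_variation_le_of_entropy p (fun _ _ => measureReal_nonneg)
    (by simp only [h1]; exact sum_measureReal_fiber hA) (I := I) (by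
      simp only [h1, h2]; rw [← k2]; exact hI)
  simp only [h1, h2] at h3
  have h4 : ∫ ω, F (A ω) (B ω) ∂μ = ∑ a, ∑ b, (p a b : ℂ) * F a b := by
    have e : ∀ ω, F (A ω) (B ω) = ∑ a, ∑ b,
        (A ⁻¹' {a} ∩ B ⁻¹' {b}).indicator (fun _ => F a b) ω := by
      intro ω
      rw [sum_eq_single (A ω), sum_eq_single (B ω)]
      · simp
      · intro b _ hb; simp [hb.symm]
      · simp
      · intro a _ ha; refine sum_eq_zero fun b _ => ?_; simp [ha.symm]
      · simp
    simp only [e]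
    rw [integral_finsetSum]
    · refine sum_congr rfl fun a _ => ?_
      rw [integral_finsetSum]
      · refine sum_congr rfl fun b _ => ?_
        rw [integral_indicator_const _ ((hA a).inter (hB b)), Complex.real_smul]
      · intro b _; exact (integrable_const _).indicator ((hA a).inter (hB b))
    · intro a _
      exact integrable_finsetSum _ fun b _ => (integrable_const _).indicator ((hA a).inter (hB b))
  rw [h4]
  simp only [← sum_sub_distrib, ← sub_mul]
  refine le_trans ?_ h3
  refine (norm_sum_le _ _).trans (sum_le_sum fun a _ => (norm_sum_le _ _).trans
    (sum_le_sum fun b _ => ?_))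
  rw [norm_mul, ← Complex.ofReal_mul, ← Complex.ofReal_sub, Complex.norm_real, Real.norm_eq_abs]
  exact mul_le_of_le_one_right (abs_nonneg _) (hF a b)

/-- The word of length `L` read by `ξ` along the orbit. -/
def orbitWord (T : Ω → Ω) (ξ : Ω → α) (L : ℕ) (ω : Ω) : Fin L → α := fun i => ξ (T^[i] ω)

theorem fiberMeasurable_orbitWord {T : Ω → Ω} (hT : Measurable T) {ξ : Ω → α}
    (hξ : FiberMeasurable ξ) (L : ℕ) : FiberMeasurable (orbitWord T ξ L) :=
  FiberMeasurable.pi (A := fun (i : Fin L) ω => ξ (T^[i] ω)) fun i => hξ.comp (hT.iterate i)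

theorem entropy_orbitWord_add_le [Fintype α] [Fintype β] {T : Ω → Ω} (hT : MeasurePreserving T μ μ)
    {ξ : Ω → α} (hξ : FiberMeasurable ξ) {Z : Ω → β} (hZ : FiberMeasurable Z)
    (hstep : ∃ φ : α → β → β, ∀ᵐ ω ∂μ, Z (T ω) = φ (ξ ω) (Z ω)) (L K : ℕ) :
    entropy μ (fun ω => (orbitWord T ξ (L + K) ω, Z ω)) - entropy μ Z ≤
      (entropy μ (fun ω => (orbitWord T ξ L ω, Z ω)) - entropy μ Z) +
      (entropy μ (fun ω => (orbitWord T ξ K ω, Z ω)) - entropy μ Z) := by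
  obtain ⟨φ, hφ⟩ := hstep
  have hTL := hT.iterate L
  set X := orbitWord T ξ L
  set X' : Ω → Fin K → α := fun ω => orbitWord T ξ K (T^[L] ω)
  set Z' : Ω → β := fun ω => Z (T^[L] ω)
  have hX : FiberMeasurable X := fiberMeasurable_orbitWord hT.measurable hξ L
  have hX' : FiberMeasurable X' := (fiberMeasurable_orbitWord hT.measurable hξ K).comp hTL.measurable
  have hZ' : FiberMeasurable Z' := hZ.comp hTL.measurable
  have hdet : ∃ ψ : (Fin L → α) → β → β, ∀ᵐ ω ∂μ, Z' ω = ψ (X ω) (Z ω) := by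
    have : ∀ M ≤ L, ∃ ψ : (Fin L → α) → β → β, ∀ᵐ ω ∂μ, Z (T^[M] ω) = ψ (X ω) (Z ω) := by
      intro M
      induction M with
      | zero => intro _; exact ⟨fun _ z => z, ae_of_all _ fun _ => rfl⟩
      | succ M ih =>
        intro hM
        obtain ⟨ψ, hψ⟩ := ih (by omega)
        refine ⟨fun x z => φ (x ⟨M, by omega⟩) (ψ x z), ?_⟩
        filter_upwards [hψ, (hT.iterate M).quasiMeasurePreserving.ae hφ] with ω h1 h2
        rw [Function.iterate_succ_apply', h2, h1]; rfl
    exact this L le_rfl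
  obtain ⟨ψ, hψ⟩ := hdet
  have e1 : entropy μ (fun ω => (orbitWord T ξ (L + K) ω, Z ω)) ≤
      entropy μ (fun ω => ((X ω, Z ω), X' ω, Z' ω)) := by
    refine entropy_le_of_eq_comp ((hX.prodMk hZ).prodMk (hX'.prodMk hZ'))
      (fun q => (Fin.append q.1.1 q.2.1, q.1.2)) (ae_of_all _ fun ω => ?_)
    refine Prod.ext ?_ rfl
    funext i
    refine Fin.addCases (fun i => ?_) (fun i => ?_) i
    · simp [X, orbitWord]
    · simp [X', orbitWord, ← Function.iterate_add_apply, add_comm]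
  have e2 := entropy_strong_subadditivity (μ := μ) (hX.prodMk hZ) hX' hZ'
  have e3 : entropy μ (fun ω => ((X ω, Z ω), Z' ω)) ≤ entropy μ (fun ω => (X ω, Z ω)) :=
    entropy_le_of_eq_comp (hX.prodMk hZ) (fun q => (q, ψ q.1 q.2))
      (by filter_upwards [hψ] with ω h; rw [h])
  have e4 : entropy μ Z' = entropy μ Z := entropy_comp_measurePreserving hTL hZ
  have e5 : entropy μ (fun ω => (X' ω, Z' ω)) = entropy μ (fun ω => (orbitWord T ξ K ω, Z ω)) :=
    entropy_comp_measurePreserving hTL ((fiberMeasurable_orbitWord hT.measurable hξ K).prodMk hZ)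
  linarith

theorem entropy_orbitWord_mul_le [Fintype α] [Fintype β] {T : Ω → Ω} (hT : MeasurePreserving T μ μ)
    {ξ : Ω → α} (hξ : FiberMeasurable ξ) {Z : Ω → β} (hZ : FiberMeasurable Z)
    (hstep : ∃ φ : α → β → β, ∀ᵐ ω ∂μ, Z (T ω) = φ (ξ ω) (Z ω)) (L k : ℕ) (hk : 1 ≤ k) :
    entropy μ (fun ω => (orbitWord T ξ (L * k) ω, Z ω)) - entropy μ Z ≤
      k * (entropy μ (fun ω => (orbitWord T ξ L ω, Z ω)) - entropy μ Z) := by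
  induction k, hk using Nat.le_induction with
  | base => rw [mul_one, Nat.cast_one, one_mul]
  | succ k hk ih =>
    have := entropy_orbitWord_add_le hT hξ hZ hstep (L * k) L
    rw [mul_add, mul_one]; push_cast; linarith

/-- Entropy decrement: variables `Z n` that evolve along the orbit in a way determined by `ξ`
and are successively independent have, for most `n`, little mutual information with the word
of length `C * n`. -/
theorem summable_mutualInfo_orbitWord [Fintype α] {T : Ω → Ω} (hT : MeasurePreserving T μ μ)
    {ξ : Ω → α} (hξ : FiberMeasurable ξ) {ζ : ℕ → Type} [∀ n, Fintype (ζ n)] (Z : ∀ n, Ω → ζ n)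
    (hZ : ∀ n, FiberMeasurable (Z n))
    (hstep : ∀ n, ∃ φ : α → ζ n → ζ n, ∀ᵐ ω ∂μ, Z n (T ω) = φ (ξ ω) (Z n ω))
    (hind : ∀ n z (w : ∀ i : Fin n, ζ i),
      μ.real (Z n ⁻¹' {z} ∩ (fun ω (i : Fin n) => Z i ω) ⁻¹' {w}) =
        μ.real (Z n ⁻¹' {z}) * μ.real ((fun ω (i : Fin n) => Z i ω) ⁻¹' {w})) (C : ℕ) :
    Summable fun n : ℕ => mutualInfo μ (orbitWord T ξ (C * n)) (Z n) / n := by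
  set W : ∀ n, Ω → ∀ i : Fin n, ζ i := fun n ω i => Z i ω
  have hW : ∀ n, FiberMeasurable (W n) := fun n => FiberMeasurable.pi fun i => hZ i
  have hX : ∀ L, FiberMeasurable (orbitWord T ξ L) := fiberMeasurable_orbitWord hT.measurable hξ
  set cond : ℕ → ℕ → ℝ := fun L n =>
    entropy μ (fun ω => (orbitWord T ξ L ω, W n ω)) - entropy μ (W n) with hcond
  have hcond0 : ∀ L n, 0 ≤ cond L n := fun L n => sub_nonneg.2
    (entropy_le_of_eq_comp ((hX L).prodMk (hW n)) (fun q => q.2) (ae_of_all _ fun _ => rfl))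
  have hstepW : ∀ n, ∃ φ : α → (∀ i : Fin n, ζ i) → (∀ i : Fin n, ζ i),
      ∀ᵐ ω ∂μ, W n (T ω) = φ (ξ ω) (W n ω) := by
    intro n
    choose φ hφ using hstep
    refine ⟨fun a w i => φ i a (w i), ?_⟩
    filter_upwards [ae_all_iff.2 fun i : Fin n => hφ i] with ω h
    funext i; exact h i
  have hI : ∀ L n, mutualInfo μ (orbitWord T ξ L) (Z n) ≤ cond L n - cond L (n + 1) := by
    intro L n
    have h1 := entropy_strong_subadditivity (μ := μ) (hW n) (hZ n) (hX L)
    have h2 : entropy μ (fun ω => (Z n ω, W n ω)) = entropy μ (Z n) + entropy μ (W n) :=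
      entropy_prod_of_indep (hZ n) (hW n) (hind n)
    have h3 : entropy μ (fun ω => (Z n ω, W n ω)) ≤ entropy μ (W (n + 1)) :=
      entropy_le_of_eq_comp (hW _) (fun w => (w (Fin.last n), fun i => w i.castSucc))
        (ae_of_all _ fun _ => rfl)
    have h4 : entropy μ (fun ω => (orbitWord T ξ L ω, W (n + 1) ω)) ≤
        entropy μ (fun ω => (W n ω, Z n ω, orbitWord T ξ L ω)) := by
      refine entropy_le_of_eq_comp ((hW n).prodMk ((hZ n).prodMk (hX L)))
        (fun q => (q.2.2, fun i => Fin.lastCases (motive := fun i => ζ i) q.2.1 q.1 i))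
        (ae_of_all _ fun ω => ?_)
      refine Prod.ext rfl ?_
      funext i
      refine Fin.lastCases ?_ (fun j => ?_) i
      · simp [W]
      · simp [W]
    have h5 : entropy μ (fun ω => (Z n ω, orbitWord T ξ L ω)) ≤
        entropy μ (fun ω => (orbitWord T ξ L ω, Z n ω)) :=
      entropy_le_of_eq_comp ((hX L).prodMk (hZ n)) (fun q => (q.2, q.1)) (ae_of_all _ fun _ => rfl)
    have h6 : entropy μ (fun ω => (W n ω, orbitWord T ξ L ω)) ≤
        entropy μ (fun ω => (orbitWord T ξ L ω, W n ω)) :=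
      entropy_le_of_eq_comp ((hX L).prodMk (hW n)) (fun q => (q.2, q.1)) (ae_of_all _ fun _ => rfl)
    simp only [mutualInfo, hcond]
    linarith
  have hI0 : ∀ L n, 0 ≤ mutualInfo μ (orbitWord T ξ L) (Z n) := by
    intro L n
    have h1 := entropy_strong_subadditivity (μ := μ) (hX L) (hZ n)
      (C := fun _ => ()) (fun _ => by simp)
    have h2 : entropy μ (fun ω => (orbitWord T ξ L ω, Z n ω)) ≤
        entropy μ (fun ω => (orbitWord T ξ L ω, Z n ω, ())) :=
      entropy_le_of_eq_comp ((hX L).prodMk ((hZ n).prodMk fun _ => by simp))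
        (fun q => (q.1, q.2.1)) (ae_of_all _ fun _ => rfl)
    have h3 : entropy μ (fun ω => (orbitWord T ξ L ω, ())) ≤ entropy μ (orbitWord T ξ L) :=
      entropy_le_of_eq_comp (hX L) (fun q => (q, ())) (ae_of_all _ fun _ => rfl)
    have h4 : entropy μ (fun ω => (Z n ω, ())) ≤ entropy μ (Z n) :=
      entropy_le_of_eq_comp (hZ n) (fun q => (q, ())) (ae_of_all _ fun _ => rfl)
    have h5 : 0 ≤ entropy μ (fun _ : Ω => ()) :=
      sum_nonneg fun _ _ => Real.negMulLog_nonneg measureReal_nonneg measureReal_le_one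
    unfold mutualInfo; linarith
  set u : ℕ → ℝ := fun m => cond (C * 8 ^ (m + 1)) (8 ^ m) / 8 ^ m with hu
  have hblock : ∀ m, ∑ n ∈ Ico (8 ^ m) (8 ^ (m + 1)),
      mutualInfo μ (orbitWord T ξ (C * n)) (Z n) / n ≤ u m - u (m + 1) := by
    intro m
    have h8 : (0 : ℝ) < 8 ^ m := by positivity
    have hle : (8 : ℕ) ^ m ≤ 8 ^ (m + 1) := Nat.pow_le_pow_right (by norm_num) (by omega)
    calc _ ≤ ∑ n ∈ Ico (8 ^ m) (8 ^ (m + 1)),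
          (cond (C * 8 ^ (m + 1)) n - cond (C * 8 ^ (m + 1)) (n + 1)) / 8 ^ m := by
          refine sum_le_sum fun n hn => ?_
          rw [mem_Ico] at hn
          have hn' : C * n ≤ C * 8 ^ (m + 1) := Nat.mul_le_mul_left _ hn.2.le
          refine div_le_div₀ ((hI0 _ _).trans (hI _ _)) ?_ h8 (by exact_mod_cast hn.1)
          refine le_trans ?_ (hI _ _)
          exact mutualInfo_le_of_eq_comp (hX _) (hZ n) (hX _)
            (fun w i => w (Fin.castLE hn' i)) (ae_of_all _ fun _ => rfl)
      _ = (cond (C * 8 ^ (m + 1)) (8 ^ m) - cond (C * 8 ^ (m + 1)) (8 ^ (m + 1))) / 8 ^ m := by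
          rw [← sum_div, sum_Ico_eq_sub _ hle, sum_range_sub',
            sum_range_sub']
          ring
      _ ≤ _ := by
          have := entropy_orbitWord_mul_le hT hξ (hW (8 ^ (m + 1))) (hstepW (8 ^ (m + 1)))
            (C * 8 ^ (m + 1)) 8 (by norm_num)
          have h9 : cond (C * 8 ^ (m + 1 + 1)) (8 ^ (m + 1)) ≤
              8 * cond (C * 8 ^ (m + 1)) (8 ^ (m + 1)) := by
            rw [pow_succ 8 (m + 1), ← mul_assoc]; exact_mod_cast this
          simp only [hu]
          rw [sub_div]
          have : cond (C * 8 ^ (m + 1 + 1)) (8 ^ (m + 1)) / 8 ^ (m + 1) ≤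
              cond (C * 8 ^ (m + 1)) (8 ^ (m + 1)) / 8 ^ m := by
            rw [div_le_div_iff₀ (by positivity) h8]
            calc _ ≤ 8 * cond (C * 8 ^ (m + 1)) (8 ^ (m + 1)) * 8 ^ m := by gcongr
              _ = _ := by rw [pow_succ (8 : ℝ) m]; ring
          linarith
  have hsum : ∀ K, ∑ n ∈ Ico 1 (8 ^ K),
      mutualInfo μ (orbitWord T ξ (C * n)) (Z n) / n ≤ u 0 - u K := by
    intro K
    induction K with
    | zero => simp
    | succ K ih =>
      rw [← sum_Ico_consecutive _ (Nat.one_le_pow _ _ (by norm_num))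
        (Nat.pow_le_pow_right (by norm_num) (Nat.le_succ K))]
      linarith [hblock K]
  refine summable_of_sum_range_le (c := u 0) (fun n => div_nonneg (hI0 _ _) (Nat.cast_nonneg _))
    fun K => ?_
  have hK : K ≤ 8 ^ K := (Nat.lt_pow_self (by norm_num)).le
  calc _ ≤ ∑ n ∈ range (8 ^ K), mutualInfo μ (orbitWord T ξ (C * n)) (Z n) / n :=
        sum_le_sum_of_subset_of_nonneg (range_mono hK)
          fun n _ _ => div_nonneg (hI0 _ _) (Nat.cast_nonneg _)
    _ = ∑ n ∈ Ico 1 (8 ^ K), mutualInfo μ (orbitWord T ξ (C * n)) (Z n) / n := by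
        rw [range_eq_Ico, sum_eq_sum_Ico_succ_bot (by positivity)]; simp
    _ ≤ u 0 - u K := hsum K
    _ ≤ u 0 := sub_le_self _ (div_nonneg (hcond0 _ _) (by positivity))

end Entropy

section ShiftSpace

/-- The action of `ℤ` on the sequence space by shifts. -/
def shiftBy (n : ℤ) (x : SymbolSpace) : SymbolSpace := fun k => x (k + n)

/-- The zeroth coordinate. -/
def coord (x : SymbolSpace) : ℝ := ((x 0 : ℤ) : ℝ)

/-- The dilation `x ↦ (-x (p k))_k`. -/
def dilate (p : ℤ) (x : SymbolSpace) : SymbolSpace := fun k =>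
  ⟨-(x (p * k) : ℤ), by
    have := (x (p * k)).2
    simp only [Set.mem_insert_iff, Set.mem_singleton_iff] at this ⊢
    omega⟩

theorem shiftBy_zero (x : SymbolSpace) : shiftBy 0 x = x := by funext k; simp [shiftBy]

theorem shiftBy_shiftBy (m n : ℤ) (x : SymbolSpace) : shiftBy m (shiftBy n x) = shiftBy (m + n) x := by
  funext k; simp [shiftBy, add_assoc]

theorem shift_eq_shiftBy : (shift : SymbolSpace → SymbolSpace) = shiftBy 1 := rfl

theorem iterate_shiftBy (a : ℤ) (n : ℕ) (x : SymbolSpace) :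
    (shiftBy a)^[n] x = shiftBy (n * a) x := by
  induction n with
  | zero => simp [shiftBy_zero]
  | succ n ih => rw [Function.iterate_succ_apply', ih, shiftBy_shiftBy]; congr 1; push_cast; ring

theorem iterate_shift (n : ℕ) (x : SymbolSpace) : shift^[n] x = shiftBy n x := by
  rw [shift_eq_shiftBy, iterate_shiftBy, mul_one]

theorem continuous_shiftBy (n : ℤ) : Continuous (shiftBy n) :=
  continuous_pi fun k => continuous_apply (k + n)

theorem measurable_shiftBy (n : ℤ) : Measurable (shiftBy n) := (continuous_shiftBy n).measurable

theorem continuous_dilate (p : ℤ) : Continuous (dilate p) :=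
  continuous_pi fun k => by
    refine Continuous.subtype_mk ?_ _
    exact (continuous_subtype_val.comp (continuous_apply (p * k))).neg

theorem measurable_dilate (p : ℤ) : Measurable (dilate p) := (continuous_dilate p).measurable

theorem dilate_shiftBy (p n : ℤ) (x : SymbolSpace) :
    dilate p (shiftBy (p * n) x) = shiftBy n (dilate p x) := by
  funext k; simp [dilate, shiftBy, mul_add]

theorem continuous_coord : Continuous coord :=
  continuous_of_discreteTopology.comp (continuous_subtype_val.comp (continuous_apply 0))

theorem measurable_coord : Measurable coord := continuous_coord.measurable

theorem coord_mem (x : SymbolSpace) : coord x = -1 ∨ coord x = 0 ∨ coord x = 1 := by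
  have := (x 0).2
  simp only [Set.mem_insert_iff, Set.mem_singleton_iff] at this
  unfold coord
  rcases this with h | h | h <;> simp [h]

theorem abs_coord_le (x : SymbolSpace) : |coord x| ≤ 1 := by
  rcases coord_mem x with h | h | h <;> simp [h]

theorem coord_dilate (p k : ℤ) (x : SymbolSpace) :
    coord (shiftBy k (dilate p x)) = -coord (shiftBy (p * k) x) := by
  simp [coord, shiftBy, dilate]

theorem dilate_liouvillePoint {p : ℕ} (hp : p.Prime) (n : ℤ) :
    dilate p (shiftBy (p * n) liouvillePoint) = shiftBy n liouvillePoint := by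
  rw [dilate_shiftBy]
  congr 1
  funext k
  refine Subtype.ext ?_
  simp only [dilate, liouvillePoint]
  by_cases hk : k = 0
  · simp [hk]
  · have hpk : (p : ℤ) * k ≠ 0 := mul_ne_zero (by exact_mod_cast hp.ne_zero) hk
    rw [if_neg hpk, if_neg hk, Int.natAbs_mul, Int.natAbs_natCast, liouville, liouville,
      ArithmeticFunction.cardFactors_mul hp.ne_zero (by simpa using hk),
      ArithmeticFunction.cardFactors_apply_prime hp, pow_add]
    ring

variable {κ : Measure SymbolSpace}

theorem measurePreserving_shiftBy (hT : MeasurePreserving shift κ κ) (n : ℤ) :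
    MeasurePreserving (shiftBy n) κ κ := by
  have h : ∀ n : ℕ, MeasurePreserving (shiftBy n) κ κ := fun n => by
    have := hT.iterate n
    rwa [show (shift^[n] : SymbolSpace → SymbolSpace) = shiftBy n from
      funext fun x => iterate_shift n x] at this
  obtain ⟨m, rfl | rfl⟩ := n.eq_nat_or_neg
  · exact h m
  · refine ⟨measurable_shiftBy _, ?_⟩
    conv_lhs => rw [← (h m).map_eq]
    rw [Measure.map_map (measurable_shiftBy _) (measurable_shiftBy _)]
    have : shiftBy (-(m : ℤ)) ∘ shiftBy m = id := by funext x; simp [shiftBy_shiftBy, shiftBy_zero]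
    rw [this, Measure.map_id]

variable [IsProbabilityMeasure κ]

/-- Generic points along multiples of a prime: a shift-invariant limit measure. -/
theorem exists_measure_along_multiples
    (hgen : ∀ f : C(SymbolSpace, ℝ), Tendsto (fun N : ℕ => (1 / (N : ℝ)) *
      ∑ n ∈ Icc 1 N, f (shift^[n] liouvillePoint)) atTop (nhds (∫ y, f y ∂κ)))
    {p : ℕ} (hp : p.Prime) : ∃ μ : Measure SymbolSpace, IsProbabilityMeasure μ ∧
      MeasurePreserving (shiftBy p) μ μ ∧ μ ≪ κ ∧ μ.map (dilate p) = κ := by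
  have hp0 : 0 < p := hp.pos
  set pt : ℕ → SymbolSpace := fun m => shiftBy (p * (m : ℤ)) liouvillePoint
  set emp : ℕ → Measure SymbolSpace := fun N =>
    ((N + 1 : ℕ) : ENNReal)⁻¹ • ∑ m ∈ Icc 1 (N + 1), Measure.dirac (pt m)
  have hemp : ∀ N, IsProbabilityMeasure (emp N) := fun N => ⟨by
    simp only [emp, Measure.smul_apply, Measure.finsetSum_apply, measure_univ, sum_const,
      Nat.card_Icc, smul_eq_mul, nsmul_eq_mul, mul_one]
    rw [Nat.add_sub_cancel]
    exact ENNReal.inv_mul_cancel (by simp) (ENNReal.natCast_ne_top _)⟩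
  set P : ℕ → ProbabilityMeasure SymbolSpace := fun N => ⟨emp N, hemp N⟩
  have hInt : ∀ (f : C(SymbolSpace, ℝ)) N, ∫ x, f x ∂(emp N) =
      (1 / ((N + 1 : ℕ) : ℝ)) * ∑ m ∈ Icc 1 (N + 1), f (pt m) := fun f N => by
    simp only [emp]; rw [integral_smul_measure, integral_finsetSum_measure]
    · rw [ENNReal.toReal_inv, ENNReal.toReal_natCast, smul_eq_mul, one_div]
      simp only [integral_dirac]
    · intro i _
      exact (integrable_dirac (by simp [enorm_lt_top]))
  let U : Ultrafilter ℕ := Filter.hyperfilter ℕ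
  have hU : (U : Filter ℕ) ≤ atTop := Nat.hyperfilter_le_atTop
  obtain ⟨Q, hQ⟩ : ∃ Q, Tendsto P U (𝓝 Q) := ⟨_, (U.map P).le_nhds_lim⟩
  have hlim : ∀ f : C(SymbolSpace, ℝ), Tendsto (fun N : ℕ =>
      (1 / ((N + 1 : ℕ) : ℝ)) * ∑ m ∈ Icc 1 (N + 1), f (pt m)) U
        (𝓝 (∫ x, f x ∂(Q : Measure SymbolSpace))) := by
    intro f
    have := (ProbabilityMeasure.tendsto_iff_forall_integral_tendsto.1 hQ)
      (BoundedContinuousFunction.mkOfCompact f)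
    refine this.congr fun N => ?_
    exact hInt f N
  have huniq : ∀ (ν ν' : Measure SymbolSpace) [IsFiniteMeasure ν] [IsFiniteMeasure ν'],
      (∀ f : C(SymbolSpace, ℝ), ∫ x, f x ∂ν = ∫ x, f x ∂ν') → ν = ν' := fun ν ν' _ _ h => by
    refine ext_of_forall_integral_eq_of_IsFiniteMeasure fun f => ?_
    exact h f.toContinuousMap
  have hN : Tendsto (fun N : ℕ => N + 1) atTop atTop := tendsto_add_atTop_nat 1
  refine ⟨Q, inferInstance, ⟨measurable_shiftBy _, ?_⟩, ?_, ?_⟩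
  · have := Measure.isProbabilityMeasure_map (μ := (Q : Measure SymbolSpace))
      (measurable_shiftBy p).aemeasurable
    refine huniq _ _ fun f => ?_
    rw [integral_map (measurable_shiftBy p).aemeasurable f.continuous.aestronglyMeasurable]
    have h1 := hlim (f.comp ⟨shiftBy p, continuous_shiftBy p⟩)
    have h2 := hlim f
    have h3 : Tendsto (fun N : ℕ => (1 / ((N + 1 : ℕ) : ℝ)) * (f (pt (N + 2)) - f (pt 1))) U (𝓝 0) := by
      refine Tendsto.mono_left ?_ hU
      obtain ⟨B, hB⟩ := (isCompact_univ.image f.continuous).isBounded.exists_norm_le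
      refine squeeze_zero_norm (a := fun N : ℕ => (1 / ((N + 1 : ℕ) : ℝ)) * (2 * B)) (fun N => ?_) ?_
      · rw [norm_mul]
        have e1 := hB _ ⟨pt (N + 2), trivial, rfl⟩
        have e2 := hB _ ⟨pt 1, trivial, rfl⟩
        have e3 := norm_sub_le (f (pt (N + 2))) (f (pt 1))
        rw [Real.norm_of_nonneg (by positivity : (0 : ℝ) ≤ 1 / ((N + 1 : ℕ) : ℝ))]
        gcongr; linarith
      · have := (tendsto_one_div_atTop_nhds_zero_nat (𝕜 := ℝ)).comp hN
        simpa using this.mul_const (2 * B)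
    have h4 := h2.add h3
    rw [add_zero] at h4
    refine tendsto_nhds_unique h1 (h4.congr fun N => ?_)
    rw [← mul_add]
    congr 1
    have e : ∀ m, (f.comp ⟨shiftBy p, continuous_shiftBy p⟩) (pt m) = f (pt (m + 1)) := fun m => by
      simp only [ContinuousMap.comp_apply, ContinuousMap.coe_mk, pt, shiftBy_shiftBy]
      congr 2; push_cast; ring
    simp only [e]
    have : ∀ K, ∑ m ∈ Icc 1 K, f (pt m) + (f (pt (K + 1)) - f (pt 1)) =
        ∑ m ∈ Icc 1 K, f (pt (m + 1)) := fun K => by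
      induction K with
      | zero => simp
      | succ K ih =>
        rw [sum_Icc_succ_top (by omega), sum_Icc_succ_top (by omega), ← ih]; ring
    exact this (N + 1)
  · have hle : (Q : Measure SymbolSpace) ≤ (p : ENNReal) • κ := by
      have : (p : ENNReal) • κ = ∑ j ∈ range p, (Q : Measure SymbolSpace).map (shiftBy j) := by
        have i1 : IsFiniteMeasure ((p : ENNReal) • κ) := Measure.smul_finite _ (ENNReal.natCast_ne_top _)
        have i3 : ∀ j : ℕ, IsFiniteMeasure ((Q : Measure SymbolSpace).map (shiftBy j)) :=
          fun j => inferInstance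
        have i2 : IsFiniteMeasure (∑ j ∈ range p, (Q : Measure SymbolSpace).map (shiftBy j)) :=
          inferInstance
        refine huniq _ _ fun f => ?_
        have e1 : ∀ j : ℕ, ∫ x, f x ∂((Q : Measure SymbolSpace).map (shiftBy j)) =
            ∫ x, (f.comp ⟨shiftBy j, continuous_shiftBy j⟩) x ∂(Q : Measure SymbolSpace) := fun j =>
          integral_map (measurable_shiftBy j).aemeasurable f.continuous.aestronglyMeasurable
        have hfi : ∀ j ∈ range p, Integrable f ((Q : Measure SymbolSpace).map (shiftBy j)) :=
          fun j _ => (BoundedContinuousFunction.mkOfCompact f).integrable _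
        rw [integral_finsetSum_measure hfi, integral_smul_measure]
        simp only [e1, ENNReal.toReal_natCast, smul_eq_mul]
        have h1 := tendsto_finsetSum (range p) fun j _ =>
          hlim (f.comp ⟨shiftBy j, continuous_shiftBy j⟩)
        set S : ℕ → ℝ := fun K => ∑ n ∈ Icc 1 K, f (shift^[n] liouvillePoint)
        have e2 : ∀ N : ℕ, (∑ j ∈ range p, (1 / ((N + 1 : ℕ) : ℝ)) *
            ∑ m ∈ Icc 1 (N + 1), (f.comp ⟨shiftBy j, continuous_shiftBy j⟩) (pt m)) =
            (1 / ((N + 1 : ℕ) : ℝ)) * (S (p * (N + 1) + (p - 1)) - S (p - 1)) := by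
          intro N
          rw [← mul_sum, sum_comm]
          congr 1
          have : ∀ K, ∑ m ∈ Icc 1 K, ∑ j ∈ range p,
              (f.comp ⟨shiftBy j, continuous_shiftBy j⟩) (pt m) = S (p * K + (p - 1)) - S (p - 1) := fun K => by
            induction K with
            | zero => simp
            | succ K ih =>
              rw [sum_Icc_succ_top (by omega), ih]
              have : S (p * (K + 1) + (p - 1)) = S (p * K + (p - 1)) +
                  ∑ j ∈ range p, f (shift^[p * (K + 1) + j] liouvillePoint) := by
                simp only [S]
                rw [← Ico_add_one_right_eq_Icc, ← Ico_add_one_right_eq_Icc,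
                  ← sum_Ico_consecutive _ (show 1 ≤ p * K + (p - 1) + 1 by omega)
                    (show p * K + (p - 1) + 1 ≤ p * (K + 1) + (p - 1) + 1 by
                      have : p * (K + 1) = p * K + p := by ring
                      omega)]
                congr 1
                rw [sum_Ico_eq_sum_range]
                have : p * K + (p - 1) + 1 = p * (K + 1) := by
                  have : p * (K + 1) = p * K + p := by ring
                  omega
                rw [this]
                have : p * (K + 1) + (p - 1) + 1 - p * (K + 1) = p := by omega
                rw [this]
              rw [this]
              have : ∀ j : ℕ, (f.comp ⟨shiftBy j, continuous_shiftBy j⟩) (pt (K + 1)) =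
                  f (shift^[p * (K + 1) + j] liouvillePoint) := fun j => by
                simp only [ContinuousMap.comp_apply, ContinuousMap.coe_mk, pt, shiftBy_shiftBy,
                  iterate_shift]
                congr 2; push_cast; ring
              simp only [this]; ring
          exact this (N + 1)
        simp only [e2] at h1
        refine tendsto_nhds_unique (Tendsto.mono_left ?_ hU) h1
        have hK : Tendsto (fun N : ℕ => p * (N + 1) + (p - 1)) atTop atTop := by
          refine tendsto_atTop_mono (fun N => ?_) (tendsto_id (α := ℕ))
          have : N + 1 ≤ p * (N + 1) := Nat.le_mul_of_pos_left _ hp0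
          simp only [id]; omega
        have h5 := (hgen f).comp hK
        have h6 : Tendsto (fun N : ℕ => ((p * (N + 1) + (p - 1) : ℕ) : ℝ) / ((N + 1 : ℕ) : ℝ)) atTop
            (𝓝 p) := by
          have : Tendsto (fun N : ℕ => (p : ℝ) + ((p - 1 : ℕ) : ℝ) * (1 / ((N + 1 : ℕ) : ℝ))) atTop
              (𝓝 (p + ((p - 1 : ℕ) : ℝ) * 0)) :=
            ((tendsto_one_div_atTop_nhds_zero_nat (𝕜 := ℝ)).comp hN |>.const_mul _).const_add _
          rw [mul_zero, add_zero] at this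
          refine this.congr fun N => ?_
          have : ((N + 1 : ℕ) : ℝ) ≠ 0 := by positivity
          push_cast at this ⊢; field_simp
        have h7 : Tendsto (fun N : ℕ => (1 / ((N + 1 : ℕ) : ℝ)) * S (p - 1)) atTop (𝓝 (0 * S (p - 1))) :=
          ((tendsto_one_div_atTop_nhds_zero_nat (𝕜 := ℝ)).comp hN).mul_const _
        have h8 := (h6.mul h5).sub h7
        rw [zero_mul, sub_zero] at h8
        refine h8.congr fun N => ?_
        have q1 : ((N + 1 : ℕ) : ℝ) ≠ 0 := by positivity
        have q2 : ((p * (N + 1) + (p - 1) : ℕ) : ℝ) ≠ 0 := by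
          have : 0 < p * (N + 1) + (p - 1) := by positivity
          exact_mod_cast this.ne'
        simp only [Function.comp, S]
        generalize ((p * (N + 1) + (p - 1) : ℕ) : ℝ) = u at *
        field_simp
      rw [this]
      have h0 : (Q : Measure SymbolSpace).map (shiftBy ((0 : ℕ) : ℤ)) = Q := by
        have : shiftBy ((0 : ℕ) : ℤ) = id := funext fun x => shiftBy_zero x
        rw [this, Measure.map_id]
      conv_lhs => rw [← h0]
      exact single_le_sum (f := fun j : ℕ => (Q : Measure SymbolSpace).map (shiftBy j))
        (fun _ _ => Measure.zero_le _) (mem_range.2 hp0)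
    exact (Measure.absolutelyContinuous_of_le hle).trans Measure.smul_absolutelyContinuous
  · have := Measure.isProbabilityMeasure_map (μ := (Q : Measure SymbolSpace))
      (measurable_dilate p).aemeasurable
    refine huniq _ _ fun f => ?_
    rw [integral_map (measurable_dilate p).aemeasurable f.continuous.aestronglyMeasurable]
    have h1 := hlim (f.comp ⟨dilate p, continuous_dilate p⟩)
    refine tendsto_nhds_unique h1 ?_
    refine Tendsto.mono_left ?_ hU
    refine ((hgen f).comp hN).congr fun N => ?_
    simp only [Function.comp, ContinuousMap.comp_apply, ContinuousMap.coe_mk, pt,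
      dilate_liouvillePoint hp, iterate_shift]

theorem measure_iUnion_shiftBy_eq_one (hErg : Ergodic shift κ) {p : ℕ} (hp : 0 < p)
    {A : Set SymbolSpace} (hA : MeasurableSet A) (hinv : shiftBy p ⁻¹' A = A) (h0 : κ A ≠ 0) :
    κ (⋃ j ∈ range p, shiftBy j ⁻¹' A) = 1 := by
  set B : Set SymbolSpace := ⋃ j ∈ range p, shiftBy j ⁻¹' A with hBdef
  have hB : MeasurableSet B := measurableSet_biUnion _ fun j _ => measurable_shiftBy _ hA
  have hinv' : ∀ x, shiftBy p x ∈ A ↔ x ∈ A := fun x => by rw [← Set.mem_preimage, hinv]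
  have hBinv : shift ⁻¹' B = B := by
    ext x
    simp only [hBdef, Set.mem_preimage, Set.mem_iUnion, mem_range, exists_prop,
      shift_eq_shiftBy, shiftBy_shiftBy]
    constructor
    · rintro ⟨j, hj, hx⟩
      by_cases h : j + 1 < p
      · exact ⟨j + 1, h, by exact_mod_cast hx⟩
      · refine ⟨0, hp, ?_⟩
        have : (j : ℤ) + 1 = p := by omega
        rw [this, hinv'] at hx
        simpa [shiftBy_zero] using hx
    · rintro ⟨j, hj, hx⟩
      rcases Nat.eq_zero_or_pos j with rfl | hj0
      · refine ⟨p - 1, by omega, ?_⟩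
        have : ((p - 1 : ℕ) : ℤ) + 1 = p := by omega
        rw [this, hinv']
        simpa [shiftBy_zero] using hx
      · refine ⟨j - 1, by omega, ?_⟩
        have : ((j - 1 : ℕ) : ℤ) + 1 = j := by omega
        rwa [this]
  have hAB : A ⊆ B := fun x hx => by
    simp only [hBdef, Set.mem_iUnion, mem_range, exists_prop]; exact ⟨0, hp, by simpa [shiftBy_zero] using hx⟩
  exact (hErg.toPreErgodic.prob_eq_zero_or_one hB hBinv).resolve_left fun h =>
    h0 (measure_mono_null hAB h)

theorem measureReal_ge_of_invariant (hErg : Ergodic shift κ) {p : ℕ} (hp : 0 < p)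
    {A : Set SymbolSpace} (hA : MeasurableSet A) (hinv : shiftBy p ⁻¹' A = A) (h0 : κ A ≠ 0) :
    1 / (p : ℝ) ≤ κ.real A := by
  have hB1 := measure_iUnion_shiftBy_eq_one hErg hp hA hinv h0
  have h1 : κ.real (⋃ j ∈ range p, shiftBy j ⁻¹' A) ≤
      ∑ j ∈ range p, κ.real (shiftBy j ⁻¹' A) := measureReal_biUnion_finset_le _ _
  have h2 : ∀ j : ℕ, κ.real (shiftBy j ⁻¹' A) = κ.real A := fun j =>
    (measurePreserving_shiftBy hErg.toMeasurePreserving j).measureReal_preimage hA.nullMeasurableSet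
  simp only [h2, sum_const, card_range, nsmul_eq_mul, measureReal_def, hB1] at h1
  rw [div_le_iff₀ (by positivity), mul_comm]
  simpa [measureReal_def] using h1

/-- An ergodic component of the `p`-th power of the shift, on which dilation by `p` is a factor
map onto the original system. -/
theorem exists_dilation_atom (hErg : Ergodic shift κ) {p : ℕ} (hp : 0 < p) {μ : Measure SymbolSpace}
    [IsProbabilityMeasure μ] (hμ : MeasurePreserving (shiftBy p) μ μ) (hac : μ ≪ κ)
    (hmap : μ.map (dilate p) = κ) :
    ∃ A : Set SymbolSpace, MeasurableSet A ∧ shiftBy p ⁻¹' A = A ∧ κ A ≠ 0 ∧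
      (∀ B, MeasurableSet B → shiftBy p ⁻¹' B = B → B ⊆ A → κ B = 0 ∨ κ (A \ B) = 0) ∧
      Ergodic (shiftBy p) (κ.restrict A) ∧ (κ.restrict A).map (dilate p) = κ A • κ := by
  have hp' : (0 : ℝ) < 1 / p := by positivity
  set V : Set ℝ := {v | ∃ A, MeasurableSet A ∧ shiftBy p ⁻¹' A = A ∧ μ A ≠ 0 ∧ v = κ.real A}
  have hVne : V.Nonempty := ⟨_, Set.univ, MeasurableSet.univ, Set.preimage_univ, by simp, rfl⟩
  have hVbdd : BddBelow V := ⟨0, by rintro _ ⟨A, _, _, _, rfl⟩; exact measureReal_nonneg⟩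
  obtain ⟨_, ⟨A, hA, hAinv, hA0, rfl⟩, hAlt⟩ : ∃ v ∈ V, v < sInf V + 1 / p :=
    exists_lt_of_csInf_lt hVne (lt_add_of_pos_right _ hp')
  have hκA : κ A ≠ 0 := fun h => hA0 (hac h)
  have hatom : ∀ B, MeasurableSet B → shiftBy p ⁻¹' B = B → B ⊆ A → κ B = 0 ∨ κ (A \ B) = 0 := by
    intro B hB hBinv hBA
    by_contra! h
    have hCinv : shiftBy p ⁻¹' (A \ B) = A \ B := by rw [Set.preimage_sdiff, hAinv, hBinv]
    have hsum : κ.real A = κ.real B + κ.real (A \ B) := by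
      rw [add_comm, measureReal_sdiff_add_inter hB |>.symm, Set.inter_eq_self_of_subset_right hBA]
    have h1 := measureReal_ge_of_invariant hErg hp hB hBinv h.1
    have h2 := measureReal_ge_of_invariant hErg hp (hA.diff hB) hCinv h.2
    by_cases hμB : μ B = 0
    · have : μ (A \ B) ≠ 0 := by rw [measure_sdiff_null hμB]; exact hA0
      have := csInf_le hVbdd ⟨A \ B, hA.diff hB, hCinv, this, rfl⟩
      linarith
    · have := csInf_le hVbdd ⟨B, hB, hBinv, hμB, rfl⟩
      linarith
  have hmp : MeasurePreserving (shiftBy p) (κ.restrict A) (κ.restrict A) := by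
    have := (measurePreserving_shiftBy hErg.toMeasurePreserving p).restrict_preimage hA
    rwa [hAinv] at this
  have herg : Ergodic (shiftBy p) (κ.restrict A) := by
    refine ⟨hmp, ⟨fun {s} hs hsinv => ?_⟩⟩
    have hinv : shiftBy p ⁻¹' (s ∩ A) = s ∩ A := by rw [Set.preimage_inter, hsinv, hAinv]
    rcases hatom (s ∩ A) (hs.inter hA) hinv Set.inter_subset_right with h | h
    · refine Filter.eventuallyConst_set.2 (Or.inr ?_)
      rw [ae_iff]; simpa [Measure.restrict_apply hs] using h
    · refine Filter.eventuallyConst_set.2 (Or.inl ?_)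
      rw [ae_iff]
      change (κ.restrict A) sᶜ = 0
      rw [Measure.restrict_apply hs.compl]
      convert h using 2
      ext x; simp; tauto
  refine ⟨A, hA, hAinv, hκA, hatom, herg, ?_⟩
  have hmpμ : MeasurePreserving (shiftBy p) (μ.restrict A) (μ.restrict A) := by
    have := hμ.restrict_preimage hA
    rwa [hAinv] at this
  obtain ⟨c, hc⟩ := herg.eq_smul_of_absolutelyContinuous hmpμ (hac.restrict A)
  have hc0 : c ≠ 0 := by
    rintro rfl
    apply hA0
    have := congrArg (fun m : Measure SymbolSpace => m Set.univ) hc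
    simpa using this
  have hac2 : (κ.restrict A).map (dilate p) ≪ κ := by
    refine Measure.AbsolutelyContinuous.mk fun s hs h => ?_
    rw [Measure.map_apply (measurable_dilate p) hs]
    rw [← hmap, Measure.map_apply (measurable_dilate p) hs] at h
    have h1 : (μ.restrict A) (dilate p ⁻¹' s) = 0 :=
      le_antisymm ((Measure.restrict_apply_le _ _).trans h.le) zero_le
    rw [hc] at h1
    simpa [hc0] using h1
  have hmp2 : MeasurePreserving shift ((κ.restrict A).map (dilate p)) ((κ.restrict A).map (dilate p)) := by
    refine ⟨measurable_shiftBy 1, ?_⟩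
    rw [shift_eq_shiftBy, Measure.map_map (measurable_shiftBy 1) (measurable_dilate p)]
    have : (shiftBy 1 ∘ dilate p : SymbolSpace → SymbolSpace) = dilate p ∘ shiftBy p := by
      funext x
      have := dilate_shiftBy p 1 x
      rw [mul_one] at this; exact this.symm
    rw [this, ← Measure.map_map (measurable_dilate p) (measurable_shiftBy p), hmp.map_eq]
  obtain ⟨c', hc'⟩ := hErg.eq_smul_of_absolutelyContinuous hmp2 hac2
  have := congrArg (fun m : Measure SymbolSpace => m Set.univ) hc'
  simp only [Measure.map_apply (measurable_dilate p) MeasurableSet.univ, Set.preimage_univ,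
    Measure.restrict_apply MeasurableSet.univ, Set.univ_inter, Measure.smul_apply, measure_univ,
    smul_eq_mul, mul_one] at this
  rw [hc', this]

theorem shiftBy_mul_mem_iff {p : ℕ} {A : Set SymbolSpace} (hinv : shiftBy p ⁻¹' A = A) (k : ℤ)
    (x : SymbolSpace) : shiftBy (p * k) x ∈ A ↔ x ∈ A := by
  have h : ∀ x, shiftBy p x ∈ A ↔ x ∈ A := fun x => by rw [← Set.mem_preimage, hinv]
  induction k using Int.induction_on with
  | zero => simp [shiftBy_zero]
  | succ k ih =>
    refine Iff.trans ?_ ih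
    rw [← h (shiftBy (p * k) x), shiftBy_shiftBy, show (p : ℤ) * (k + 1) = p + p * k by ring]
  | pred k ih =>
    refine Iff.trans ?_ ih
    rw [← h (shiftBy (p * (-k - 1)) x), shiftBy_shiftBy,
      show (p : ℤ) + p * (-k - 1) = p * -k by ring]

theorem shiftBy_mem_congr {p : ℕ} {A : Set SymbolSpace} (hinv : shiftBy p ⁻¹' A = A) {i j : ℤ}
    (hij : (i : ZMod p) = j) (x : SymbolSpace) : shiftBy i x ∈ A ↔ shiftBy j x ∈ A := by
  obtain ⟨k, hk⟩ := (ZMod.intCast_eq_intCast_iff_dvd_sub j i p).1 hij.symm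
  rw [← shiftBy_mul_mem_iff hinv k (shiftBy j x), shiftBy_shiftBy, ← hk, sub_add_cancel]

/-- The cyclic factor attached to a prime: either the `p`-th power of the shift is ergodic, or there
is an equivariant map to `ZMod p`; dilation by `p` maps the zero fibre onto the whole system. -/
theorem exists_dilation_factor
    (hgen : ∀ f : C(SymbolSpace, ℝ), Tendsto (fun N : ℕ => (1 / (N : ℝ)) *
      ∑ n ∈ Icc 1 N, f (shift^[n] liouvillePoint)) atTop (nhds (∫ y, f y ∂κ)))
    (hErg : Ergodic shift κ) {p : ℕ} (hp : p.Prime) :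
    ∃ d : ℕ, (d = 1 ∨ d = p) ∧ ∃ Y : SymbolSpace → ZMod d, FiberMeasurable Y ∧
      (∀ᵐ x ∂κ, Y (shiftBy 1 x) = Y x + 1) ∧ Ergodic (shiftBy p) (κ.restrict (Y ⁻¹' {0})) ∧
      (κ.restrict (Y ⁻¹' {0})).map (dilate p) = κ (Y ⁻¹' {0}) • κ ∧
      κ.real (Y ⁻¹' {0}) = 1 / d := by
  classical
  obtain ⟨μ, hμ1, hμ2, hac, hmap⟩ := exists_measure_along_multiples hgen hp
  obtain ⟨A, hA, hinv, hA0, hatom, herg, hAmap⟩ := exists_dilation_atom hErg hp.pos hμ2 hac hmap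
  have hmp := measurePreserving_shiftBy hErg.toMeasurePreserving
  by_cases hA1 : κ A = 1
  · refine ⟨1, Or.inl rfl, fun _ => 0, fun a => ?_, ae_of_all _ fun _ => Subsingleton.elim _ _, ?_⟩
    · rw [Subsingleton.elim a 0]; simp
    have h1 : (fun _ : SymbolSpace => (0 : ZMod 1)) ⁻¹' {0} = Set.univ := by ext; simp
    have h2 : κ.restrict A = κ := by
      rw [Measure.restrict_congr_set (t := Set.univ), Measure.restrict_univ]
      rw [ae_eq_univ, prob_compl_eq_zero_iff hA, hA1]
    rw [h1, Measure.restrict_univ]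
    rw [h2, hA1] at hAmap
    rw [h2] at herg; exact ⟨herg, by rw [measure_univ]; exact hAmap, by simp⟩
  have hp1 : Fact p.Prime := ⟨hp⟩
  have hnull : ∀ j : ℕ, 0 < j → j < p → κ (A ∩ shiftBy j ⁻¹' A) = 0 := by
    intro j hj0 hjp
    have hB : MeasurableSet (A ∩ shiftBy j ⁻¹' A) := hA.inter (measurable_shiftBy _ hA)
    have hBinv : shiftBy p ⁻¹' (A ∩ shiftBy j ⁻¹' A) = A ∩ shiftBy j ⁻¹' A := by
      ext x
      have e1 := shiftBy_mul_mem_iff hinv 1 x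
      have e2 := shiftBy_mul_mem_iff hinv 1 (shiftBy j x)
      rw [shiftBy_shiftBy, mul_one] at e2
      rw [mul_one] at e1
      simp only [Set.mem_preimage, Set.mem_inter_iff, shiftBy_shiftBy]; rw [e1, add_comm, e2]
    refine (hatom _ hB hBinv Set.inter_subset_left).resolve_right fun h => ?_
    rw [Set.sdiff_self_inter] at h
    have hAj : shiftBy j ⁻¹' A =ᵐ[κ] A := by
      refine (ae_eq_of_ae_subset_of_measure_ge (ae_le_set.2 h) ?_ hA.nullMeasurableSet
        (measure_ne_top _ _)).symm
      rw [(hmp j).measure_preimage hA.nullMeasurableSet]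
    have hAk : ∀ k : ℕ, shiftBy (j * k : ℕ) ⁻¹' A =ᵐ[κ] A := fun k => by
      induction k with
      | zero =>
        have : shiftBy ((j * 0 : ℕ) : ℤ) = id := funext fun x => by simp [shiftBy_zero]
        rw [this]; rfl
      | succ k ih =>
        have h3 := (hmp j).quasiMeasurePreserving.preimage_ae_eq ih
        have h4 : shiftBy j ⁻¹' (shiftBy (j * k : ℕ) ⁻¹' A) = shiftBy (j * (k + 1) : ℕ) ⁻¹' A := by
          ext x
          simp only [Set.mem_preimage, shiftBy_shiftBy]
          rw [show ((j * k : ℕ) : ℤ) + j = ((j * (k + 1) : ℕ) : ℤ) by push_cast; ring]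
        rw [h4] at h3; exact h3.trans hAj
    have hj : (j : ZMod p) ≠ 0 := by
      rw [Ne, ZMod.natCast_eq_zero_iff]; exact fun h => absurd (Nat.le_of_dvd hj0 h) (by omega)
    have h5 := hAk ((j : ZMod p)⁻¹).val
    have h6 : shiftBy (j * ((j : ZMod p)⁻¹).val : ℕ) ⁻¹' A = shift ⁻¹' A := by
      ext x
      simp only [Set.mem_preimage, shift_eq_shiftBy]
      refine shiftBy_mem_congr hinv ?_ x
      push_cast; rw [ZMod.natCast_val, ZMod.cast_id, mul_inv_cancel₀ hj]
    rw [h6] at h5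
    rcases hErg.quasiErgodic.ae_empty_or_univ₀ hA.nullMeasurableSet h5 with h7 | h7
    · exact hA0 (ae_eq_empty.1 h7)
    · rw [ae_eq_univ, prob_compl_eq_zero_iff hA] at h7; exact hA1 h7
  have hdisj : ∀ i ∈ range p, ∀ j ∈ range p, i ≠ j →
      κ (shiftBy i ⁻¹' A ∩ shiftBy j ⁻¹' A) = 0 := by
    have key : ∀ i j : ℕ, i < j → j < p → κ (shiftBy i ⁻¹' A ∩ shiftBy j ⁻¹' A) = 0 := fun i j hij hj => by
      have h1 := hnull (j - i) (by omega) (by omega)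
      rw [← (hmp i).measure_preimage (hA.inter (measurable_shiftBy _ hA)).nullMeasurableSet] at h1
      convert h1 using 2
      ext x
      simp only [Set.mem_inter_iff, Set.mem_preimage, shiftBy_shiftBy]
      rw [show ((j - i : ℕ) : ℤ) + i = j by omega]
    intro i hi j hj hij
    rw [mem_range] at hi hj
    rcases lt_or_gt_of_ne hij with h | h
    · exact key i j h hj
    · rw [Set.inter_comm]; exact key j i h hi
  have hU := measure_iUnion_shiftBy_eq_one hErg hp.pos hA hinv hA0
  have hκA : κ.real A = 1 / p := by
    rw [measure_biUnion_finset₀ (fun i hi j hj hij => hdisj i hi j hj hij)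
      (fun j _ => (measurable_shiftBy _ hA).nullMeasurableSet)] at hU
    simp only [(hmp _).measure_preimage hA.nullMeasurableSet, sum_const, card_range,
      nsmul_eq_mul] at hU
    have := congrArg ENNReal.toReal hU
    rw [ENNReal.toReal_mul, ENNReal.toReal_natCast, ENNReal.toReal_one] at this
    rw [measureReal_def, eq_div_iff (by exact_mod_cast hp.ne_zero), mul_comm, this]
  have hgood : ∀ᵐ x ∂κ, ∃ j : ZMod p, ∀ i : ℤ, shiftBy i x ∈ A ↔ (i : ZMod p) = j := by
    have h1 : ∀ᵐ x ∂κ, x ∈ ⋃ j ∈ range p, shiftBy j ⁻¹' A := by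
      exact (mem_ae_iff_prob_eq_one₀ (measurableSet_biUnion _
        fun j _ => measurable_shiftBy _ hA).nullMeasurableSet).2 hU
    have h2 : ∀ᵐ x ∂κ, ∀ i : Fin p, ∀ j : Fin p, i ≠ j →
        ¬ (shiftBy (i : ℕ) x ∈ A ∧ shiftBy (j : ℕ) x ∈ A) := by
      refine ae_all_iff.2 fun i => ae_all_iff.2 fun j => ?_
      by_cases hij : i = j
      · simp [hij]
      · have := hdisj i (mem_range.2 i.2) j (mem_range.2 j.2) (Fin.val_ne_of_ne hij)
        filter_upwards [measure_eq_zero_iff_ae_notMem.1 this] with x hx _ hx'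
        exact hx hx'
    filter_upwards [h1, h2] with x hx1 hx2
    simp only [Set.mem_iUnion, mem_range, exists_prop, Set.mem_preimage] at hx1
    obtain ⟨j, hj, hxj⟩ := hx1
    refine ⟨(j : ZMod p), fun i => ⟨fun hi => ?_, fun hi => ?_⟩⟩
    · by_contra hne
      have hv := ZMod.val_lt (i : ZMod p)
      refine hx2 ⟨_, hv⟩ ⟨j, hj⟩ ?_ ⟨?_, hxj⟩
      · intro h
        apply hne
        have : ((i : ZMod p).val : ZMod p) = (j : ZMod p) := by rw [Fin.mk.inj_iff.1 h]
        rwa [ZMod.natCast_val, ZMod.cast_id] at this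
      · refine (shiftBy_mem_congr hinv ?_ x).1 hi
        push_cast; rw [ZMod.natCast_val, ZMod.cast_id]
    · exact (shiftBy_mem_congr hinv (by rw [hi]; simp) x).1 hxj
  set Y : SymbolSpace → ZMod p := fun x =>
    ∑ i ∈ range p, if shiftBy i x ∈ A then -(i : ZMod p) else 0 with hYdef
  have hYeq : ∀ x (j : ZMod p), (∀ i : ℤ, shiftBy i x ∈ A ↔ (i : ZMod p) = j) → Y x = -j := fun x j h => by
    simp only [hYdef, h]; rw [sum_eq_single j.val]
    · rw [if_pos (by simp)]; simp
    · intro i hi hne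
      rw [if_neg]
      intro h'
      apply hne
      rw [← h']; push_cast; rw [ZMod.val_cast_of_lt (mem_range.1 hi)]
    · intro h'; exact absurd (mem_range.2 (ZMod.val_lt j)) h'
  have hYm : FiberMeasurable Y := by
    have h1 : FiberMeasurable fun x (i : Fin p) => decide (shiftBy (i : ℕ) x ∈ A) := by
      refine FiberMeasurable.pi fun i b => ?_
      have hm := measurable_shiftBy (i : ℕ) hA
      cases b
      · convert hm.compl using 1; ext; simp
      · convert hm using 1; ext; simp
    have h2 := h1.map (fun w : Fin p → Bool => ∑ i : Fin p, if w i then -((i : ℕ) : ZMod p) else 0)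
    convert h2 using 1
    funext x
    rw [sum_fin_eq_sum_range]
    simp only [hYdef]
    refine sum_congr rfl fun i hi => ?_
    rw [dif_pos (mem_range.1 hi)]; simp
  have hY0 : Y ⁻¹' {0} =ᵐ[κ] A := by
    filter_upwards [hgood] with x ⟨j, hj⟩
    have h1 := hYeq x j hj
    have h2 := hj 0
    rw [shiftBy_zero] at h2
    refine propext ?_
    change Y x = 0 ↔ x ∈ A
    rw [h1, h2]
    simp [eq_comm]
  refine ⟨p, Or.inr rfl, Y, hYm, ?_, ?_, ?_, ?_⟩
  · filter_upwards [hgood] with x ⟨j, hj⟩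
    rw [hYeq x j hj, hYeq (shiftBy 1 x) (j - 1) fun i => ?_]
    · ring
    · rw [shiftBy_shiftBy, hj]; push_cast; rw [eq_sub_iff_add_eq]
  · rw [Measure.restrict_congr_set hY0]; exact herg
  · rw [Measure.restrict_congr_set hY0, measure_congr hY0]; exact hAmap
  · rw [measureReal_congr hY0, hκA]

end ShiftSpace

section Patterns

/-- The correlation monomial `∏ x_k` over a list of positions. -/
def pat (l : List ℤ) (x : SymbolSpace) : ℝ := (l.map fun k => coord (shiftBy k x)).prod

theorem pat_cons (k : ℤ) (l : List ℤ) (x : SymbolSpace) :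
    pat (k :: l) x = coord (shiftBy k x) * pat l x := by simp [pat]

theorem pat_append (l l' : List ℤ) (x : SymbolSpace) : pat (l ++ l') x = pat l x * pat l' x := by simp [pat]

theorem pat_shiftBy (l : List ℤ) (n : ℤ) (x : SymbolSpace) :
    pat l (shiftBy n x) = pat (l.map (· + n)) x := by
  simp [pat, shiftBy_shiftBy, Function.comp_def]

theorem pat_dilate (l : List ℤ) (p : ℤ) (x : SymbolSpace) :
    pat l (dilate p x) = (-1) ^ l.length * pat (l.map (p * ·)) x := by
  induction l with
  | nil => simp [pat]
  | cons k l ih => rw [pat_cons, List.map_cons, pat_cons, ih, coord_dilate, List.length_cons]; ring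

theorem abs_pat_le (l : List ℤ) (x : SymbolSpace) : |pat l x| ≤ 1 := by
  induction l with
  | nil => simp [pat]
  | cons k l ih =>
    rw [pat_cons, abs_mul]; exact mul_le_one₀ (abs_coord_le _) (abs_nonneg _) ih

theorem continuous_pat (l : List ℤ) : Continuous (pat l) := by
  induction l with
  | nil => exact continuous_const
  | cons k l ih =>
    have : pat (k :: l) = fun x => coord (shiftBy k x) * pat l x := funext fun x => pat_cons k l x
    rw [this]; exact (continuous_coord.comp (continuous_shiftBy k)).mul ih

theorem measurable_pat (l : List ℤ) : Measurable (pat l) := (continuous_pat l).measurable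

end Patterns

section Independence

/-- A finite group valued variable which can be translated by almost any amount while almost fixing
an event is uniformly distributed on that event. -/
theorem measureReal_fiber_inter_eq_of_translation {Ω V : Type*} [MeasurableSpace Ω] {μ : Measure Ω}
    [IsProbabilityMeasure μ] [AddGroup V] [Fintype V] {Z : Ω → V} (hZ : FiberMeasurable Z)
    {E : Set Ω} (hE : MeasurableSet E)
    (h : ∀ v : V, ∀ ε > 0, ∃ S : Ω → Ω, MeasurePreserving S μ μ ∧
      μ.real {x | ¬ (S x ∈ E ↔ x ∈ E)} ≤ ε ∧ μ.real {x | Z (S x) ≠ Z x + v} ≤ ε) (z : V) :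
    μ.real (Z ⁻¹' {z} ∩ E) = μ.real E / Fintype.card V := by
  have key : ∀ z v : V, μ.real (Z ⁻¹' {z} ∩ E) ≤ μ.real (Z ⁻¹' {z + v} ∩ E) := fun z v => by
    refine le_of_forall_pos_le_add fun ε hε => ?_
    obtain ⟨S, hS, h1, h2⟩ := h v (ε / 2) (by positivity)
    calc μ.real (Z ⁻¹' {z} ∩ E) ≤ μ.real (S ⁻¹' (Z ⁻¹' {z + v} ∩ E) ∪
          ({x | ¬ (S x ∈ E ↔ x ∈ E)} ∪ {x | Z (S x) ≠ Z x + v})) := by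
          refine measureReal_mono ?_
          rintro x ⟨hx1, hx2⟩
          simp only [Set.mem_preimage, Set.mem_singleton_iff] at hx1
          by_cases hb : Z (S x) ≠ Z x + v
          · exact Or.inr (Or.inr hb)
          by_cases hb' : S x ∈ E ↔ x ∈ E
          · left
            push Not at hb
            refine ⟨?_, hb'.2 hx2⟩
            simp [hb, hx1]
          · exact Or.inr (Or.inl hb')
      _ ≤ μ.real (S ⁻¹' (Z ⁻¹' {z + v} ∩ E)) + (ε / 2 + ε / 2) := by
          refine (measureReal_union_le _ _).trans ?_
          gcongr
          exact (measureReal_union_le _ _).trans (add_le_add h1 h2)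
      _ = μ.real (Z ⁻¹' {z + v} ∩ E) + ε := by
          rw [hS.measureReal_preimage ((hZ _).inter hE).nullMeasurableSet]; ring
  have heq : ∀ z', μ.real (Z ⁻¹' {z'} ∩ E) = μ.real (Z ⁻¹' {z} ∩ E) := fun z' => by
    refine le_antisymm ?_ ?_
    · simpa using key z' (-z' + z)
    · simpa using key z (-z + z')
  have hsum : ∑ z' : V, μ.real (Z ⁻¹' {z'} ∩ E) = μ.real E := by
    have := sum_measureReal_inter_fiber (μ := μ) hZ hE
    rw [← this]; exact sum_congr rfl fun z' _ => by rw [Set.inter_comm]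
  rw [sum_congr rfl fun z' _ => heq z', sum_const, card_univ, nsmul_eq_mul] at hsum; rw [← hsum]; field_simp

theorem integral_comp_eq_sum_fiber {Ω α : Type*} [MeasurableSpace Ω] {μ : Measure Ω}
    [IsProbabilityMeasure μ] [Fintype α] {A : Ω → α} (hA : FiberMeasurable A) {Φ : α → Ω → ℂ}
    (hΦ : ∀ a, Integrable (Φ a) μ) :
    ∫ ω, Φ (A ω) ω ∂μ = ∑ a, ∫ ω in A ⁻¹' {a}, Φ a ω ∂μ := by
  classical
  have e : ∀ ω, Φ (A ω) ω = ∑ a, (A ⁻¹' {a}).indicator (Φ a) ω := fun ω => by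
    rw [sum_eq_single (A ω)]
    · simp
    · intro b _ hb; simp [hb.symm]
    · simp
  simp only [e]; rw [integral_finsetSum _ fun a _ => (hΦ a).indicator (hA a)]
  exact sum_congr rfl fun a _ => integral_indicator (hA a)

/-- Small mutual information decouples observables factoring through one variable from the other
variable. -/
theorem norm_integral_sub_sum_integral_le_of_mutualInfo {Ω α β : Type*} [MeasurableSpace Ω]
    {μ : Measure Ω} [IsProbabilityMeasure μ] [Fintype α] [Fintype β] {A : Ω → α} {B : Ω → β}
    (hA : FiberMeasurable A) (hB : FiberMeasurable B) {I : ℝ} (hI : mutualInfo μ A B ≤ I)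
    (Φ : β → Ω → ℂ) (hΦ : ∀ b ω, ‖Φ b ω‖ ≤ 1) (hfac : ∀ b ω ω', A ω = A ω' → Φ b ω = Φ b ω') :
    ‖∑ b, ∫ ω in B ⁻¹' {b}, Φ b ω ∂μ - ∑ b, (μ.real (B ⁻¹' {b}) : ℂ) * ∫ ω, Φ b ω ∂μ‖ ≤
      2 * √I := by
  classical
  set F : α → β → ℂ := fun a b => if h : ∃ ω, A ω = a then Φ b h.choose else 0
  have hF : ∀ b ω, Φ b ω = F (A ω) b := fun b ω => by
    have h : ∃ ω', A ω' = A ω := ⟨ω, rfl⟩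
    simp only [F, dif_pos h]; exact hfac b _ _ h.choose_spec.symm
  have hF1 : ∀ a b, ‖F a b‖ ≤ 1 := fun a b => by
    simp only [F]; split_ifs
    · exact hΦ _ _
    · simp
  have hInt : ∀ b, Integrable (Φ b) μ := fun b => by
    have : Φ b = fun ω => F (A ω) b := funext (hF b)
    rw [this]
    exact Integrable.of_bound (hA.measurable fun a => F a b).aestronglyMeasurable 1
      (ae_of_all _ fun ω => hF1 _ _)
  have h1 := norm_integral_sub_sum_le_of_mutualInfo hA hB hI F hF1
  have h2 : ∫ ω, F (A ω) (B ω) ∂μ = ∑ b, ∫ ω in B ⁻¹' {b}, Φ b ω ∂μ := by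
    rw [← integral_comp_eq_sum_fiber hB hInt]; exact integral_congr_ae (ae_of_all _ fun ω => (hF _ _).symm)
  have h3 : ∑ a, ∑ b, (μ.real (A ⁻¹' {a}) : ℂ) * (μ.real (B ⁻¹' {b}) : ℂ) * F a b =
      ∑ b, (μ.real (B ⁻¹' {b}) : ℂ) * ∫ ω, Φ b ω ∂μ := by
    rw [sum_comm]
    refine sum_congr rfl fun b _ => ?_
    have : ∫ ω, Φ b ω ∂μ = ∑ a, (μ.real (A ⁻¹' {a}) : ℂ) * F a b := by
      have := integral_comp_eq_sum_fiber (μ := μ) hA (Φ := fun a _ => F a b)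
        (fun a => integrable_const _)
      simp only [← hF, setIntegral_const, Complex.real_smul] at this; exact this
    rw [this, mul_sum]; exact sum_congr rfl fun a _ => by ring
  rwa [h2, h3] at h1

end Independence

section DilationSystem

variable {κ : Measure SymbolSpace}

theorem ae_shiftBy_of_step (hT : MeasurePreserving shift κ κ) {V : Type*} (φ : SymbolSpace → V)
    (g : Equiv.Perm V) (h : ∀ᵐ x ∂κ, φ (shiftBy 1 x) = g (φ x)) (n : ℤ) :
    ∀ᵐ x ∂κ, φ (shiftBy n x) = (g ^ n) (φ x) := by
  have hmp := measurePreserving_shiftBy hT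
  induction n using Int.induction_on with
  | zero => simp [shiftBy_zero]
  | succ n ih =>
    filter_upwards [ih, (hmp n).quasiMeasurePreserving.ae h] with x h1 h2
    rw [add_comm, ← shiftBy_shiftBy, h2, h1, zpow_one_add]; rfl
  | pred n ih =>
    filter_upwards [ih, (hmp (-n - 1)).quasiMeasurePreserving.ae h] with x h1 h2
    rw [shiftBy_shiftBy, show (1 : ℤ) + (-n - 1) = -n by ring, h1] at h2
    rw [sub_eq_add_neg, add_comm (-(n : ℤ)), zpow_add, Equiv.Perm.mul_apply, h2, add_comm (-1),
      ← sub_eq_add_neg]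
    simp

theorem ae_shiftBy_add (hT : MeasurePreserving shift κ κ) {V : Type*} [AddCommGroup V]
    (φ : SymbolSpace → V) (v : V) (h : ∀ᵐ x ∂κ, φ (shiftBy 1 x) = φ x + v) (n : ℤ) :
    ∀ᵐ x ∂κ, φ (shiftBy n x) = φ x + n • v := by
  have := ae_shiftBy_of_step hT φ (Equiv.addRight v) h n
  simpa using this

theorem ae_shiftBy_mul (hT : MeasurePreserving shift κ κ) (φ : SymbolSpace → ℂ) {c : ℂ} (hc : c ≠ 0)
    (h : ∀ᵐ x ∂κ, φ (shiftBy 1 x) = c * φ x) (n : ℤ) :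
    ∀ᵐ x ∂κ, φ (shiftBy n x) = c ^ n * φ x := by
  have := ae_shiftBy_of_step hT φ (Equiv.mulLeft₀ c hc) h n
  have h2 : ∀ z : ℂ, (Equiv.mulLeft₀ c hc ^ n) z = c ^ n * z := by
    intro z
    induction n using Int.induction_on generalizing z with
    | zero => simp
    | succ n ih =>
      rw [zpow_add_one, Equiv.Perm.mul_apply, ih]
      · rw [zpow_add_one₀ hc]; simp [mul_assoc]
      · exact ae_shiftBy_of_step hT φ (Equiv.mulLeft₀ c hc) h n
    | pred n ih =>
      rw [zpow_sub_one, Equiv.Perm.mul_apply, ih]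
      · rw [zpow_sub_one₀ hc]; simp [mul_assoc, Equiv.Perm.inv_def]
      · exact ae_shiftBy_of_step hT φ (Equiv.mulLeft₀ c hc) h _
  simpa [h2] using this

theorem measurableEmbedding_shiftBy (n : ℤ) : MeasurableEmbedding (shiftBy n) :=
  (MeasurableEquiv.mk ⟨shiftBy n, shiftBy (-n), fun x => by simp [shiftBy_shiftBy, shiftBy_zero],
    fun x => by simp [shiftBy_shiftBy, shiftBy_zero]⟩ (measurable_shiftBy n)
    (measurable_shiftBy (-n))).measurableEmbedding

theorem integral_comp_shiftBy (hT : MeasurePreserving shift κ κ) (n : ℤ) {E : Type*}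
    [NormedAddCommGroup E] [NormedSpace ℝ E] (g : SymbolSpace → E) :
    ∫ x, g (shiftBy n x) ∂κ = ∫ x, g x ∂κ :=
  (measurePreserving_shiftBy hT n).integral_comp (measurableEmbedding_shiftBy n) g

/-- A choice, for every prime, of the cyclic factor on whose zero fibre dilation acts. -/
structure DilationSystem (κ : Measure SymbolSpace) where
  d : ℕ → ℕ
  Y : ∀ n, SymbolSpace → ZMod (d n)
  d_eq : ∀ n, d n = 1 ∨ n.Prime ∧ d n = n
  fiberMeasurable : ∀ n, FiberMeasurable (Y n)
  step : ∀ n, ∀ᵐ x ∂κ, Y n (shiftBy 1 x) = Y n x + 1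
  ergodic : ∀ p : ℕ, p.Prime → Ergodic (shiftBy p) (κ.restrict (Y p ⁻¹' {0}))
  map_dilate : ∀ p : ℕ, p.Prime →
    (κ.restrict (Y p ⁻¹' {0})).map (dilate p) = κ (Y p ⁻¹' {0}) • κ
  measureReal_zero : ∀ n, κ.real (Y n ⁻¹' {0}) = 1 / d n

variable [IsProbabilityMeasure κ]

theorem nonempty_dilationSystem
    (hgen : ∀ f : C(SymbolSpace, ℝ), Tendsto (fun N : ℕ => (1 / (N : ℝ)) *
      ∑ n ∈ Icc 1 N, f (shift^[n] liouvillePoint)) atTop (nhds (∫ y, f y ∂κ)))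
    (hErg : Ergodic shift κ) : Nonempty (DilationSystem κ) := by
  classical
  have h : ∀ n : ℕ, ∃ d : ℕ, ∃ Y : SymbolSpace → ZMod d, (d = 1 ∨ n.Prime ∧ d = n) ∧
      FiberMeasurable Y ∧ (∀ᵐ x ∂κ, Y (shiftBy 1 x) = Y x + 1) ∧
      (n.Prime → Ergodic (shiftBy n) (κ.restrict (Y ⁻¹' {0}))) ∧
      (n.Prime → (κ.restrict (Y ⁻¹' {0})).map (dilate n) = κ (Y ⁻¹' {0}) • κ) ∧
      κ.real (Y ⁻¹' {0}) = 1 / d := by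
    intro n
    by_cases hn : n.Prime
    · obtain ⟨d, hd, Y, h1, h2, h3, h4, h5⟩ := exists_dilation_factor hgen hErg hn
      exact ⟨d, Y, hd.imp id fun h => ⟨hn, h⟩, h1, h2, fun _ => h3, fun _ => h4, h5⟩
    · refine ⟨1, fun _ => 0, Or.inl rfl, fun a => ?_, ae_of_all _ fun _ => Subsingleton.elim _ _,
        fun h => absurd h hn, fun h => absurd h hn, ?_⟩
      · rw [Subsingleton.elim a 0]; simp
      · have : (fun _ : SymbolSpace => (0 : ZMod 1)) ⁻¹' {0} = Set.univ := by ext; simp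
        rw [this]; simp
  choose d Y h1 h2 h3 h4 h5 h6 using h
  exact ⟨⟨d, Y, h1, h2, h3, h4, h5, h6⟩⟩

namespace DilationSystem

variable (D : DilationSystem κ)

instance (n : ℕ) : NeZero (D.d n) := ⟨by
  rcases D.d_eq n with h | ⟨h1, h2⟩
  · simp [h]
  · rw [h2]; exact h1.ne_zero⟩

theorem step_shiftBy (hT : MeasurePreserving shift κ κ) (n : ℕ) (m : ℤ) :
    ∀ᵐ x ∂κ, D.Y n (shiftBy m x) = D.Y n x + m := by
  simpa using ae_shiftBy_add hT (D.Y n) 1 (D.step n) m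

theorem coprime_prod (n : ℕ) : (D.d n).Coprime (∏ i : Fin n, D.d i) := by
  rcases D.d_eq n with h | ⟨hp, h⟩
  · simp [h]
  · rw [h]
    refine Nat.Coprime.prod_right fun i _ => ?_
    rcases D.d_eq i with hi | ⟨hq, hi⟩
    · simp [hi]
    · rw [hi]; exact (Nat.coprime_primes hp hq).2 i.2.ne'

theorem exists_translation (n : ℕ) (v : ZMod (D.d n)) :
    ∃ m : ℤ, (m : ZMod (D.d n)) = v ∧ ∀ i < n, (m : ZMod (D.d i)) = 0 := by
  obtain ⟨m, h1, h2⟩ := Nat.chineseRemainder (D.coprime_prod n) v.val 0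
  refine ⟨m, ?_, fun i hi => ?_⟩
  · have := (ZMod.natCast_eq_natCast_iff _ _ _).2 h1
    rw [ZMod.natCast_val, ZMod.cast_id] at this
    exact_mod_cast this
  · have h3 : D.d i ∣ m := (dvd_prod_of_mem (fun i : Fin n => D.d i)
      (mem_univ ⟨i, hi⟩)).trans ((Nat.modEq_zero_iff_dvd).1 h2)
    rw [Int.cast_natCast]; exact (ZMod.natCast_eq_zero_iff _ _).2 h3

theorem measureReal_fiber (hT : MeasurePreserving shift κ κ) (n : ℕ) (z : ZMod (D.d n)) :
    κ.real (D.Y n ⁻¹' {z}) = 1 / D.d n := by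
  have := measureReal_fiber_inter_eq_of_translation (μ := κ) (D.fiberMeasurable n)
    (E := Set.univ) MeasurableSet.univ (fun v ε hε => by
      obtain ⟨m, hm, -⟩ := D.exists_translation n v
      refine ⟨shiftBy m, measurePreserving_shiftBy hT m, by simpa using hε.le, ?_⟩
      have h0 : κ {x | D.Y n (shiftBy m x) ≠ D.Y n x + v} = 0 := by
        have := D.step_shiftBy hT n m
        rw [hm] at this; exact this
      rw [measureReal_def, h0]; simpa using hε.le) z
  simpa using this

theorem independence (hT : MeasurePreserving shift κ κ) (n : ℕ) (z : ZMod (D.d n))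
    (w : ∀ i : Fin n, ZMod (D.d i)) :
    κ.real (D.Y n ⁻¹' {z} ∩ (fun x (i : Fin n) => D.Y i x) ⁻¹' {w}) =
      κ.real (D.Y n ⁻¹' {z}) * κ.real ((fun x (i : Fin n) => D.Y i x) ⁻¹' {w}) := by
  have hE : MeasurableSet ((fun x (i : Fin n) => D.Y i x) ⁻¹' {w}) :=
    FiberMeasurable.pi (A := fun (i : Fin n) x => D.Y i x) (fun i => D.fiberMeasurable i) w
  rw [D.measureReal_fiber hT, measureReal_fiber_inter_eq_of_translation (μ := κ)
    (D.fiberMeasurable n) hE, ZMod.card]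
  · ring
  intro v ε hε
  obtain ⟨m, hm, hm0⟩ := D.exists_translation n v
  refine ⟨shiftBy m, measurePreserving_shiftBy hT m, ?_, ?_⟩
  · have h0 : κ {x | ¬ (shiftBy m x ∈ (fun x (i : Fin n) => D.Y i x) ⁻¹' {w} ↔
        x ∈ (fun x (i : Fin n) => D.Y i x) ⁻¹' {w})} = 0 := by
      have := ae_all_iff.2 fun i : Fin n => D.step_shiftBy hT i m
      change ∀ᵐ x ∂κ, _
      filter_upwards [this] with x hx
      have : (fun i : Fin n => D.Y i (shiftBy m x)) = fun i : Fin n => D.Y i x := by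
        funext i; rw [hx i, hm0 i i.2, add_zero]
      simp only [Set.mem_preimage, Set.mem_singleton_iff, this]
    rw [measureReal_def, h0]; simpa using hε.le
  · have h0 : κ {x | D.Y n (shiftBy m x) ≠ D.Y n x + v} = 0 := by
      have := D.step_shiftBy hT n m
      rw [hm] at this; exact this
    rw [measureReal_def, h0]; simpa using hε.le

theorem integral_dilate {p : ℕ} (hp : p.Prime) {Φ : SymbolSpace → ℂ} (hΦ : Measurable Φ) :
    ∫ x, Φ x ∂κ = D.d p * ∫ x in D.Y p ⁻¹' {0}, Φ (dilate p x) ∂κ := by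
  have h1 := D.map_dilate p hp
  have h2 : ∫ x, Φ x ∂((κ.restrict (D.Y p ⁻¹' {0})).map (dilate p)) =
      ∫ x in D.Y p ⁻¹' {0}, Φ (dilate p x) ∂κ :=
    integral_map (measurable_dilate p).aemeasurable hΦ.aestronglyMeasurable
  rw [← h2, h1, integral_smul_measure, ← measureReal_def, D.measureReal_zero]
  have : (D.d p : ℂ) ≠ 0 := by exact_mod_cast (NeZero.ne (D.d p))
  rw [Complex.real_smul]; push_cast; field_simp

/-- The mutual information between the cyclic factor of `p` and the word of length `C * p` seen
through the zeroth coordinate and an auxiliary finite-valued observable. -/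
noncomputable def info {α : Type} [Fintype α] (y : SymbolSpace → α) (C p : ℕ) : ℝ :=
  mutualInfo κ (orbitWord shift (fun x => (x 0, y x)) (C * p)) (D.Y p)

theorem fiberMeasurable_observable {α : Type} {y : SymbolSpace → α} (hy : FiberMeasurable y) :
    FiberMeasurable fun x : SymbolSpace => (x 0, y x) :=
  FiberMeasurable.prodMk (fun a => (measurable_pi_apply (0 : ℤ)) (measurableSet_singleton a)) hy

theorem summable_info (hT : MeasurePreserving shift κ κ) {α : Type} [Fintype α]
    {y : SymbolSpace → α} (hy : FiberMeasurable y) (C : ℕ) :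
    Summable fun n : ℕ => D.info y C n / n :=
  summable_mutualInfo_orbitWord hT (fiberMeasurable_observable hy) D.Y D.fiberMeasurable
    (fun n => ⟨fun _ z => z + 1, D.step n⟩) (D.independence hT) C

theorem setIntegral_fiber_shiftBy (hT : MeasurePreserving shift κ κ) (p : ℕ) (Φ : SymbolSpace → ℂ)
    (b : ZMod (D.d p)) : ∫ x in D.Y p ⁻¹' {b}, Φ (shiftBy ((-b).val : ℕ) x) ∂κ =
      ∫ x in D.Y p ⁻¹' {0}, Φ x ∂κ := by
  rw [← integral_indicator (D.fiberMeasurable p b), ← integral_indicator (D.fiberMeasurable p 0),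
    ← integral_comp_shiftBy hT ((-b).val : ℕ) ((D.Y p ⁻¹' {0}).indicator Φ)]
  refine integral_congr_ae ?_
  filter_upwards [D.step_shiftBy hT p ((-b).val : ℕ)] with x hx
  rw [Int.cast_natCast, ZMod.natCast_zmod_val] at hx
  simp only [Set.indicator, Set.mem_preimage, Set.mem_singleton_iff, hx]
  by_cases hb : D.Y p x = b
  · simp [hb]
  · rw [if_neg hb, if_neg]
    rwa [← sub_eq_add_neg, sub_eq_zero]

/-- Where the mutual information is small, correlations do not see the cyclic factor. -/
theorem norm_sub_le_of_info_le (hT : MeasurePreserving shift κ κ) {α : Type} [Fintype α]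
    {y : SymbolSpace → α} (hy : FiberMeasurable y) {C p : ℕ} {ε : ℝ}
    (hC : 0 < C) (hI : D.info y C p ≤ ε) {l : List ℤ} (hl : ∀ k ∈ l, 0 ≤ k ∧ k + 1 < C) {h : α → ℂ}
    (hh : ∀ a, ‖h a‖ ≤ 1) :
    ‖D.d p * ∫ x in D.Y p ⁻¹' {0}, (pat (l.map (p * ·)) x : ℂ) * h (y x) ∂κ -
      ∫ x, (pat (l.map (p * ·)) x : ℂ) * h (y x) ∂κ‖ ≤ 2 * √ε := by
  set Φ : SymbolSpace → ℂ := fun x => (pat (l.map (p * ·)) x : ℂ) * h (y x) with hΦdef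
  have hΦ1 : ∀ x, ‖Φ x‖ ≤ 1 := fun x => by
    simp only [hΦdef, norm_mul, Complex.norm_real, Real.norm_eq_abs]
    exact mul_le_one₀ (abs_pat_le _ _) (norm_nonneg _) (hh _)
  rcases D.d_eq p with hd | ⟨hp, hd⟩
  · have hs : Subsingleton (ZMod (D.d p)) := by rw [hd]; infer_instance
    have : D.Y p ⁻¹' {0} = Set.univ := by ext x; simp [Subsingleton.elim (D.Y p x) 0]
    rw [this, hd]; simp
  have hjlt : ∀ b : ZMod (D.d p), (-b).val < p := fun b => (ZMod.val_lt (-b)).trans_eq hd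
  have hfac : ∀ (b : ZMod (D.d p)) x x',
      orbitWord shift (fun x => (x 0, y x)) (C * p) x =
        orbitWord shift (fun x => (x 0, y x)) (C * p) x' →
      Φ (shiftBy ((-b).val : ℕ) x) = Φ (shiftBy ((-b).val : ℕ) x') := by
    intro b x x' hxx
    have hco : ∀ i : ℕ, i < C * p → (shiftBy i x) 0 = (shiftBy i x') 0 ∧
        y (shiftBy i x) = y (shiftBy i x') := fun i hi => by
      have := congrFun hxx ⟨i, hi⟩
      simp only [orbitWord, iterate_shift, Prod.mk.injEq] at this; exact this
    have hj := hjlt b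
    have h1 : (-b).val < C * p := hj.trans_le (Nat.le_mul_of_pos_left p hC)
    simp only [hΦdef]; rw [(hco _ h1).2]
    congr 2
    simp only [pat, List.map_map, Function.comp_def, shiftBy_shiftBy]
    congr 1
    refine List.map_congr_left fun k hk => ?_
    obtain ⟨hk0, hkC⟩ := hl k hk
    lift k to ℕ using hk0
    have h2 : p * k + (-b).val < C * p := by
      have : p * (k + 2) ≤ p * C := Nat.mul_le_mul_left p (by omega)
      nlinarith
    have h3 := (hco _ h2).1
    push_cast at h3
    simp only [coord, h3]
  have key := norm_integral_sub_sum_integral_le_of_mutualInfo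
    (fiberMeasurable_orbitWord (measurable_shiftBy 1) (fiberMeasurable_observable hy) (C * p))
    (D.fiberMeasurable p) hI (fun b x => Φ (shiftBy ((-b).val : ℕ) x)) (fun _ _ => hΦ1 _) hfac
  have e1 := D.setIntegral_fiber_shiftBy hT p Φ
  have e2 : ∀ b : ZMod (D.d p), ∫ x, Φ (shiftBy ((-b).val : ℕ) x) ∂κ = ∫ x, Φ x ∂κ := fun b =>
    integral_comp_shiftBy hT _ _
  simp only [e1, e2, D.measureReal_fiber hT, sum_const, card_univ, ZMod.card,
    nsmul_eq_mul] at key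
  have hd0 : (D.d p : ℂ) ≠ 0 := by exact_mod_cast (NeZero.ne (D.d p))
  have e3 : (D.d p : ℂ) * (((1 / (D.d p : ℝ) : ℝ) : ℂ) * ∫ x, Φ x ∂κ) = ∫ x, Φ x ∂κ := by push_cast; field_simp
  rwa [e3] at key

end DilationSystem
end DilationSystem

section Eigenfunctions

/-- A unimodular eigenfunction of the shift. -/
structure IsEigenfunction (κ : Measure SymbolSpace) (e : SymbolSpace → ℂ) (c : ℂ) : Prop where
  measurable : Measurable e
  norm_eq_one : ∀ x, ‖e x‖ = 1
  step : ∀ᵐ x ∂κ, e (shiftBy 1 x) = c * e x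

theorem exists_eq_mul_of_ergodic {S : SymbolSpace → SymbolSpace} {ν : Measure SymbolSpace} [NeZero ν]
    (hS : Ergodic S ν) {φ ψ : SymbolSpace → ℂ} (hφ : Measurable φ) (hψ : Measurable ψ)
    (hφ1 : ∀ x, ‖φ x‖ = 1) (hψ1 : ∀ x, ‖ψ x‖ = 1) {c : ℂ} (hφc : ∀ᵐ x ∂ν, φ (S x) = c * φ x)
    (hψc : ∀ᵐ x ∂ν, ψ (S x) = c * ψ x) : ∃ ζ : ℂ, ‖ζ‖ = 1 ∧ ∀ᵐ x ∂ν, φ x = ζ * ψ x := by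
  have hψ0 : ∀ x, ψ x ≠ 0 := fun x h => by simpa [h] using hψ1 x
  have hinv : (fun x => φ x / ψ x) ∘ S =ᵐ[ν] fun x => φ x / ψ x := by
    filter_upwards [hφc, hψc] with x h1 h2
    have hc : c ≠ 0 := fun h => by rw [h, zero_mul] at h2; exact hψ0 _ h2
    simp only [Function.comp, h1, h2]; rw [mul_div_mul_left _ _ hc]
  obtain ⟨ζ, hζ⟩ := hS.quasiErgodic.ae_eq_const_of_ae_eq_comp₀
    (hφ.div hψ).nullMeasurable hinv
  have h1 : ∀ᵐ x ∂ν, φ x = ζ * ψ x := by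
    filter_upwards [hζ] with x hx
    rw [← show φ x / ψ x = ζ from hx, div_mul_cancel₀ _ (hψ0 x)]
  obtain ⟨x, hx⟩ := h1.exists
  refine ⟨ζ, ?_, h1⟩
  have := congrArg norm hx
  rw [norm_mul, hφ1, hψ1, mul_one] at this; exact this.symm

namespace IsEigenfunction

variable {κ : Measure SymbolSpace} {e : SymbolSpace → ℂ} {c : ℂ}

theorem ne_zero (he : IsEigenfunction κ e c) (x : SymbolSpace) : e x ≠ 0 := fun h => by
  simpa [h] using he.norm_eq_one x

theorem mul {e' : SymbolSpace → ℂ} {c' : ℂ} (he : IsEigenfunction κ e c)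
    (he' : IsEigenfunction κ e' c') : IsEigenfunction κ (fun x => e x * e' x) (c * c') where
  measurable := he.measurable.mul he'.measurable
  norm_eq_one x := by rw [norm_mul, he.norm_eq_one, he'.norm_eq_one, one_mul]
  step := by
    filter_upwards [he.step, he'.step] with x h1 h2
    rw [h1, h2]; ring

theorem pow (he : IsEigenfunction κ e c) (n : ℕ) : IsEigenfunction κ (fun x => e x ^ n) (c ^ n) where
  measurable := he.measurable.pow_const n
  norm_eq_one x := by rw [norm_pow, he.norm_eq_one, one_pow]
  step := by
    filter_upwards [he.step] with x h1
    rw [h1, mul_pow]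

variable [IsProbabilityMeasure κ]

theorem norm_eigenvalue (he : IsEigenfunction κ e c) : ‖c‖ = 1 := by
  obtain ⟨x, hx⟩ := he.step.exists
  have := congrArg norm hx
  rw [norm_mul, he.norm_eq_one, he.norm_eq_one, mul_one] at this; exact this.symm

theorem eigenvalue_ne_zero (he : IsEigenfunction κ e c) : c ≠ 0 := fun h => by
  simpa [h] using he.norm_eigenvalue

theorem shiftBy_eq (he : IsEigenfunction κ e c) (hT : MeasurePreserving shift κ κ) (n : ℤ) :
    ∀ᵐ x ∂κ, e (shiftBy n x) = c ^ n * e x :=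
  ae_shiftBy_mul hT e he.eigenvalue_ne_zero he.step n

theorem unique (hErg : Ergodic shift κ) {e' : SymbolSpace → ℂ} (he : IsEigenfunction κ e c)
    (he' : IsEigenfunction κ e' c) : ∃ ζ : ℂ, ‖ζ‖ = 1 ∧ ∀ᵐ x ∂κ, e x = ζ * e' x :=
  exists_eq_mul_of_ergodic hErg he.measurable he'.measurable he.norm_eq_one he'.norm_eq_one
    he.step he'.step

theorem integrable_mul (he : IsEigenfunction κ e c) {φ : SymbolSpace → ℝ} (hφ : Measurable φ)
    (hφ1 : ∀ x, |φ x| ≤ 1) : Integrable (fun x => (φ x : ℂ) * e x) κ :=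
  Integrable.of_bound (C := 1)
    ((Complex.measurable_ofReal.comp hφ).mul he.measurable).aestronglyMeasurable
    (ae_of_all _ fun x => by
      rw [norm_mul, he.norm_eq_one, mul_one, Complex.norm_real]; exact hφ1 x)

end IsEigenfunction

theorem measurable_of_fiberMeasurable {Ω α E : Type*} [MeasurableSpace Ω] [MeasurableSpace E]
    [AddCommMonoid E] [MeasurableAdd₂ E] [Fintype α] {A : Ω → α} (hA : FiberMeasurable A)
    {Φ : α → Ω → E} (hΦ : ∀ a, Measurable (Φ a)) : Measurable fun ω => Φ (A ω) ω := by
  classical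
  have e : (fun ω => Φ (A ω) ω) = fun ω => ∑ a, (A ⁻¹' {a}).indicator (Φ a) ω := by
    funext ω
    rw [sum_eq_single (A ω)]
    · simp
    · intro b _ hb; simp [hb.symm]
    · simp
  rw [e]; exact measurable_sum _ fun a _ => (hΦ a).indicator (hA a)

namespace DilationSystem

variable {κ : Measure SymbolSpace} [IsProbabilityMeasure κ] (D : DilationSystem κ)

theorem restrict_ne_zero (p : ℕ) : NeZero (κ.restrict (D.Y p ⁻¹' {0})) := ⟨fun h => by
  rw [Measure.restrict_eq_zero] at h
  have h2 := D.measureReal_zero p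
  rw [measureReal_def, h] at h2
  have := NeZero.ne (D.d p)
  simp at h2
  exact this (by exact_mod_cast h2.symm)⟩

theorem ae_dilate {p : ℕ} (hp : p.Prime) {P : SymbolSpace → Prop} (h : ∀ᵐ x ∂κ, P x) :
    ∀ᵐ x ∂κ, D.Y p x = 0 → P (dilate p x) := by
  have h1 : ∀ᵐ x ∂((κ.restrict (D.Y p ⁻¹' {0})).map (dilate p)), P x := by
    rw [D.map_dilate p hp]; exact Measure.smul_absolutelyContinuous.ae_le h
  have h2 := ae_of_ae_map (measurable_dilate p).aemeasurable h1
  exact (ae_restrict_iff' (D.fiberMeasurable p 0)).1 h2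

theorem dilate_step {p : ℕ} (hp : p.Prime) {e : SymbolSpace → ℂ} {c : ℂ}
    (he : IsEigenfunction κ e c) :
    ∀ᵐ x ∂κ, D.Y p x = 0 → e (dilate p (shiftBy p x)) = c * e (dilate p x) := by
  filter_upwards [D.ae_dilate hp he.step] with x hx h0
  rw [← hx h0, ← dilate_shiftBy, mul_one]

/-- The dilate of an eigenfunction, extended from the zero fibre to an eigenfunction. -/
theorem exists_root_eigenfunction (hErg : Ergodic shift κ) {p : ℕ} (hp : p.Prime)
    {e : SymbolSpace → ℂ} {c : ℂ} (he : IsEigenfunction κ e c) :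
    ∃ (u : SymbolSpace → ℂ) (β : ℂ), IsEigenfunction κ u β ∧ β ^ p = c ∧
      ∀ᵐ x ∂κ, D.Y p x = 0 → u x = e (dilate p x) := by
  have hT := hErg.toMeasurePreserving
  rcases D.d_eq p with hd | ⟨-, hd⟩
  · have hs : Subsingleton (ZMod (D.d p)) := by rw [hd]; infer_instance
    have hA : D.Y p ⁻¹' {0} = Set.univ := by ext x; simp [Subsingleton.elim (D.Y p x) 0]
    have hY : ∀ x, D.Y p x = 0 := fun x => Subsingleton.elim _ _
    have herg := D.ergodic p hp
    rw [hA, Measure.restrict_univ] at herg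
    have hst := D.dilate_step hp he
    simp only [hY, true_imp_iff] at hst
    have hst2 := (measurePreserving_shiftBy hT 1).quasiMeasurePreserving.ae hst
    have hm := he.measurable.comp (measurable_dilate p)
    obtain ⟨β, hβ, hβ'⟩ := exists_eq_mul_of_ergodic herg (c := c)
      (φ := fun x => e (dilate p (shiftBy 1 x))) (ψ := fun x => e (dilate p x))
      (hm.comp (measurable_shiftBy 1)) hm (fun _ => he.norm_eq_one _) (fun _ => he.norm_eq_one _)
      (by
        filter_upwards [hst2] with x hx
        rw [shiftBy_shiftBy] at hx ⊢
        rw [add_comm, hx]) hst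
    have hu : IsEigenfunction κ (fun x => e (dilate p x)) β := ⟨hm, fun _ => he.norm_eq_one _, hβ'⟩
    refine ⟨_, β, hu, ?_, ae_of_all _ fun _ _ => rfl⟩
    obtain ⟨x, hx1, hx2⟩ := ((hu.shiftBy_eq hT p).and hst).exists
    rw [hx2, zpow_natCast] at hx1; exact (mul_right_cancel₀ (he.ne_zero _) hx1).symm
  · obtain ⟨β, hβ⟩ := IsAlgClosed.exists_pow_nat_eq c hp.pos
    have hβ1 : ‖β‖ = 1 := by
      have h := congrArg norm hβ
      rw [norm_pow, he.norm_eigenvalue] at h; exact (pow_eq_one_iff_of_nonneg (norm_nonneg _) hp.ne_zero).1 h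
    set u : SymbolSpace → ℂ := fun x =>
      β ^ (D.Y p x).val * e (dilate p (shiftBy (-((D.Y p x).val : ℤ)) x)) with hu
    refine ⟨u, β, ⟨?_, ?_, ?_⟩, hβ, ?_⟩
    · exact measurable_of_fiberMeasurable (D.fiberMeasurable p)
        (Φ := fun a x => β ^ a.val * e (dilate p (shiftBy (-(a.val : ℤ)) x)))
        fun a => (he.measurable.comp ((measurable_dilate p).comp
          (measurable_shiftBy _))).const_mul _
    · intro x; simp [hu, hβ1, he.norm_eq_one]
    · have h1 := (measurePreserving_shiftBy hT (-((p - 1 : ℕ) : ℤ))).quasiMeasurePreserving.ae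
        (D.dilate_step hp he)
      filter_upwards [D.step p, h1, D.step_shiftBy hT p (-((p - 1 : ℕ) : ℤ))] with x h1 h2 h3
      simp only [hu, h1]
      have hlt := ZMod.val_lt (D.Y p x)
      have hp1 := hp.one_lt
      by_cases hv : (D.Y p x).val + 1 < D.d p
      · have : (D.Y p x + 1).val = (D.Y p x).val + 1 := by
          have : Fact (1 < D.d p) := ⟨by omega⟩
          rw [ZMod.val_add, ZMod.val_one, Nat.mod_eq_of_lt hv]
        rw [this, shiftBy_shiftBy, pow_succ]; push_cast
        rw [show -(((D.Y p x).val : ℤ) + 1) + 1 = -((D.Y p x).val : ℤ) by ring]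
        ring
      · have hval : (D.Y p x).val = p - 1 := by omega
        have hY : D.Y p x = ((p - 1 : ℕ) : ZMod (D.d p)) := by rw [← hval, ZMod.natCast_zmod_val]
        have h0 : D.Y p x + 1 = 0 := by
          rw [hY, ← Nat.cast_succ, Nat.succ_eq_add_one, Nat.sub_add_cancel hp.pos]
          exact (ZMod.natCast_eq_zero_iff _ _).2 hd.dvd
        have h4 := h2 (by rw [h3, hY]; push_cast; ring)
        rw [shiftBy_shiftBy, show (p : ℤ) + -((p - 1 : ℕ) : ℤ) = 1 by
          have := hp.pos; omega] at h4
        rw [h0, ZMod.val_zero, pow_zero, one_mul, Nat.cast_zero, neg_zero, shiftBy_zero, h4, hval,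
          ← hβ, ← mul_assoc, ← pow_succ', Nat.sub_add_cancel hp.pos]
    · refine ae_of_all _ fun x hx => ?_
      simp [hu, hx, shiftBy_zero]

/-- For a prime not dividing the order of the eigenvalue, the dilate of an eigenfunction is a
multiple of a power of that eigenfunction on the zero fibre. -/
theorem exists_dilate_eq_pow (hT : MeasurePreserving shift κ κ) {p : ℕ} (hp : p.Prime)
    {e : SymbolSpace → ℂ} {c : ℂ} (he : IsEigenfunction κ e c) {a : ℕ} (ha : c ^ (a * p) = c) :
    ∃ ζ : ℂ, ‖ζ‖ = 1 ∧ ∀ᵐ x ∂κ, D.Y p x = 0 → e (dilate p x) = ζ * e x ^ a := by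
  have := D.restrict_ne_zero p
  have hm := he.measurable.comp (measurable_dilate p)
  obtain ⟨ζ, hζ, h⟩ := exists_eq_mul_of_ergodic (D.ergodic p hp) (c := c)
    (φ := fun x => e (dilate p x)) (ψ := fun x => e x ^ a) hm (he.pow a).measurable
    (fun _ => he.norm_eq_one _) (he.pow a).norm_eq_one
    ((ae_restrict_iff' (D.fiberMeasurable p 0)).2 (D.dilate_step hp he))
    (ae_restrict_of_ae (by
      filter_upwards [(he.pow a).shiftBy_eq hT p] with x hx
      rw [hx, zpow_natCast, ← pow_mul, ha]))
  exact ⟨ζ, hζ, (ae_restrict_iff' (D.fiberMeasurable p 0)).1 h⟩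

end DilationSystem
end Eigenfunctions

section PrimesInProgressions

open Real

open ArithmeticFunction.vonMangoldt in
/-- The sum of the reciprocals of the primes in an invertible residue class diverges. -/
theorem not_summable_one_div_prime_residueClass {q : ℕ} [NeZero q] {a : ZMod q} (ha : IsUnit a) :
    ¬ Summable fun n : ℕ => if n.Prime ∧ (n : ZMod q) = a then 1 / (n : ℝ) else 0 := by
  classical
  intro hs
  set s : ℕ → ℝ := fun n => if n.Prime ∧ (n : ZMod q) = a then 1 / (n : ℝ) else 0 with hsdef
  have hs0 : ∀ n, 0 ≤ s n := fun n => by simp only [hsdef]; split_ifs <;> positivity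
  obtain ⟨C, hC⟩ := LSeries_residueClass_lower_bound ha
  have hnp := summable_residueClass_non_primes_div a
  set np : ℕ → ℝ := fun n => (if n.Prime then 0 else residueClass a n) / n with hnpdef
  set c : ℝ := (q.totient : ℝ)⁻¹
  have hc0 : 0 < c := by
    have : 0 < q.totient := Nat.totient_pos.2 (Nat.pos_of_neZero q)
    positivity
  obtain ⟨P, hP⟩ : ∃ P, ∑' n, s (n + P) < c / 2 :=
    ((tendsto_sum_nat_add s).eventually (gt_mem_nhds (half_pos hc0))).exists
  set s1 : ℕ → ℝ := fun n => if n ∈ range P then s n * log n else 0 with hs1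
  set s2 : ℕ → ℝ := fun n => if n ∈ range P then 0 else s n with hs2
  have hs1s : Summable s1 := summable_of_ne_finset_zero (s := range P) fun n hn => by simp only [hs1, if_neg hn]
  have hs2s : Summable s2 := hs.of_nonneg_of_le
    (fun n => by simp only [hs2]; split_ifs <;> simp [hs0])
    (fun n => by simp only [hs2]; split_ifs <;> simp [hs0])
  have hs2t : ∑' n, s2 n < c / 2 := by
    rw [← hs2s.sum_add_tsum_nat_add P]
    have h1 : ∑ n ∈ range P, s2 n = 0 := sum_eq_zero fun n hn => by simp only [hs2, if_pos hn]
    have h2 : ∀ n, s2 (n + P) = s (n + P) := fun n => by simp [hs2]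
    rw [h1, zero_add, tsum_congr h2]; exact hP
  have hbound : ∀ δ : ℝ, 0 < δ → δ ≤ 1 → c / δ - C ≤ ∑' n, np n + ∑' n, s1 n + (c / 2) / δ := fun δ h0 h1 => by
    have hl := hC (x := 1 + δ) ⟨by linarith, by linarith⟩
    rw [add_sub_cancel_left] at hl
    refine hl.trans ?_
    have hle : ∀ n, residueClass a n / (n : ℝ) ^ (1 + δ) ≤ np n + s1 n + s2 n / δ := fun n => by
      have hr0 := residueClass_nonneg a n
      rcases Nat.eq_zero_or_pos n with rfl | hn
      · simp [hnpdef, hs1, hs2, hsdef]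
      have hn1 : (1 : ℝ) ≤ n := by exact_mod_cast hn
      have hn0 : (0 : ℝ) < n := by positivity
      have hpw : (n : ℝ) ≤ (n : ℝ) ^ (1 + δ) := by
        conv_lhs => rw [← rpow_one (n : ℝ)]
        exact rpow_le_rpow_of_exponent_le hn1 (by linarith)
      have hs2n : 0 ≤ s2 n := by simp only [hs2]; split_ifs <;> simp [hs0]
      have hs1n : 0 ≤ s1 n := by
        simp only [hs1]; split_ifs
        · exact mul_nonneg (hs0 n) (log_nonneg hn1)
        · rfl
      by_cases hp : n.Prime
      · have hnp0 : np n = 0 := by simp [hnpdef, hp]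
        have hval : residueClass a n / n = s n * log n := by
          simp only [residueClass, Set.indicator, Set.mem_ofPred_eq, hsdef, hp, true_and]
          split_ifs
          · rw [ArithmeticFunction.vonMangoldt_apply_prime hp]; ring
          · simp
        rw [hnp0, zero_add]
        by_cases hPn : n ∈ range P
        · have h3 : residueClass a n / (n : ℝ) ^ (1 + δ) ≤ residueClass a n / n :=
            div_le_div_of_nonneg_left hr0 hn0 hpw
          have h4 : s1 n = s n * log n := by simp only [hs1, if_pos hPn]
          rw [h4, ← hval]
          have := div_nonneg hs2n h0.le
          linarith
        · have h4 : s2 n = s n := by simp only [hs2, if_neg hPn]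
          have h5 : residueClass a n / (n : ℝ) ^ (1 + δ) = s n * (log n / (n : ℝ) ^ δ) := by
            rw [rpow_add hn0, rpow_one, ← div_div, hval]; ring
          have h6 : log n / (n : ℝ) ^ δ ≤ 1 / δ := by
            rw [div_le_iff₀ (by positivity)]
            have := log_le_rpow_div hn0.le h0
            rw [one_div, inv_mul_eq_div]; exact this
          rw [h5, h4]
          have := mul_le_mul_of_nonneg_left h6 (hs0 n)
          rw [mul_one_div] at this; linarith
      · have h3 : np n = residueClass a n / n := by simp [hnpdef, hp]
        have h4 : residueClass a n / (n : ℝ) ^ (1 + δ) ≤ residueClass a n / n :=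
          div_le_div_of_nonneg_left hr0 hn0 hpw
        have := div_nonneg hs2n h0.le
        linarith
    have hsum : Summable fun n => np n + s1 n + s2 n / δ := (hnp.add hs1s).add (hs2s.div_const δ)
    have hnn : ∀ n : ℕ, 0 ≤ residueClass a n / (n : ℝ) ^ (1 + δ) := fun n =>
      div_nonneg (residueClass_nonneg a n) (by positivity)
    refine (Summable.tsum_le_tsum hle (hsum.of_nonneg_of_le hnn hle) hsum).trans ?_
    rw [(hnp.add hs1s).tsum_add (hs2s.div_const δ), hnp.tsum_add hs1s, tsum_div_const]
    gcongr
  set K := ∑' n, np n + ∑' n, s1 n + C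
  have h1 : ∀ δ : ℝ, 0 < δ → δ ≤ 1 → c / 2 ≤ K * δ := fun δ h0 h1 => by
    have := hbound δ h0 h1
    have h2 : (c / 2) / δ ≤ K := by
      have : c / δ = (c / 2) / δ + (c / 2) / δ := by ring
      linarith
    rwa [div_le_iff₀ h0] at h2
  have hKpos : 0 < K := by
    have := h1 1 one_pos le_rfl
    linarith
  have h2 := h1 (min 1 (c / (4 * K))) (lt_min one_pos (by positivity)) (min_le_left _ _)
  have h3 : K * min 1 (c / (4 * K)) ≤ K * (c / (4 * K)) := by gcongr; exact min_le_right _ _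
  have h4 : K * (c / (4 * K)) = c / 4 := by field_simp
  linarith

/-- A set of exceptions with convergent weighted sum leaves infinitely many primes in every
invertible residue class. -/
theorem exists_prime_residueClass_le {q : ℕ} [NeZero q] {a : ZMod q} (ha : IsUnit a) {I : ℕ → ℝ}
    (hI : Summable fun n : ℕ => I n / n) {ε : ℝ} (hε : 0 < ε) (N : ℕ) :
    ∃ p : ℕ, p.Prime ∧ (p : ZMod q) = a ∧ N ≤ p ∧ I p ≤ ε := by
  by_contra! h
  refine not_summable_one_div_prime_residueClass ha ?_
  have h1 : Summable fun n : ℕ => ε⁻¹ * ‖I n / n‖ := hI.norm.mul_left _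
  refine (summable_nat_add_iff N).1 (((summable_nat_add_iff N).2 h1).of_nonneg_of_le
    (fun n => by split_ifs <;> positivity) fun n => ?_)
  split_ifs with hn
  · have := h (n + N) hn.1 hn.2 (by omega)
    rw [norm_div, norm_eq_abs, norm_eq_abs, abs_of_pos (hε.trans this), Nat.abs_cast,
      inv_mul_eq_div, div_div, div_le_div_iff₀ (by have := hn.1.pos; positivity)
        (by have := hn.1.pos; positivity)]
    have : (0 : ℝ) ≤ ((n + N : ℕ) : ℝ) := by positivity
    nlinarith
  · positivity

end PrimesInProgressions

section RationalEigenvalues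

variable {κ : Measure SymbolSpace} [IsProbabilityMeasure κ] {e : SymbolSpace → ℂ} {c : ℂ}

theorem IsEigenfunction.exists_finite_valued (hErg : Ergodic shift κ) (he : IsEigenfunction κ e c) {M : ℕ} (hM : 0 < M) (hc : c ^ M = 1) :
    ∃ (S : Finset ℂ) (y : SymbolSpace → S), FiberMeasurable y ∧ (∀ s ∈ S, ‖s‖ = 1) ∧
      ∀ᵐ x ∂κ, e x = y x := by
  classical
  obtain ⟨η, hη, h⟩ := exists_eq_mul_of_ergodic hErg (φ := fun x => e x ^ M) (ψ := fun _ => 1)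
    (c := 1) (he.pow M).measurable measurable_const (he.pow M).norm_eq_one (fun _ => norm_one)
    (by have := (he.pow M).step; rwa [hc] at this) (ae_of_all _ fun _ => by simp)
  simp only [mul_one] at h
  obtain ⟨z, hz⟩ := IsAlgClosed.exists_pow_nat_eq η hM
  set S : Finset ℂ := (Polynomial.nthRoots M η).toFinset
  have hS : ∀ s, s ∈ S ↔ s ^ M = η := fun s => by rw [Multiset.mem_toFinset, Polynomial.mem_nthRoots hM]
  refine ⟨S, fun x => if h : e x ∈ S then ⟨e x, h⟩ else ⟨z, (hS z).2 hz⟩, fun s => ?_, fun s hs => ?_, ?_⟩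
  · have : (fun x => if h : e x ∈ S then (⟨e x, h⟩ : S) else ⟨z, (hS z).2 hz⟩) ⁻¹' {s} =
        e ⁻¹' {(s : ℂ)} ∪ (e ⁻¹' (S : Set ℂ))ᶜ ∩ {_x | s = ⟨z, (hS z).2 hz⟩} := by
      ext x
      simp only [Set.mem_preimage, Set.mem_singleton_iff, Set.mem_union, Set.mem_inter_iff,
        Set.mem_compl_iff, Set.mem_ofPred_eq, mem_coe]
      split_ifs with hx
      · simp [hx, Subtype.ext_iff]
      · simp only [hx, not_false_iff, true_and]
        constructor
        · exact fun h => Or.inr h.symm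
        · rintro (h | h)
          · exact absurd (h ▸ s.2) hx
          · exact h.symm
    rw [this]; exact (he.measurable (measurableSet_singleton _)).union
      ((he.measurable S.finite_toSet.measurableSet).compl.inter (MeasurableSet.const _))
  · have := congrArg norm ((hS s).1 hs)
    rw [norm_pow, hη] at this; exact (pow_eq_one_iff_of_nonneg (norm_nonneg _) hM.ne').1 this
  · filter_upwards [h] with x hx
    rw [dif_pos ((hS _).2 hx)]

namespace DilationSystem

variable (D : DilationSystem κ)

/-- Correlations with an eigenfunction of finite order are almost preserved by dilation by a
prime with small mutual information. -/
theorem norm_integral_pat_sub_le (hT : MeasurePreserving shift κ κ) {p : ℕ} (hp : p.Prime)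
    (he : IsEigenfunction κ e c) {S : Finset ℂ} {y : SymbolSpace → S}
    (hy : FiberMeasurable y) (hS : ∀ s ∈ S, ‖s‖ = 1) (hey : ∀ᵐ x ∂κ, e x = y x) {C : ℕ} {ε : ℝ}
    (hC : 0 < C) (hI : D.info y C p ≤ ε) {l : List ℤ} (hl : ∀ k ∈ l, 0 ≤ k ∧ k + 1 < C) {a : ℕ}
    {ζ : ℂ} (hζ : ‖ζ‖ = 1) (h : ∀ᵐ x ∂κ, D.Y p x = 0 → e (dilate p x) = ζ * e x ^ a) (b : ℕ) :
    ‖∫ x, (pat l x : ℂ) * e x ^ b ∂κ -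
      (-1) ^ l.length * ζ ^ b * ∫ x, (pat (l.map (p * ·)) x : ℂ) * e x ^ (a * b) ∂κ‖ ≤ 2 * √ε := by
  have key := D.norm_sub_le_of_info_le hT hy hC hI hl (h := fun s => (s : ℂ) ^ (a * b))
    (fun s => by rw [norm_pow, hS s s.2, one_pow])
  have e0 : ∀ᵐ x ∂κ, (pat (l.map (p * ·)) x : ℂ) * (y x : ℂ) ^ (a * b) =
      (pat (l.map (p * ·)) x : ℂ) * e x ^ (a * b) := by
    filter_upwards [hey] with x hx; rw [hx]
  rw [integral_congr_ae e0, integral_congr_ae (ae_restrict_of_ae e0)] at key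
  have e1 : ∫ x, (pat l x : ℂ) * e x ^ b ∂κ = (-1) ^ l.length * ζ ^ b *
      (D.d p * ∫ x in D.Y p ⁻¹' {0}, (pat (l.map (p * ·)) x : ℂ) * e x ^ (a * b) ∂κ) := by
    rw [D.integral_dilate hp (Φ := fun x => (pat l x : ℂ) * e x ^ b)
      ((Complex.measurable_ofReal.comp (measurable_pat l)).mul (he.measurable.pow_const b))]
    rw [mul_left_comm]
    refine congrArg (fun z => (D.d p : ℂ) * z) ?_
    rw [← integral_const_mul]
    refine setIntegral_congr_ae (D.fiberMeasurable p 0) ?_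
    filter_upwards [h] with x hx h0
    rw [hx h0, pat_dilate]; push_cast; ring
  rw [e1, ← mul_sub, norm_mul, norm_mul, norm_pow ζ, hζ]; simpa using key

/-- A square root of an eigenfunction, correlating with the zeroth coordinate if the given
eigenfunction does. -/
theorem exists_sqrt_eigenfunction (D : DilationSystem κ) (hErg : Ergodic shift κ) (he : IsEigenfunction κ e c) (h : ∫ x, (coord x : ℂ) * e x ∂κ ≠ 0) :
    ∃ (g : SymbolSpace → ℂ) (γ : ℂ), IsEigenfunction κ g γ ∧ γ ^ 2 = c ∧
      ∫ x, (coord x : ℂ) * g x ∂κ ≠ 0 := by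
  classical
  obtain ⟨u, β, hu, hβ, hue⟩ := D.exists_root_eigenfunction hErg Nat.prime_two he
  have h1 : ∫ x, (coord x : ℂ) * e x ∂κ =
      -(D.d 2 * ∫ x in D.Y 2 ⁻¹' {0}, (coord x : ℂ) * u x ∂κ) := by
    rw [D.integral_dilate Nat.prime_two (Φ := fun x => (coord x : ℂ) * e x)
      ((Complex.measurable_ofReal.comp measurable_coord).mul he.measurable), ← mul_neg,
      ← integral_neg]
    congr 1
    refine setIntegral_congr_ae (D.fiberMeasurable 2 0) ?_
    filter_upwards [hue] with x hx h0
    have := coord_dilate 2 0 x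
    simp only [shiftBy_zero, mul_zero] at this; rw [hx h0, Nat.cast_ofNat, this]; push_cast; ring
  rcases D.d_eq 2 with hd | ⟨-, hd⟩
  · have hs : Subsingleton (ZMod (D.d 2)) := by rw [hd]; infer_instance
    have hA : D.Y 2 ⁻¹' {0} = Set.univ := by ext x; simp [Subsingleton.elim (D.Y 2 x) 0]
    rw [hA, Measure.restrict_univ, hd] at h1
    refine ⟨u, β, hu, hβ, fun h2 => h ?_⟩
    rw [h1, h2]; simp
  · set w : SymbolSpace → ℂ := fun x => if D.Y 2 x = 0 then 1 else -1 with hw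
    have hwe : IsEigenfunction κ w (-1) := by
      refine ⟨(D.fiberMeasurable 2).measurable fun a => if a = 0 then (1 : ℂ) else -1,
        fun x => ?_, ?_⟩
      · simp only [hw]; split_ifs <;> simp
      · filter_upwards [D.step 2] with x hx
        simp only [hw, hx]
        have hz : ∀ (n : ℕ), n = 2 → ∀ z : ZMod n, z + 1 = 0 ↔ ¬ z = 0 := by rintro n rfl; decide
        by_cases h0 : D.Y 2 x = 0
        · have := (hz _ hd (D.Y 2 x)).not.2 (not_not.2 h0)
          rw [if_neg this, if_pos h0, mul_one]
        · rw [if_pos ((hz _ hd _).2 h0), if_neg h0]; ring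
    have hwu := hwe.mul hu
    by_cases h2 : ∫ x, (coord x : ℂ) * u x ∂κ = 0
    · refine ⟨_, _, hwu, by rw [neg_one_mul, neg_sq, hβ], fun h3 => h ?_⟩
      have h4 : 2 * ∫ x in D.Y 2 ⁻¹' {0}, (coord x : ℂ) * u x ∂κ =
          ∫ x, (coord x : ℂ) * u x ∂κ + ∫ x, (coord x : ℂ) * (w x * u x) ∂κ := by
        rw [← integral_add (hu.integrable_mul measurable_coord abs_coord_le)
          (hwu.integrable_mul measurable_coord abs_coord_le),
          ← integral_indicator (D.fiberMeasurable 2 0), ← integral_const_mul]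
        refine integral_congr_ae (ae_of_all _ fun x => ?_)
        simp only [Set.indicator, Set.mem_preimage, Set.mem_singleton_iff, hw]
        split_ifs <;> ring
      rw [h1, show (D.d 2 : ℂ) = 2 by rw [hd]; norm_num, h4, h2, h3]; simp
    · exact ⟨u, β, hu, hβ, h2⟩

/-- The zeroth coordinate is orthogonal to all eigenfunctions of finite order. -/
theorem integral_coord_mul_eigenfunction_eq_zero (D : DilationSystem κ) (hErg : Ergodic shift κ) (he : IsEigenfunction κ e c) {M : ℕ} (hM : 0 < M) (hc : c ^ M = 1) :
    ∫ x, (coord x : ℂ) * e x ∂κ = 0 := by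
  have hT := hErg.toMeasurePreserving
  by_contra h
  obtain ⟨g, γ, hg, hγ, hA⟩ := D.exists_sqrt_eigenfunction hErg he h
  have hγM : γ ^ (2 * M) = 1 := by rw [pow_mul, hγ, hc]
  have h2M : 0 < 2 * M := by omega
  have : NeZero (2 * M) := ⟨h2M.ne'⟩
  obtain ⟨ω, hω, hge⟩ := IsEigenfunction.unique hErg (c := c) (by simpa [hγ] using hg.pow 2) he
  have hB : ∫ x, (coord x : ℂ) * g x ^ 2 ∂κ ≠ 0 := by
    have : ∫ x, (coord x : ℂ) * g x ^ 2 ∂κ = ω * ∫ x, (coord x : ℂ) * e x ∂κ := by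
      rw [← integral_const_mul]
      refine integral_congr_ae ?_
      filter_upwards [hge] with x hx
      rw [hx]; ring
    rw [this]; exact mul_ne_zero (fun h0 => by simp [h0] at hω) h
  obtain ⟨S, y, hy, hS, hgy⟩ := hg.exists_finite_valued hErg h2M hγM
  set A := ∫ x, (coord x : ℂ) * g x ∂κ
  set B := ∫ x, (coord x : ℂ) * g x ^ 2 ∂κ
  set m := min ‖A‖ ‖B‖
  have hm0 : 0 < m := lt_min (norm_pos_iff.2 hA) (norm_pos_iff.2 hB)
  obtain ⟨p, hp, hp1, -, hI⟩ := exists_prime_residueClass_le (q := 2 * M) isUnit_one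
    (D.summable_info hT hy 2) (ε := (m / 8) ^ 2) (by positivity) 0
  have hγp : γ ^ (1 * p) = γ := by
    have h1 : p ≡ 1 [MOD 2 * M] := (ZMod.natCast_eq_natCast_iff _ _ _).1 (by simpa using hp1)
    rw [one_mul, pow_eq_pow_mod p hγM, h1, ← pow_eq_pow_mod 1 hγM, pow_one]
  obtain ⟨ζ, hζ, hζe⟩ := D.exists_dilate_eq_pow hT hp hg hγp
  have hk := D.norm_integral_pat_sub_le hT hp hg hy hS hgy (C := 2) (by norm_num) hI
    (l := [0]) (by simp) hζ hζe
  have hsq : √((m / 8) ^ 2) = m / 8 := Real.sqrt_sq (by positivity)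
  have k1 := hk 1
  have k2 := hk 2
  simp only [pat, List.map_cons, List.map_nil, List.prod_cons, List.prod_nil, mul_one, mul_zero,
    shiftBy_zero, pow_one, List.length_singleton, one_mul, hsq] at k1 k2
  have e1 : A - -1 * ζ * A = (1 + ζ) * A := by ring
  have e2 : B - -1 * ζ ^ 2 * B = (1 + ζ ^ 2) * B := by ring
  rw [e1, norm_mul] at k1
  rw [e2, norm_mul] at k2
  have q1 : ‖1 + ζ‖ ≤ 1 / 4 := by
    have : m ≤ ‖A‖ := min_le_left _ _
    by_contra! hlt
    nlinarith [norm_nonneg (1 + ζ)]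
  have q2 : ‖1 + ζ ^ 2‖ ≤ 1 / 4 := by
    have : m ≤ ‖B‖ := min_le_right _ _
    by_contra! hlt
    nlinarith [norm_nonneg (1 + ζ ^ 2)]
  have q3 : (2 : ℂ) = (1 + ζ ^ 2) + (1 + ζ) * (1 - ζ) := by ring
  have q4 : ‖(2 : ℂ)‖ ≤ ‖1 + ζ ^ 2‖ + ‖1 + ζ‖ * ‖1 - ζ‖ := by
    rw [← norm_mul]; conv_lhs => rw [q3]
    exact norm_add_le _ _
  have q5 : ‖1 - ζ‖ ≤ 2 := (norm_sub_le _ _).trans (by rw [norm_one, hζ]; norm_num)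
  have q6 : ‖(2 : ℂ)‖ = 2 := by simp
  nlinarith [norm_nonneg (1 + ζ), norm_nonneg (1 - ζ)]

end DilationSystem
end RationalEigenvalues

section UnitExp

open Complex

/-- The unimodular exponential `s ↦ exp (2 π i s)`. -/
noncomputable def unitExp (s : ℝ) : ℂ := exp (2 * Real.pi * I * s)

theorem unitExp_add (s t : ℝ) : unitExp (s + t) = unitExp s * unitExp t := by
  rw [unitExp, unitExp, unitExp, ← exp_add]; congr 1; push_cast; ring

theorem unitExp_nat_mul (n : ℕ) (s : ℝ) : unitExp (n * s) = unitExp s ^ n := by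
  rw [unitExp, unitExp, ← exp_nat_mul]; congr 1; push_cast; ring

theorem unitExp_eq_exp_ofReal (s : ℝ) :
    unitExp s = exp (I * ((2 * Real.pi * s : ℝ) : ℂ)) := by
  rw [unitExp]; congr 1; push_cast; ring

theorem norm_unitExp (s : ℝ) : ‖unitExp s‖ = 1 := by
  rw [unitExp_eq_exp_ofReal, mul_comm, norm_exp_ofReal_mul_I]

theorem unitExp_ne_zero (s : ℝ) : unitExp s ≠ 0 := exp_ne_zero _

theorem unitExp_intCast (n : ℤ) : unitExp n = 1 := by
  rw [unitExp, exp_eq_one_iff]; exact ⟨n, by push_cast; ring⟩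

theorem unitExp_eq_iff {s t : ℝ} : unitExp s = unitExp t ↔ ∃ n : ℤ, s = t + n := by
  rw [unitExp, unitExp, exp_eq_exp_iff_exists_int]
  refine exists_congr fun n => ?_
  have hpi : (2 * Real.pi * I : ℂ) ≠ 0 := two_pi_I_ne_zero
  rw [show (2 * Real.pi * I * t + n * (2 * Real.pi * I) : ℂ) =
    2 * Real.pi * I * (t + n) by ring, mul_right_inj' hpi]
  exact_mod_cast Iff.rfl

theorem norm_unitExp_sub_one_le {s : ℝ} (hs : 0 ≤ s) : ‖unitExp s - 1‖ ≤ 2 * Real.pi * s := by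
  rw [unitExp_eq_exp_ofReal]
  refine Real.norm_exp_I_mul_ofReal_sub_one_le.trans_eq ?_
  rw [Real.norm_eq_abs, abs_of_nonneg (by positivity)]

/-- The argument of a complex number, normalised to lie in `[0, 1)`. -/
noncomputable def unitArg (z : ℂ) : ℝ := Int.fract (arg z / (2 * Real.pi))

theorem unitArg_nonneg (z : ℂ) : 0 ≤ unitArg z := Int.fract_nonneg _

theorem unitArg_lt_one (z : ℂ) : unitArg z < 1 := Int.fract_lt_one _

theorem measurable_unitArg : Measurable unitArg :=
  measurable_fract.comp (measurable_arg.div_const _)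

theorem unitExp_unitArg {z : ℂ} (hz : ‖z‖ = 1) : unitExp (unitArg z) = z := by
  have h1 : unitExp (unitArg z) = unitExp (arg z / (2 * Real.pi)) := by
    rw [unitExp_eq_iff]
    refine ⟨-⌊arg z / (2 * Real.pi)⌋, ?_⟩
    rw [unitArg, Int.fract]; push_cast; ring
  rw [h1, unitExp]
  have hpi : (Real.pi : ℂ) ≠ 0 := by exact_mod_cast Real.pi_ne_zero
  conv_rhs => rw [← norm_mul_exp_arg_mul_I z, hz]
  rw [ofReal_one, one_mul]
  congr 1
  push_cast; field_simp

theorem unitExp_div_eq_stdAddChar {N : ℕ} [NeZero N] (k : ℤ) :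
    unitExp ((k : ℝ) / N) = ZMod.stdAddChar (k : ZMod N) := by
  rw [ZMod.stdAddChar_coe, unitExp]; congr 1; push_cast; ring

theorem exists_stdAddChar_eq {N : ℕ} [NeZero N] {z : ℂ} (hz : z ^ N = 1) :
    ∃ j : ZMod N, z = ZMod.stdAddChar j := by
  obtain ⟨i, -, hi⟩ := (isPrimitiveRoot_exp N (NeZero.ne N)).eq_pow_of_pow_eq_one hz
  refine ⟨((i : ℤ) : ZMod N), ?_⟩
  rw [ZMod.stdAddChar_coe, ← hi, ← exp_nat_mul]
  congr 1; push_cast; ring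

theorem norm_stdAddChar {N : ℕ} [NeZero N] (j : ZMod N) :
    ‖(ZMod.stdAddChar j : ℂ)‖ = 1 := by
  obtain ⟨k, rfl⟩ := ZMod.intCast_surjective j
  rw [← unitExp_div_eq_stdAddChar, norm_unitExp]

/-- Simultaneous approximation: integers in prescribed residue classes with small difference
`m χ - j` from above. -/
theorem exists_int_mul_sub_mem_Ico {χ : ℝ} (hχ : Irrational χ) {Q : ℕ} (hQ : 0 < Q) (a b : ℤ)
    {δ : ℝ} (hδ : 0 < δ) : ∃ m j : ℤ, (Q : ℤ) ∣ m - a ∧ (Q : ℤ) ∣ j - b ∧ 0 ≤ m * χ - j ∧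
      m * χ - j < δ := by
  have hd : Dense (AddSubgroup.closure {χ, 1} : Set ℝ) :=
    dense_addSubgroupClosure_pair_iff.2 (by simpa using hχ)
  have hQ' : (0 : ℝ) < Q := by exact_mod_cast hQ
  obtain ⟨x, hx, hx1, hx2⟩ := hd.exists_between
    (show (b - a * χ) / Q < (b - a * χ + δ) / Q by gcongr; linarith)
  obtain ⟨k, i, hki⟩ := AddSubgroup.mem_closure_pair.1 hx
  rw [div_lt_iff₀ hQ'] at hx1
  rw [lt_div_iff₀ hQ'] at hx2
  simp only [zsmul_eq_mul, mul_one] at hki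
  refine ⟨a + Q * k, b - Q * i, ⟨k, by ring⟩, ⟨-i, by ring⟩, ?_, ?_⟩
  all_goals
    push_cast
    rw [← hki] at hx1 hx2; nlinarith

end UnitExp

section Carry

variable {κ : Measure SymbolSpace} [IsProbabilityMeasure κ] {e : SymbolSpace → ℂ} {c : ℂ}

/-- The carry when adding `unitArg c` to the argument of `e x`. -/
noncomputable def carry (e : SymbolSpace → ℂ) (c : ℂ) (x : SymbolSpace) : Bool :=
  decide (1 ≤ unitArg (e x) + unitArg c)

theorem fiberMeasurable_carry {e : SymbolSpace → ℂ} (he : Measurable e) (c : ℂ) :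
    FiberMeasurable (carry e c) := by
  have hm : MeasurableSet {x | 1 ≤ unitArg (e x) + unitArg c} :=
    measurableSet_le measurable_const ((measurable_unitArg.comp he).add_const _)
  intro b
  cases b
  · convert! hm.compl using 1
    ext x; simp [carry]
  · convert! hm using 1
    ext x; simp [carry]

theorem IsEigenfunction.unitArg_step (he : IsEigenfunction κ e c) :
    ∀ᵐ x ∂κ, unitArg (e (shiftBy 1 x)) =
      unitArg (e x) + unitArg c - ((carry e c x).toNat : ℤ) := by
  filter_upwards [he.step] with x hx
  have h1 : unitExp (unitArg (e (shiftBy 1 x))) = unitExp (unitArg (e x) + unitArg c) := by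
    rw [unitExp_add, unitExp_unitArg (he.norm_eq_one _), unitExp_unitArg (he.norm_eq_one _),
      unitExp_unitArg he.norm_eigenvalue, hx, mul_comm]
  obtain ⟨n, hn⟩ := unitExp_eq_iff.1 h1
  have a1 := unitArg_nonneg (e (shiftBy 1 x))
  have a2 := unitArg_lt_one (e (shiftBy 1 x))
  have b1 := unitArg_nonneg (e x)
  have b2 := unitArg_lt_one (e x)
  have c1 := unitArg_nonneg c
  have c2 := unitArg_lt_one c
  by_cases h : 1 ≤ unitArg (e x) + unitArg c
  · have hn1 : n = -1 := by
      have h3 : (-2 : ℝ) < n := by linarith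
      have h4 : (n : ℝ) < 0 := by linarith
      have h3' : -2 < n := by exact_mod_cast h3
      have h4' : n < 0 := by exact_mod_cast h4
      omega
    rw [hn, hn1]; simp [carry, h]; ring
  · have hn1 : n = 0 := by
      have h3 : (-1 : ℝ) < n := by linarith
      have h4 : (n : ℝ) < 1 := by linarith
      have h3' : -1 < n := by exact_mod_cast h3
      have h4' : n < 1 := by exact_mod_cast h4
      omega
    rw [hn, hn1]; simp [carry, h]

/-- The digit of the root of an eigenfunction attached to a prime. -/
theorem DilationSystem.exists_digit (D : DilationSystem κ) (hErg : Ergodic shift κ)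
    (he : IsEigenfunction κ e c) {p : ℕ} (hp : p.Prime) (m : ℕ)
    [NeZero m] (hm : m = p) :
    ∃ (N : SymbolSpace → ZMod m) (g : ZMod m), FiberMeasurable N ∧
      (∀ᵐ x ∂κ, N (shiftBy 1 x) = N x + ((carry e c x).toNat : ℤ) + g) ∧
      ∃ w : ℂ, ‖w‖ = 1 ∧ ∀ᵐ x ∂κ, D.Y p x = 0 →
        ‖e (dilate p x) - w * ZMod.stdAddChar (N x)‖ ≤ 2 * Real.pi / p := by
  classical
  subst hm
  have hp0 : (m : ℝ) ≠ 0 := by exact_mod_cast hp.ne_zero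
  obtain ⟨u, β, hu, hβ, hue⟩ := D.exists_root_eigenfunction hErg hp he
  obtain ⟨ω, hω, hω'⟩ := IsEigenfunction.unique hErg (c := c) (hβ ▸ hu.pow m) he
  obtain ⟨w, hw⟩ := IsAlgClosed.exists_pow_nat_eq ω hp.pos
  have hw1 : ‖w‖ = 1 := by
    have h := congrArg norm hw
    rw [norm_pow, hω] at h; exact (pow_eq_one_iff_of_nonneg (norm_nonneg _) hp.ne_zero).1 h
  have hw0 : w ≠ 0 := fun h => by simp [h] at hw1
  set v : SymbolSpace → ℂ := fun x => u x / (w * unitExp (unitArg (e x) / m)) with hv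
  have hroot : ∀ z : ℂ, ‖z‖ = 1 → unitExp (unitArg z / m) ^ m = z := fun z hz => by
    rw [← unitExp_nat_mul, mul_div_cancel₀ _ hp0, unitExp_unitArg hz]
  have hvm : Measurable v := hu.measurable.div (measurable_const.mul
    ((Complex.continuous_exp.measurable.comp ((Complex.measurable_ofReal.comp
      ((measurable_unitArg.comp he.measurable).div_const _)).const_mul _))))
  have hv1 : ∀ᵐ x ∂κ, v x ^ m = 1 := by
    filter_upwards [hω'] with x hx
    simp only [hv, div_pow, mul_pow, hw, hroot _ (he.norm_eq_one x), hx]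
    exact div_self (mul_ne_zero (by rw [← hw]; exact pow_ne_zero _ hw0) (he.ne_zero x))
  set γ : ℂ := β / unitExp (unitArg c / m) with hγ
  obtain ⟨g, hg⟩ : ∃ g : ZMod m, γ = ZMod.stdAddChar g := exists_stdAddChar_eq (by
    rw [hγ, div_pow, hβ, hroot _ he.norm_eigenvalue, div_self he.eigenvalue_ne_zero])
  have hvT : ∀ᵐ x ∂κ, v (shiftBy 1 x) =
      v x * ZMod.stdAddChar ((((carry e c x).toNat : ℤ) : ZMod m) + g) := by
    filter_upwards [hu.step, he.unitArg_step] with x h1 h2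
    simp only [hv, h1, h2]; rw [AddChar.map_add_eq_mul, ← hg, ← unitExp_div_eq_stdAddChar, hγ]
    have h3 : unitExp (unitArg (e x) / m) * unitExp (unitArg c / m) =
        unitExp ((unitArg (e x) + unitArg c - (((carry e c x).toNat : ℤ) : ℝ)) / m) *
          unitExp ((((carry e c x).toNat : ℤ) : ℝ) / m) := by
      rw [← unitExp_add, ← unitExp_add]; congr 1; ring
    have n1 := unitExp_ne_zero (unitArg (e x) / m)
    have n2 := unitExp_ne_zero (unitArg c / m)
    have n3 := unitExp_ne_zero
      ((unitArg (e x) + unitArg c - (((carry e c x).toNat : ℤ) : ℝ)) / m)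
    field_simp
    rw [mul_assoc, h3]; ring
  refine ⟨fun x => if h : ∃ j, v x = ZMod.stdAddChar j then h.choose else 0, g, ?_, ?_, w, hw1, ?_⟩
  · intro j
    have : (fun x => if h : ∃ j : ZMod m, v x = ZMod.stdAddChar j then h.choose else 0) ⁻¹' {j} =
        v ⁻¹' {(ZMod.stdAddChar j : ℂ)} ∪
          (v ⁻¹' (Set.range fun j : ZMod m => (ZMod.stdAddChar j : ℂ)))ᶜ ∩ {_x | j = 0} := by
      ext x
      simp only [Set.mem_preimage, Set.mem_singleton_iff, Set.mem_union, Set.mem_inter_iff,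
        Set.mem_compl_iff, Set.mem_ofPred_eq, Set.mem_range]
      by_cases h : ∃ j : ZMod m, v x = ZMod.stdAddChar j
      · rw [dif_pos h]
        have h' : ∃ y : ZMod m, ZMod.stdAddChar y = v x := h.imp fun _ => Eq.symm
        simp only [h', not_true_eq_false, false_and, or_false]
        constructor
        · rintro rfl; exact h.choose_spec
        · intro hj
          exact ZMod.injective_stdAddChar (h.choose_spec.symm.trans hj)
      · rw [dif_neg h]
        have h' : ¬ ∃ y : ZMod m, ZMod.stdAddChar y = v x := fun h'' => h (h''.imp fun _ => Eq.symm)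
        simp only [h', not_false_eq_true, true_and]
        constructor
        · exact fun hj => Or.inr hj.symm
        · rintro (hj | hj)
          · exact absurd ⟨j, hj⟩ h
          · exact hj.symm
    rw [this]; exact (hvm (measurableSet_singleton _)).union
      ((hvm (Set.finite_range _).measurableSet).compl.inter (MeasurableSet.const _))
  · filter_upwards [hv1, hvT] with x h1 h2
    obtain ⟨j, hj⟩ := exists_stdAddChar_eq (N := m) h1
    have hx : ∃ j : ZMod m, v x = ZMod.stdAddChar j := ⟨j, hj⟩
    have hTx : ∃ j : ZMod m, v (shiftBy 1 x) = ZMod.stdAddChar j := ⟨_, by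
      rw [h2, hj, ← AddChar.map_add_eq_mul]⟩
    rw [dif_pos hx, dif_pos hTx]
    refine ZMod.injective_stdAddChar (N := m) ?_
    rw [← hTx.choose_spec, h2, add_assoc, AddChar.map_add_eq_mul _ hx.choose, ← hx.choose_spec]
  · filter_upwards [hv1, hue] with x h1 h2 h0
    obtain ⟨j, hj⟩ := exists_stdAddChar_eq (N := m) h1
    have hx : ∃ j : ZMod m, v x = ZMod.stdAddChar j := ⟨j, hj⟩
    rw [dif_pos hx, ← hx.choose_spec, ← h2 h0]
    have h3 : u x = v x * w * unitExp (unitArg (e x) / m) := by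
      have n1 := unitExp_ne_zero (unitArg (e x) / m)
      simp only [hv]; field_simp
    have h4 : ‖v x‖ = 1 := by rw [hj, norm_stdAddChar]
    have h5 : u x - w * v x = v x * w * (unitExp (unitArg (e x) / m) - 1) := by rw [h3]; ring
    rw [h5, norm_mul, norm_mul, h4, hw1, one_mul, one_mul]
    have hmpos : (0 : ℝ) < m := by exact_mod_cast hp.pos
    have t0 := unitArg_nonneg (e x)
    refine (norm_unitExp_sub_one_le (by positivity)).trans ?_
    rw [← mul_div_assoc]; exact (div_le_div_iff_of_pos_right hmpos).2
      (mul_le_of_le_one_right (by positivity) (unitArg_lt_one (e x)).le)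

end Carry

section Windows

variable {κ : Measure SymbolSpace} [IsProbabilityMeasure κ]

theorem norm_integral_pat_map_add (hT : MeasurePreserving shift κ κ) {e : SymbolSpace → ℂ} {c : ℂ}
    (he : IsEigenfunction κ e c) (l : List ℤ) (m : ℤ) :
    ‖∫ x, (pat (l.map (· + m)) x : ℂ) * e x ∂κ‖ = ‖∫ x, (pat l x : ℂ) * e x ∂κ‖ := by
  have h1 : ∫ x, (pat l x : ℂ) * e x ∂κ = c ^ m * ∫ x, (pat (l.map (· + m)) x : ℂ) * e x ∂κ := by
    rw [← integral_comp_shiftBy hT m, ← integral_const_mul]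
    refine integral_congr_ae ?_
    filter_upwards [he.shiftBy_eq hT m] with x hx
    rw [hx, pat_shiftBy]; ring
  rw [h1, norm_mul, norm_zpow, he.norm_eigenvalue, one_zpow, one_mul]

theorem exists_window (l : List ℤ) :
    ∃ (m : ℤ) (C : ℕ), 0 < C ∧ ∀ k ∈ l.map (· + m), 0 ≤ k ∧ k + 1 < C := by
  induction l with
  | nil => exact ⟨0, 1, one_pos, by simp⟩
  | cons a l ih =>
    obtain ⟨m, C, hC, h⟩ := ih
    refine ⟨m + (a + m).natAbs, C + 2 * (a + m).natAbs + 2, by omega, fun k hk => ?_⟩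
    simp only [List.map_cons, List.mem_cons, List.mem_map] at hk h
    rcases hk with rfl | ⟨b, hb, rfl⟩
    · constructor <;> omega
    · have := h (b + m) ⟨b, hb, rfl⟩
      constructor <;> omega

end Windows

section IrrationalEigenvalues

open Complex

variable {κ : Measure SymbolSpace} [IsProbabilityMeasure κ] {e : SymbolSpace → ℂ} {c : ℂ}

theorem irrational_unitArg {c : ℂ} (hc : ‖c‖ = 1) (h : ∀ n : ℕ, 0 < n → c ^ n ≠ 1) :
    Irrational (unitArg c) := by
  rintro ⟨q, hq⟩
  refine h q.den q.pos ?_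
  rw [← unitExp_unitArg hc, ← unitExp_nat_mul, ← hq]
  have : (q.den : ℝ) * q = (q.num : ℝ) := by exact_mod_cast Rat.den_mul_eq_num q
  rw [this, unitExp_intCast]

/-- The modulus of the digit at `n`: `n` itself for primes, and `1` otherwise. -/
def digitMod (n : ℕ) : ℕ := if n.Prime then n else 1

instance (n : ℕ) : NeZero (digitMod n) := ⟨by
  unfold digitMod; split_ifs with h
  · exact h.ne_zero
  · exact one_ne_zero⟩

theorem coprime_digitMod_prod (n : ℕ) : (digitMod n).Coprime (∏ i : Fin n, digitMod i) := by
  refine Nat.Coprime.prod_right fun i _ => ?_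
  unfold digitMod
  split_ifs with h1 h2 h2
  · exact (Nat.coprime_primes h1 h2).2 i.2.ne'
  all_goals simp

theorem DilationSystem.d_dvd_digitMod (D : DilationSystem κ) (n : ℕ) : D.d n ∣ digitMod n := by
  rcases D.d_eq n with h | ⟨h1, h2⟩
  · simp [h]
  · rw [h2, digitMod, if_pos h1]

/-- The digits of the roots of an eigenfunction. -/
structure DigitSystem (D : DilationSystem κ) (e : SymbolSpace → ℂ) (c : ℂ) where
  N : ∀ n, SymbolSpace → ZMod (digitMod n)
  g : ∀ n, ZMod (digitMod n)
  fiberMeasurable : ∀ n, FiberMeasurable (N n)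
  step : ∀ n, ∀ᵐ x ∂κ, N n (shiftBy 1 x) = N n x + ((carry e c x).toNat : ℤ) + g n
  approx : ∀ p : ℕ, p.Prime → ∃ w : ℂ, ‖w‖ = 1 ∧ ∀ᵐ x ∂κ, D.Y p x = 0 →
    ‖e (dilate p x) - w * ZMod.stdAddChar (N p x)‖ ≤ 2 * Real.pi / p

theorem nonempty_digitSystem (D : DilationSystem κ) (hErg : Ergodic shift κ)
    (he : IsEigenfunction κ e c) : Nonempty (DigitSystem D e c) := by
  have h : ∀ n : ℕ, ∃ (N : SymbolSpace → ZMod (digitMod n)) (g : ZMod (digitMod n)),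
      FiberMeasurable N ∧
      (∀ᵐ x ∂κ, N (shiftBy 1 x) = N x + ((carry e c x).toNat : ℤ) + g) ∧
      (n.Prime → ∃ w : ℂ, ‖w‖ = 1 ∧ ∀ᵐ x ∂κ, D.Y n x = 0 →
        ‖e (dilate n x) - w * ZMod.stdAddChar (N x)‖ ≤ 2 * Real.pi / n) := by
    intro n
    by_cases hn : n.Prime
    · obtain ⟨N, g, h1, h2, h3⟩ := D.exists_digit hErg he hn (digitMod n) (if_pos hn)
      exact ⟨N, g, h1, h2, fun _ => h3⟩
    · have hs : Subsingleton (ZMod (digitMod n)) := by rw [digitMod, if_neg hn]; infer_instance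
      refine ⟨fun _ => 0, 0, fun a => ?_, ae_of_all _ fun _ => Subsingleton.elim _ _,
        fun h => absurd h hn⟩
      rw [Subsingleton.elim a 0]; simp
  choose N g h1 h2 h3 using h
  exact ⟨⟨N, g, h1, h2, h3⟩⟩

theorem exists_measureReal_unitArg_le {e : SymbolSpace → ℂ} (he : Measurable e) {ε : ℝ}
    (hε : 0 < ε) : ∃ δ > 0, κ.real {x | 1 - δ ≤ unitArg (e x)} ≤ ε := by
  have hm : Measurable fun x => unitArg (e x) := measurable_unitArg.comp he
  set s : ℕ → Set SymbolSpace := fun n => {x | 1 - 1 / ((n : ℝ) + 1) ≤ unitArg (e x)}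
  have hanti : Antitone s := fun i j hij x hx => by
    have : 1 / ((j : ℝ) + 1) ≤ 1 / ((i : ℝ) + 1) :=
      one_div_le_one_div_of_le (by positivity) (by gcongr)
    have hx' : 1 - 1 / ((j : ℝ) + 1) ≤ unitArg (e x) := hx
    change 1 - 1 / ((i : ℝ) + 1) ≤ unitArg (e x)
    linarith
  have hemp : ⋂ n, s n = ∅ := by
    refine Set.eq_empty_of_forall_notMem fun x hx => ?_
    have h1 := unitArg_lt_one (e x)
    obtain ⟨n, hn⟩ := exists_nat_one_div_lt (sub_pos.2 h1)
    have : 1 - 1 / ((n : ℝ) + 1) ≤ unitArg (e x) := Set.mem_iInter.1 hx n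
    linarith
  have ht := tendsto_measure_iInter_atTop (μ := κ) (s := s)
    (fun n => (measurableSet_le measurable_const hm).nullMeasurableSet) hanti
    ⟨0, measure_ne_top _ _⟩
  rw [hemp, measure_empty] at ht
  obtain ⟨n, hn⟩ := (ht.eventually (gt_mem_nhds (ENNReal.ofReal_pos.2 hε))).exists
  refine ⟨1 / ((n : ℝ) + 1), by positivity, ?_⟩
  rw [measureReal_def]; exact ENNReal.toReal_le_of_le_ofReal hε.le hn.le

namespace DigitSystem

variable {D : DilationSystem κ} (W : DigitSystem D e c)

theorem shiftBy_eq (hT : MeasurePreserving shift κ κ) (he : IsEigenfunction κ e c) (m : ℤ) :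
    ∀ᵐ x ∂κ, ∃ k : ℤ, (k : ℝ) = unitArg (e x) + m * unitArg c - unitArg (e (shiftBy m x)) ∧
      ∀ n, W.N n (shiftBy m x) = W.N n x + k + m * W.g n := by
  have hmp := measurePreserving_shiftBy hT
  have hst := ae_all_iff.2 W.step
  induction m using Int.induction_on with
  | zero => exact ae_of_all _ fun x => ⟨0, by simp [shiftBy_zero]⟩
  | succ m ih =>
    filter_upwards [ih, (hmp m).quasiMeasurePreserving.ae hst,
      (hmp m).quasiMeasurePreserving.ae he.unitArg_step] with x h1 h2 h3
    obtain ⟨k, hk1, hk2⟩ := h1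
    simp only [shiftBy_shiftBy, add_comm (1 : ℤ)] at h2 h3
    refine ⟨k + (carry e c (shiftBy m x)).toNat, ?_, fun n => ?_⟩
    · rw [h3]; push_cast at hk1 ⊢; linarith
    · rw [h2, hk2]; push_cast; ring
  | pred m ih =>
    filter_upwards [ih, (hmp (-m - 1)).quasiMeasurePreserving.ae hst,
      (hmp (-m - 1)).quasiMeasurePreserving.ae he.unitArg_step] with x h1 h2 h3
    obtain ⟨k, hk1, hk2⟩ := h1
    simp only [shiftBy_shiftBy, show (1 : ℤ) + (-m - 1) = -m by ring] at h2 h3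
    refine ⟨k - (carry e c (shiftBy (-m - 1) x)).toNat, ?_, fun n => ?_⟩
    · rw [h3] at hk1; push_cast at hk1 ⊢; linarith
    · have h4 := h2 n
      rw [hk2] at h4
      have h5 : W.N n (shiftBy (-m - 1) x) = W.N n x + k + (-m : ℤ) * W.g n -
        ((carry e c (shiftBy (-m - 1) x)).toNat : ℤ) - W.g n := by rw [h4]; ring
      rw [h5]; push_cast; ring

theorem exists_translation (hc : Irrational (unitArg c)) (n : ℕ)
    (v : ZMod (digitMod n) × ZMod (D.d n)) {δ : ℝ} (hδ : 0 < δ) :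
    ∃ m j : ℤ, 0 ≤ m * unitArg c - j ∧ m * unitArg c - j < δ ∧
      (j : ZMod (digitMod n)) + m * W.g n = v.1 ∧ (m : ZMod (D.d n)) = v.2 ∧
      ∀ i < n, (m : ZMod (D.d i)) = 0 ∧ (m : ZMod (digitMod i)) = 0 ∧
        (j : ZMod (digitMod i)) = 0 := by
  have hco := coprime_digitMod_prod n
  set Q := ∏ i : Fin n, digitMod i
  obtain ⟨a, ha1, ha2⟩ := Nat.chineseRemainder hco v.2.val 0
  obtain ⟨b, hb1, hb2⟩ := Nat.chineseRemainder hco (v.1 - (a : ZMod (digitMod n)) * W.g n).val 0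
  have hQ0 : 0 < Q := prod_pos fun i _ => Nat.pos_of_neZero _
  obtain ⟨m, j, hm, hj, h1, h2⟩ := exists_int_mul_sub_mem_Ico hc
    (Nat.mul_pos (Nat.pos_of_neZero (digitMod n)) hQ0) a b hδ
  have cast1 : ∀ (d : ℕ), d ∣ digitMod n * Q → (m : ZMod d) = a ∧ (j : ZMod d) = b := fun d hd => by
    have hd' : (d : ℤ) ∣ ((digitMod n * Q : ℕ) : ℤ) := by exact_mod_cast hd
    constructor
    · have := (ZMod.intCast_eq_intCast_iff_dvd_sub (a : ℤ) m d).2 (hd'.trans hm)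
      exact_mod_cast this.symm
    · have := (ZMod.intCast_eq_intCast_iff_dvd_sub (b : ℤ) j d).2 (hd'.trans hj)
      exact_mod_cast this.symm
  have hn1 : digitMod n ∣ digitMod n * Q := dvd_mul_right _ _
  have hi1 : ∀ i < n, digitMod i ∣ Q := fun i hi =>
    dvd_prod_of_mem (fun i : Fin n => digitMod i) (mem_univ ⟨i, hi⟩)
  refine ⟨m, j, h1, h2, ?_, ?_, fun i hi => ?_⟩
  · rw [(cast1 _ hn1).1, (cast1 _ hn1).2]
    have := (ZMod.natCast_eq_natCast_iff _ _ _).2 hb1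
    rw [ZMod.natCast_zmod_val] at this
    rw [this]; ring
  · rw [(cast1 _ ((D.d_dvd_digitMod n).trans hn1)).1]
    have := (ZMod.natCast_eq_natCast_iff _ _ _).2 (ha1.of_dvd (D.d_dvd_digitMod n))
    rwa [ZMod.natCast_zmod_val] at this
  · have hia : digitMod i ∣ a := (hi1 i hi).trans ((Nat.modEq_zero_iff_dvd).1 ha2)
    have hib : digitMod i ∣ b := (hi1 i hi).trans ((Nat.modEq_zero_iff_dvd).1 hb2)
    have hiQ : digitMod i ∣ digitMod n * Q := (hi1 i hi).mul_left _
    refine ⟨?_, ?_, ?_⟩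
    · rw [(cast1 _ ((D.d_dvd_digitMod i).trans hiQ)).1]
      exact (ZMod.natCast_eq_zero_iff _ _).2 ((D.d_dvd_digitMod i).trans hia)
    · rw [(cast1 _ hiQ).1]; exact (ZMod.natCast_eq_zero_iff _ _).2 hia
    · rw [(cast1 _ hiQ).2]; exact (ZMod.natCast_eq_zero_iff _ _).2 hib

/-- The digit together with the position in the cyclic factor. -/
def Z (n : ℕ) (x : SymbolSpace) : ZMod (digitMod n) × ZMod (D.d n) := (W.N n x, D.Y n x)

theorem fiberMeasurable_Z (n : ℕ) : FiberMeasurable (W.Z n) :=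
  (W.fiberMeasurable n).prodMk (D.fiberMeasurable n)

theorem measureReal_fiber_inter (hT : MeasurePreserving shift κ κ) (he : IsEigenfunction κ e c)
    (hc : Irrational (unitArg c)) (n : ℕ) (z : ZMod (digitMod n) × ZMod (D.d n))
    {E : Set SymbolSpace} (hE : MeasurableSet E)
    (hEZ : ∀ x x', (∀ i < n, W.Z i x = W.Z i x') → (x ∈ E ↔ x' ∈ E)) :
    κ.real (W.Z n ⁻¹' {z} ∩ E) =
      κ.real E / Fintype.card (ZMod (digitMod n) × ZMod (D.d n)) := by
  refine measureReal_fiber_inter_eq_of_translation (W.fiberMeasurable_Z n) hE (fun v ε hε => ?_) z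
  obtain ⟨δ, hδ, hδε⟩ := exists_measureReal_unitArg_le (κ := κ) he.measurable hε
  obtain ⟨m, j, h1, h2, h3, h4, h5⟩ := W.exists_translation hc n v hδ
  have hgood : ∀ᵐ x ∂κ, ¬ (1 - δ ≤ unitArg (e x)) → W.Z n (shiftBy m x) = W.Z n x + v ∧
      ∀ i < n, W.Z i (shiftBy m x) = W.Z i x := by
    filter_upwards [W.shiftBy_eq hT he m, ae_all_iff.2 fun i => D.step_shiftBy hT i m] with
      x hx hY hlt
    obtain ⟨k, hk1, hk2⟩ := hx
    have a1 := unitArg_nonneg (e (shiftBy m x))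
    have a2 := unitArg_lt_one (e (shiftBy m x))
    have b1 := unitArg_nonneg (e x)
    push Not at hlt
    have hkj : k = j := by
      have e1 : (k : ℝ) - j < 1 := by linarith
      have e2 : (-1 : ℝ) < k - j := by linarith
      have e1' : k - j < 1 := by exact_mod_cast e1
      have e2' : -1 < k - j := by exact_mod_cast e2
      omega
    refine ⟨Prod.ext ?_ ?_, fun i hi => Prod.ext ?_ ?_⟩
    · simp only [Z, Prod.fst_add]; rw [hk2, hkj, add_assoc, h3]
    · simp only [Z, Prod.snd_add]; rw [hY, h4]
    · simp only [Z]; rw [hk2, hkj, (h5 i hi).2.1, (h5 i hi).2.2]; ring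
    · simp only [Z]; rw [hY, (h5 i hi).1, add_zero]
  have hle : ∀ s : Set SymbolSpace, (∀ᵐ x ∂κ, x ∈ s → 1 - δ ≤ unitArg (e x)) → κ.real s ≤ ε := fun s hs => by
    refine le_trans ?_ hδε
    rw [measureReal_def, measureReal_def]; exact ENNReal.toReal_mono (measure_ne_top _ _) (measure_mono_ae hs)
  refine ⟨shiftBy m, measurePreserving_shiftBy hT m, hle _ ?_, hle _ ?_⟩
  · filter_upwards [hgood] with x hx hx'
    by_contra h
    exact hx' (hEZ _ _ (hx h).2)
  · filter_upwards [hgood] with x hx hx'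
    by_contra h
    exact hx' (hx h).1

theorem measureReal_fiber (hT : MeasurePreserving shift κ κ) (he : IsEigenfunction κ e c)
    (hc : Irrational (unitArg c)) (n : ℕ) (z : ZMod (digitMod n) × ZMod (D.d n)) :
    κ.real (W.Z n ⁻¹' {z}) = 1 / Fintype.card (ZMod (digitMod n) × ZMod (D.d n)) := by
  simpa using W.measureReal_fiber_inter hT he hc n z MeasurableSet.univ (by simp)

theorem summable_info (hT : MeasurePreserving shift κ κ) (he : IsEigenfunction κ e c)
    (hc : Irrational (unitArg c)) (C : ℕ) : Summable fun n : ℕ =>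
      mutualInfo κ (orbitWord shift (fun x => (x 0, carry e c x)) (C * n)) (W.Z n) / n := by
  refine summable_mutualInfo_orbitWord hT
    (DilationSystem.fiberMeasurable_observable (fiberMeasurable_carry he.measurable c)) W.Z
    W.fiberMeasurable_Z (fun n => ⟨fun s z => (z.1 + (s.2.toNat : ℤ) + W.g n, z.2 + 1), ?_⟩)
    (fun n z w => ?_) C
  · filter_upwards [W.step n, D.step n] with x h1 h2
    exact Prod.ext h1 h2
  · have hE : MeasurableSet ((fun x (i : Fin n) => W.Z i x) ⁻¹' {w}) :=
      FiberMeasurable.pi (A := fun (i : Fin n) x => W.Z i x) (fun i => W.fiberMeasurable_Z i) w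
    rw [W.measureReal_fiber hT he hc, W.measureReal_fiber_inter hT he hc n z hE]
    · ring
    · intro x x' h
      have : (fun i : Fin n => W.Z i x) = fun i : Fin n => W.Z i x' := funext fun i => h i i.2
      simp only [Set.mem_preimage, Set.mem_singleton_iff, this]

theorem N_shiftBy (hT : MeasurePreserving shift κ κ) (n j : ℕ) :
    ∀ᵐ x ∂κ, W.N n (shiftBy j x) = W.N n x +
      ((∑ i ∈ range j, (carry e c (shiftBy i x)).toNat : ℕ) + j * W.g n) := by
  induction j with
  | zero => simp [shiftBy_zero]
  | succ j ih =>
    filter_upwards [ih, (measurePreserving_shiftBy hT j).quasiMeasurePreserving.ae (W.step n)] with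
      x h1 h2
    rw [shiftBy_shiftBy, add_comm (1 : ℤ)] at h2; rw [Nat.cast_succ, h2, h1, sum_range_succ]
    push_cast; ring

theorem norm_setIntegral_le (hT : MeasurePreserving shift κ κ) (he : IsEigenfunction κ e c)
    (hc : Irrational (unitArg c)) {p C : ℕ} (hp : p.Prime) (hC : 0 < C) {ε : ℝ}
    (hI : mutualInfo κ (orbitWord shift (fun x => (x 0, carry e c x)) (C * p)) (W.Z p) ≤ ε)
    {l : List ℤ} (hl : ∀ k ∈ l, 0 ≤ k ∧ k + 1 < C) :
    ‖D.d p * ∫ x in D.Y p ⁻¹' {0}, (pat (l.map (p * ·)) x : ℂ) * ZMod.stdAddChar (W.N p x) ∂κ‖ ≤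
      2 * √ε := by
  set V : SymbolSpace → ℂ := fun x => (pat (l.map (p * ·)) x : ℂ) with hV
  have hVm : Measurable V := measurable_ofReal.comp (measurable_pat _)
  have hV1 : ∀ x, ‖V x‖ ≤ 1 := fun x => by rw [hV, norm_real]; exact abs_pat_le _ _
  set K : ℕ → SymbolSpace → ℕ := fun j x =>
    ∑ i ∈ range j, (carry e c (shiftBy i x)).toNat
  have hKm : ∀ j, Measurable (K j) := fun j => measurable_sum _ fun i _ =>
    ((fiberMeasurable_carry he.measurable c).comp (measurable_shiftBy i)).measurable Bool.toNat
  set Φ : ZMod (digitMod p) × ZMod (D.d p) → SymbolSpace → ℂ := fun b x =>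
    V (shiftBy ((-b.2).val : ℕ) x) * (ZMod.stdAddChar b.1 *
      ZMod.stdAddChar ((K (-b.2).val x : ZMod (digitMod p)) + ((-b.2).val : ZMod (digitMod p)) * W.g p)) with hΦ
  have hΦ1 : ∀ b x, ‖Φ b x‖ ≤ 1 := fun b x => by simp only [hΦ, norm_mul, norm_stdAddChar, mul_one]; exact hV1 _
  have hjlt : ∀ b : ZMod (D.d p), (-b).val < p := fun b => (ZMod.val_lt (-b)).trans_le (by
    rcases D.d_eq p with h | ⟨-, h⟩
    · rw [h]; exact hp.one_lt.le
    · exact h.le)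
  have hΦm : ∀ b, Measurable (Φ b) := fun b => by
    refine (hVm.comp (measurable_shiftBy _)).mul (measurable_const.mul ?_)
    exact (measurable_from_top (f := fun k : ℕ => (ZMod.stdAddChar
      ((k : ZMod (digitMod p)) + ((-b.2).val : ZMod (digitMod p)) * W.g p) : ℂ))).comp (hKm _)
  have hfac : ∀ b x x', orbitWord shift (fun x => (x 0, carry e c x)) (C * p) x =
      orbitWord shift (fun x => (x 0, carry e c x)) (C * p) x' → Φ b x = Φ b x' := fun b x x' hxx => by
    have hco : ∀ i : ℕ, i < C * p → (shiftBy i x) 0 = (shiftBy i x') 0 ∧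
        carry e c (shiftBy i x) = carry e c (shiftBy i x') := fun i hi => by
      have := congrFun hxx ⟨i, hi⟩
      simp only [orbitWord, iterate_shift, Prod.mk.injEq] at this; exact this
    have hj := hjlt b.2
    have h1 : p ≤ C * p := Nat.le_mul_of_pos_left p hC
    have hKK : K (-b.2).val x = K (-b.2).val x' := sum_congr rfl fun i hi => by
      rw [(hco i (by have := mem_range.1 hi; omega)).2]
    simp only [hΦ, hKK, hV]
    congr 2
    simp only [pat, List.map_map, Function.comp_def, shiftBy_shiftBy]
    congr 1
    refine List.map_congr_left fun k hk => ?_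
    obtain ⟨hk0, hkC⟩ := hl k hk
    lift k to ℕ using hk0
    have h2 : p * k + (-b.2).val < C * p := by
      have : p * (k + 2) ≤ p * C := Nat.mul_le_mul_left p (by omega)
      nlinarith
    have h3 := (hco _ h2).1
    push_cast at h3
    simp only [coord, h3]
  have key := norm_integral_sub_sum_integral_le_of_mutualInfo
    (fiberMeasurable_orbitWord (measurable_shiftBy 1)
      (DilationSystem.fiberMeasurable_observable (fiberMeasurable_carry he.measurable c)) (C * p))
    (W.fiberMeasurable_Z p) hI Φ hΦ1 hfac
  have hψm : Measurable fun x => V x * ZMod.stdAddChar (W.N p x) :=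
    hVm.mul ((W.fiberMeasurable p).measurable fun a => (ZMod.stdAddChar a : ℂ))
  have e1 : ∑ b, ∫ x in W.Z p ⁻¹' {b}, Φ b x ∂κ =
      D.d p * ∫ x in D.Y p ⁻¹' {0}, V x * ZMod.stdAddChar (W.N p x) ∂κ := by
    rw [← integral_comp_eq_sum_fiber (W.fiberMeasurable_Z p) fun b =>
      Integrable.of_bound (hΦm b).aestronglyMeasurable 1 (ae_of_all _ (hΦ1 b))]
    have h1 : ∀ᵐ x ∂κ, Φ (W.Z p x) x =
        (fun y : ZMod (D.d p) => fun x => V (shiftBy ((-y).val : ℕ) x) *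
          ZMod.stdAddChar (W.N p (shiftBy ((-y).val : ℕ) x))) (D.Y p x) x := by
      filter_upwards [ae_all_iff.2 fun j => W.N_shiftBy hT p j] with x hx
      simp only [hΦ, Z]; rw [hx, AddChar.map_add_eq_mul _ (W.N p x)]
    rw [integral_congr_ae h1, integral_comp_eq_sum_fiber (D.fiberMeasurable p)
      (Φ := fun y : ZMod (D.d p) => fun x => V (shiftBy ((-y).val : ℕ) x) *
          ZMod.stdAddChar (W.N p (shiftBy ((-y).val : ℕ) x))) fun y =>
      Integrable.of_bound (hψm.comp (measurable_shiftBy _)).aestronglyMeasurable 1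
        (ae_of_all _ fun x => ?_)]
    · rw [sum_congr rfl fun y _ => D.setIntegral_fiber_shiftBy hT p
        (fun x => V x * ZMod.stdAddChar (W.N p x)) y]
      simp [ZMod.card]
    · simp only [norm_mul, norm_stdAddChar, mul_one]; exact hV1 _
  have e2 : ∑ b, (κ.real (W.Z p ⁻¹' {b}) : ℂ) * ∫ x, Φ b x ∂κ = 0 := by
    simp only [W.measureReal_fiber hT he hc]; rw [← mul_sum, Fintype.sum_prod_type_right]
    refine mul_eq_zero_of_right _ (sum_eq_zero fun y _ => ?_)
    have h2 : ∀ n : ZMod (digitMod p), ∫ x, Φ (n, y) x ∂κ = ZMod.stdAddChar n *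
        ∫ x, V (shiftBy ((-y).val : ℕ) x) * ZMod.stdAddChar ((K (-y).val x : ZMod (digitMod p)) +
          ((-y).val : ZMod (digitMod p)) * W.g p) ∂κ := by
      intro n
      rw [← integral_const_mul]; exact integral_congr_ae (ae_of_all _ fun x => by simp only [hΦ]; ring)
    simp only [h2]; rw [← sum_mul, AddChar.sum_eq_zero_of_ne_one, zero_mul]
    intro h
    have h3 : Fact (1 < digitMod p) := ⟨by rw [digitMod, if_pos hp]; exact hp.one_lt⟩
    have h4 := congrArg (fun ψ : AddChar (ZMod (digitMod p)) ℂ => ψ 1) h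
    simp only [AddChar.one_apply] at h4
    have h5 : (1 : ZMod (digitMod p)) = 0 := ZMod.injective_stdAddChar
      (h4.trans (AddChar.map_zero_eq_one _).symm)
    exact one_ne_zero h5
  rwa [e1, e2, sub_zero] at key

end DigitSystem

/-- Correlation monomials are orthogonal to eigenfunctions of infinite order. -/
theorem DilationSystem.integral_pat_mul_eq_zero_of_infinite_order (D : DilationSystem κ)
    (hErg : Ergodic shift κ) (he : IsEigenfunction κ e c)
    (hc : ∀ n : ℕ, 0 < n → c ^ n ≠ 1) (l : List ℤ) : ∫ x, (pat l x : ℂ) * e x ∂κ = 0 := by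
  have hT := hErg.toMeasurePreserving
  have hirr := irrational_unitArg he.norm_eigenvalue hc
  obtain ⟨W⟩ := nonempty_digitSystem D hErg he
  obtain ⟨m, C, hC, hl⟩ := exists_window l
  rw [← norm_eq_zero, ← norm_integral_pat_map_add hT he l m]
  refine le_antisymm (le_of_forall_pos_le_add fun η hη => ?_) (norm_nonneg _)
  set l' := l.map (· + m)
  obtain ⟨N, hN⟩ := exists_nat_gt (4 * Real.pi / η)
  obtain ⟨p, hp, -, hpN, hI⟩ := exists_prime_residueClass_le (q := 1) (a := 1) isUnit_one
    (W.summable_info hT he hirr C) (ε := (η / 4) ^ 2) (by positivity) (N + 1)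
  obtain ⟨w, hw, hwe⟩ := W.approx p hp
  have k1 := W.norm_setIntegral_le hT he hirr hp hC hI hl
  rw [Real.sqrt_sq (by positivity)] at k1
  have hp0 : (0 : ℝ) < p := by exact_mod_cast hp.pos
  have hmE : Measurable fun x => (pat l' x : ℂ) * e x :=
    (measurable_ofReal.comp (measurable_pat l')).mul he.measurable
  have hVm : Measurable fun x => (pat (l'.map (p * ·)) x : ℂ) :=
    measurable_ofReal.comp (measurable_pat _)
  have hNm : Measurable fun x => (ZMod.stdAddChar (W.N p x) : ℂ) :=
    (W.fiberMeasurable p).measurable fun a => (ZMod.stdAddChar a : ℂ)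
  have hem : Measurable fun x => e (dilate p x) := he.measurable.comp (measurable_dilate p)
  have hV1 : ∀ x, ‖(pat (l'.map (p * ·)) x : ℂ)‖ ≤ 1 := fun x => by rw [norm_real]; exact abs_pat_le _ _
  have hi1 : Integrable (fun x => (pat (l'.map (p * ·)) x : ℂ) * e (dilate p x))
      (κ.restrict (D.Y p ⁻¹' {0})) :=
    Integrable.of_bound (hVm.mul hem).aestronglyMeasurable 1 (ae_of_all _ fun x => by
      rw [norm_mul, he.norm_eq_one, mul_one]; exact hV1 x)
  have hi2 : Integrable (fun x => (pat (l'.map (p * ·)) x : ℂ) *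
      (w * ZMod.stdAddChar (W.N p x))) (κ.restrict (D.Y p ⁻¹' {0})) :=
    Integrable.of_bound (hVm.mul (hNm.const_mul w)).aestronglyMeasurable 1 (ae_of_all _ fun x => by
      rw [norm_mul, norm_mul, norm_stdAddChar, hw, mul_one, mul_one]; exact hV1 x)
  have e1 : ∫ x, (pat l' x : ℂ) * e x ∂κ = (-1) ^ l'.length * (D.d p *
      ∫ x in D.Y p ⁻¹' {0}, (pat (l'.map (p * ·)) x : ℂ) * e (dilate p x) ∂κ) := by
    rw [D.integral_dilate hp hmE, mul_left_comm]
    refine congrArg (fun z => (D.d p : ℂ) * z) ?_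
    rw [← integral_const_mul]
    refine integral_congr_ae (ae_of_all _ fun x => ?_)
    simp only [pat_dilate]
    push_cast; ring
  have e2 : D.d p * ∫ x in D.Y p ⁻¹' {0}, (pat (l'.map (p * ·)) x : ℂ) * e (dilate p x) ∂κ =
      D.d p * ∫ x in D.Y p ⁻¹' {0}, (pat (l'.map (p * ·)) x : ℂ) *
        (e (dilate p x) - w * ZMod.stdAddChar (W.N p x)) ∂κ +
      w * (D.d p * ∫ x in D.Y p ⁻¹' {0}, (pat (l'.map (p * ·)) x : ℂ) *
        ZMod.stdAddChar (W.N p x) ∂κ) := by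
    rw [mul_left_comm w, ← mul_add, ← integral_const_mul w]
    have : ∫ x in D.Y p ⁻¹' {0}, w * ((pat (l'.map (p * ·)) x : ℂ) *
        ZMod.stdAddChar (W.N p x)) ∂κ = ∫ x in D.Y p ⁻¹' {0}, (pat (l'.map (p * ·)) x : ℂ) *
      (w * ZMod.stdAddChar (W.N p x)) ∂κ :=
      integral_congr_ae (ae_of_all _ fun x => by ring)
    refine congrArg (fun z => (D.d p : ℂ) * z) ?_
    rw [this, ← sub_eq_iff_eq_add, ← integral_sub hi1 hi2]
    exact integral_congr_ae (ae_of_all _ fun x => by ring)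
  have e3 : ‖D.d p * ∫ x in D.Y p ⁻¹' {0}, (pat (l'.map (p * ·)) x : ℂ) *
        (e (dilate p x) - w * ZMod.stdAddChar (W.N p x)) ∂κ‖ ≤ 2 * Real.pi / p := by
    have h1 := norm_setIntegral_le_of_norm_le_const_ae (μ := κ) (s := D.Y p ⁻¹' {0})
      (f := fun x => (pat (l'.map (p * ·)) x : ℂ) * (e (dilate p x) - w * ZMod.stdAddChar (W.N p x)))
      (C := 2 * Real.pi / p) (measure_lt_top _ _) (by
        rw [ae_restrict_iff' (D.fiberMeasurable p 0)]
        filter_upwards [hwe] with x hx h0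
        rw [norm_mul]
        exact (mul_le_of_le_one_left (norm_nonneg _) (hV1 x)).trans (hx h0))
    rw [D.measureReal_zero] at h1
    have hd0 : (0 : ℝ) < D.d p := by exact_mod_cast Nat.pos_of_neZero (D.d p)
    rw [norm_mul, Complex.norm_natCast]
    calc (D.d p : ℝ) * _ ≤ D.d p * (2 * Real.pi / p * (1 / D.d p)) := by gcongr
      _ = 2 * Real.pi / p := by field_simp
  have e4 : 2 * Real.pi / p ≤ η / 2 := by
    rw [div_le_iff₀ hp0]
    have h1 : (N : ℝ) ≤ p := by exact_mod_cast (Nat.le_of_succ_le hpN)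
    rw [div_lt_iff₀ hη] at hN; nlinarith
  rw [e1, e2, norm_mul, norm_pow, norm_neg, norm_one, one_pow, one_mul, zero_add]
  refine (norm_add_le _ _).trans ?_
  rw [norm_mul w, hw, one_mul]; linarith

end IrrationalEigenvalues

section SpectralMeasure

open Complex ComplexConjugate

theorem integral_fourier_haar (n : ℤ) :
    ∫ θ, fourier n θ ∂(AddCircle.haarAddCircle : Measure UnitAddCircle) = if n = 0 then 1 else 0 := by
  have h := (orthonormal_iff_ite.1 (orthonormal_fourier (T := (1 : ℝ)))) 0 n
  rw [L2.inner_def] at h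
  have h2 : ∀ᵐ θ ∂(AddCircle.haarAddCircle : Measure UnitAddCircle),
      inner ℂ (fourierLp 2 0 θ : ℂ) (fourierLp 2 n θ) = fourier n θ := by
    filter_upwards [coeFn_fourierLp (T := (1 : ℝ)) 2 0, coeFn_fourierLp (T := (1 : ℝ)) 2 n] with θ h1 h2
    rw [h1, h2]; simp
  rw [integral_congr_ae h2] at h; rw [h]
  simp only [eq_comm]

theorem card_filter_sub_eq (L : ℕ) (n : ℤ) :
    ((L : ℝ) - |(n : ℝ)| ≤ ∑ m ∈ range L, ∑ m' ∈ range L,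
      if n = (m' : ℤ) - m then (1 : ℝ) else 0) ∧
    ∑ m ∈ range L, ∑ m' ∈ range L, (if n = (m' : ℤ) - m then (1 : ℝ) else 0) ≤ L := by
  have hinner : ∀ m ∈ range L, ∑ m' ∈ range L,
      (if n = (m' : ℤ) - m then (1 : ℝ) else 0) = if 0 ≤ m + n ∧ m + n < L then 1 else 0 := fun m _ => by
    split_ifs with h
    · rw [sum_eq_single (m + n).toNat]
      · rw [if_pos (by omega)]
      · intro b _ hb; rw [if_neg (by omega)]
      · intro hb; rw [mem_range] at hb; omega
    · refine sum_eq_zero fun m' hm' => ?_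
      rw [mem_range] at hm'; rw [if_neg (by omega)]
  rw [sum_congr rfl hinner]
  constructor
  · rw [sum_ite, sum_const_zero, add_zero, sum_const, nsmul_eq_mul, mul_one]
    have h1 : (range L).card ≤ ((range L).filter fun m : ℕ =>
        0 ≤ (m : ℤ) + n ∧ (m : ℤ) + n < L).card + n.natAbs := by
      rw [← card_filter_add_card_filter_not (s := range L)
        (fun m : ℕ => 0 ≤ (m : ℤ) + n ∧ (m : ℤ) + n < L)]
      gcongr
      rcases le_total 0 n with hn | hn
      · refine (card_le_card (t := Ico (L - n.natAbs) L) fun m hm => ?_).trans ?_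
        · simp only [mem_filter, mem_range, mem_Ico] at hm ⊢; omega
        · rw [Nat.card_Ico]; omega
      · refine (card_le_card (t := range n.natAbs) fun m hm => ?_).trans ?_
        · simp only [mem_filter, mem_range] at hm ⊢; omega
        · rw [card_range]
    rw [card_range] at h1
    have h2 := (Nat.cast_le (α := ℝ)).2 h1
    rw [Nat.cast_add, Nat.cast_natAbs, Int.cast_abs] at h2; linarith
  · refine (sum_le_sum (g := fun _ => (1 : ℝ)) fun m _ => by split_ifs <;> norm_num).trans ?_
    simp

/-- Herglotz' theorem: a positive definite sequence is the sequence of Fourier coefficients of a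
probability measure on the circle. -/
theorem exists_spectral_measure {a : ℤ → ℂ} (ha0 : a 0 = 1) {r : ℕ → UnitAddCircle → ℝ}
    (hr0 : ∀ L θ, 0 ≤ r L θ)
    (hr : ∀ L θ, (r L θ : ℂ) = ∑ m ∈ range L, ∑ m' ∈ range L,
      a (m' - m) * fourier ((m : ℤ) - m') θ) :
    ∃ σ : Measure UnitAddCircle, IsProbabilityMeasure σ ∧ ∀ n : ℤ, ∫ θ, fourier n θ ∂σ = a n := by
  set haar : Measure UnitAddCircle := AddCircle.haarAddCircle
  have hrc : ∀ L, Continuous (r L) := fun L => by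
    have : Continuous fun θ => (r L θ : ℂ) := by
      simp only [hr]; exact continuous_finsetSum _ fun m _ => continuous_finsetSum _ fun m' _ =>
        continuous_const.mul (fourier _).continuous
    have h2 := continuous_re.comp this
    simpa [Function.comp_def] using h2
  set ν : ℕ → Measure UnitAddCircle := fun L =>
    haar.withDensity fun θ => ENNReal.ofReal (r (L + 1) θ / (L + 1 : ℕ))
  have hInt : ∀ L (n : ℤ), ∫ θ, fourier n θ ∂(ν L) =
      a n * (((∑ m ∈ range (L + 1), ∑ m' ∈ range (L + 1),
        if n = (m' : ℤ) - m then (1 : ℝ) else 0) / (L + 1 : ℕ) : ℝ) : ℂ) := by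
    intro L n
    have hL : ((L + 1 : ℕ) : ℂ) ≠ 0 := by exact_mod_cast Nat.succ_ne_zero L
    simp only [ν]
    rw [integral_withDensity_eq_integral_toReal_smul
      ((hrc (L + 1)).measurable.div_const _).ennreal_ofReal (ae_of_all _ fun _ => ENNReal.ofReal_lt_top)]
    have e1 : ∀ θ, (ENNReal.ofReal (r (L + 1) θ / (L + 1 : ℕ))).toReal • fourier n θ =
        ((L + 1 : ℕ) : ℂ)⁻¹ * ∑ m ∈ range (L + 1), ∑ m' ∈ range (L + 1),
          a (m' - m) * fourier (n + ((m : ℤ) - m')) θ := by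
      intro θ
      rw [ENNReal.toReal_ofReal (div_nonneg (hr0 _ _) (Nat.cast_nonneg _)), real_smul]; push_cast
      rw [hr, div_mul_eq_mul_div, div_eq_inv_mul, sum_mul]
      congr 1
      refine sum_congr rfl fun m _ => ?_
      rw [sum_mul]
      refine sum_congr rfl fun m' _ => ?_
      rw [fourier_add]; ring
    have hfi : ∀ k : ℤ, Integrable (fun θ => (fourier k θ : ℂ)) haar := fun k =>
      (fourier k).continuous.integrable_of_hasCompactSupport
        (HasCompactSupport.of_compactSpace _)
    simp only [e1]; rw [integral_const_mul, integral_finsetSum]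
    · have e2 : ∀ m ∈ range (L + 1), ∫ θ, ∑ m' ∈ range (L + 1),
          a (m' - m) * fourier (n + ((m : ℤ) - m')) θ ∂haar =
          ∑ m' ∈ range (L + 1), a n * ((if n = (m' : ℤ) - m then (1 : ℝ) else 0 : ℝ) : ℂ) := by
        intro m _
        rw [integral_finsetSum _ fun m' _ => (hfi _).const_mul _]
        refine sum_congr rfl fun m' _ => ?_
        rw [integral_const_mul, integral_fourier_haar]
        by_cases h : n = (m' : ℤ) - m
        · rw [if_pos h, if_pos (by omega), h]; simp
        · rw [if_neg h, if_neg (by omega)]; simp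
      rw [sum_congr rfl e2]; push_cast
      simp only [← mul_sum]; field_simp
    · exact fun m _ => integrable_finsetSum _ fun m' _ => (hfi _).const_mul _
  have hprob : ∀ L, IsProbabilityMeasure (ν L) := fun L => by
    have h0 := hInt L 0
    have hfin : IsFiniteMeasure (ν L) := isFiniteMeasure_withDensity_ofReal (by
      exact (((hrc (L + 1)).div_const _).integrable_of_hasCompactSupport
        (HasCompactSupport.of_compactSpace _)).2)
    refine ⟨?_⟩
    have h1 : ∑ m ∈ range (L + 1), ∑ m' ∈ range (L + 1),
        (if (0 : ℤ) = (m' : ℤ) - m then (1 : ℝ) else 0) = (L + 1 : ℕ) := by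
      have := card_filter_sub_eq (L + 1) 0
      simp only [Int.cast_zero, abs_zero, sub_zero] at this; exact le_antisymm this.2 this.1
    rw [h1, div_self (by positivity), ha0] at h0
    simp only [fourier_zero, integral_const, real_smul, mul_one, ofReal_one] at h0
    have h2 : (ν L).real Set.univ = 1 := by exact_mod_cast h0
    rwa [measureReal_def, ENNReal.toReal_eq_one_iff] at h2
  set P : ℕ → ProbabilityMeasure UnitAddCircle := fun L => ⟨ν L, hprob L⟩
  let U : Ultrafilter ℕ := Filter.hyperfilter ℕ
  have hU : (U : Filter ℕ) ≤ atTop := Nat.hyperfilter_le_atTop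
  obtain ⟨σ, hσ⟩ : ∃ σ, Tendsto P U (𝓝 σ) := ⟨_, (U.map P).le_nhds_lim⟩
  refine ⟨σ, inferInstance, fun n => ?_⟩
  have hlimR : ∀ f : C(UnitAddCircle, ℝ), Tendsto (fun L => ∫ θ, f θ ∂(ν L)) U
      (𝓝 (∫ θ, f θ ∂(σ : Measure UnitAddCircle))) := fun f =>
    (ProbabilityMeasure.tendsto_iff_forall_integral_tendsto.1 hσ)
      (BoundedContinuousFunction.mkOfCompact f)
  have hfi : ∀ (μ : Measure UnitAddCircle) [IsProbabilityMeasure μ],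
      Integrable (fun θ => (fourier n θ : ℂ)) μ := fun μ _ =>
    (fourier n).continuous.integrable_of_hasCompactSupport (HasCompactSupport.of_compactSpace _)
  have hlim : Tendsto (fun L => ∫ θ, fourier n θ ∂(ν L)) U
      (𝓝 (∫ θ, fourier n θ ∂(σ : Measure UnitAddCircle))) := by
    have hre := hlimR ⟨fun θ => (fourier n θ).re, continuous_re.comp (fourier n).continuous⟩
    have him := hlimR ⟨fun θ => (fourier n θ).im, continuous_im.comp (fourier n).continuous⟩
    have e : ∀ (μ : Measure UnitAddCircle) [IsProbabilityMeasure μ], ∫ θ, fourier n θ ∂μ =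
        ((∫ θ, (fourier n θ).re ∂μ : ℝ) : ℂ) + ((∫ θ, (fourier n θ).im ∂μ : ℝ) : ℂ) * I := fun μ _ => by
      rw [← integral_re_add_im (hfi μ)]; rfl
    rw [e]
    refine Tendsto.congr (fun L => (e (ν L)).symm) ?_
    exact ((continuous_ofReal.tendsto _).comp hre).add
      (((continuous_ofReal.tendsto _).comp him).mul_const _)
  have hlim2 : Tendsto (fun L => ∫ θ, fourier n θ ∂(ν L)) atTop (𝓝 (a n)) := by
    simp only [hInt]
    have h1 : Tendsto (fun L : ℕ => ((∑ m ∈ range (L + 1), ∑ m' ∈ range (L + 1),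
        if n = (m' : ℤ) - m then (1 : ℝ) else 0) / (L + 1 : ℕ) : ℝ)) atTop (𝓝 1) := by
      have h2 : Tendsto (fun L : ℕ => (1 : ℝ) - |(n : ℝ)| / ((L + 1 : ℕ) : ℝ)) atTop (𝓝 (1 - 0)) :=
        tendsto_const_nhds.sub ((tendsto_const_div_atTop_nhds_zero_nat _).comp (tendsto_add_atTop_nat 1))
      rw [sub_zero] at h2
      refine tendsto_of_tendsto_of_tendsto_of_le_of_le h2 tendsto_const_nhds (fun L => ?_) fun L => ?_
      · have hL : (0 : ℝ) < ((L + 1 : ℕ) : ℝ) := by positivity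
        rw [le_div_iff₀ hL, sub_mul, div_mul_cancel₀ _ hL.ne', one_mul]; exact (card_filter_sub_eq (L + 1) n).1
      · have hL : (0 : ℝ) < ((L + 1 : ℕ) : ℝ) := by positivity
        rw [div_le_one hL]; exact (card_filter_sub_eq (L + 1) n).2
    have h3 := ((continuous_ofReal.tendsto _).comp h1).const_mul (a n)
    simpa [Function.comp_def] using h3
  exact tendsto_nhds_unique hlim (hlim2.mono_left hU)

theorem fourier_natCast_eq_pow (m : ℕ) (τ : UnitAddCircle) : fourier (m : ℤ) τ = fourier 1 τ ^ m := by
  induction m with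
  | zero => simp
  | succ m ih => rw [Nat.cast_succ, fourier_add, ih, pow_succ]

theorem norm_fourier_apply (n : ℤ) (τ : UnitAddCircle) : ‖(fourier n τ : ℂ)‖ = 1 := by
  rw [fourier_apply]; exact Circle.norm_coe _

theorem fourier_sub_arg (n : ℤ) (θ φ : UnitAddCircle) :
    (fourier n (θ - φ) : ℂ) = fourier n θ * conj (fourier n φ) := by
  rw [← fourier_neg]
  simp only [fourier_apply, sub_eq_add_neg, zsmul_add, zsmul_neg, AddCircle.toCircle_add, neg_zsmul]; simp

/-- The Cesàro averages of characters of the circle. -/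
noncomputable def fourierAverage (L : ℕ) (τ : UnitAddCircle) : ℂ :=
  (L : ℂ)⁻¹ * ∑ m ∈ range L, fourier (m : ℤ) τ

theorem continuous_fourierAverage (L : ℕ) : Continuous (fourierAverage L) :=
  continuous_const.mul (continuous_finsetSum _ fun _ _ => (fourier _).continuous)

theorem norm_fourierAverage_le (L : ℕ) (τ : UnitAddCircle) : ‖fourierAverage L τ‖ ≤ 1 := by
  rw [fourierAverage, norm_mul, norm_inv, Complex.norm_natCast]
  rcases Nat.eq_zero_or_pos L with rfl | hL
  · simp
  · have hL' : (0 : ℝ) < L := by exact_mod_cast hL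
    rw [inv_mul_le_iff₀ hL', mul_one]
    refine (norm_sum_le _ _).trans ?_
    simp only [norm_fourier_apply, sum_const, card_range, nsmul_eq_mul, mul_one]; exact le_rfl

theorem tendsto_fourierAverage (τ : UnitAddCircle) :
    Tendsto (fun L => fourierAverage L τ) atTop (𝓝 (if τ = 0 then 1 else 0)) := by
  split_ifs with h
  · refine tendsto_const_nhds.congr' ?_
    filter_upwards [eventually_gt_atTop 0] with L hL
    have : (L : ℂ) ≠ 0 := by exact_mod_cast hL.ne'
    simp [fourierAverage, h, this]
  · have hz : (fourier 1 τ : ℂ) ≠ 1 := by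
      intro h1
      apply h
      refine AddCircle.injective_toCircle (T := (1 : ℝ)) one_ne_zero ?_
      rw [fourier_one] at h1; rw [AddCircle.toCircle_zero]; exact Circle.coe_injective (by simpa using h1)
    have hz' : 0 < ‖(fourier 1 τ : ℂ) - 1‖ := norm_pos_iff.2 (sub_ne_zero.2 hz)
    refine squeeze_zero_norm (a := fun L : ℕ => 2 / ‖(fourier 1 τ : ℂ) - 1‖ / L) (fun L => ?_)
      (tendsto_const_div_atTop_nhds_zero_nat _)
    simp only [fourierAverage, fourier_natCast_eq_pow]
    rw [geom_sum_eq hz, norm_mul, norm_inv, Complex.norm_natCast, norm_div, inv_mul_eq_div]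
    gcongr
    refine (norm_sub_le _ _).trans ?_
    rw [norm_pow, norm_fourier_apply, one_pow, norm_one]; norm_num

variable {σ : Measure UnitAddCircle} [IsProbabilityMeasure σ] {a : ℤ → ℂ}

theorem integrable_fourier (n : ℤ) : Integrable (fun θ => (fourier n θ : ℂ)) σ :=
  (fourier n).continuous.integrable_of_hasCompactSupport (HasCompactSupport.of_compactSpace _)

/-- The mass of an atom is the limit of the twisted averages of the Fourier coefficients. -/
theorem tendsto_average_atom (ha : ∀ n : ℤ, ∫ θ, fourier n θ ∂σ = a n) (θ₀ : UnitAddCircle) :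
    Tendsto (fun L : ℕ => (L : ℂ)⁻¹ * ∑ m ∈ range L,
      a m * conj (fourier (m : ℤ) θ₀)) atTop (𝓝 (σ.real {θ₀} : ℂ)) := by
  have h1 : ∀ L : ℕ, (L : ℂ)⁻¹ * ∑ m ∈ range L, a m * conj (fourier (m : ℤ) θ₀) =
      ∫ θ, fourierAverage L (θ - θ₀) ∂σ := fun L => by
    simp only [fourierAverage, fourier_sub_arg]
    rw [integral_const_mul, integral_finsetSum _ fun m _ => (integrable_fourier _).mul_const _]
    simp only [integral_mul_const, ha]
  simp only [h1]
  have h2 : ∫ θ, (if θ - θ₀ = 0 then (1 : ℂ) else 0) ∂σ = σ.real {θ₀} := by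
    have : (fun θ => if θ - θ₀ = 0 then (1 : ℂ) else 0) = ({θ₀} : Set UnitAddCircle).indicator fun _ => 1 := by
      funext θ; simp [Set.indicator, sub_eq_zero]
    rw [this, integral_indicator_const _ (measurableSet_singleton _), real_smul, mul_one]
  rw [← h2]
  refine tendsto_integral_of_dominated_convergence (fun _ => 1) (fun L => ?_) (integrable_const _)
    (fun L => ae_of_all _ fun θ => norm_fourierAverage_le L _)
    (ae_of_all _ fun θ => tendsto_fourierAverage _)
  exact ((continuous_fourierAverage L).comp (continuous_id.sub continuous_const)).aestronglyMeasurable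

theorem sum_norm_sq_eq_integral (ha : ∀ n : ℤ, ∫ θ, fourier n θ ∂σ = a n) (L : ℕ) :
    ((L : ℂ)⁻¹ * (L : ℂ)⁻¹) * ∑ m ∈ range L, ∑ m' ∈ range L,
      ((‖a (m' - m)‖ ^ 2 : ℝ) : ℂ) =
    ∫ z : UnitAddCircle × UnitAddCircle, fourierAverage L (z.1 - z.2) *
      conj (fourierAverage L (z.1 - z.2)) ∂(σ.prod σ) := by
  have hInt : ∀ n : ℤ, Integrable (fun z : UnitAddCircle × UnitAddCircle =>
      (fourier n (z.1 - z.2) : ℂ)) (σ.prod σ) := fun n =>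
    ((fourier n).continuous.comp (continuous_fst.sub continuous_snd)).integrable_of_hasCompactSupport
      (HasCompactSupport.of_compactSpace _)
  have h1 : ∀ n : ℤ, ∫ z : UnitAddCircle × UnitAddCircle, (fourier n (z.1 - z.2) : ℂ) ∂(σ.prod σ) =
      ((‖a n‖ ^ 2 : ℝ) : ℂ) := fun n => by
    simp only [fourier_sub_arg]
    rw [integral_prod_mul (fun θ => (fourier n θ : ℂ)) (fun φ => conj (fourier n φ : ℂ)),
      ha, integral_conj, ha, mul_conj, normSq_eq_norm_sq]
  have h2 : ∀ τ : UnitAddCircle, fourierAverage L τ * conj (fourierAverage L τ) =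
      ((L : ℂ)⁻¹ * (L : ℂ)⁻¹) * ∑ m ∈ range L, ∑ m' ∈ range L,
        fourier ((m' : ℤ) - m) τ := by
    intro τ
    simp only [fourierAverage, map_mul, map_inv₀, conj_natCast, map_sum]
    rw [mul_mul_mul_comm, sum_mul_sum, sum_comm]
    congr 1
    refine sum_congr rfl fun m _ => sum_congr rfl fun m' _ => ?_
    rw [sub_eq_add_neg, fourier_add, fourier_neg]
  simp only [h2]; rw [integral_const_mul, integral_finsetSum]
  · congr 1
    refine sum_congr rfl fun m _ => ?_
    rw [integral_finsetSum _ fun m' _ => hInt _]; exact sum_congr rfl fun m' _ => (h1 _).symm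
  · exact fun m _ => integrable_finsetSum _ fun _ _ => hInt _

/-- Wiener's lemma: the mean square of the Fourier coefficients is controlled by the atoms. -/
theorem eventually_mean_sq_le (ha : ∀ n : ℤ, ∫ θ, fourier n θ ∂σ = a n) (F : Finset UnitAddCircle)
    {δ : ℝ} (hδ0 : 0 ≤ δ) (hδ : ∀ θ ∉ F, σ.real {θ} ≤ δ) {ε : ℝ} (hε : 0 < ε) :
    ∀ᶠ L : ℕ in atTop, ((L : ℝ)⁻¹ * (L : ℝ)⁻¹) * ∑ m ∈ range L, ∑ m' ∈ range L,
      ‖a (m' - m)‖ ^ 2 ≤ ∑ θ ∈ F, σ.real {θ} + δ + ε := by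
  classical
  set dg : Set (UnitAddCircle × UnitAddCircle) := {z | z.1 = z.2} with hdg
  have hdm : MeasurableSet dg := measurableSet_eq_fun measurable_fst measurable_snd
  have hlim : Tendsto (fun L : ℕ => ∫ z : UnitAddCircle × UnitAddCircle,
      fourierAverage L (z.1 - z.2) * conj (fourierAverage L (z.1 - z.2)) ∂(σ.prod σ))
      atTop (𝓝 ((σ.prod σ).real dg : ℂ)) := by
    have h2 : ∫ z : UnitAddCircle × UnitAddCircle, (if z.1 - z.2 = 0 then (1 : ℂ) else 0) ∂(σ.prod σ) =
        (σ.prod σ).real dg := by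
      have : (fun z : UnitAddCircle × UnitAddCircle => if z.1 - z.2 = 0 then (1 : ℂ) else 0) =
          dg.indicator fun _ => 1 := by
        funext z; simp [Set.indicator, sub_eq_zero, hdg]
      rw [this, integral_indicator_const _ hdm, real_smul, mul_one]
    rw [← h2]
    refine tendsto_integral_of_dominated_convergence (fun _ => 1) (fun L => ?_) (integrable_const _)
      (fun L => ae_of_all _ fun z => ?_) (ae_of_all _ fun z => ?_)
    · have hc := (continuous_fourierAverage L).comp
        (continuous_fst.sub continuous_snd : Continuous fun z : UnitAddCircle × UnitAddCircle => z.1 - z.2)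
      exact (hc.mul (continuous_conj.comp hc)).aestronglyMeasurable
    · rw [norm_mul, RCLike.norm_conj]
      exact mul_le_one₀ (norm_fourierAverage_le _ _) (norm_nonneg _) (norm_fourierAverage_le _ _)
    · have h := tendsto_fourierAverage (z.1 - z.2)
      have h' := h.mul ((continuous_conj.tendsto _).comp h)
      convert! h' using 2
      split_ifs <;> simp
  simp only [← sum_norm_sq_eq_integral ha] at hlim
  have hlimR := (continuous_re.tendsto _).comp hlim
  have hdiag : (σ.prod σ).real dg ≤ ∑ θ ∈ F, σ.real {θ} + δ := by
    have h1 : (σ.prod σ).real dg = ∫ θ, σ.real {θ} ∂σ := by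
      rw [measureReal_def, Measure.prod_apply hdm, integral_eq_lintegral_of_nonneg_ae
        (ae_of_all _ fun _ => measureReal_nonneg)]
      · congr 1
        refine lintegral_congr fun θ => ?_
        rw [measureReal_def, ENNReal.ofReal_toReal (measure_ne_top _ _)]
        congr 1
        ext φ; simp [hdg, eq_comm]
      · have h3 := measurable_measure_prodMk_left (ν := σ) hdm
        have h4 : (fun θ => σ.real {θ}) = fun θ => (σ (Prod.mk θ ⁻¹' dg)).toReal := by
          funext θ
          rw [measureReal_def]
          congr 2
          ext φ; simp [hdg, eq_comm]
        rw [h4]; exact h3.ennreal_toReal.aestronglyMeasurable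
    have h2 : ∀ θ, σ.real {θ} ≤ ∑ φ ∈ F, ({φ} : Set UnitAddCircle).indicator (fun _ => (1 : ℝ)) θ + δ := fun θ => by
      by_cases hθ : θ ∈ F
      · have h3 : (1 : ℝ) ≤ ∑ φ ∈ F, ({φ} : Set UnitAddCircle).indicator (fun _ => (1 : ℝ)) θ := by
          rw [sum_eq_single θ]
          · simp
          · intro b _ hb; simp [hb.symm]
          · exact fun h => absurd hθ h
        have h4 : σ.real {θ} ≤ 1 := measureReal_le_one
        linarith
      · have h3 : (0 : ℝ) ≤ ∑ φ ∈ F, ({φ} : Set UnitAddCircle).indicator (fun _ => (1 : ℝ)) θ :=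
          sum_nonneg fun φ _ => Set.indicator_nonneg (fun _ _ => zero_le_one) _
        linarith [hδ θ hθ]
    have hI : ∀ φ ∈ F, Integrable (({φ} : Set UnitAddCircle).indicator fun _ => (1 : ℝ)) σ :=
      fun φ _ => (integrable_const _).indicator (measurableSet_singleton _)
    rw [h1]
    refine (integral_mono_of_nonneg (ae_of_all _ fun _ => measureReal_nonneg)
      ((integrable_finsetSum F hI).add (integrable_const δ)) (ae_of_all _ h2)).trans_eq ?_
    simp only [Pi.add_apply]
    rw [integral_add (integrable_finsetSum F hI) (integrable_const _), integral_finsetSum F hI]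
    congr 1
    · refine sum_congr rfl fun φ _ => ?_
      rw [integral_indicator_const _ (measurableSet_singleton _), smul_eq_mul, mul_one]
    · simp
  have hev := hlimR.eventually (gt_mem_nhds (show (((σ.prod σ).real dg : ℂ)).re <
    (σ.prod σ).real dg + ε by rw [ofReal_re]; linarith))
  filter_upwards [hev] with L hL
  have hcast : (((L : ℂ)⁻¹ * (L : ℂ)⁻¹) * ∑ m ∈ range L, ∑ m' ∈ range L,
      ((‖a (m' - m)‖ ^ 2 : ℝ) : ℂ)) = ((((L : ℝ)⁻¹ * (L : ℝ)⁻¹) * ∑ m ∈ range L,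
      ∑ m' ∈ range L, ‖a (m' - m)‖ ^ 2 : ℝ) : ℂ) := by push_cast; rfl
  simp only [Function.comp, hcast, ofReal_re] at hL; linarith

end SpectralMeasure

section MeanErgodic

open Complex ComplexConjugate

variable {κ : Measure SymbolSpace} [IsProbabilityMeasure κ]

/-- Autocorrelations of a real function. -/
noncomputable def autocorr (κ : Measure SymbolSpace) (g : SymbolSpace → ℝ) (n : ℤ) : ℝ :=
  ∫ x, g x * g (shiftBy n x) ∂κ

theorem exists_eigenfunction_of_fixed (hErg : Ergodic shift κ) {h : SymbolSpace → ℂ}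
    (hm : Measurable h) {c : ℂ} (hc : ‖c‖ = 1) (hstep : ∀ᵐ x ∂κ, h (shiftBy 1 x) = c * h x)
    (h0 : ¬ h =ᵐ[κ] 0) : ∃ (e : SymbolSpace → ℂ) (ρ : ℝ), IsEigenfunction κ e c ∧ 0 < ρ ∧
      ∀ᵐ x ∂κ, h x = ρ * e x := by
  have hinv : (fun x => ‖h x‖) ∘ shift =ᵐ[κ] fun x => ‖h x‖ := by
    filter_upwards [hstep] with x hx
    simp only [Function.comp, shift_eq_shiftBy, hx, norm_mul, hc, one_mul]
  obtain ⟨ρ, hρ⟩ := hErg.quasiErgodic.ae_eq_const_of_ae_eq_comp₀ hm.norm.nullMeasurable hinv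
  have hρ' : ∀ᵐ x ∂κ, ‖h x‖ = ρ := hρ
  have hρ0 : 0 < ρ := by
    obtain ⟨x, hx⟩ := hρ'.exists
    refine lt_of_le_of_ne (hx ▸ norm_nonneg _) fun h1 => h0 ?_
    filter_upwards [hρ'] with x hx
    rw [← h1] at hx; exact norm_eq_zero.1 hx
  classical
  refine ⟨fun x => if ‖h x‖ = ρ then h x / ρ else 1, ρ, ⟨?_, fun x => ?_, ?_⟩, hρ0, ?_⟩
  · exact Measurable.ite (hm.norm (measurableSet_singleton _)) (hm.div_const _) measurable_const
  · split_ifs with hx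
    · rw [norm_div, hx, norm_real, Real.norm_eq_abs, abs_of_pos hρ0, div_self hρ0.ne']
    · exact norm_one
  · filter_upwards [hstep, hρ'] with x h1 h2
    have h3 : ‖h (shiftBy 1 x)‖ = ρ := by rw [h1, norm_mul, hc, one_mul, h2]
    rw [if_pos h3, if_pos h2, h1, mul_div_assoc]
  · filter_upwards [hρ'] with x hx
    have : (ρ : ℂ) ≠ 0 := by exact_mod_cast hρ0.ne'
    rw [if_pos hx]; field_simp

/-- Twisted averages of autocorrelations detect eigenfunctions. -/
theorem exists_eigenfunction_of_average (hErg : Ergodic shift κ) {g : SymbolSpace → ℝ}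
    (hg : Measurable g) (hg1 : ∀ x, |g x| ≤ 1) {c : ℂ} (hc : ‖c‖ = 1) :
    ∃ ρ : ℝ, Tendsto (fun L : ℕ => (L : ℂ)⁻¹ * ∑ m ∈ range L,
      (autocorr κ g m : ℂ) * conj (c ^ m)) atTop (𝓝 ρ) ∧
      (ρ = 0 ∨ ∃ e, IsEigenfunction κ e c ∧ ‖∫ x, (g x : ℂ) * e x ∂κ‖ ^ 2 = ρ) := by
  have hT := hErg.toMeasurePreserving
  have hgL : MemLp (fun x => (g x : ℂ)) 2 κ :=
    MemLp.of_bound (measurable_ofReal.comp hg).aestronglyMeasurable 1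
      (ae_of_all _ fun x => by rw [norm_real]; exact hg1 x)
  set G : Lp ℂ 2 κ := hgL.toLp _
  set U : Lp ℂ 2 κ →L[ℂ] Lp ℂ 2 κ := (Lp.compMeasurePreservingₗᵢ ℂ shift hT).toContinuousLinearMap
  set V : Lp ℂ 2 κ →L[ℂ] Lp ℂ 2 κ := conj c • U with hV
  have hcc : conj c * c = 1 := by
    rw [mul_comm, mul_conj, normSq_eq_norm_sq, hc]; norm_num
  have hUc : ∀ f : Lp ℂ 2 κ, U f =ᵐ[κ] f ∘ shift := fun f => Lp.coeFn_compMeasurePreserving f hT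
  have hVn : ‖V‖ ≤ 1 := by
    refine ContinuousLinearMap.opNorm_le_bound _ zero_le_one fun f => ?_
    have : ‖U f‖ = ‖f‖ := (Lp.compMeasurePreservingₗᵢ ℂ shift hT).norm_map f
    simp only [hV, _root_.smul_apply, norm_smul, RCLike.norm_conj, hc, one_mul, this]; exact le_rfl
  have hVc : ∀ f : Lp ℂ 2 κ, V f =ᵐ[κ] fun x => conj c * f (shiftBy 1 x) := fun f => by
    have h1 : V f = conj c • U f := rfl
    rw [h1]
    filter_upwards [Lp.coeFn_smul (conj c) (U f), hUc f] with x h2 h3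
    rw [h2, Pi.smul_apply, h3, smul_eq_mul]; rfl
  have hit : ∀ m : ℕ, ∀ᵐ x ∂κ, (V^[m] G) x = conj (c ^ m) * (g (shiftBy m x) : ℂ) := fun m => by
    induction m with
    | zero =>
      filter_upwards [hgL.coeFn_toLp] with x hx
      simpa [shiftBy_zero] using hx
    | succ m ih =>
      rw [Function.iterate_succ_apply']
      filter_upwards [hVc (V^[m] G), (measurePreserving_shiftBy hT 1).quasiMeasurePreserving.ae ih]
        with x h1 h2
      rw [h1, h2, shiftBy_shiftBy, pow_succ, map_mul]; push_cast; ring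
  have hlim := V.tendsto_birkhoffAverage_orthogonalProjection hVn G
  set K := V.eqLocus (1 : Lp ℂ 2 κ →L[ℂ] Lp ℂ 2 κ)
  set H : Lp ℂ 2 κ := (K.orthogonalProjectionOnto G : Lp ℂ 2 κ)
  have hinner : ∀ m : ℕ, inner ℂ G (V^[m] G) = (autocorr κ g m : ℂ) * conj (c ^ m) := fun m => by
    rw [L2.inner_def, autocorr, ← integral_complex_ofReal, ← integral_mul_const]
    refine integral_congr_ae ?_
    filter_upwards [hit m, hgL.coeFn_toLp] with x h1 h2
    rw [h1, h2]
    simp only [RCLike.inner_apply, conj_ofReal]; push_cast; ring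
  have hlim2 : Tendsto (fun L : ℕ => (L : ℂ)⁻¹ * ∑ m ∈ range L,
      (autocorr κ g m : ℂ) * conj (c ^ m)) atTop (𝓝 (inner ℂ G H)) := by
    have h1 := (tendsto_const_nhds (x := G)).inner hlim (𝕜 := ℂ)
    refine h1.congr fun L => ?_
    rw [birkhoffAverage, birkhoffSum, inner_smul_right, inner_sum]
    simp only [id, hinner]
  have hGH : inner ℂ G H = ((‖H‖ ^ 2 : ℝ) : ℂ) := by
    have h1 : inner ℂ (G - H) H = 0 := Submodule.starProjection_inner_eq_zero G H
      (Submodule.coe_mem _)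
    rw [inner_sub_left, sub_eq_zero] at h1
    rw [h1, inner_self_eq_norm_sq_to_K]; push_cast; rfl
  refine ⟨‖H‖ ^ 2, by rw [← hGH]; exact hlim2, ?_⟩
  by_cases hH0 : H = 0
  · left; rw [hH0]; simp
  right
  have hHm := (Lp.stronglyMeasurable H).measurable
  have hHK : V H = H := by
    have : H ∈ K := Submodule.coe_mem _
    exact this
  have hHs : ∀ᵐ x ∂κ, H (shiftBy 1 x) = c * H x := by
    have h1 := hVc H
    rw [hHK] at h1
    filter_upwards [h1] with x hx
    rw [hx, ← mul_assoc, mul_comm c, hcc, one_mul]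
  obtain ⟨e, ρ, he, hρ, hHe⟩ := exists_eigenfunction_of_fixed hErg hHm hc hHs fun h =>
    hH0 (Lp.eq_zero_iff_ae_eq_zero.2 h)
  refine ⟨e, he, ?_⟩
  have h1 : inner ℂ G H = ρ * ∫ x, (g x : ℂ) * e x ∂κ := by
    rw [L2.inner_def, ← integral_const_mul]
    refine integral_congr_ae ?_
    filter_upwards [hHe, hgL.coeFn_toLp] with x h1 h2
    rw [h1, h2]
    simp only [RCLike.inner_apply, conj_ofReal]; ring
  have h2 : ‖H‖ ^ 2 = ρ ^ 2 := by
    have h3 : inner ℂ H H = ((ρ ^ 2 : ℝ) : ℂ) := by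
      rw [L2.inner_def]
      have : ∀ᵐ x ∂κ, inner ℂ (H x) (H x) = ((ρ ^ 2 : ℝ) : ℂ) := by
        filter_upwards [hHe] with x hx
        rw [inner_self_eq_norm_sq_to_K, hx, norm_mul, he.norm_eq_one, mul_one, norm_real,
          Real.norm_eq_abs, abs_of_pos hρ]
        push_cast; rfl
      rw [integral_congr_ae this]; simp
    rw [inner_self_eq_norm_sq_to_K] at h3
    exact ofReal_injective (by push_cast; push_cast at h3; exact h3)
  rw [h1] at hGH
  have h4 := congrArg norm hGH
  rw [norm_mul, norm_real, norm_real, Real.norm_eq_abs, Real.norm_eq_abs, abs_of_pos hρ,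
    abs_of_nonneg (by positivity), h2, sq, mul_right_inj' hρ.ne'] at h4
  rw [h4, h2]

theorem autocorr_shift (hT : MeasurePreserving shift κ κ) (g : SymbolSpace → ℝ) (m m' : ℤ) :
    ∫ x, g (shiftBy m x) * g (shiftBy m' x) ∂κ = autocorr κ g (m' - m) := by
  rw [autocorr, ← integral_comp_shiftBy hT m fun x => g x * g (shiftBy (m' - m) x)]
  simp only [shiftBy_shiftBy, sub_add_cancel]

theorem integral_normSq_sum_eq (hT : MeasurePreserving shift κ κ) {g : SymbolSpace → ℝ}
    (hg : Measurable g) (hg1 : ∀ x, |g x| ≤ 1) (L : ℕ) (w : ℕ → ℂ) :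
    ((∫ x, ‖∑ m ∈ range L, w m * (g (shiftBy m x) : ℂ)‖ ^ 2 ∂κ : ℝ) : ℂ) =
      ∑ m ∈ range L, ∑ m' ∈ range L,
        (autocorr κ g (m' - m) : ℂ) * (w m * conj (w m')) := by
  have hInt : ∀ m m' : ℕ, Integrable (fun x => (w m * conj (w m')) *
      ((g (shiftBy m x) * g (shiftBy m' x) : ℝ) : ℂ)) κ := fun m m' => by
    refine Integrable.const_mul (Integrable.ofReal ?_) _
    exact Integrable.of_bound ((hg.comp (measurable_shiftBy _)).mul
      (hg.comp (measurable_shiftBy _))).aestronglyMeasurable 1 (ae_of_all _ fun x =>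
        (abs_mul _ _).trans_le (mul_le_one₀ (hg1 _) (abs_nonneg _) (hg1 _)))
  rw [← integral_complex_ofReal]
  have h1 : ∀ x, ((‖∑ m ∈ range L, w m * (g (shiftBy m x) : ℂ)‖ ^ 2 : ℝ) : ℂ) =
      ∑ m ∈ range L, ∑ m' ∈ range L, (w m * conj (w m')) *
      ((g (shiftBy m x) * g (shiftBy m' x) : ℝ) : ℂ) := fun x => by
    rw [← normSq_eq_norm_sq, ← mul_conj, map_sum, sum_mul_sum]
    refine sum_congr rfl fun m _ => sum_congr rfl fun m' _ => ?_
    rw [map_mul, conj_ofReal]; push_cast; ring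
  simp only [h1]; rw [integral_finsetSum _ fun m _ => integrable_finsetSum _ fun m' _ => hInt m m']
  refine sum_congr rfl fun m _ => ?_
  rw [integral_finsetSum _ fun m' _ => hInt m m']
  refine sum_congr rfl fun m' _ => ?_
  rw [integral_const_mul, integral_complex_ofReal, autocorr_shift hT]; ring

theorem abs_autocorr_le (hT : MeasurePreserving shift κ κ) {g : SymbolSpace → ℝ}
    (hg : Measurable g) (hg1 : ∀ x, |g x| ≤ 1) (n : ℤ) : |autocorr κ g n| ≤ autocorr κ g 0 := by
  have hi : ∀ a b : ℤ, Integrable (fun x => g (shiftBy a x) * g (shiftBy b x)) κ := fun a b =>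
    Integrable.of_bound ((hg.comp (measurable_shiftBy _)).mul
      (hg.comp (measurable_shiftBy _))).aestronglyMeasurable 1 (ae_of_all _ fun x => by
        rw [Real.norm_eq_abs, abs_mul]
        exact mul_le_one₀ (hg1 _) (abs_nonneg _) (hg1 _))
  have h0 : autocorr κ g n = ∫ x, g (shiftBy 0 x) * g (shiftBy n x) ∂κ := by rw [autocorr_shift hT, sub_zero]
  have e1 : autocorr κ g 0 = ∫ x, g (shiftBy 0 x) * g (shiftBy 0 x) ∂κ := by rw [autocorr_shift hT, sub_zero]
  have e2 : autocorr κ g 0 = ∫ x, g (shiftBy n x) * g (shiftBy n x) ∂κ := by rw [autocorr_shift hT, sub_self]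
  have key : ∀ s : ℝ, s ^ 2 = 1 → s * autocorr κ g n ≤ autocorr κ g 0 := fun s hs => by
    have h3 : 0 ≤ ∫ x, (g (shiftBy 0 x) - s * g (shiftBy n x)) ^ 2 ∂κ :=
      integral_nonneg fun x => sq_nonneg _
    have h4 : ∀ x, (g (shiftBy 0 x) - s * g (shiftBy n x)) ^ 2 = g (shiftBy 0 x) * g (shiftBy 0 x) +
        g (shiftBy n x) * g (shiftBy n x) - (2 * s) * (g (shiftBy 0 x) * g (shiftBy n x)) := fun x => by
      linear_combination (g (shiftBy n x)) ^ 2 * hs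
    simp only [h4] at h3
    rw [integral_sub (by exact (hi 0 0).add (hi n n)) ((hi 0 n).const_mul _), integral_add (hi 0 0) (hi n n),
      integral_const_mul, ← e1, ← e2, ← h0] at h3
    linarith
  have k1 := key 1 (by norm_num)
  have k2 := key (-1) (by norm_num)
  rw [abs_le]
  constructor <;> linarith

/-- The normalised autocorrelations are the Fourier coefficients of a probability measure. -/
theorem exists_spectral_measure_autocorr (hT : MeasurePreserving shift κ κ) {g : SymbolSpace → ℝ}
    (hg : Measurable g) (hg1 : ∀ x, |g x| ≤ 1) (hpos : 0 < autocorr κ g 0) :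
    ∃ σ : Measure UnitAddCircle, IsProbabilityMeasure σ ∧
      ∀ n : ℤ, ∫ θ, fourier n θ ∂σ = (autocorr κ g n : ℂ) / (autocorr κ g 0 : ℂ) := by
  have hAc : (autocorr κ g 0 : ℂ) ≠ 0 := by exact_mod_cast hpos.ne'
  exact exists_spectral_measure (a := fun n => (autocorr κ g n : ℂ) / autocorr κ g 0)
    (r := fun L θ => (autocorr κ g 0)⁻¹ * ∫ x, ‖∑ m ∈ range L, (fourier (m : ℤ) θ : ℂ) *
      (g (shiftBy m x) : ℂ)‖ ^ 2 ∂κ) (div_self hAc)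
    (fun L θ => mul_nonneg (inv_nonneg.2 hpos.le) (integral_nonneg fun x => sq_nonneg _))
    (fun L θ => by
      rw [ofReal_mul, integral_normSq_sum_eq hT hg hg1, mul_sum]
      refine sum_congr rfl fun m _ => ?_
      rw [mul_sum]
      refine sum_congr rfl fun m' _ => ?_
      rw [← fourier_neg, ← fourier_add, ← sub_eq_add_neg, ofReal_inv]
      ring)

/-- If all eigenfunctions with eigenvalue outside a finite set correlate little with `g`, then the
mean square of the autocorrelations of `g` is controlled by the remaining eigenfunctions. -/
theorem eventually_mean_sq_autocorr_le (hErg : Ergodic shift κ) {g : SymbolSpace → ℝ}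
    (hg : Measurable g) (hg1 : ∀ x, |g x| ≤ 1) (F : Finset ℂ) {δ : ℝ} (hδ0 : 0 ≤ δ)
    (hδ : ∀ c ∉ F, ∀ e, IsEigenfunction κ e c → ‖∫ x, (g x : ℂ) * e x ∂κ‖ ^ 2 ≤ δ)
    {s : ℂ → ℝ} (hs0 : ∀ c, 0 ≤ s c)
    (hs : ∀ c ∈ F, ∀ e, IsEigenfunction κ e c → ‖∫ x, (g x : ℂ) * e x ∂κ‖ ^ 2 ≤ s c)
    {ε : ℝ} (hε : 0 < ε) :
    ∀ᶠ L : ℕ in atTop, ((L : ℝ)⁻¹ * (L : ℝ)⁻¹) * ∑ m ∈ range L, ∑ m' ∈ range L,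
      autocorr κ g (m' - m) ^ 2 ≤ ∑ c ∈ F, s c + δ + ε := by
  have hT := hErg.toMeasurePreserving
  have habs := abs_autocorr_le hT hg hg1
  have hsum0 : 0 ≤ ∑ c ∈ F, s c := sum_nonneg fun c _ => hs0 c
  set A := autocorr κ g 0 with hA
  have hA0 : 0 ≤ A := (abs_nonneg _).trans (habs 0)
  have hA1 : A ≤ 1 := by
    rw [hA, autocorr]
    refine (le_abs_self _).trans ?_
    have := norm_integral_le_of_norm_le_const (μ := κ) (f := fun x => g x * g (shiftBy 0 x)) (C := 1)
      (ae_of_all _ fun x => by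
        rw [Real.norm_eq_abs, abs_mul]; exact mul_le_one₀ (hg1 _) (abs_nonneg _) (hg1 _))
    simpa using this
  rcases hA0.eq_or_lt with h0 | hpos
  · refine Eventually.of_forall fun L => ?_
    have : ∀ n, autocorr κ g n = 0 := fun n => abs_eq_zero.1 (le_antisymm (h0 ▸ habs n) (abs_nonneg _))
    simp only [this]
    simp only [ne_eq, OfNat.ofNat_ne_zero, not_false_eq_true, zero_pow, sum_const_zero, mul_zero]; positivity
  have hAc : (A : ℂ) ≠ 0 := by exact_mod_cast hpos.ne'
  obtain ⟨σ, hσ, ha⟩ := exists_spectral_measure_autocorr hT hg hg1 hpos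
  simp only [← hA] at ha
  have hatom : ∀ θ, σ.real {θ} = 0 ∨ ∃ e, IsEigenfunction κ e (fourier 1 θ : ℂ) ∧
      ‖∫ x, (g x : ℂ) * e x ∂κ‖ ^ 2 = A * σ.real {θ} := fun θ => by
    obtain ⟨ρ, h1, h2⟩ := exists_eigenfunction_of_average hErg hg hg1 (norm_fourier_apply 1 θ)
    have h3 := (tendsto_average_atom ha θ).const_mul (A : ℂ)
    have h4 : (A : ℂ) * (σ.real {θ} : ℂ) = ρ := by
      refine tendsto_nhds_unique (h3.congr fun L => ?_) h1
      rw [mul_left_comm, mul_sum]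
      congr 1
      refine sum_congr rfl fun m _ => ?_
      rw [fourier_natCast_eq_pow]; field_simp
    have h5 : A * σ.real {θ} = ρ := by exact_mod_cast h4
    rcases h2 with h2 | ⟨e, he, h2⟩
    · left
      rw [h2] at h5; exact (mul_eq_zero.1 h5).resolve_left hpos.ne'
    · exact Or.inr ⟨e, he, by rw [h2, h5]⟩
  have hinj : Function.Injective fun θ : UnitAddCircle => (fourier 1 θ : ℂ) := fun θ φ h => by
    simp only [fourier_one] at h; exact AddCircle.injective_toCircle one_ne_zero (Circle.coe_injective h)
  set F' := F.preimage _ hinj.injOn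
  have hev := eventually_mean_sq_le ha F' (δ := δ / A) (by positivity) (fun θ hθ => by
    rcases hatom θ with h | ⟨e, he, h⟩
    · rw [h]; positivity
    · rw [le_div_iff₀ hpos, mul_comm, ← h]
      exact hδ _ (fun hc => hθ (mem_preimage.2 hc)) e he) hε
  have hsum : A * ∑ θ ∈ F', σ.real {θ} ≤ ∑ c ∈ F, s c := by
    rw [mul_sum]
    calc _ ≤ ∑ θ ∈ F', s (fourier 1 θ) := sum_le_sum fun θ hθ => by
          rcases hatom θ with h | ⟨e, he, h⟩
          · rw [h, mul_zero]; exact hs0 _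
          · rw [← h]; exact hs _ (mem_preimage.1 hθ) e he
      _ = ∑ c ∈ F'.image (fun θ => (fourier 1 θ : ℂ)), s c := (sum_image hinj.injOn).symm
      _ ≤ _ := sum_le_sum_of_subset_of_nonneg
          (image_subset_iff.2 fun θ hθ => mem_preimage.1 hθ) fun c _ _ => hs0 c
  filter_upwards [hev] with L hL
  have h6 : ∀ n : ℤ, autocorr κ g n ^ 2 = A ^ 2 * ‖(autocorr κ g n : ℂ) / A‖ ^ 2 := fun n => by
    rw [norm_div, norm_real, norm_real, Real.norm_eq_abs, Real.norm_eq_abs,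
      abs_of_pos hpos, div_pow, sq_abs]
    field_simp
  simp only [h6, ← mul_sum]; rw [mul_left_comm]
  refine (mul_le_mul_of_nonneg_left hL (sq_nonneg A)).trans ?_
  have h7 : A ^ 2 * (∑ θ ∈ F', σ.real {θ} + δ / A + ε) =
      A * (A * ∑ θ ∈ F', σ.real {θ}) + A * δ + A ^ 2 * ε := by field_simp
  rw [h7]
  have h8 : A ^ 2 ≤ 1 := pow_le_one₀ hA0 hA1
  have h9 : A * (A * ∑ θ ∈ F', σ.real {θ}) ≤ 1 * ∑ c ∈ F, s c :=
    mul_le_mul hA1 hsum (mul_nonneg hA0 (sum_nonneg fun _ _ => measureReal_nonneg)) zero_le_one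
  nlinarith

end MeanErgodic

section CubeAverages

open Complex

theorem fourierAverage_mul (k L : ℕ) (τ : UnitAddCircle) :
    fourierAverage (k * L) τ = fourierAverage k (L • τ) * fourierAverage L τ := by
  have h1 : ∑ m ∈ range (k * L), (fourier (m : ℤ) τ : ℂ) =
      (∑ i ∈ range k, (fourier (i : ℤ) (L • τ) : ℂ)) *
        ∑ m ∈ range L, (fourier (m : ℤ) τ : ℂ) := by
    induction k with
    | zero => simp
    | succ k ih =>
      rw [add_mul, one_mul, sum_range_add, ih, sum_range_succ, add_mul]
      congr 1
      rw [mul_sum]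
      refine sum_congr rfl fun m _ => ?_
      have h2 : (fourier (k : ℤ) (L • τ) : ℂ) = fourier ((k * L : ℕ) : ℤ) τ := by
        rw [fourier_apply, fourier_apply]
        congr 2
        rw [← natCast_zsmul τ L, smul_smul]; push_cast; rfl
      rw [h2, ← fourier_add]; push_cast; rfl
  rw [fourierAverage, fourierAverage, fourierAverage, h1]; push_cast; rw [mul_inv]; ring

theorem norm_fourierAverage_mul_le (k L : ℕ) (τ : UnitAddCircle) :
    ‖fourierAverage (k * L) τ‖ ≤ ‖fourierAverage L τ‖ := by
  rw [fourierAverage_mul, norm_mul]; exact mul_le_of_le_one_left (norm_nonneg _) (norm_fourierAverage_le _ _)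

theorem mean_norm_sq_mul_le {σ : Measure UnitAddCircle} [IsProbabilityMeasure σ] {a : ℤ → ℂ}
    (ha : ∀ n : ℤ, ∫ θ, fourier n θ ∂σ = a n) (k L : ℕ) :
    ((((k * L : ℕ) : ℝ))⁻¹ * ((k * L : ℕ) : ℝ)⁻¹) * ∑ m ∈ range (k * L),
      ∑ m' ∈ range (k * L), ‖a (m' - m)‖ ^ 2 ≤
    ((L : ℝ)⁻¹ * (L : ℝ)⁻¹) * ∑ m ∈ range L, ∑ m' ∈ range L, ‖a (m' - m)‖ ^ 2 := by
  have key : ∀ L : ℕ, ((L : ℝ)⁻¹ * (L : ℝ)⁻¹) * ∑ m ∈ range L, ∑ m' ∈ range L,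
      ‖a (m' - m)‖ ^ 2 = ∫ z : UnitAddCircle × UnitAddCircle,
        ‖fourierAverage L (z.1 - z.2)‖ ^ 2 ∂(σ.prod σ) := fun L => by
    have h := sum_norm_sq_eq_integral ha L
    have h2 : ∀ z : UnitAddCircle × UnitAddCircle, fourierAverage L (z.1 - z.2) *
        (starRingEnd ℂ) (fourierAverage L (z.1 - z.2)) =
        ((‖fourierAverage L (z.1 - z.2)‖ ^ 2 : ℝ) : ℂ) := fun z => by
      rw [mul_conj, normSq_eq_norm_sq]
    simp only [h2] at h
    rw [integral_complex_ofReal] at h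
    apply ofReal_injective
    rw [← h]; push_cast; rfl
  have hInt : ∀ L : ℕ, Integrable (fun z : UnitAddCircle × UnitAddCircle =>
      ‖fourierAverage L (z.1 - z.2)‖ ^ 2) (σ.prod σ) := fun L =>
    (((continuous_fourierAverage L).comp (continuous_fst.sub continuous_snd)).norm.pow
      2).integrable_of_hasCompactSupport (HasCompactSupport.of_compactSpace _)
  rw [key, key]; exact integral_mono (hInt _) (hInt _) fun z =>
    pow_le_pow_left₀ (norm_nonneg _) (norm_fourierAverage_mul_le _ _ _) 2

variable {κ : Measure SymbolSpace} [IsProbabilityMeasure κ]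

theorem mean_sq_autocorr_mul_le (hT : MeasurePreserving shift κ κ) {g : SymbolSpace → ℝ}
    (hg : Measurable g) (hg1 : ∀ x, |g x| ≤ 1) (k L : ℕ) :
    ((((k * L : ℕ) : ℝ))⁻¹ * ((k * L : ℕ) : ℝ)⁻¹) * ∑ m ∈ range (k * L),
      ∑ m' ∈ range (k * L), autocorr κ g (m' - m) ^ 2 ≤
    ((L : ℝ)⁻¹ * (L : ℝ)⁻¹) * ∑ m ∈ range L, ∑ m' ∈ range L,
      autocorr κ g (m' - m) ^ 2 := by
  have habs := abs_autocorr_le hT hg hg1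
  rcases ((abs_nonneg _).trans (habs 0)).eq_or_lt with h0 | hpos
  · have : ∀ n, autocorr κ g n = 0 := fun n => abs_eq_zero.1 (le_antisymm (h0 ▸ habs n) (abs_nonneg _))
    simp [this]
  obtain ⟨σ, hσ, ha⟩ := exists_spectral_measure_autocorr hT hg hg1 hpos
  have h := mean_norm_sq_mul_le ha k L
  have h6 : ∀ n : ℤ, autocorr κ g n ^ 2 = autocorr κ g 0 ^ 2 *
      ‖(autocorr κ g n : ℂ) / (autocorr κ g 0 : ℂ)‖ ^ 2 := fun n => by
    rw [norm_div, norm_real, norm_real, Real.norm_eq_abs, Real.norm_eq_abs,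
      abs_of_pos hpos, div_pow, sq_abs]
    field_simp
  simp only [h6 (_ - _), ← mul_sum]; rw [mul_left_comm, mul_left_comm ((L : ℝ)⁻¹ * (L : ℝ)⁻¹)]
  exact mul_le_mul_of_nonneg_left h (sq_nonneg _)

/-- The multiplicative derivative of `g` in direction `j`. -/
def mulDeriv (j : ℤ) (g : SymbolSpace → ℝ) : SymbolSpace → ℝ := fun x => g x * g (shiftBy j x)

/-- Averages of a functional over iterated multiplicative derivatives with Fejér weights. -/
noncomputable def cubeAvg (Φ : (SymbolSpace → ℝ) → ℝ) : List ℕ → (SymbolSpace → ℝ) → ℝ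
  | [], g => Φ g
  | L :: Ls, g => ((L : ℝ)⁻¹ * (L : ℝ)⁻¹) * ∑ m ∈ range L, ∑ m' ∈ range L,
      cubeAvg Φ Ls (mulDeriv (m' - m) g)

theorem cubeAvg_append (Φ : (SymbolSpace → ℝ) → ℝ) (Ls Ls' : List ℕ) (g : SymbolSpace → ℝ) :
    cubeAvg Φ (Ls ++ Ls') g = cubeAvg (cubeAvg Φ Ls') Ls g := by
  induction Ls generalizing g with
  | nil => rfl
  | cons L Ls ih => simp only [List.cons_append, cubeAvg, ih]

theorem cubeAvg_mono {C : ℕ → (SymbolSpace → ℝ) → Prop} (hC : ∀ n j g, C n g → C (n + 1) (mulDeriv j g))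
    {Φ Ψ : (SymbolSpace → ℝ) → ℝ} (Ls : List ℕ) {n : ℕ}
    (h : ∀ g, C (n + Ls.length) g → Φ g ≤ Ψ g) {g : SymbolSpace → ℝ} (hg : C n g) :
    cubeAvg Φ Ls g ≤ cubeAvg Ψ Ls g := by
  induction Ls generalizing g n with
  | nil => exact h g hg
  | cons L Ls ih =>
    simp only [cubeAvg]
    refine mul_le_mul_of_nonneg_left (sum_le_sum fun m _ => sum_le_sum fun m' _ => ?_)
      (by positivity)
    refine ih (n := n + 1) (fun g hg => h g ?_) (hC _ _ _ hg)
    rwa [List.length_cons, add_comm Ls.length, ← add_assoc]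

theorem eventually_cubeAvg_le {C : ℕ → (SymbolSpace → ℝ) → Prop}
    (hC : ∀ n j g, C n g → C (n + 1) (mulDeriv j g))
    {Φ : ℕ → (SymbolSpace → ℝ) → ℝ} {Ψ : (SymbolSpace → ℝ) → ℝ} (Ls : List ℕ) {n : ℕ}
    (h : ∀ g, C (n + Ls.length) g → ∀ᶠ L in atTop, Φ L g ≤ Ψ g) {g : SymbolSpace → ℝ} (hg : C n g) :
    ∀ᶠ L in atTop, cubeAvg (Φ L) Ls g ≤ cubeAvg Ψ Ls g := by
  induction Ls generalizing g n with
  | nil => exact h g hg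
  | cons L₀ Ls ih =>
    have h1 : ∀ᶠ L in atTop, ∀ m ∈ range L₀, ∀ m' ∈ range L₀,
        cubeAvg (Φ L) Ls (mulDeriv ((m' : ℤ) - m) g) ≤ cubeAvg Ψ Ls (mulDeriv ((m' : ℤ) - m) g) := by
      rw [Filter.eventually_all_finset]
      intro m _
      rw [Filter.eventually_all_finset]
      intro m' _
      refine ih (n := n + 1) (fun g hg => h g ?_) (hC _ _ _ hg)
      rwa [List.length_cons, add_comm Ls.length, ← add_assoc]
    filter_upwards [h1] with L hL
    simp only [cubeAvg]
    exact mul_le_mul_of_nonneg_left (sum_le_sum fun m hm => sum_le_sum fun m' hm' =>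
      hL m hm m' hm') (by positivity)

theorem cubeAvg_sum_add_const {ι : Type*} (F : Finset ι) (Φ : ι → (SymbolSpace → ℝ) → ℝ) (b : ℝ)
    {Ls : List ℕ} (hL : ∀ L ∈ Ls, 0 < L) (g : SymbolSpace → ℝ) :
    cubeAvg (fun g => ∑ i ∈ F, Φ i g + b) Ls g = ∑ i ∈ F, cubeAvg (Φ i) Ls g + b := by
  induction Ls generalizing g with
  | nil => rfl
  | cons L Ls ih =>
    have hL0 : (L : ℝ) ≠ 0 := by exact_mod_cast (hL L (by simp)).ne'
    simp only [cubeAvg]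
    simp only [ih fun L' h' => hL L' (List.mem_cons_of_mem _ h'), sum_add_distrib,
      sum_const, card_range, nsmul_eq_mul, mul_add]
    congr 1
    · rw [← mul_sum, sum_comm]
      conv_rhs => rw [sum_comm]
      congr 1
      rw [sum_comm]
      refine sum_congr rfl fun m _ => ?_
      rw [sum_comm]
    · field_simp

theorem mulDeriv_comm (i j : ℤ) (g : SymbolSpace → ℝ) :
    mulDeriv i (mulDeriv j g) = mulDeriv j (mulDeriv i g) := by
  funext x
  simp only [mulDeriv, shiftBy_shiftBy, add_comm i j]; ring

theorem cubeAvg_swap (Φ : (SymbolSpace → ℝ) → ℝ) (L L' : ℕ) (Ls : List ℕ) (g : SymbolSpace → ℝ) :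
    cubeAvg Φ (L :: L' :: Ls) g = cubeAvg Φ (L' :: L :: Ls) g := by
  simp only [cubeAvg, ← mul_sum]; rw [mul_left_comm]
  congr 2
  have e1 : ∀ (a b : ℕ) (ψ : ℕ → ℕ → ℕ → ℕ → ℝ), ∑ m ∈ range a, ∑ m' ∈ range a,
      ∑ n ∈ range b, ∑ n' ∈ range b, ψ m m' n n' =
      ∑ n ∈ range b, ∑ n' ∈ range b, ∑ m ∈ range a, ∑ m' ∈ range a,
        ψ m m' n n' := by
    intro a b ψ
    exact (sum_congr rfl fun m _ => sum_comm).trans <| sum_comm.trans <|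
      sum_congr rfl fun n _ => (sum_congr rfl fun m _ => sum_comm).trans
        sum_comm
  rw [e1]
  simp only [mulDeriv_comm]

/-- The Gowers-type averages of squared integrals of iterated derivatives. -/
noncomputable def gowersAvg (κ : Measure SymbolSpace) (Ls : List ℕ) (g : SymbolSpace → ℝ) : ℝ :=
  cubeAvg (fun g => (∫ x, g x ∂κ) ^ 2) Ls g

theorem measurable_mulDeriv {g : SymbolSpace → ℝ} (hg : Measurable g) (j : ℤ) :
    Measurable (mulDeriv j g) := hg.mul (hg.comp (measurable_shiftBy j))

theorem abs_mulDeriv_le {g : SymbolSpace → ℝ} (hg : ∀ x, |g x| ≤ 1) (j : ℤ) (x : SymbolSpace) :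
    |mulDeriv j g x| ≤ 1 := by
  rw [mulDeriv, abs_mul]; exact mul_le_one₀ (hg _) (abs_nonneg _) (hg _)

theorem gowersAvg_nonneg (Ls : List ℕ) (g : SymbolSpace → ℝ) : 0 ≤ gowersAvg κ Ls g := by
  induction Ls generalizing g with
  | nil => exact sq_nonneg _
  | cons L Ls ih =>
    exact mul_nonneg (by positivity) (sum_nonneg fun m _ => sum_nonneg fun m' _ => ih _)

theorem gowersAvg_mul_cons_le (hT : MeasurePreserving shift κ κ) (k L : ℕ) (Ls : List ℕ)
    {g : SymbolSpace → ℝ} (hg : Measurable g) (hg1 : ∀ x, |g x| ≤ 1) :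
    gowersAvg κ (k * L :: Ls) g ≤ gowersAvg κ (L :: Ls) g := by
  induction Ls generalizing g with
  | nil => exact mean_sq_autocorr_mul_le hT hg hg1 k L
  | cons L' Ls ih =>
    rw [gowersAvg, cubeAvg_swap, gowersAvg, cubeAvg_swap _ L]
    exact mul_le_mul_of_nonneg_left (sum_le_sum fun m _ => sum_le_sum fun m' _ =>
      ih (measurable_mulDeriv hg _) (abs_mulDeriv_le hg1 _)) (by positivity)

end CubeAverages

section Uniformity

open Complex ComplexConjugate

variable {κ : Measure SymbolSpace} [IsProbabilityMeasure κ] {e : SymbolSpace → ℂ} {c : ℂ}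

theorem norm_integral_mulDeriv_mul (hT : MeasurePreserving shift κ κ) (he : IsEigenfunction κ e c) (g : SymbolSpace → ℝ) (m m' : ℤ) :
    ‖∫ x, (mulDeriv (m' - m) g x : ℂ) * e x ∂κ‖ =
      ‖∫ x, ((g (shiftBy m x) * g (shiftBy m' x) : ℝ) : ℂ) * e x ∂κ‖ := by
  rw [← integral_comp_shiftBy hT m fun x => (mulDeriv (m' - m) g x : ℂ) * e x]
  have h : ∀ᵐ x ∂κ, (mulDeriv (m' - m) g (shiftBy m x) : ℂ) * e (shiftBy m x) =
      c ^ m * (((g (shiftBy m x) * g (shiftBy m' x) : ℝ) : ℂ) * e x) := by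
    filter_upwards [he.shiftBy_eq hT m] with x hx
    rw [hx, mulDeriv, shiftBy_shiftBy, sub_add_cancel]; ring
  rw [integral_congr_ae h, integral_const_mul, norm_mul, norm_zpow, he.norm_eigenvalue, one_zpow,
    one_mul]

/-- Weighting by an eigenfunction does not increase the mean square of the autocorrelations. -/
theorem mean_sq_integral_mulDeriv_mul_le (hT : MeasurePreserving shift κ κ) (he : IsEigenfunction κ e c) {g : SymbolSpace → ℝ} (hg : Measurable g)
    (hg1 : ∀ x, |g x| ≤ 1) (L : ℕ) :
    ∑ m ∈ range L, ∑ m' ∈ range L,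
      ‖∫ x, (mulDeriv ((m' : ℤ) - m) g x : ℂ) * e x ∂κ‖ ^ 2 ≤
    ∑ m ∈ range L, ∑ m' ∈ range L, autocorr κ g (m' - m) ^ 2 := by
  simp only [norm_integral_mulDeriv_mul hT he]
  simp only [← autocorr_shift hT g]
  set φ : ℕ → ℕ → SymbolSpace → ℝ := fun m m' x => g (shiftBy m x) * g (shiftBy m' x) with hφ
  have hφm : ∀ m m', Measurable (φ m m') := fun m m' =>
    (hg.comp (measurable_shiftBy _)).mul (hg.comp (measurable_shiftBy _))
  have hφ1 : ∀ m m' x, |φ m m' x| ≤ 1 := fun m m' x => by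
    rw [hφ, abs_mul]; exact mul_le_one₀ (hg1 _) (abs_nonneg _) (hg1 _)
  set B : SymbolSpace × SymbolSpace → ℝ := fun z =>
    ∑ m ∈ range L, g (shiftBy m z.1) * g (shiftBy m z.2) with hB
  have hB2 : ∀ z, B z ^ 2 = ∑ m ∈ range L, ∑ m' ∈ range L, φ m m' z.1 * φ m m' z.2 := fun z => by
    rw [sq, hB, sum_mul_sum]
    exact sum_congr rfl fun m _ => sum_congr rfl fun m' _ => by simp only [hφ]; ring
  have hi1 : ∀ m m', Integrable (fun z : SymbolSpace × SymbolSpace => φ m m' z.1 * φ m m' z.2)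
      (κ.prod κ) := fun m m' =>
    Integrable.of_bound (((hφm m m').comp measurable_fst).mul
      ((hφm m m').comp measurable_snd)).aestronglyMeasurable 1 (ae_of_all _ fun z =>
        (abs_mul _ _).trans_le (mul_le_one₀ (hφ1 _ _ _) (abs_nonneg _) (hφ1 _ _ _)))
  have hi2 : ∀ m m', Integrable (fun z : SymbolSpace × SymbolSpace => ((φ m m' z.1 : ℂ) * e z.1) *
      conj ((φ m m' z.2 : ℂ) * e z.2)) (κ.prod κ) := fun m m' => by
    have hm : Measurable fun x => (φ m m' x : ℂ) * e x :=
      (measurable_ofReal.comp (hφm m m')).mul he.measurable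
    have hn : ∀ x, ‖(φ m m' x : ℂ) * e x‖ ≤ 1 := fun x => by
      rw [norm_mul, he.norm_eq_one, mul_one, norm_real]; exact hφ1 _ _ _
    refine Integrable.of_bound ((hm.comp measurable_fst).mul
      (continuous_conj.measurable.comp (hm.comp measurable_snd))).aestronglyMeasurable 1
      (ae_of_all _ fun z => ?_)
    refine (norm_mul _ _).trans_le ?_
    rw [RCLike.norm_conj]; exact mul_le_one₀ (hn _) (norm_nonneg _) (hn _)
  have h1 : ∑ m ∈ range L, ∑ m' ∈ range L, (∫ x, φ m m' x ∂κ) ^ 2 =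
      ∫ z, B z ^ 2 ∂(κ.prod κ) := by
    simp only [hB2]; rw [integral_finsetSum _ fun m _ => integrable_finsetSum _ fun m' _ => hi1 m m']
    refine sum_congr rfl fun m _ => ?_
    rw [integral_finsetSum _ fun m' _ => hi1 m m']
    refine sum_congr rfl fun m' _ => ?_
    rw [integral_prod_mul, sq]
  have h2 : ((∑ m ∈ range L, ∑ m' ∈ range L, ‖∫ x, (φ m m' x : ℂ) * e x ∂κ‖ ^ 2 : ℝ) : ℂ)
      = ∫ z, ((B z ^ 2 : ℝ) : ℂ) * (e z.1 * conj (e z.2)) ∂(κ.prod κ) := by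
    have e1 : ∀ z : SymbolSpace × SymbolSpace, ((B z ^ 2 : ℝ) : ℂ) * (e z.1 * conj (e z.2)) =
        ∑ m ∈ range L, ∑ m' ∈ range L, ((φ m m' z.1 : ℂ) * e z.1) *
          conj ((φ m m' z.2 : ℂ) * e z.2) := fun z => by
      rw [hB2]; push_cast; rw [sum_mul]
      refine sum_congr rfl fun m _ => ?_
      rw [sum_mul]
      refine sum_congr rfl fun m' _ => ?_
      rw [map_mul, conj_ofReal]; ring
    simp only [e1]; push_cast; rw [integral_finsetSum _ fun m _ => integrable_finsetSum _ fun m' _ => hi2 m m']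
    refine sum_congr rfl fun m _ => ?_
    rw [integral_finsetSum _ fun m' _ => hi2 m m']
    refine sum_congr rfl fun m' _ => ?_
    rw [integral_prod_mul (fun x => (φ m m' x : ℂ) * e x)
      (fun x => conj ((φ m m' x : ℂ) * e x)), integral_conj, mul_conj,
      normSq_eq_norm_sq]
    push_cast; rfl
  have h3 : ∀ z : SymbolSpace × SymbolSpace, ‖((B z ^ 2 : ℝ) : ℂ) * (e z.1 * conj (e z.2))‖ =
      B z ^ 2 := fun z => by
    rw [norm_mul, norm_mul, RCLike.norm_conj, he.norm_eq_one, he.norm_eq_one, mul_one, mul_one,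
      norm_real, Real.norm_eq_abs, abs_of_nonneg (sq_nonneg _)]
  calc _ = ‖((∑ m ∈ range L, ∑ m' ∈ range L,
        ‖∫ x, (φ m m' x : ℂ) * e x ∂κ‖ ^ 2 : ℝ) : ℂ)‖ := by
        rw [norm_real, Real.norm_eq_abs, abs_of_nonneg (sum_nonneg fun _ _ =>
          sum_nonneg fun _ _ => sq_nonneg _)]
    _ ≤ ∫ z, ‖((B z ^ 2 : ℝ) : ℂ) * (e z.1 * conj (e z.2))‖ ∂(κ.prod κ) := by
        rw [h2]; exact norm_integral_le_integral_norm _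
    _ = _ := by simp only [h3]; rw [← h1]

open Classical in
/-- The squared correlation of `g` with the eigenfunction of eigenvalue `c`. -/
noncomputable def eigenCorr (κ : Measure SymbolSpace) (c : ℂ) (g : SymbolSpace → ℝ) : ℝ :=
  if h : ∃ e, IsEigenfunction κ e c then ‖∫ x, (g x : ℂ) * h.choose x ∂κ‖ ^ 2 else 0

theorem eigenCorr_nonneg (c : ℂ) (g : SymbolSpace → ℝ) : 0 ≤ eigenCorr κ c g := by
  rw [eigenCorr]; split_ifs <;> positivity

theorem eigenCorr_eq (hErg : Ergodic shift κ) (he : IsEigenfunction κ e c) (g : SymbolSpace → ℝ) :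
    ‖∫ x, (g x : ℂ) * e x ∂κ‖ ^ 2 = eigenCorr κ c g := by
  have h : ∃ e, IsEigenfunction κ e c := ⟨e, he⟩
  rw [eigenCorr, dif_pos h]
  obtain ⟨ζ, hζ, h1⟩ := he.unique hErg h.choose_spec
  have h2 : ∀ᵐ x ∂κ, (g x : ℂ) * e x = ζ * ((g x : ℂ) * h.choose x) := by
    filter_upwards [h1] with x hx
    rw [hx]; ring
  rw [integral_congr_ae h2, integral_const_mul, norm_mul, hζ, one_mul]

theorem cubeAvg_eigenCorr_le (hErg : Ergodic shift κ) (c : ℂ) {Ls : List ℕ} (hLs : Ls ≠ [])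
    {g : SymbolSpace → ℝ} (hg : Measurable g) (hg1 : ∀ x, |g x| ≤ 1) :
    cubeAvg (eigenCorr κ c) Ls g ≤ gowersAvg κ Ls g := by
  rw [← List.dropLast_append_getLast hLs, gowersAvg, cubeAvg_append, cubeAvg_append]
  refine cubeAvg_mono (C := fun _ g => Measurable g ∧ ∀ x, |g x| ≤ 1)
    (fun n j g h => ⟨measurable_mulDeriv h.1 j, abs_mulDeriv_le h.2 j⟩) (n := 0) _
    (fun h hh => ?_) ⟨hg, hg1⟩
  simp only [cubeAvg]
  refine mul_le_mul_of_nonneg_left ?_ (by positivity)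
  by_cases hc : ∃ e, IsEigenfunction κ e c
  · obtain ⟨e, he⟩ := hc
    simp only [← eigenCorr_eq hErg he]
    exact mean_sq_integral_mulDeriv_mul_le hErg.toMeasurePreserving he hh.1 hh.2 _
  · refine sum_le_sum fun m _ => sum_le_sum fun m' _ => ?_
    rw [eigenCorr, dif_neg hc]; exact sq_nonneg _

theorem mulDeriv_pat (j : ℤ) (l : List ℤ) : mulDeriv j (pat l) = pat (l ++ l.map (· + j)) := by
  funext x
  rw [mulDeriv, pat_append, pat_shiftBy]

theorem coord_eq_pat : coord = pat [0] := by funext x; simp [pat, shiftBy_zero]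

open Classical in
theorem finite_roots_of_unity_lt (M : ℕ) : {c : ℂ | ∃ m : ℕ, 0 < m ∧ m < M ∧ c ^ m = 1}.Finite := by
  refine Set.Finite.subset (finite_toSet ((range M).biUnion fun m =>
    (Polynomial.nthRoots m (1 : ℂ)).toFinset)) ?_
  rintro c ⟨m, hm0, hm, hc⟩
  simp only [coe_biUnion, Set.mem_iUnion, mem_coe, mem_range]
  exact ⟨m, hm, by rw [Multiset.mem_toFinset, Polynomial.mem_nthRoots hm0]; exact hc⟩

/-- If eigenfunctions of large order correlate little with patterns, then the coordinate function
has arbitrarily small Gowers averages. -/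
theorem DilationSystem.exists_gowersAvg_coord_le (D : DilationSystem κ) (hErg : Ergodic shift κ)
    (hcorr : ∀ (n : ℕ) (δ : ℝ), 0 < δ → ∃ M : ℕ, ∀ l : List ℤ, l.length = n → ∀ e c,
      IsEigenfunction κ e c → (∀ m : ℕ, 0 < m → m < M → c ^ m ≠ 1) →
        ‖∫ x, (pat l x : ℂ) * e x ∂κ‖ ^ 2 ≤ δ) (s : ℕ) {ε : ℝ} (hε : 0 < ε) :
    ∃ Ls : List ℕ, Ls.length = s + 1 ∧ (∀ L ∈ Ls, 0 < L) ∧ gowersAvg κ Ls coord ≤ ε := by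
  induction s generalizing ε with
  | zero =>
    have h := eventually_mean_sq_autocorr_le hErg measurable_coord abs_coord_le ∅ le_rfl
      (fun c _ e he => ?_) (s := fun _ => 0) (fun _ => le_rfl) (by simp) hε
    · obtain ⟨L, h1, h2⟩ := (h.and (eventually_gt_atTop 0)).exists
      refine ⟨[L], rfl, by simpa using h2, ?_⟩
      simpa [gowersAvg, cubeAvg, autocorr, mulDeriv] using h1
    · have : ∫ x, (coord x : ℂ) * e x ∂κ = 0 := by
        by_cases hc : ∃ n : ℕ, 0 < n ∧ c ^ n = 1
        · obtain ⟨n, hn, hc⟩ := hc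
          exact D.integral_coord_mul_eigenfunction_eq_zero hErg he hn hc
        · push Not at hc
          simpa [coord_eq_pat] using D.integral_pat_mul_eq_zero_of_infinite_order hErg he hc [0]
      rw [this]; simp
  | succ s ih =>
    obtain ⟨M, hM⟩ := hcorr (2 ^ (s + 1)) (ε / 3) (by positivity)
    set F := (finite_roots_of_unity_lt M).toFinset with hF
    obtain ⟨Ls, hlen, hpos, hle⟩ := ih (ε := ε / (3 * (F.card + 1))) (by positivity)
    have hev : ∀ᶠ L : ℕ in atTop, cubeAvg (cubeAvg (fun g => (∫ x, g x ∂κ) ^ 2) [L]) Ls coord ≤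
        cubeAvg (fun g => ∑ c ∈ F, eigenCorr κ c g + (ε / 3 + ε / 3)) Ls coord := by
      refine eventually_cubeAvg_le (C := fun n g => ∃ l : List ℤ, l.length = 2 ^ n ∧ g = pat l)
        (fun n j g ⟨l, h1, h2⟩ => ⟨l ++ l.map (· + j), ?_, h2 ▸ mulDeriv_pat j l⟩)
        (Φ := fun L => cubeAvg (fun g => (∫ x, g x ∂κ) ^ 2) [L]) (n := 0) _ (fun g hg => ?_)
        ⟨[0], rfl, coord_eq_pat⟩
      · rw [List.length_append, List.length_map, h1, pow_succ]; ring
      · obtain ⟨l, h1, rfl⟩ := hg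
        rw [zero_add, hlen] at h1
        have h := eventually_mean_sq_autocorr_le hErg (measurable_pat l) (abs_pat_le l) F
          (δ := ε / 3) (by positivity) (fun c hc e he => hM l h1 e c he fun m h1 h2 h3 => hc <| by
            rw [hF, Set.Finite.mem_toFinset]; exact ⟨m, h1, h2, h3⟩)
          (s := fun c => eigenCorr κ c (pat l)) (fun c => eigenCorr_nonneg c _)
          (fun c _ e he => (eigenCorr_eq hErg he _).le) (ε := ε / 3) (by positivity)
        filter_upwards [h] with L hL
        rw [← add_assoc]; exact hL
    obtain ⟨L, h1, h2⟩ := (hev.and (eventually_gt_atTop 0)).exists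
    refine ⟨Ls ++ [L], by simp [hlen], fun L' hL' => ?_, ?_⟩
    · rcases List.mem_append.1 hL' with h | h
      · exact hpos _ h
      · rw [List.mem_singleton.1 h]; exact h2
    · rw [gowersAvg, cubeAvg_append]
      refine h1.trans ?_
      rw [cubeAvg_sum_add_const _ _ _ hpos]
      have h3 : ∑ c ∈ F, cubeAvg (eigenCorr κ c) Ls coord ≤ ∑ c ∈ F, ε / (3 * (F.card + 1)) :=
        sum_le_sum fun c _ => (cubeAvg_eigenCorr_le hErg c
          (fun h => by simp [h] at hlen) measurable_coord abs_coord_le).trans hle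
      rw [sum_const, nsmul_eq_mul] at h3
      have h4 : (F.card : ℝ) * (ε / (3 * (F.card + 1))) ≤ ε / 3 := by
        rw [mul_div_assoc', div_le_div_iff₀ (by positivity) (by norm_num)]; nlinarith
      linarith

end Uniformity

section VanDerCorput

open Complex ComplexConjugate

/-- Iterated multiplicative derivatives. -/
def iterDeriv : (r : ℕ) → (Fin r → ℤ) → (SymbolSpace → ℝ) → SymbolSpace → ℝ
  | 0, _, h => h
  | r + 1, j, h => iterDeriv r (fun i => j i.succ) (mulDeriv (j 0) h)

/-- The box of integer vectors with entries of absolute value less than `N`. -/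
noncomputable def symmBox (N r : ℕ) : Finset (Fin r → ℤ) :=
  Fintype.piFinset fun _ => Ioo (-(N : ℤ)) N

theorem sum_piFinset_cons {β : Type*} [AddCommMonoid β] (I : Finset ℤ) (r : ℕ)
    (φ : (Fin (r + 1) → ℤ) → β) :
    ∑ l ∈ Fintype.piFinset (fun _ : Fin (r + 1) => I), φ l =
      ∑ l₀ ∈ I, ∑ l ∈ Fintype.piFinset (fun _ : Fin r => I), φ (Fin.cons l₀ l) := by
  rw [← sum_product']
  refine sum_bij' (fun l _ => (l 0, Fin.tail l)) (fun z _ => Fin.cons z.1 z.2) ?_ ?_ ?_ ?_ ?_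
  · intro l hl
    rw [Fintype.mem_piFinset] at hl; exact mem_product.2 ⟨hl 0, Fintype.mem_piFinset.2 fun i => hl i.succ⟩
  · intro z hz
    rw [mem_product, Fintype.mem_piFinset] at hz; exact Fintype.mem_piFinset.2 fun i => Fin.cases hz.1 hz.2 i
  · intro l _; exact Fin.cons_self_tail l
  · intro z _; simp
  · intro l _; rw [Fin.cons_self_tail]

theorem iterDeriv_cons (r : ℕ) (d : Fin (r + 1) → ℤ) (l₀ : ℤ) (l : Fin r → ℤ) (h : SymbolSpace → ℝ) :
    iterDeriv (r + 1) (fun i => d i * (Fin.cons l₀ l : Fin (r + 1) → ℤ) i) h =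
      iterDeriv r (fun i => d i.succ * l i) (mulDeriv (d 0 * l₀) h) := rfl

theorem sum_Ioo_mul_le {φ : ℤ → ℝ} (hφ : ∀ j, 0 ≤ φ j) {d : ℤ} (hd : d ≠ 0) {N L : ℕ}
    (hL : 2 * (d.natAbs * N) ≤ L) :
    (L : ℝ) * ∑ l ∈ Ioo (-(N : ℤ)) N, φ (d * l) ≤
      2 * ∑ m ∈ range L, ∑ m' ∈ range L, φ (m' - m) := by
  have h1 : ∀ l ∈ Ioo (-(N : ℤ)) N, (L : ℝ) * φ (d * l) ≤
      2 * ∑ m ∈ range L, ∑ m' ∈ range L,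
        if d * l = (m' : ℤ) - m then φ (m' - m) else 0 := by
    intro l hl
    rw [mem_Ioo] at hl
    have h2 := (card_filter_sub_eq L (d * l)).1
    have h3 : ∑ m ∈ range L, ∑ m' ∈ range L,
        (if d * l = (m' : ℤ) - m then φ (m' - m) else 0) =
        (∑ m ∈ range L, ∑ m' ∈ range L,
          if d * l = (m' : ℤ) - m then (1 : ℝ) else 0) * φ (d * l) := by
      rw [sum_mul]
      refine sum_congr rfl fun m _ => ?_
      rw [sum_mul]
      refine sum_congr rfl fun m' _ => ?_
      split_ifs with h
      · rw [← h, one_mul]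
      · rw [zero_mul]
    rw [h3]
    have h4 : 2 * |((d * l : ℤ) : ℝ)| ≤ L := by
      have : 2 * (d * l).natAbs ≤ L := by
        rw [Int.natAbs_mul]
        have : l.natAbs ≤ N := by omega
        have := Nat.mul_le_mul_left d.natAbs this
        omega
      rw [← Int.cast_abs, Int.abs_eq_natAbs]
      exact_mod_cast this
    have := mul_le_mul_of_nonneg_right h2 (hφ (d * l))
    nlinarith [hφ (d * l)]
  rw [mul_sum]
  refine (sum_le_sum h1).trans ?_
  rw [← mul_sum]
  refine mul_le_mul_of_nonneg_left ?_ zero_le_two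
  rw [sum_comm]
  refine sum_le_sum fun m _ => ?_
  rw [sum_comm]
  refine sum_le_sum fun m' _ => ?_
  by_cases h : ∃ l ∈ Ioo (-(N : ℤ)) N, d * l = (m' : ℤ) - m
  · obtain ⟨l, hl, h⟩ := h
    rw [sum_eq_single_of_mem l hl]
    · split_ifs
      exact le_rfl
    · intro l' _ hne
      rw [if_neg]
      intro h'
      exact hne (mul_left_cancel₀ hd (h'.trans h.symm))
  · rw [sum_eq_zero]
    · exact hφ _
    · intro l hl
      rw [if_neg]; exact fun h' => h ⟨l, hl, h'⟩

variable {κ : Measure SymbolSpace} [IsProbabilityMeasure κ] {e : SymbolSpace → ℂ} {c : ℂ}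

/-- Sums of squares of integrals of derivatives over a box are bounded by Gowers averages. -/
theorem sum_sq_integral_iterDeriv_le (hT : MeasurePreserving shift κ κ) (N : ℕ) {Ls : List ℕ}
    (hpos : ∀ L ∈ Ls, 0 < L) (hN : ∀ L ∈ Ls, L ≤ N) (r : ℕ) (hr : Ls.length = r) {d : Fin r → ℤ}
    (hd : ∀ i, d i ≠ 0) {h : SymbolSpace → ℝ} (hm : Measurable h) (h1 : ∀ x, |h x| ≤ 1) :
    ∑ l ∈ symmBox N r, (∫ x, iterDeriv r (fun i => d i * l i) h x ∂κ) ^ 2 ≤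
      (∏ i, (6 * (d i).natAbs * N : ℝ)) * gowersAvg κ Ls h := by
  induction Ls generalizing r h with
  | nil =>
    obtain rfl : r = 0 := hr.symm
    simp [symmBox, iterDeriv, gowersAvg, cubeAvg]
  | cons L Ls ih =>
    obtain ⟨r, rfl⟩ : ∃ r', r = r' + 1 := ⟨_, hr.symm⟩
    have hL := hpos L (by simp)
    have hLN := hN L (by simp)
    rw [symmBox, sum_piFinset_cons]
    simp only [iterDeriv_cons]
    have h2 : ∀ l₀ : ℤ, ∑ l ∈ symmBox N r,
        (∫ x, iterDeriv r (fun i => d i.succ * l i) (mulDeriv (d 0 * l₀) h) x ∂κ) ^ 2 ≤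
        (∏ i : Fin r, (6 * (d i.succ).natAbs * N : ℝ)) * gowersAvg κ Ls (mulDeriv (d 0 * l₀) h) :=
      fun l₀ => ih (fun L' h' => hpos L' (List.mem_cons_of_mem _ h'))
        (fun L' h' => hN L' (List.mem_cons_of_mem _ h')) r (by simpa using hr) (fun i => hd _)
        (measurable_mulDeriv hm _) (abs_mulDeriv_le h1 _)
    refine (sum_le_sum fun l₀ _ => h2 l₀).trans ?_
    rw [← mul_sum, Fin.prod_univ_succ, mul_comm (6 * ((d 0).natAbs : ℝ) * N), mul_assoc]
    refine mul_le_mul_of_nonneg_left ?_ (prod_nonneg fun i _ => by positivity)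
    set k := 2 * ((d 0).natAbs * N) / L + 1 with hk
    have hk1 : 2 * ((d 0).natAbs * N) ≤ k * L := by
      have := Nat.div_add_mod (2 * ((d 0).natAbs * N)) L
      have h3 := Nat.mod_lt (2 * ((d 0).natAbs * N)) hL
      rw [hk]; nlinarith
    have hk2 : k * L ≤ 3 * ((d 0).natAbs * N) := by
      have := Nat.div_mul_le_self (2 * ((d 0).natAbs * N)) L
      have h3 : 1 ≤ (d 0).natAbs := Int.natAbs_pos.2 (hd 0)
      rw [hk, add_mul, one_mul]; nlinarith
    have hkL : 0 < k * L := Nat.mul_pos (Nat.succ_pos _) hL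
    have h3 := sum_Ioo_mul_le (φ := fun j => gowersAvg κ Ls (mulDeriv j h))
      (fun j => gowersAvg_nonneg _ _) (hd 0) hk1
    have h4 := gowersAvg_mul_cons_le hT k L Ls hm h1
    have h5 : gowersAvg κ (k * L :: Ls) h = (((k * L : ℕ) : ℝ)⁻¹ * ((k * L : ℕ) : ℝ)⁻¹) *
      ∑ m ∈ range (k * L), ∑ m' ∈ range (k * L),
        gowersAvg κ Ls (mulDeriv (m' - m) h) := rfl
    have hR : (0 : ℝ) < ((k * L : ℕ) : ℝ) := by exact_mod_cast hkL
    have h6 : ∑ m ∈ range (k * L), ∑ m' ∈ range (k * L),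
        gowersAvg κ Ls (mulDeriv (m' - m) h) =
        ((k * L : ℕ) : ℝ) * ((k * L : ℕ) : ℝ) * gowersAvg κ (k * L :: Ls) h := by
      rw [h5]; field_simp
    rw [h6] at h3
    have h7 : ∑ l ∈ Ioo (-(N : ℤ)) N, gowersAvg κ Ls (mulDeriv (d 0 * l) h) ≤
        2 * ((k * L : ℕ) : ℝ) * gowersAvg κ (k * L :: Ls) h := by
      refine le_of_mul_le_mul_left (h3.trans_eq ?_) hR
      ring
    have h8 : ((k * L : ℕ) : ℝ) ≤ 3 * ((d 0).natAbs * N) := by exact_mod_cast hk2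
    refine h7.trans ?_
    have h9 := gowersAvg_nonneg (κ := κ) (L :: Ls) h
    calc _ ≤ 2 * ((k * L : ℕ) : ℝ) * gowersAvg κ (L :: Ls) h :=
          mul_le_mul_of_nonneg_left h4 (by positivity)
      _ ≤ _ := mul_le_mul_of_nonneg_right (by linarith) h9

/-- Sums over subsets of the entries of a vector. -/
def vertexSum {r : ℕ} (ω : Fin r → Bool) (l : Fin r → ℤ) : ℤ := ∑ i, if ω i then l i else 0

theorem vertexSum_cons {r : ℕ} (b : Bool) (ω : Fin r → Bool) (l₀ : ℤ) (l : Fin r → ℤ) :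
    vertexSum (Fin.cons b ω : Fin (r + 1) → Bool) (Fin.cons l₀ l : Fin (r + 1) → ℤ) =
      (if b then l₀ else 0) + vertexSum ω l := by
  simp [vertexSum, Fin.sum_univ_succ]

/-- Iterated differences of an integer sequence. -/
def cubeDiff : (r : ℕ) → (ℤ → ℤ) → (Fin r → ℤ) → ℤ → ℤ
  | 0, a, _, n => a n
  | r + 1, a, l, n => cubeDiff r (fun n => a n - a (n + l 0)) (fun i => l i.succ) n

theorem IsEigenfunction.zpow_mul_conj (he : IsEigenfunction κ e c)
    (a b : ℤ) (x : SymbolSpace) : e x ^ a * conj (e x ^ b) = e x ^ (a - b) := by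
  have h : conj (e x) = (e x)⁻¹ := by
    rw [Complex.inv_def, normSq_eq_norm_sq, he.norm_eq_one]; simp
  rw [map_zpow₀, h, inv_zpow, zpow_sub₀ (he.ne_zero x), div_eq_mul_inv]

theorem IsEigenfunction.measurable_zpow (he : IsEigenfunction κ e c)
    (a : ℤ) : Measurable fun x => e x ^ a := by
  cases a with
  | ofNat a => simpa using he.measurable.pow_const a
  | negSucc a =>
    simp only [zpow_negSucc]; exact (he.measurable.pow_const _).inv

theorem sum_Ico_eq_sum_Ioo (N : ℕ) (I : ℤ → ℤ → ℂ)
    (hI : ∀ n n', n' ∉ Ico (0 : ℤ) N → I n n' = 0) :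
    ∑ n ∈ Ico (0 : ℤ) N, ∑ n' ∈ Ico (0 : ℤ) N, I n n' =
      ∑ l ∈ Ioo (-(N : ℤ)) N, ∑ n ∈ Ico (0 : ℤ) N, I n (n + l) := by
  conv_rhs => rw [sum_comm]
  refine sum_congr rfl fun n hn => ?_
  rw [mem_Ico] at hn; rw [← sum_subset (s₁ := (Ico (0 : ℤ) N).image (· - n)) (s₂ := Ioo (-(N : ℤ)) N)]
  · rw [sum_image fun a _ b _ h => by simpa using h]
    simp
  · intro l hl
    rw [mem_image] at hl
    obtain ⟨m, hm, rfl⟩ := hl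
    rw [mem_Ico] at hm; rw [mem_Ioo]; omega
  · intro l _ hl
    refine hI _ _ fun h => hl (mem_image.2 ⟨n + l, h, by ring⟩)

theorem integral_norm_sq_sum_le_sum_norm_integral (hT : MeasurePreserving shift κ κ)
    (he : IsEigenfunction κ e c) {N : ℕ} {z : ℤ → ℂ}
    (hz : ∀ n, z n ≠ 0 → n ∈ Ico (0 : ℤ) N) (a : ℤ → ℤ) (k : ℤ) {f : SymbolSpace → ℝ}
    (hf : Measurable f) (hf1 : ∀ x, |f x| ≤ 1) {H : ℤ → SymbolSpace → ℝ} (hH : ∀ n, Measurable (H n))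
    (hH1 : ∀ n x, |H n x| ≤ 1) :
    ∫ x, ‖∑ n ∈ Ico (0 : ℤ) N, z n * e x ^ a n * (f (shiftBy (n * k) x) * H n x : ℝ)‖ ^ 2 ∂κ ≤
      ∑ l ∈ Ioo (-(N : ℤ)) N, ‖∫ x, (mulDeriv (l * k) f x : ℂ) * ∑ n ∈ Ico (0 : ℤ) N,
        z n * conj (z (n + l)) * c ^ (-(n * k) * (a n - a (n + l))) *
          e x ^ (a n - a (n + l)) *
          (H n (shiftBy (-(n * k)) x) * H (n + l) (shiftBy (-(n * k)) x) : ℝ) ∂κ‖ := by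
  set u : ℤ → SymbolSpace → ℂ := fun n x =>
    z n * e x ^ a n * (f (shiftBy (n * k) x) * H n x : ℝ) with hu
  have hum : ∀ n, Measurable (u n) := fun n =>
    (measurable_const.mul (he.measurable_zpow _)).mul (measurable_ofReal.comp
      ((hf.comp (measurable_shiftBy _)).mul (hH n)))
  have hun : ∀ n x, ‖u n x‖ ≤ ‖z n‖ := fun n x => by
    simp only [hu]
    rw [norm_mul, norm_mul, norm_zpow, he.norm_eq_one, one_zpow, mul_one, norm_real,
      Real.norm_eq_abs, abs_mul]
    exact mul_le_of_le_one_right (norm_nonneg _) (mul_le_one₀ (hf1 _) (abs_nonneg _) (hH1 _ _))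
  have hInt : ∀ n n', Integrable (fun x => u n x * conj (u n' x)) κ := fun n n' => by
    refine Integrable.of_bound ((hum n).mul
      (continuous_conj.measurable.comp (hum n'))).aestronglyMeasurable (‖z n‖ * ‖z n'‖)
      (ae_of_all _ fun x => (norm_mul _ _).trans_le ?_)
    rw [RCLike.norm_conj]; exact mul_le_mul (hun _ _) (hun _ _) (norm_nonneg _) (norm_nonneg _)
  have h1 : ((∫ x, ‖∑ n ∈ Ico (0 : ℤ) N, u n x‖ ^ 2 ∂κ : ℝ) : ℂ) =
      ∑ n ∈ Ico (0 : ℤ) N, ∑ n' ∈ Ico (0 : ℤ) N,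
        ∫ x, u n x * conj (u n' x) ∂κ := by
    rw [← integral_complex_ofReal]
    have : ∀ x, ((‖∑ n ∈ Ico (0 : ℤ) N, u n x‖ ^ 2 : ℝ) : ℂ) =
        ∑ n ∈ Ico (0 : ℤ) N, ∑ n' ∈ Ico (0 : ℤ) N,
          u n x * conj (u n' x) := fun x => by
      rw [← normSq_eq_norm_sq, ← mul_conj, map_sum, sum_mul_sum]
    simp only [this]; rw [integral_finsetSum _ fun n _ => integrable_finsetSum _ fun n' _ => hInt n n']
    exact sum_congr rfl fun n _ => integral_finsetSum _ fun n' _ => hInt n n'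
  rw [sum_Ico_eq_sum_Ioo N (fun n n' => ∫ x, u n x * conj (u n' x) ∂κ)] at h1
  swap
  · intro n n' hn'
    have : z n' = 0 := by
      by_contra h
      exact hn' (hz _ h)
    simp [hu, this]
  have h2 : ∀ l n : ℤ, (∫ x, u n x * conj (u (n + l) x) ∂κ) =
      ∫ x, (mulDeriv (l * k) f x : ℂ) * (z n * conj (z (n + l)) *
        c ^ (-(n * k) * (a n - a (n + l))) * e x ^ (a n - a (n + l)) *
          (H n (shiftBy (-(n * k)) x) * H (n + l) (shiftBy (-(n * k)) x) : ℝ)) ∂κ := fun l n => by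
    rw [← integral_comp_shiftBy hT (-(n * k)) fun x => u n x * conj (u (n + l) x)]
    refine integral_congr_ae ?_
    filter_upwards [he.shiftBy_eq hT (-(n * k))] with x hx
    simp only [hu, mulDeriv]; rw [map_mul, map_mul, conj_ofReal]
    have e1 : e (shiftBy (-(n * k)) x) ^ a n * conj (e (shiftBy (-(n * k)) x) ^ a (n + l)) =
        c ^ (-(n * k) * (a n - a (n + l))) * e x ^ (a n - a (n + l)) := by
      rw [he.zpow_mul_conj, hx, mul_zpow, zpow_mul]
    rw [shiftBy_shiftBy, shiftBy_shiftBy, show n * k + -(n * k) = 0 by ring,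
      show (n + l) * k + -(n * k) = l * k by ring, shiftBy_zero]
    push_cast
    linear_combination (z n * conj (z (n + l)) * f x * f (shiftBy (l * k) x) *
      H n (shiftBy (-(n * k)) x) * H (n + l) (shiftBy (-(n * k)) x)) * e1
  have hint2 : ∀ l n : ℤ, Integrable (fun x => (mulDeriv (l * k) f x : ℂ) *
      (z n * conj (z (n + l)) *
        c ^ (-(n * k) * (a n - a (n + l))) * e x ^ (a n - a (n + l)) *
          (H n (shiftBy (-(n * k)) x) * H (n + l) (shiftBy (-(n * k)) x) : ℝ))) κ := fun l n => by
    have hH2 : Measurable fun x => H n (shiftBy (-(n * k)) x) * H (n + l) (shiftBy (-(n * k)) x) :=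
      ((hH n).comp (measurable_shiftBy _)).mul ((hH (n + l)).comp (measurable_shiftBy _))
    refine Integrable.of_bound ((measurable_ofReal.comp (measurable_mulDeriv hf _)).mul
      ((measurable_const.mul (he.measurable_zpow _)).mul
        (measurable_ofReal.comp hH2))).aestronglyMeasurable
      (‖z n * conj (z (n + l)) * c ^ (-(n * k) * (a n - a (n + l)))‖)
      (ae_of_all _ fun x => (norm_mul _ _).trans_le ?_)
    rw [norm_mul (_ * _ ^ _), norm_mul _ (_ ^ _), norm_zpow (e x), he.norm_eq_one, one_zpow, mul_one,
      norm_real, norm_real, Real.norm_eq_abs, Real.norm_eq_abs]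
    have b1 := abs_mulDeriv_le hf1 (l * k) x
    have b2 : |H n (shiftBy (-(n * k)) x) * H (n + l) (shiftBy (-(n * k)) x)| ≤ 1 := by
      rw [abs_mul]; exact mul_le_one₀ (hH1 _ _) (abs_nonneg _) (hH1 _ _)
    exact (mul_le_of_le_one_left (by positivity) b1).trans
      (mul_le_of_le_one_right (norm_nonneg _) b2)
  have h3 : ((∫ x, ‖∑ n ∈ Ico (0 : ℤ) N, u n x‖ ^ 2 ∂κ : ℝ) : ℂ) =
      ∑ l ∈ Ioo (-(N : ℤ)) N, ∫ x, (mulDeriv (l * k) f x : ℂ) * ∑ n ∈ Ico (0 : ℤ) N,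
        z n * conj (z (n + l)) * c ^ (-(n * k) * (a n - a (n + l))) *
          e x ^ (a n - a (n + l)) *
          (H n (shiftBy (-(n * k)) x) * H (n + l) (shiftBy (-(n * k)) x) : ℝ) ∂κ := by
    rw [h1]
    refine sum_congr rfl fun l _ => ?_
    simp only [mul_sum]; rw [integral_finsetSum _ fun n _ => hint2 l n]; exact sum_congr rfl fun n _ => h2 l n
  calc _ = ‖((∫ x, ‖∑ n ∈ Ico (0 : ℤ) N, u n x‖ ^ 2 ∂κ : ℝ) : ℂ)‖ := by
        rw [norm_real, Real.norm_eq_abs, abs_of_nonneg (integral_nonneg fun _ => sq_nonneg _)]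
    _ ≤ _ := by rw [h3]; exact norm_sum_le _ _

theorem norm_integral_mul_sq_le {φ : SymbolSpace → ℝ} (hφ1 : ∀ x, |φ x| ≤ 1)
    {Ψ : SymbolSpace → ℂ} (hΨ : Measurable Ψ) {B : ℝ} (hB : ∀ x, ‖Ψ x‖ ≤ B) :
    ‖∫ x, (φ x : ℂ) * Ψ x ∂κ‖ ^ 2 ≤ ∫ x, ‖Ψ x‖ ^ 2 ∂κ := by
  have hi : Integrable (fun x => ‖Ψ x‖) κ :=
    Integrable.of_bound hΨ.norm.aestronglyMeasurable B (ae_of_all _ fun x => by simpa using hB x)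
  have hi2 : Integrable (fun x => ‖Ψ x‖ ^ 2) κ :=
    Integrable.of_bound (hΨ.norm.pow_const 2).aestronglyMeasurable (B ^ 2) (ae_of_all _ fun x => by
      rw [Real.norm_eq_abs, abs_of_nonneg (sq_nonneg _)]
      exact pow_le_pow_left₀ (norm_nonneg _) (hB x) 2)
  have h1 : ‖∫ x, (φ x : ℂ) * Ψ x ∂κ‖ ≤ ∫ x, ‖Ψ x‖ ∂κ := by
    refine (norm_integral_le_integral_norm _).trans (integral_mono_of_nonneg
      (ae_of_all _ fun x => norm_nonneg _) hi (ae_of_all _ fun x => ?_))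
    simp only [norm_mul, norm_real, Real.norm_eq_abs]
    exact mul_le_of_le_one_left (norm_nonneg _) (hφ1 x)
  have h2 : 0 ≤ ∫ x, (‖Ψ x‖ - ∫ y, ‖Ψ y‖ ∂κ) ^ 2 ∂κ := integral_nonneg fun x => sq_nonneg _
  set m := ∫ y, ‖Ψ y‖ ∂κ
  have h3 : ∀ x, (‖Ψ x‖ - m) ^ 2 = ‖Ψ x‖ ^ 2 - 2 * m * ‖Ψ x‖ + m ^ 2 := fun x => by ring
  simp only [h3] at h2
  rw [integral_add (by exact hi2.sub (hi.const_mul _)) (integrable_const _),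
    integral_sub hi2 (hi.const_mul _), integral_const_mul, integral_const] at h2
  simp only [probReal_univ, one_smul] at h2
  have h4 : ‖∫ x, (φ x : ℂ) * Ψ x ∂κ‖ ^ 2 ≤ m ^ 2 := pow_le_pow_left₀ (norm_nonneg _) h1 2
  nlinarith

end VanDerCorput

section VanDerCorput

open ComplexConjugate

variable {κ : Measure SymbolSpace} [IsProbabilityMeasure κ] {e : SymbolSpace → ℂ} {c : ℂ}

/-- The directions of the derivatives produced by iterating the van der Corput inequality. -/
def vdcDirections {r : ℕ} (K : ℤ) (k : Fin r → ℤ) : Fin (r + 1) → ℤ :=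
  Fin.cons K fun i => K - k i

/-- A multiple average along a sequence of weights. -/
noncomputable def multiAverage (N : ℕ) (z : ℤ → ℂ) (e : SymbolSpace → ℂ) (a : ℤ → ℤ) {r : ℕ} (K : ℤ)
    (h : SymbolSpace → ℝ) (k : Fin r → ℤ) (f : Fin r → SymbolSpace → ℝ) (x : SymbolSpace) : ℂ :=
  ∑ n ∈ Ico (0 : ℤ) N, z n * e x ^ a n *
    (h (shiftBy (n * K) x) * ∏ i, f i (shiftBy (n * k i) x) : ℝ)

theorem measurable_multiAverage (he : IsEigenfunction κ e c) (N : ℕ)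
    (z : ℤ → ℂ) (a : ℤ → ℤ) {r : ℕ} (K : ℤ) {h : SymbolSpace → ℝ} (hh : Measurable h) (k : Fin r → ℤ)
    {f : Fin r → SymbolSpace → ℝ} (hf : ∀ i, Measurable (f i)) :
    Measurable (multiAverage N z e a K h k f) :=
  Finset.measurable_fun_sum _ fun _ _ => (measurable_const.mul (he.measurable_zpow _)).mul
    (Complex.measurable_ofReal.comp ((hh.comp (measurable_shiftBy _)).mul
      (Finset.measurable_fun_prod _ fun i _ => (hf i).comp (measurable_shiftBy _))))

theorem abs_prod_le_one {ι : Type*} (s : Finset ι) {f : ι → ℝ} (hf : ∀ i, |f i| ≤ 1) :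
    |∏ i ∈ s, f i| ≤ 1 := by
  rw [abs_prod]; exact prod_le_one (fun _ _ => abs_nonneg _) fun i _ => hf i

theorem norm_multiAverage_le (he : IsEigenfunction κ e c) (N : ℕ)
    {z : ℤ → ℂ} (hz : ∀ n, ‖z n‖ ≤ 1) (a : ℤ → ℤ) {r : ℕ} (K : ℤ) {h : SymbolSpace → ℝ}
    (hh : ∀ x, |h x| ≤ 1) (k : Fin r → ℤ) {f : Fin r → SymbolSpace → ℝ} (hf : ∀ i x, |f i x| ≤ 1)
    (x : SymbolSpace) : ‖multiAverage N z e a K h k f x‖ ≤ N := by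
  refine (norm_sum_le _ _).trans ?_
  refine (sum_le_sum (g := fun _ => (1 : ℝ)) fun n _ => ?_).trans (by simp)
  rw [norm_mul, norm_mul, norm_zpow, he.norm_eq_one, one_zpow, mul_one, Complex.norm_real,
    Real.norm_eq_abs, abs_mul]
  exact mul_le_one₀ (hz n) (by positivity) (mul_le_one₀ (hh _) (abs_nonneg _)
    (abs_prod_le_one _ fun i => hf i _))

theorem sum_pow_le_mul_sum_pow {s : Finset ℤ} {φ : ℤ → ℝ} (hφ : ∀ i ∈ s, 0 ≤ φ i) (m : ℕ) {B : ℝ}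
    (hs : (s.card : ℝ) ≤ B) : (∑ i ∈ s, φ i) ^ (m + 1) ≤ B ^ m * ∑ i ∈ s, φ i ^ (m + 1) := by
  rcases s.eq_empty_or_nonempty with rfl | hne
  · simp
  have hc : (0 : ℝ) < s.card := by exact_mod_cast hne.card_pos
  have h := pow_sum_div_card_le_sum_pow (s := s) (f := φ) hφ m
  rw [div_le_iff₀ (by positivity)] at h
  refine h.trans ?_
  rw [mul_comm]; exact mul_le_mul_of_nonneg_right (pow_le_pow_left₀ hc.le hs m)
    (sum_nonneg fun i hi => pow_nonneg (hφ i hi) _)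

/-- The iterated van der Corput inequality. -/
theorem exists_vanDerCorput (hT : MeasurePreserving shift κ κ) (he : IsEigenfunction κ e c) (N : ℕ) (r : ℕ) (K : ℤ) {h : SymbolSpace → ℝ} (hm : Measurable h)
    (h1 : ∀ x, |h x| ≤ 1) (k : Fin r → ℤ) {f : Fin r → SymbolSpace → ℝ} (hf : ∀ i, Measurable (f i))
    (hf1 : ∀ i x, |f i x| ≤ 1) {S : Set ℤ} (hS : ∀ n ∈ S, n ∈ Ico (0 : ℤ) N) {z : ℤ → ℂ}
    (hz : ∀ n, ‖z n‖ ≤ 1) (hzS : ∀ n, z n ≠ 0 → n ∈ S) (a : ℤ → ℤ) :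
    ∃ w : (Fin (r + 1) → ℤ) → ℤ → ℂ, (∀ l n, ‖w l n‖ ≤ 1) ∧
      (∀ l n, w l n ≠ 0 → ∀ ω, n + vertexSum ω l ∈ S) ∧
      (∫ x, ‖multiAverage N z e a K h k f x‖ ^ 2 ∂κ) ^ 2 ^ r ≤
        (2 * N : ℝ) ^ (2 ^ (r + 1) - (r + 2)) * ∑ l ∈ symmBox N (r + 1),
          ‖∫ x, (iterDeriv (r + 1) (fun i => vdcDirections K k i * l i) h x : ℂ) *
            ∑ n ∈ Ico (0 : ℤ) N, w l n * e x ^ cubeDiff (r + 1) a l n ∂κ‖ := by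
  have hc1 : ∀ m : ℤ, ‖c ^ m‖ = 1 := fun m => by rw [norm_zpow, he.norm_eigenvalue, one_zpow]
  have hphase : ∀ {z : ℤ → ℂ}, (∀ n, ‖z n‖ ≤ 1) → ∀ (l n m : ℤ),
      ‖z n * conj (z (n + l)) * c ^ m‖ ≤ 1 := fun {z} hz l n m => by
    rw [norm_mul, norm_mul, RCLike.norm_conj, hc1, mul_one]; exact mul_le_one₀ (hz _) (norm_nonneg _) (hz _)
  induction r generalizing K h z a S with
  | zero =>
    have step := integral_norm_sq_sum_le_sum_norm_integral hT he (fun n hn => hS _ (hzS n hn)) a K hm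
      h1 (H := fun _ _ => 1) (fun _ => measurable_const) (fun _ _ => by simp)
    refine ⟨fun l n => z n * conj (z (n + l 0)) * c ^ (-(n * K) * (a n - a (n + l 0))),
      fun l n => hphase hz _ _ _, fun l n hn ω => ?_, ?_⟩
    · have hn1 : z n ≠ 0 := fun h => hn (by simp [h])
      have hn2 : z (n + l 0) ≠ 0 := fun h => hn (by simp [h])
      simp only [vertexSum, Fin.sum_univ_succ, univ_eq_empty, sum_empty, add_zero]
      split_ifs
      · exact hzS _ hn2
      · rw [add_zero]; exact hzS _ hn1
    · have e1 : ∀ x, multiAverage N z e a K h k f x = ∑ n ∈ Ico (0 : ℤ) N, z n * e x ^ a n *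
          (h (shiftBy (n * K) x) * 1 : ℝ) := fun x => by simp [multiAverage]
      simp only [e1, pow_zero, pow_one]
      refine step.trans (le_of_eq ?_)
      rw [symmBox, sum_piFinset_cons]
      simp [iterDeriv, cubeDiff, vdcDirections, mul_comm]
  | succ r ih =>
    set H : ℤ → SymbolSpace → ℝ := fun n x => h (shiftBy (n * K) x) *
      ∏ i : Fin r, f i.succ (shiftBy (n * k i.succ) x) with hH
    have hHm : ∀ n, Measurable (H n) := fun n => (hm.comp (measurable_shiftBy _)).mul
      (Finset.measurable_fun_prod _ fun i _ => (hf i.succ).comp (measurable_shiftBy _))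
    have hH1 : ∀ n x, |H n x| ≤ 1 := fun n x => by
      rw [hH, abs_mul]; exact mul_le_one₀ (h1 _) (abs_nonneg _) (abs_prod_le_one _ fun i => hf1 _ _)
    have step := integral_norm_sq_sum_le_sum_norm_integral hT he (fun n hn => hS _ (hzS n hn)) a (k 0)
      (hf 0) (hf1 0) hHm hH1
    have e1 : ∀ x, multiAverage N z e a K h k f x = ∑ n ∈ Ico (0 : ℤ) N, z n * e x ^ a n *
        (f 0 (shiftBy (n * k 0) x) * H n x : ℝ) := fun x => by
      rw [multiAverage]
      refine sum_congr rfl fun n _ => ?_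
      rw [Fin.prod_univ_succ]
      simp only [hH]
      congr 2
      ring
    simp only [← e1] at step
    set z' : ℤ → ℤ → ℂ := fun l n =>
      z n * conj (z (n + l)) * c ^ (-(n * k 0) * (a n - a (n + l))) with hz'
    set a' : ℤ → ℤ → ℤ := fun l n => a n - a (n + l) with ha'
    set k' : Fin r → ℤ := fun i => k i.succ - k 0 with hk'
    set f' : ℤ → Fin r → SymbolSpace → ℝ := fun l i => mulDeriv (k i.succ * l) (f i.succ) with hf'
    set h' : ℤ → SymbolSpace → ℝ := fun l => mulDeriv (K * l) h with hh'
    have e2 : ∀ l x, ∑ n ∈ Ico (0 : ℤ) N,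
        z n * conj (z (n + l)) * c ^ (-(n * k 0) * (a n - a (n + l))) *
          e x ^ (a n - a (n + l)) *
          (H n (shiftBy (-(n * k 0)) x) * H (n + l) (shiftBy (-(n * k 0)) x) : ℝ) =
        multiAverage N (z' l) e (a' l) (K - k 0) (h' l) k' (f' l) x := fun l x => by
      rw [multiAverage]
      refine sum_congr rfl fun n _ => ?_
      simp only [hz', ha', hk', hf', hh', hH, mulDeriv, shiftBy_shiftBy, prod_mul_distrib]
      congr 2
      have t1 : ∀ j : ℤ, n * j + -(n * k 0) = n * (j - k 0) := fun j => by ring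
      have t2 : ∀ j : ℤ, (n + l) * j + -(n * k 0) = j * l + n * (j - k 0) := fun j => by ring
      simp only [t1, t2]; ring
    simp only [e2] at step
    have hz'1 : ∀ l n, ‖z' l n‖ ≤ 1 := fun l n => hphase hz _ _ _
    choose w hw1 hw2 hw3 using fun l : ℤ => ih (K := K - k 0) (h := h' l) (measurable_mulDeriv hm _)
      (abs_mulDeriv_le h1 _) k' (f := f' l) (fun i => measurable_mulDeriv (hf _) _)
      (fun i => abs_mulDeriv_le (hf1 _) _) (S := {n | n ∈ S ∧ n + l ∈ S}) (fun n hn => hS n hn.1)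
      (z := z' l) (hz'1 l) (fun n hn => ⟨hzS n fun h0 => hn (by simp [hz', h0]),
        hzS _ fun h0 => hn (by simp [hz', h0])⟩) (a' l)
    refine ⟨fun l n => w (l 0) (fun i => l i.succ) n, fun l n => hw1 _ _ _, fun l n hn ω => ?_, ?_⟩
    · have h2 := hw2 _ _ _ hn fun i => ω i.succ
      have h3 : vertexSum ω l = (if ω 0 then l 0 else 0) +
          vertexSum (fun i => ω i.succ) fun i => l i.succ := by
        simp [vertexSum, Fin.sum_univ_succ]
      rw [h3]
      split_ifs
      · have := h2.2
        rwa [add_assoc, add_comm (vertexSum _ _)] at this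
      · rw [zero_add]; exact h2.1
    · have hcard : ((Ioo (-(N : ℤ)) N).card : ℝ) ≤ 2 * N := by
        rw [Int.card_Ioo]
        have : ((N : ℤ) - -(N : ℤ) - 1).toNat ≤ 2 * N := by omega
        exact_mod_cast this
      obtain ⟨q, hq⟩ : ∃ q, 2 ^ (r + 1) = q + 1 := ⟨2 ^ (r + 1) - 1, by
        have := Nat.one_le_two_pow (n := r + 1); omega⟩
      have hI0 : 0 ≤ ∫ x, ‖multiAverage N z e a K h k f x‖ ^ 2 ∂κ := integral_nonneg fun _ => sq_nonneg _
      have hexp : 2 ^ (r + 1 + 1) - (r + 1 + 2) = q + (2 ^ (r + 1) - (r + 2)) := by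
        have : r + 2 ≤ 2 ^ (r + 1) := Nat.lt_two_pow_self (n := r + 1)
        rw [pow_succ 2 (r + 1)]; omega
      calc (∫ x, ‖multiAverage N z e a K h k f x‖ ^ 2 ∂κ) ^ 2 ^ (r + 1)
          ≤ (∑ l ∈ Ioo (-(N : ℤ)) N, ‖∫ x, (mulDeriv (l * k 0) (f 0) x : ℂ) *
            multiAverage N (z' l) e (a' l) (K - k 0) (h' l) k' (f' l) x ∂κ‖) ^ 2 ^ (r + 1) :=
            pow_le_pow_left₀ hI0 step _
        _ ≤ (2 * N : ℝ) ^ q * ∑ l ∈ Ioo (-(N : ℤ)) N, ‖∫ x, (mulDeriv (l * k 0) (f 0) x : ℂ) *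
            multiAverage N (z' l) e (a' l) (K - k 0) (h' l) k' (f' l) x ∂κ‖ ^ 2 ^ (r + 1) := by
            rw [hq]; exact sum_pow_le_mul_sum_pow (fun _ _ => norm_nonneg _) q hcard
        _ ≤ (2 * N : ℝ) ^ q * ∑ l ∈ Ioo (-(N : ℤ)) N,
            (∫ x, ‖multiAverage N (z' l) e (a' l) (K - k 0) (h' l) k' (f' l) x‖ ^ 2 ∂κ) ^ 2 ^ r := by
            refine mul_le_mul_of_nonneg_left (sum_le_sum fun l _ => ?_) (by positivity)
            rw [pow_succ 2 r, mul_comm (2 ^ r), pow_mul]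
            refine pow_le_pow_left₀ (sq_nonneg _) ?_ _
            exact norm_integral_mul_sq_le (abs_mulDeriv_le (hf1 0) _)
              (measurable_multiAverage he N _ _ _ (measurable_mulDeriv hm _) _
                fun i => measurable_mulDeriv (hf _) _)
              (norm_multiAverage_le he N (hz'1 l) _ _ (abs_mulDeriv_le h1 _) _
                fun i => abs_mulDeriv_le (hf1 _) _)
        _ ≤ _ := by
            rw [hexp, pow_add, mul_assoc]
            refine mul_le_mul_of_nonneg_left ?_ (by positivity)
            rw [symmBox, sum_piFinset_cons, mul_sum]
            refine sum_le_sum fun l _ => (hw3 l).trans (le_of_eq ?_)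
            congr 1
            refine sum_congr rfl fun l' _ => ?_
            rw [iterDeriv_cons]
            have hd : (fun i => vdcDirections (K - k 0) k' i * l' i) =
                fun i => vdcDirections K k i.succ * l' i := by
              funext i
              congr 1
              refine Fin.cases rfl (fun j => ?_) i
              simp [vdcDirections, hk']
            rw [hd]; rfl

end VanDerCorput

section BrunHooley

open Real

variable {ι : Type*} [DecidableEq ι]

/-- Truncated inclusion-exclusion sums. -/
def truncSum (k : ℕ) (s : Finset ι) (g : ι → ℝ) : ℝ :=
  ∑ u ∈ s.powerset with u.card ≤ k, (-1) ^ u.card * ∏ i ∈ u, g i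

theorem truncSum_zero (s : Finset ι) (g : ι → ℝ) : truncSum 0 s g = 1 := by
  have : (s.powerset.filter fun u => u.card ≤ 0) = {∅} := by
    ext u
    simp only [mem_filter, mem_powerset, nonpos_iff_eq_zero, card_eq_zero,
      mem_singleton]
    exact ⟨fun h => h.2, fun h => ⟨h ▸ empty_subset _, h⟩⟩
  rw [truncSum, this]; simp

theorem truncSum_empty (k : ℕ) (g : ι → ℝ) : truncSum k ∅ g = 1 := by simp [truncSum, sum_filter]

theorem truncSum_succ_insert (k : ℕ) {s : Finset ι} {a : ι} (ha : a ∉ s) (g : ι → ℝ) :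
    truncSum (k + 1) (insert a s) g = truncSum (k + 1) s g - g a * truncSum k s g := by
  simp only [truncSum, sum_filter]; rw [sum_powerset_insert ha, sub_eq_add_neg, ← neg_mul, mul_sum]
  congr 1
  refine sum_congr rfl fun u hu => ?_
  have hau : a ∉ u := fun h => ha (mem_powerset.1 hu h)
  rw [card_insert_of_notMem hau, prod_insert hau]
  by_cases h : u.card ≤ k
  · rw [if_pos (by omega), if_pos h, pow_succ]; ring
  · rw [if_neg (by omega), if_neg h, mul_zero]

/-- The Bonferroni inequalities. -/
theorem truncSum_bounds {g : ι → ℝ} (h0 : ∀ i, 0 ≤ g i) (h1 : ∀ i, g i ≤ 1) (s : Finset ι) (b : ℕ) :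
    ∏ i ∈ s, (1 - g i) ≤ truncSum (2 * b) s g ∧ truncSum (2 * b + 1) s g ≤ ∏ i ∈ s, (1 - g i) := by
  induction s using Finset.induction_on generalizing b with
  | empty => simp [truncSum_empty]
  | insert a s ha ih =>
    rw [prod_insert ha]
    have hodd : ∀ b, truncSum (2 * b + 1) (insert a s) g ≤ (1 - g a) * ∏ i ∈ s, (1 - g i) := fun b => by
      rw [truncSum_succ_insert _ ha]
      have := mul_le_mul_of_nonneg_left (ih b).1 (h0 a)
      linarith [(ih b).2]
    refine ⟨?_, hodd b⟩
    cases b with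
    | zero =>
      rw [mul_zero, truncSum_zero]
      exact mul_le_one₀ (by linarith [h0 a]) (prod_nonneg fun i _ => by linarith [h1 i])
        (prod_le_one (fun i _ => by linarith [h1 i]) fun i _ => by linarith [h0 i])
    | succ b =>
      rw [show 2 * (b + 1) = 2 * b + 1 + 1 by ring, truncSum_succ_insert _ ha]
      have := mul_le_mul_of_nonneg_left (ih b).2 (h0 a)
      have h2 := (ih (b + 1)).1
      rw [show 2 * (b + 1) = 2 * b + 1 + 1 by ring] at h2
      linarith

theorem two_pow_mul_sum_powersetCard_le {g : ι → ℝ} (h0 : ∀ i, 0 ≤ g i) (s : Finset ι) (k : ℕ) :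
    2 ^ k * ∑ u ∈ s.powersetCard k, ∏ i ∈ u, g i ≤ exp (2 * ∑ i ∈ s, g i) := by
  calc 2 ^ k * ∑ u ∈ s.powersetCard k, ∏ i ∈ u, g i
      = ∑ u ∈ s.powersetCard k, ∏ i ∈ u, 2 * g i := by
        rw [mul_sum]
        refine sum_congr rfl fun u hu => ?_
        rw [prod_mul_distrib, prod_const, (mem_powersetCard.1 hu).2]
    _ ≤ ∑ u ∈ s.powerset, ∏ i ∈ u, 2 * g i :=
        sum_le_sum_of_subset_of_nonneg (fun u hu => mem_powerset.2
          (mem_powersetCard.1 hu).1) fun u _ _ => prod_nonneg fun i _ => by have := h0 i; positivity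
    _ = ∏ i ∈ s, (1 + 2 * g i) := (prod_one_add _).symm
    _ ≤ ∏ i ∈ s, exp (2 * g i) := Finset.prod_le_prod (fun i _ => by have := h0 i; positivity)
        fun i _ => by rw [add_comm]; exact add_one_le_exp _
    _ = _ := by rw [← exp_sum, mul_sum]

theorem truncSum_even_le {g : ι → ℝ} (h0 : ∀ i, 0 ≤ g i) (h1 : ∀ i, g i ≤ 1) (s : Finset ι) (b : ℕ) :
    truncSum (2 * b) s g ≤
      ∏ i ∈ s, (1 - g i) + exp (2 * ∑ i ∈ s, g i) / 2 ^ (2 * b + 1) := by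
  have h : truncSum (2 * b + 1) s g = truncSum (2 * b) s g -
      ∑ u ∈ s.powersetCard (2 * b + 1), ∏ i ∈ u, g i := by
    have e1 : (s.powerset.filter fun u => u.card ≤ 2 * b + 1) =
        (s.powerset.filter fun u => u.card ≤ 2 * b) ∪ s.powersetCard (2 * b + 1) := by
      ext u
      simp only [mem_filter, mem_powerset, mem_union, mem_powersetCard,
        ← and_or_left]
      exact and_congr_right fun _ => Nat.le_add_one_iff
    rw [truncSum, truncSum, e1, sum_union, sub_eq_add_neg, ← sum_neg_distrib]
    · congr 1
      refine sum_congr rfl fun u hu => ?_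
      rw [(mem_powersetCard.1 hu).2, Odd.neg_one_pow ⟨b, rfl⟩, neg_one_mul]
    · refine disjoint_left.2 fun u hu hu' => ?_
      have := (mem_filter.1 hu).2
      have := (mem_powersetCard.1 hu').2
      omega
  have h2 := (truncSum_bounds h0 h1 s b).2
  have h3 := two_pow_mul_sum_powersetCard_le h0 s (2 * b + 1)
  rw [mul_comm, ← le_div_iff₀ (by positivity)] at h3; linarith

theorem sum_truncated_prod_le {x : ι → ℝ} (h0 : ∀ i, 0 ≤ x i) (s : Finset ι) (k : ℕ) {y : ℝ}
    (hy : 1 ≤ y) (hs : ∑ i ∈ s, x i ≤ y) :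
    ∑ u ∈ s.powerset with u.card ≤ k, ∏ i ∈ u, x i ≤ y ^ k * exp 1 := by
  have hy0 : 0 < y := by linarith
  calc ∑ u ∈ s.powerset with u.card ≤ k, ∏ i ∈ u, x i
      ≤ ∑ u ∈ s.powerset with u.card ≤ k, y ^ k * ∏ i ∈ u, x i / y := by
        refine sum_le_sum fun u hu => ?_
        rw [prod_div_distrib, prod_const, mul_div_assoc', le_div_iff₀ (by positivity),
          mul_comm]
        exact mul_le_mul_of_nonneg_right (pow_le_pow_right₀ hy (mem_filter.1 hu).2)
          (prod_nonneg fun i _ => h0 i)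
    _ ≤ ∑ u ∈ s.powerset, y ^ k * ∏ i ∈ u, x i / y :=
        sum_le_sum_of_subset_of_nonneg (filter_subset _ _) fun u _ _ =>
          mul_nonneg (by positivity) (prod_nonneg fun i _ => div_nonneg (h0 i) hy0.le)
    _ = y ^ k * ∏ i ∈ s, (1 + x i / y) := by rw [← mul_sum, prod_one_add]
    _ ≤ y ^ k * ∏ i ∈ s, exp (x i / y) := by
        refine mul_le_mul_of_nonneg_left (Finset.prod_le_prod (fun i _ => ?_) fun i _ => ?_)
          (by positivity)
        · have := div_nonneg (h0 i) hy0.le; positivity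
        · rw [add_comm]; exact add_one_le_exp _
    _ ≤ _ := by
        rw [← exp_sum, ← sum_div]
        exact mul_le_mul_of_nonneg_left (exp_le_exp.2 ((div_le_one hy0).2 hs)) (by positivity)

open Classical in
/-- The Brun-Hooley upper bound sieve. -/
theorem card_sifted_le_of_blocks {α 𝒥 : Type*} [Fintype 𝒥] [DecidableEq 𝒥] (X : Finset α)
    (bad : α → ι → Prop) (P : 𝒥 → Finset ι) (b : 𝒥 → ℕ) {g x : ι → ℝ} (h0 : ∀ i, 0 ≤ g i)
    (h1 : ∀ i, g i ≤ 1) {M E : ℝ} (hM : 0 ≤ M)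
    (hR : ∀ u : 𝒥 → Finset ι, (∀ j, u j ⊆ P j) →
      |((X.filter fun a => ∀ j, ∀ i ∈ u j, bad a i).card : ℝ) - M * ∏ j, ∏ i ∈ u j, g i| ≤
        E * ∏ j, ∏ i ∈ u j, x i) :
    ((X.filter fun a => ∀ j, ∀ i ∈ P j, ¬ bad a i).card : ℝ) ≤
      M * ∏ j, (∏ i ∈ P j, (1 - g i) + exp (2 * ∑ i ∈ P j, g i) / 2 ^ (2 * b j + 1)) +
      E * ∏ j, ∑ u ∈ (P j).powerset with u.card ≤ 2 * b j, ∏ i ∈ u, x i := by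
  set T : 𝒥 → Finset (Finset ι) := fun j => (P j).powerset.filter fun u => u.card ≤ 2 * b j
  set ind : α → ι → ℝ := fun a i => if bad a i then 1 else 0 with hind
  have hi0 : ∀ a i, 0 ≤ ind a i := fun a i => by simp only [hind]; split_ifs <;> norm_num
  have hi1 : ∀ a i, ind a i ≤ 1 := fun a i => by simp only [hind]; split_ifs <;> norm_num
  have hpt : ∀ a ∈ X, (if ∀ j, ∀ i ∈ P j, ¬ bad a i then (1 : ℝ) else 0) ≤
      ∏ j, truncSum (2 * b j) (P j) (ind a) := fun a _ => by
    calc (if ∀ j, ∀ i ∈ P j, ¬ bad a i then (1 : ℝ) else 0) ≤ ∏ j, ∏ i ∈ P j, (1 - ind a i) := by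
          split_ifs with h
          · refine le_of_eq (Eq.symm ?_)
            refine prod_eq_one fun j _ => prod_eq_one fun i hi => ?_
            simp [hind, h j i hi]
          · exact prod_nonneg fun j _ => prod_nonneg fun i _ => by linarith [hi1 a i]
      _ ≤ _ := Finset.prod_le_prod (fun j _ => prod_nonneg fun i _ => by linarith [hi1 a i])
          fun j _ => (truncSum_bounds (hi0 a) (hi1 a) (P j) (b j)).1
  have hexp : ∀ h : ι → ℝ, ∏ j, truncSum (2 * b j) (P j) h =
      ∑ u ∈ Fintype.piFinset T, (∏ j, (-1 : ℝ) ^ (u j).card) * ∏ j, ∏ i ∈ u j, h i := fun h => by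
    simp only [truncSum]; rw [prod_univ_sum]; exact sum_congr rfl fun u _ => prod_mul_distrib
  have hcount : ∀ u : 𝒥 → Finset ι, ∑ a ∈ X, ∏ j, ∏ i ∈ u j, ind a i =
      ((X.filter fun a => ∀ j, ∀ i ∈ u j, bad a i).card : ℝ) := fun u => by
    rw [card_filter]; push_cast
    refine sum_congr rfl fun a _ => ?_
    split_ifs with h
    · exact prod_eq_one fun j _ => prod_eq_one fun i hi => if_pos (h j i hi)
    · push Not at h
      obtain ⟨j, i, hi, h⟩ := h
      exact prod_eq_zero (mem_univ j) (prod_eq_zero hi (if_neg h))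
  have hsign : ∀ u : 𝒥 → Finset ι, |∏ j, (-1 : ℝ) ^ (u j).card| = 1 := fun u => by
    rw [abs_prod]; exact prod_eq_one fun j _ => by simp
  calc ((X.filter fun a => ∀ j, ∀ i ∈ P j, ¬ bad a i).card : ℝ)
      = ∑ a ∈ X, if ∀ j, ∀ i ∈ P j, ¬ bad a i then (1 : ℝ) else 0 := by rw [card_filter]; push_cast; rfl
    _ ≤ ∑ a ∈ X, ∏ j, truncSum (2 * b j) (P j) (ind a) := sum_le_sum hpt
    _ = ∑ u ∈ Fintype.piFinset T, (∏ j, (-1 : ℝ) ^ (u j).card) *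
          ((X.filter fun a => ∀ j, ∀ i ∈ u j, bad a i).card : ℝ) := by
        simp only [hexp]; rw [sum_comm]; exact sum_congr rfl fun u _ => by rw [← mul_sum, hcount]
    _ ≤ ∑ u ∈ Fintype.piFinset T, ((∏ j, (-1 : ℝ) ^ (u j).card) * (M * ∏ j, ∏ i ∈ u j, g i) +
          E * ∏ j, ∏ i ∈ u j, x i) := by
        refine sum_le_sum fun u hu => ?_
        have h2 := hR u fun j => mem_powerset.1
          (mem_filter.1 (Fintype.mem_piFinset.1 hu j)).1
        rw [← sub_le_iff_le_add', ← mul_sub]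
        refine (le_abs_self _).trans ?_
        rw [abs_mul, hsign, one_mul]; exact h2
    _ = M * ∏ j, truncSum (2 * b j) (P j) g + E * ∏ j, ∑ u ∈ T j, ∏ i ∈ u, x i := by
        rw [sum_add_distrib, hexp, prod_univ_sum, mul_sum, mul_sum]
        congr 1
        exact sum_congr rfl fun u _ => by ring
    _ ≤ _ := by
        refine add_le_add_left (mul_le_mul_of_nonneg_left (Finset.prod_le_prod (fun j _ => ?_)
          fun j _ => truncSum_even_le h0 h1 _ _) hM) _
        exact (prod_nonneg fun i _ => by linarith [h1 i]).trans
          (truncSum_bounds h0 h1 (P j) (b j)).1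

end BrunHooley

section PrimeSums

open Real

theorem sum_one_div_prime_dyadic_le {i : ℕ} (hi : 0 < i) :
    ∑ p ∈ (Ioc (2 ^ i) (2 ^ (i + 1))).filter Nat.Prime, (1 / p : ℝ) ≤ 4 / i := by
  have hi' : (0 : ℝ) < i := by exact_mod_cast hi
  have h1 : ∀ p ∈ (Ioc (2 ^ i) (2 ^ (i + 1))).filter Nat.Prime,
      (1 / p : ℝ) ≤ log p / (2 ^ i * (i * log 2)) := fun p hp => by
    have hp1 := (mem_Ioc.1 (mem_filter.1 hp).1).1
    have hp2 : (2 : ℝ) ^ i ≤ p := by exact_mod_cast hp1.le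
    have hp0 : (0 : ℝ) < p := lt_of_lt_of_le (by positivity) hp2
    have h2 : i * log 2 ≤ log p := by rw [← log_pow]; exact log_le_log (by positivity) hp2
    rw [div_le_div_iff₀ hp0 (by positivity), one_mul, mul_comm (log p)]
    exact mul_le_mul hp2 h2 (by positivity) hp0.le
  refine (sum_le_sum h1).trans ?_
  rw [← sum_div]
  have h3 : ∑ p ∈ (Ioc (2 ^ i) (2 ^ (i + 1))).filter Nat.Prime, log p ≤
      Chebyshev.theta ((2 ^ (i + 1) : ℕ) : ℝ) := by
    rw [Chebyshev.theta, Nat.floor_natCast]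
    refine sum_le_sum_of_subset_of_nonneg (filter_subset_filter _
      (Ioc_subset_Ioc_left (Nat.zero_le _))) fun p _ _ => log_natCast_nonneg _
  have h4 := h3.trans (Chebyshev.theta_le_log4_mul_x (by positivity))
  have h5 : log 4 = 2 * log 2 := by rw [show (4 : ℝ) = 2 ^ 2 by norm_num, log_pow]; norm_num
  rw [div_le_div_iff₀ (by positivity) hi']
  rw [h5] at h4
  push_cast at h4
  rw [pow_succ] at h4
  calc _ ≤ 2 * log 2 * (2 ^ i * 2) * i := mul_le_mul_of_nonneg_right h4 hi'.le
    _ = _ := by ring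

theorem sum_one_div_prime_block_le {I : ℕ} (hI : 0 < I) :
    ∑ p ∈ (Ioc (2 ^ I) (2 ^ (2 * I))).filter Nat.Prime, (1 / p : ℝ) ≤ 4 := by
  have key : ∀ k : ℕ, ∑ p ∈ (Ioc (2 ^ I) (2 ^ (I + k))).filter Nat.Prime, (1 / p : ℝ) ≤
      ∑ i ∈ range k, 4 / ((I + i : ℕ) : ℝ) := fun k => by
    induction k with
    | zero => simp
    | succ k ih =>
      rw [sum_range_succ]
      have hU : Ioc (2 ^ I) (2 ^ (I + (k + 1))) =
          Ioc (2 ^ I) (2 ^ (I + k)) ∪ Ioc (2 ^ (I + k)) (2 ^ (I + k + 1)) := by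
        rw [Ioc_union_Ioc_eq_Ioc] <;> [rfl; skip; skip] <;>
        exact Nat.pow_le_pow_right (by norm_num) (by omega)
      rw [hU, filter_union]
      have h1 := sum_union_inter (s₁ := (Ioc (2 ^ I) (2 ^ (I + k))).filter Nat.Prime)
        (s₂ := (Ioc (2 ^ (I + k)) (2 ^ (I + k + 1))).filter Nat.Prime)
        (f := fun p : ℕ => (1 / p : ℝ))
      have h2 := sum_one_div_prime_dyadic_le (i := I + k) (by omega)
      have h3 : 0 ≤ ∑ p ∈ (Ioc (2 ^ I) (2 ^ (I + k))).filter Nat.Prime ∩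
          (Ioc (2 ^ (I + k)) (2 ^ (I + k + 1))).filter Nat.Prime, (1 / p : ℝ) :=
        sum_nonneg fun p _ => by positivity
      linarith
  rw [two_mul]
  refine (key I).trans ?_
  calc ∑ i ∈ range I, 4 / ((I + i : ℕ) : ℝ) ≤ ∑ i ∈ range I, 4 / (I : ℝ) := by
        refine sum_le_sum fun i _ => div_le_div_of_nonneg_left (by norm_num)
          (by exact_mod_cast hI) (by exact_mod_cast Nat.le_add_right _ _)
    _ = 4 := by
        have : (I : ℝ) ≠ 0 := by exact_mod_cast hI.ne'
        rw [sum_const, card_range, nsmul_eq_mul]; field_simp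

theorem sum_telescope_le_one (N : ℕ) :
    ∑ n ∈ Ico 2 N, (1 / ((n : ℝ) - 1) - 1 / n) ≤ 1 := by
  have h : ∀ k : ℕ, ∑ n ∈ Ico 2 (2 + k), (1 / ((n : ℝ) - 1) - 1 / n) = 1 - 1 / (k + 1) := fun k => by
    induction k with
    | zero => simp
    | succ k ih =>
      rw [← add_assoc, sum_Ico_succ_top (by omega), ih]; push_cast
      have h1 : (2 + (k : ℝ) - 1) = k + 1 := by ring
      have h2 : (2 + (k : ℝ)) = k + 1 + 1 := by ring
      rw [h1, h2]; ring
  rcases le_total N 2 with h2 | h2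
  · rw [Ico_eq_empty_of_le h2]; simp
  · obtain ⟨k, rfl⟩ := Nat.exists_eq_add_of_le h2
    rw [h]
    have : (0 : ℝ) ≤ 1 / (k + 1) := by positivity
    linarith

theorem sum_primesBelow_telescope_le_one (N : ℕ) :
    ∑ p ∈ N.primesBelow, (1 / ((p : ℝ) - 1) - 1 / p) ≤ 1 := by
  refine (sum_le_sum_of_subset_of_nonneg (t := Ico 2 N) (fun p hp => ?_) ?_).trans
    (sum_telescope_le_one N)
  · have := Nat.mem_primesBelow.1 hp
    exact mem_Ico.2 ⟨this.2.two_le, this.1⟩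
  · intro n hn _
    have h2 : (2 : ℝ) ≤ n := by exact_mod_cast (mem_Ico.1 hn).1
    rw [sub_nonneg]; exact one_div_le_one_div_of_le (by linarith) (by linarith)

/-- A lower bound for the sum of the reciprocals of the primes. -/
theorem log_log_le_sum_one_div_primesBelow {N : ℕ} (hN : 2 ≤ N) :
    log (log N) ≤ ∑ p ∈ N.primesBelow, (1 / p : ℝ) + 1 := by
  let f : ℕ →* ℝ :=
    { toFun := fun n => (n : ℝ)⁻¹
      map_one' := by simp
      map_mul' := fun a b => by rw [Nat.cast_mul, mul_inv] }
  have hf : ∀ n : ℕ, f n = (n : ℝ)⁻¹ := fun n => rfl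
  have hp1 : ∀ {p : ℕ}, p.Prime → ‖f p‖ < 1 := fun {p} hp => by
    rw [hf, norm_inv, Real.norm_natCast]; exact inv_lt_one_of_one_lt₀ (by exact_mod_cast hp.one_lt)
  have hs := (EulerProduct.summable_and_hasSum_smoothNumbers_prod_primesBelow_geometric hp1 N).2
  have h1 : log N ≤ ∏ p ∈ N.primesBelow, (1 - f p)⁻¹ := by
    obtain ⟨M, rfl⟩ := Nat.exists_eq_add_of_le' (by omega : 1 ≤ N)
    have h2 := log_add_one_le_harmonic M
    push_cast at h2 ⊢
    refine h2.trans ?_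
    have hmem : ∀ i ∈ range M, i + 1 ∈ (M + 1).smoothNumbers := fun i hi =>
      Nat.mem_smoothNumbers_of_lt (Nat.succ_pos _) (by simpa using hi)
    have h3 := sum_le_hasSum (((range M).attach).image fun i =>
      (⟨i.1 + 1, hmem i.1 i.2⟩ : (M + 1).smoothNumbers)) (fun m _ => by rw [hf]; positivity) hs
    rw [sum_image] at h3
    · simp only [hf] at h3
      rw [sum_attach _ fun i : ℕ => (((i + 1 : ℕ) : ℝ))⁻¹] at h3
      refine le_trans (le_of_eq ?_) h3
      rw [harmonic]; push_cast; rfl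
    · intro a _ b _ hab
      have := congrArg (fun m : (M + 1).smoothNumbers => (m : ℕ)) hab
      exact Subtype.ext (by simpa using this)
  have h2 : ∏ p ∈ N.primesBelow, (1 - f p)⁻¹ ≤
      exp (∑ p ∈ N.primesBelow, (1 / p : ℝ) + 1) := by
    calc ∏ p ∈ N.primesBelow, (1 - f p)⁻¹ ≤ ∏ p ∈ N.primesBelow, exp (1 / ((p : ℝ) - 1)) := by
          refine Finset.prod_le_prod (fun p hp => ?_) fun p hp => ?_
          · have := hp1 (Nat.mem_primesBelow.1 hp).2
            rw [norm_eq_abs] at this; exact inv_nonneg.2 (by linarith [(abs_lt.1 this).2])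
          · have h2 : (2 : ℝ) ≤ p := by exact_mod_cast (Nat.mem_primesBelow.1 hp).2.two_le
            have h3 : (p : ℝ) - 1 ≠ 0 := by linarith
            have h4 : (p : ℝ) ≠ 0 := by linarith
            have : (1 - f p)⁻¹ = 1 / ((p : ℝ) - 1) + 1 := by rw [hf]; field_simp; ring
            rw [this]; exact add_one_le_exp _
      _ = exp (∑ p ∈ N.primesBelow, 1 / ((p : ℝ) - 1)) := (exp_sum _ _).symm
      _ ≤ _ := by
          refine exp_le_exp.2 ?_
          have := sum_primesBelow_telescope_le_one N
          rw [sum_sub_distrib] at this; linarith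
  have hlog : 0 < log N := log_pos (by exact_mod_cast hN)
  rw [← log_exp (∑ p ∈ N.primesBelow, (1 / p : ℝ) + 1)]; exact log_le_log hlog (h1.trans h2)

end PrimeSums

section AffineForms

variable {σ ι : Type*} [Fintype σ] [Fintype ι] [DecidableEq σ] [DecidableEq ι]

/-- The value of the `i`-th affine form of a system. -/
def affineForm {R : Type*} [CommRing R] (c : ι → ℤ) (m : ι → σ → ℤ) (i : ι) (y : σ → R) : R :=
  (c i : R) + ∑ s, (m i s : R) * y s

/-- The product of a system of affine forms. -/
def formProd {R : Type*} [CommRing R] (c : ι → ℤ) (m : ι → σ → ℤ) (y : σ → R) : R :=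
  ∏ i, affineForm c m i y

theorem map_formProd {R S : Type*} [CommRing R] [CommRing S] (φ : R →+* S) (c : ι → ℤ)
    (m : ι → σ → ℤ) (y : σ → R) : φ (formProd c m y) = formProd c m fun s => φ (y s) := by
  simp [formProd, affineForm, map_prod, map_sum]

/-- The number of zeros of the product of the forms modulo `d`. -/
noncomputable def zeroCount (c : ι → ℤ) (m : ι → σ → ℤ) (d : ℕ) : ℕ :=
  Nat.card {y : σ → ZMod d // formProd c m y = 0}

theorem zeroCount_one (c : ι → ℤ) (m : ι → σ → ℤ) : zeroCount c m 1 = 1 := by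
  rw [zeroCount, Nat.card_eq_one_iff_unique]
  exact ⟨⟨fun a b => Subtype.ext (funext fun s => Subsingleton.elim _ _)⟩,
    ⟨⟨fun _ => 0, Subsingleton.elim _ _⟩⟩⟩

theorem zeroCount_mul (c : ι → ℤ) (m : ι → σ → ℤ) {a b : ℕ} (hab : a.Coprime b) :
    zeroCount c m (a * b) = zeroCount c m a * zeroCount c m b := by
  rw [zeroCount, zeroCount, zeroCount, ← Nat.card_prod]
  set φ := ZMod.chineseRemainder hab
  let E : (σ → ZMod (a * b)) ≃ (σ → ZMod a) × (σ → ZMod b) :=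
    (Equiv.piCongrRight fun _ : σ => φ.toEquiv).trans (Equiv.arrowProdEquivProdArrow _ _ _)
  refine Nat.card_congr ((Equiv.subtypeEquiv E
    (q := fun z => formProd c m z.1 = 0 ∧ formProd c m z.2 = 0) fun y => ?_).trans
    (Equiv.subtypeProdEquivProd (p := fun y : σ → ZMod a => formProd c m y = 0)
      (q := fun y : σ → ZMod b => formProd c m y = 0)))
  have h1 : formProd c m y = 0 ↔ φ (formProd c m y) = 0 := (map_eq_zero_iff φ φ.injective).symm
  rw [h1, Prod.ext_iff]
  have h2 : (φ (formProd c m y)).1 = formProd c m (E y).1 := by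
    have := map_formProd ((RingHom.fst _ _).comp φ.toRingHom) c m y
    exact this
  have h3 : (φ (formProd c m y)).2 = formProd c m (E y).2 := by
    have := map_formProd ((RingHom.snd _ _).comp φ.toRingHom) c m y
    exact this
  rw [h2, h3]; rfl

theorem zeroCount_prod (c : ι → ℤ) (m : ι → σ → ℤ) {s : Finset ℕ} (hs : ∀ p ∈ s, p.Prime) :
    zeroCount c m (∏ p ∈ s, p) = ∏ p ∈ s, zeroCount c m p := by
  induction s using Finset.induction_on with
  | empty => simp [zeroCount_one]
  | insert p s hp ih =>
    have hs' : ∀ q ∈ s, q.Prime := fun q hq => hs q (mem_insert_of_mem hq)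
    rw [prod_insert hp, prod_insert hp, zeroCount_mul, ih hs']
    refine Nat.Coprime.prod_right fun q hq => ?_
    exact (Nat.coprime_primes (hs p (mem_insert_self _ _)) (hs' q hq)).2 fun h => hp (h ▸ hq)

theorem zeroCount_le (c : ι → ℤ) (m : ι → σ → ℤ) {d : ℕ} (hd : 0 < d) :
    zeroCount c m d ≤ d ^ Fintype.card σ := by
  have : NeZero d := ⟨hd.ne'⟩
  calc zeroCount c m d ≤ Nat.card (σ → ZMod d) := Nat.card_le_card_of_injective _ Subtype.val_injective
    _ = _ := by rw [Nat.card_eq_fintype_card, Fintype.card_fun, ZMod.card]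

theorem abs_prod_sub_pow_le {b : ℝ} (hb : 0 ≤ b) {a : σ → ℝ} (ha : ∀ s, 0 ≤ a s)
    (hab : ∀ s, |a s - b| ≤ 1) (S : Finset σ) :
    (b + 1) * |∏ s ∈ S, a s - b ^ S.card| ≤ S.card * (b + 1) ^ S.card := by
  induction S using Finset.induction_on with
  | empty => simp
  | insert s S hs ih =>
    rw [prod_insert hs, card_insert_of_notMem hs]
    have h1 : a s * ∏ x ∈ S, a x - b ^ (S.card + 1) =
        a s * (∏ x ∈ S, a x - b ^ S.card) + (a s - b) * b ^ S.card := by ring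
    have h2 : a s ≤ b + 1 := by linarith [(abs_le.1 (hab s)).2]
    have h3 : |a s * ∏ x ∈ S, a x - b ^ (S.card + 1)| ≤
        (b + 1) * |∏ x ∈ S, a x - b ^ S.card| + b ^ S.card := by
      rw [h1]
      refine (abs_add_le _ _).trans ?_
      rw [abs_mul, abs_mul, abs_of_nonneg (ha s), abs_of_nonneg (pow_nonneg hb _)]
      exact add_le_add (mul_le_mul_of_nonneg_right h2 (abs_nonneg _))
        (mul_le_of_le_one_left (pow_nonneg hb _) (hab s))
    have h4 : b ^ S.card ≤ (b + 1) ^ S.card := pow_le_pow_left₀ hb (by linarith) _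
    calc _ ≤ (b + 1) * ((b + 1) * |∏ x ∈ S, a x - b ^ S.card| + b ^ S.card) :=
          mul_le_mul_of_nonneg_left h3 (by linarith)
      _ ≤ (b + 1) * (S.card * (b + 1) ^ S.card + (b + 1) ^ S.card) :=
          mul_le_mul_of_nonneg_left (add_le_add ih h4) (by linarith)
      _ = _ := by push_cast; ring

theorem abs_card_residue_sub_le (K : ℕ) {d : ℕ} (hd : 0 < d) (v : ZMod d) :
    |(((range K).filter fun x : ℕ => (x : ZMod d) = v).card : ℝ) - (K : ℝ) / d| ≤ 1 := by
  have : NeZero d := ⟨hd.ne'⟩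
  have h1 : ((range K).filter fun x : ℕ => (x : ZMod d) = v) =
      (range K).filter fun x : ℕ => x ≡ v.val [MOD d] := by
    refine filter_congr fun x _ => ?_
    rw [← ZMod.natCast_eq_natCast_iff, ZMod.natCast_val, ZMod.cast_id', id]
  rw [h1, ← Nat.count_eq_card_filter_range, Nat.count_modEq_card _ hd]
  have hd' : (0 : ℝ) < d := by exact_mod_cast hd
  have h2 : (K : ℝ) = d * ((K / d : ℕ) : ℝ) + ((K % d : ℕ) : ℝ) := by exact_mod_cast (Nat.div_add_mod K d).symm
  have h3 : ((K % d : ℕ) : ℝ) < d := by exact_mod_cast Nat.mod_lt K hd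
  have h5 : (K : ℝ) / d = ((K / d : ℕ) : ℝ) + ((K % d : ℕ) : ℝ) / d := by
    rw [eq_comm, ← sub_eq_zero]; rw [h2]; field_simp; ring
  have h6 : ((K % d : ℕ) : ℝ) / d < 1 := (div_lt_one hd').2 h3
  have h7 : 0 ≤ ((K % d : ℕ) : ℝ) / d := by positivity
  rw [h5, abs_le]
  split_ifs <;> constructor <;> push_cast <;> linarith

/-- The number of points of a box at which `d` divides the product of the forms. -/
theorem abs_card_dvd_formProd_sub_le [Nonempty σ] (c : ι → ℤ) (m : ι → σ → ℤ) {K d : ℕ} (hK : 0 < K)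
    (hd : 0 < d) :
    |(((Fintype.piFinset fun _ : σ => range K).filter fun y =>
        (d : ℤ) ∣ formProd c m fun s => (y s : ℤ)).card : ℝ) -
      (K : ℝ) ^ Fintype.card σ * (zeroCount c m d / (d : ℝ) ^ Fintype.card σ)| ≤
    Fintype.card σ * 2 ^ Fintype.card σ * ((K : ℝ) ^ Fintype.card σ / K) * d := by
  have : NeZero d := ⟨hd.ne'⟩
  have hd' : (0 : ℝ) < d := by exact_mod_cast hd
  have hK' : (0 : ℝ) < K := by exact_mod_cast hK
  set D := Fintype.card σ
  have hD1 : (1 : ℝ) ≤ D := by exact_mod_cast Fintype.card_pos (α := σ)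
  set B := Fintype.piFinset fun _ : σ => range K with hB
  have hnz : (zeroCount c m d : ℝ) ≤ (d : ℝ) ^ D := by exact_mod_cast zeroCount_le c m hd
  have h2D : (1 : ℝ) ≤ 2 ^ D := one_le_pow₀ one_le_two
  rcases lt_or_ge K d with hlt | hge
  · have h1 : ((B.filter fun y => (d : ℤ) ∣ formProd c m fun s => (y s : ℤ)).card : ℝ) ≤
        (K : ℝ) ^ D := by
      have := card_filter_le B fun y => (d : ℤ) ∣ formProd c m fun s => (y s : ℤ)
      rw [hB, Fintype.card_piFinset, prod_const, card_range, card_univ] at this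
      exact_mod_cast this
    have h2 : (K : ℝ) ^ D * (zeroCount c m d / (d : ℝ) ^ D) ≤ (K : ℝ) ^ D :=
      mul_le_of_le_one_right (by positivity) ((div_le_one (by positivity)).2 hnz)
    have h3 : 0 ≤ (K : ℝ) ^ D * (zeroCount c m d / (d : ℝ) ^ D) := by positivity
    have h4 : (K : ℝ) ^ D ≤ D * 2 ^ D * ((K : ℝ) ^ D / K) * d := by
      have h5 : (K : ℝ) ^ D ≤ ((K : ℝ) ^ D / K) * d := by
        rw [div_mul_eq_mul_div, le_div_iff₀ hK']
        exact mul_le_mul_of_nonneg_left (by exact_mod_cast hlt.le) (by positivity)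
      rw [mul_assoc]
      exact h5.trans (le_mul_of_one_le_left (by positivity) (one_le_mul_of_one_le_of_one_le hD1 h2D))
    rw [abs_le]
    constructor <;> [linarith; linarith]
  · set cnt : ZMod d → ℝ := fun v =>
      (((range K).filter fun x : ℕ => (x : ZMod d) = v).card : ℝ) with hcnt
    set b : ℝ := (K : ℝ) / d with hb
    have hb1 : 1 ≤ b := by rw [hb, le_div_iff₀ hd', one_mul]; exact_mod_cast hge
    classical
    have hcard : ((B.filter fun y => (d : ℤ) ∣ formProd c m fun s => (y s : ℤ)).card : ℝ) =
        ∑ v : {v : σ → ZMod d // formProd c m v = 0}, ∏ s, cnt (v.1 s) := by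
      rw [card_eq_sum_card_fiberwise (f := fun y : σ → ℕ => fun s => (y s : ZMod d))
        (t := univ.filter fun v : σ → ZMod d => formProd c m v = 0)]
      · push_cast
        rw [sum_subtype (p := fun v : σ → ZMod d => formProd c m v = 0) _
          (by intro v; simp)]
        refine sum_congr rfl fun v _ => ?_
        rw [hcnt, ← Nat.cast_prod, ← Fintype.card_piFinset]
        congr 2
        ext y
        simp only [mem_filter, Fintype.mem_piFinset, hB]
        constructor
        · rintro ⟨⟨h1, _⟩, h2⟩ s
          exact ⟨h1 s, congrFun h2 s⟩
        · intro h
          have h2 : (fun s => (y s : ZMod d)) = v.1 := funext fun s => (h s).2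
          refine ⟨⟨fun s => (h s).1, ?_⟩, h2⟩
          rw [← ZMod.intCast_zmod_eq_zero_iff_dvd]
          have := map_formProd (Int.castRingHom (ZMod d)) c m fun s => (y s : ℤ)
          simp only [eq_intCast, Int.cast_natCast] at this; rw [this, h2, v.2]
      · intro y hy
        have hy := (mem_filter.1 hy).2
        rw [← ZMod.intCast_zmod_eq_zero_iff_dvd] at hy
        have := map_formProd (Int.castRingHom (ZMod d)) c m fun s => (y s : ℤ)
        simp only [eq_intCast, Int.cast_natCast] at this
        simp only [coe_filter, mem_univ, true_and]
        change formProd c m _ = 0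
        rw [← this, hy]
    have hzc : (zeroCount c m d : ℝ) =
        (Fintype.card {v : σ → ZMod d // formProd c m v = 0} : ℝ) := by
      rw [zeroCount, Nat.card_eq_fintype_card]
    have hmain : (K : ℝ) ^ D * (zeroCount c m d / (d : ℝ) ^ D) =
        ∑ v : {v : σ → ZMod d // formProd c m v = 0}, b ^ D := by
      rw [sum_const, card_univ, nsmul_eq_mul, ← hzc, hb, div_pow]; ring
    rw [hcard, hmain, ← sum_sub_distrib]
    have hterm : ∀ v : {v : σ → ZMod d // formProd c m v = 0},
        |∏ s, cnt (v.1 s) - b ^ D| ≤ D * (b + 1) ^ D / (b + 1) := fun v => by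
      rw [le_div_iff₀ (by linarith), mul_comm]
      have := abs_prod_sub_pow_le (b := b) (by linarith) (a := fun s => cnt (v.1 s))
        (fun s => Nat.cast_nonneg _) (fun s => abs_card_residue_sub_le K hd _) univ
      rwa [card_univ] at this
    refine (abs_sum_le_sum_abs _ _).trans ((sum_le_sum fun v _ => hterm v).trans ?_)
    rw [sum_const, card_univ, nsmul_eq_mul, ← hzc]
    have h5 : (D : ℝ) * (b + 1) ^ D / (b + 1) ≤ D * (2 * b) ^ D / b := by
      refine div_le_div₀ (by positivity) ?_ (by linarith) (by linarith)
      exact mul_le_mul_of_nonneg_left (pow_le_pow_left₀ (by linarith) (by linarith) _) (by positivity)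
    calc (zeroCount c m d : ℝ) * (D * (b + 1) ^ D / (b + 1)) ≤
          (d : ℝ) ^ D * (D * (2 * b) ^ D / b) := mul_le_mul hnz h5 (by positivity) (by positivity)
      _ = _ := by rw [hb, mul_pow, div_pow]; field_simp

end AffineForms

section AffineForms

variable {σ ι : Type*} [Fintype σ] [Fintype ι] [DecidableEq σ] [DecidableEq ι]

/-- The linear part of an affine form. -/
def linearPart (m : ι → σ → ℤ) (p : ℕ) (i : ι) : (σ → ZMod p) →+ ZMod p where
  toFun y := ∑ s, (m i s : ZMod p) * y s
  map_zero' := by simp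
  map_add' y z := by simp [mul_add, sum_add_distrib]

/-- The linear parts of the forms are nonzero and pairwise independent modulo `p`. -/
def PairwiseIndependent (m : ι → σ → ℤ) (p : ℕ) : Prop :=
  (∀ i, Function.Surjective (linearPart m p i)) ∧
    ∀ i j, i ≠ j → Function.Surjective ((linearPart m p i).prod (linearPart m p j))

theorem card_mul_card_fiber {G H : Type*} [AddGroup G] [AddGroup H] [Fintype G] [Fintype H]
    [DecidableEq H] (f : G →+ H) (hf : Function.Surjective f) (h : H) :
    Fintype.card H * (univ.filter fun g => f g = h).card = Fintype.card G := by
  rw [← card_univ (α := G), card_eq_sum_card_fiberwise (s := (univ : Finset G))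
    (f := f) (t := univ) (by intro x _; simp)]
  rw [sum_congr rfl fun h' _ => AddMonoidHom.card_fiber_eq_of_mem_range f (hf h') (hf h)]; simp

theorem zeroCount_prime_bounds (c : ι → ℤ) {m : ι → σ → ℤ} {p : ℕ} (hp : p.Prime)
    (hm : PairwiseIndependent m p) :
    (zeroCount c m p : ℝ) / (p : ℝ) ^ Fintype.card σ ≤ Fintype.card ι / p ∧
    (Fintype.card ι : ℝ) / p - (Fintype.card ι : ℝ) ^ 2 * (1 / (p : ℝ) ^ 2) ≤
      (zeroCount c m p : ℝ) / (p : ℝ) ^ Fintype.card σ := by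
  classical
  have := Fact.mk hp
  have hp0 : (0 : ℝ) < p := by exact_mod_cast hp.pos
  set t := Fintype.card ι
  set V : ℝ := (p : ℝ) ^ Fintype.card σ
  have hV0 : 0 < V := by positivity
  have hVc : (Fintype.card (σ → ZMod p) : ℝ) = V := by rw [Fintype.card_fun, ZMod.card]; push_cast; rfl
  have hform : ∀ i (y : σ → ZMod p), affineForm c m i y = 0 ↔ linearPart m p i y = -(c i : ZMod p) :=
    fun i y => by rw [affineForm, add_comm, add_eq_zero_iff_eq_neg]; rfl
  set ind : ι → (σ → ZMod p) → ℝ := fun i y => if affineForm c m i y = 0 then 1 else 0 with hind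
  have h1 : ∀ i, ∑ y, ind i y = V / p := fun i => by
    have := card_mul_card_fiber (linearPart m p i) (hm.1 i) (-(c i : ZMod p))
    rw [ZMod.card] at this
    simp only [hind, hform]; rw [sum_boole, eq_div_iff hp0.ne', ← hVc, ← this]
    push_cast; ring
  have h2 : ∀ i j, i ≠ j → ∑ y, ind i y * ind j y = V / p ^ 2 := fun i j hij => by
    have := card_mul_card_fiber _ (hm.2 i j hij) (-(c i : ZMod p), -(c j : ZMod p))
    rw [Fintype.card_prod, ZMod.card] at this
    have e : ∀ y, ind i y * ind j y =
        if (linearPart m p i).prod (linearPart m p j) y = (-(c i : ZMod p), -(c j : ZMod p))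
          then 1 else 0 := fun y => by
      simp only [hind, hform, AddMonoidHom.prod_apply, Prod.mk.injEq]
      split_ifs <;> simp_all
    simp only [e]; rw [sum_boole, eq_div_iff (by positivity), ← hVc, ← this]
    push_cast; ring
  set z : (σ → ZMod p) → ℝ := fun y => if formProd c m y = 0 then 1 else 0 with hz
  have hzc : (zeroCount c m p : ℝ) = ∑ y, z y := by
    rw [zeroCount, Nat.card_eq_fintype_card, Fintype.card_subtype, hz, sum_boole]
  have hz0 : ∀ y : σ → ZMod p, formProd c m y = 0 ↔ ∃ i, affineForm c m i y = 0 := fun y => by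
    rw [formProd, prod_eq_zero_iff]; simp
  have hi0 : ∀ i y, 0 ≤ ind i y := fun i y => by simp only [hind]; split_ifs <;> norm_num
  constructor
  · have h3 : ∀ y, z y ≤ ∑ i, ind i y := fun y => by
      simp only [hz]
      split_ifs with h
      · obtain ⟨i, hi⟩ := (hz0 y).1 h
        calc (1 : ℝ) = ind i y := by simp [hind, hi]
          _ ≤ _ := single_le_sum (f := fun i => ind i y) (fun j _ => hi0 j y) (mem_univ i)
      · exact sum_nonneg fun i _ => hi0 i y
    have h4 : (zeroCount c m p : ℝ) ≤ t * (V / p) := by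
      rw [hzc]
      refine (sum_le_sum fun y _ => h3 y).trans ?_
      rw [sum_comm]
      simp only [h1, sum_const, card_univ, nsmul_eq_mul]; exact le_rfl
    rw [div_le_iff₀ hV0]
    refine h4.trans (le_of_eq ?_)
    ring
  · have h3 : ∀ y, ∑ i, ind i y - ∑ i, ∑ j, (if i = j then 0 else ind i y * ind j y) ≤ z y := fun y => by
      set n : ℕ := (univ.filter fun i => affineForm c m i y = 0).card with hn
      have e1 : ∑ i, ind i y = n := by rw [hn, hind, sum_boole]
      have e2 : ∑ i, ∑ j, (if i = j then 0 else ind i y * ind j y) = n * n - n := by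
        have e3 : ∀ i j, (if i = j then 0 else ind i y * ind j y) =
            ind i y * ind j y - if i = j then ind i y else 0 := fun i j => by
          split_ifs with h
          · subst h
            simp only [hind]; split_ifs <;> norm_num
          · ring
        simp only [e3, sum_sub_distrib]; rw [← sum_mul_sum, e1]
        simp [e1]
      rw [e1, e2]
      simp only [hz]
      split_ifs with h
      · have : (n : ℝ) * n ≥ 2 * n - 1 := by nlinarith [sq_nonneg ((n : ℝ) - 1)]
        linarith
      · have : n = 0 := by rw [hn, card_eq_zero, filter_eq_empty_iff]; exact fun i _ hi => h ((hz0 y).2 ⟨i, hi⟩)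
        simp [this]
    have h4 := sum_le_sum fun y (_ : y ∈ (univ : Finset (σ → ZMod p))) => h3 y
    rw [← hzc, sum_sub_distrib, sum_comm] at h4
    simp only [h1, sum_const, card_univ, nsmul_eq_mul] at h4
    have h5 : ∑ y : σ → ZMod p, ∑ i, ∑ j, (if i = j then 0 else ind i y * ind j y) ≤
        t ^ 2 * (V / p ^ 2) := by
      rw [sum_comm]
      calc _ ≤ ∑ i : ι, ∑ j : ι, V / (p : ℝ) ^ 2 := by
            refine sum_le_sum fun i _ => ?_
            rw [sum_comm]
            refine sum_le_sum fun j _ => ?_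
            by_cases hij : i = j
            · simp only [hij, if_true, sum_const_zero]; positivity
            · simp only [hij, if_false]; exact (h2 i j hij).le
        _ = _ := by simp only [sum_const, card_univ, nsmul_eq_mul]; ring
    rw [le_div_iff₀ hV0]
    have e6 : ((t : ℝ) / p - (t : ℝ) ^ 2 * (1 / (p : ℝ) ^ 2)) * V =
        t * (V / p) - t ^ 2 * (V / p ^ 2) := by ring
    rw [e6]; linarith

theorem exp_neg_two_mul_le {x : ℝ} (h0 : 0 ≤ x) (h1 : x ≤ 1 / 2) : Real.exp (-(2 * x)) ≤ 1 - x := by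
  rw [Real.exp_neg, inv_le_comm₀ (Real.exp_pos _) (by linarith)]
  refine le_trans ?_ (Real.add_one_le_exp _)
  rw [inv_le_iff_one_le_mul₀ (by linarith)]; nlinarith

theorem sum_block_exponents_le (J : ℕ) :
    ∑ j ∈ range J, 2 ^ (j + 1) * (4 * (J - j) + 1) + 18 ≤ 18 * 2 ^ J := by
  induction J with
  | zero => simp
  | succ J ih =>
    rw [sum_range_succ]
    have h1 : ∑ j ∈ range J, 2 ^ (j + 1) * (4 * (J + 1 - j) + 1) =
        ∑ j ∈ range J, 2 ^ (j + 1) * (4 * (J - j) + 1) + 8 * ∑ j ∈ range J, 2 ^ j := by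
      rw [mul_sum, ← sum_add_distrib]
      refine sum_congr rfl fun j hj => ?_
      rw [Nat.sub_add_comm (mem_range.1 hj).le, pow_succ]; ring
    have h2 := Nat.geomSum_eq (le_refl 2) J
    have h3 : ∑ j ∈ range J, 2 ^ j ≤ 2 ^ J := by rw [h2]; simp
    rw [h1, show J + 1 - J = 1 by omega, pow_succ]
    omega

theorem sum_one_div_two_pow_sub_le (J : ℕ) : ∑ j ∈ range J, (1 / 2 ^ (J - j) : ℝ) ≤ 1 := by
  induction J with
  | zero => simp
  | succ J ih =>
    rw [sum_range_succ, show J + 1 - J = 1 by omega]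
    have h1 : ∑ j ∈ range J, (1 / 2 ^ (J + 1 - j) : ℝ) =
        (1 / 2) * ∑ j ∈ range J, (1 / 2 ^ (J - j) : ℝ) := by
      rw [mul_sum]
      refine sum_congr rfl fun j hj => ?_
      rw [Nat.sub_add_comm (mem_range.1 hj).le, pow_succ]; ring
    rw [h1]; linarith

end AffineForms

section PrimeBlocks

open Real

/-- The primes other than `q` in the `j`-th block. -/
def primeBlock (w q j : ℕ) : Finset ℕ :=
  (Ioc (2 ^ (w * 2 ^ j)) (2 ^ (w * 2 ^ (j + 1)))).filter fun p => p.Prime ∧ p ≠ q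

theorem mem_primeBlock {w q j p : ℕ} : p ∈ primeBlock w q j ↔
    (2 ^ (w * 2 ^ j) < p ∧ p ≤ 2 ^ (w * 2 ^ (j + 1))) ∧ p.Prime ∧ p ≠ q := by
  rw [primeBlock, mem_filter, mem_Ioc]

theorem disjoint_primeBlock (w q : ℕ) {i j : ℕ} (hij : i ≠ j) :
    Disjoint (primeBlock w q i) (primeBlock w q j) := by
  wlog h : i < j generalizing i j with H
  · exact (H hij.symm (lt_of_le_of_ne (not_lt.1 h) hij.symm)).symm
  refine disjoint_left.2 fun p hp hp' => ?_
  have h1 := (mem_primeBlock.1 hp).1.2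
  have h2 := (mem_primeBlock.1 hp').1.1
  have h3 : 2 ^ (w * 2 ^ (i + 1)) ≤ 2 ^ (w * 2 ^ j) := Nat.pow_le_pow_right (by norm_num)
    (Nat.mul_le_mul_left _ (Nat.pow_le_pow_right (by norm_num) h))
  omega

theorem exists_mem_primeBlock {w q p : ℕ} (hp : p.Prime) (hq : p ≠ q) (h1 : 2 ^ w < p) (J : ℕ)
    (h2 : p ≤ 2 ^ (w * 2 ^ J)) : ∃ j < J, p ∈ primeBlock w q j := by
  induction J with
  | zero => simp at h2; omega
  | succ J ih =>
    by_cases h : p ≤ 2 ^ (w * 2 ^ J)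
    · obtain ⟨j, hj, hm⟩ := ih h
      exact ⟨j, by omega, hm⟩
    · exact ⟨J, by omega, mem_primeBlock.2 ⟨⟨not_le.1 h, h2⟩, hp, hq⟩⟩

theorem sum_one_div_primeBlock_le {w : ℕ} (hw : 0 < w) (q j : ℕ) :
    ∑ p ∈ primeBlock w q j, (1 / p : ℝ) ≤ 4 := by
  refine (sum_le_sum_of_subset_of_nonneg ?_ fun p _ _ => by positivity).trans
    (sum_one_div_prime_block_le (I := w * 2 ^ j) (by positivity))
  intro p hp
  have h := mem_primeBlock.1 hp
  rw [mem_filter, mem_Ioc]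
  refine ⟨⟨h.1.1, h.1.2.trans (le_of_eq ?_)⟩, h.2.1⟩
  rw [pow_succ]; ring_nf

theorem le_sum_one_div_primeBlocks {w : ℕ} (hw : 2 ≤ w) (q J : ℕ) :
    J * log 2 - 2 ^ w - 3 ≤ ∑ j : Fin J, ∑ p ∈ primeBlock w q j, (1 / p : ℝ) := by
  classical
  set Z := 2 ^ (w * 2 ^ J) with hZ
  have hw2 : 2 ≤ w * 2 ^ J := le_mul_of_le_of_one_le hw Nat.one_le_two_pow
  have hZ2 : 2 ≤ Z := by
    calc 2 = 2 ^ 1 := rfl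
      _ ≤ Z := Nat.pow_le_pow_right (by norm_num) (by omega)
  have h1 := log_log_le_sum_one_div_primesBelow hZ2
  have hlog : (J : ℝ) * log 2 ≤ log (log Z) := by
    have e1 : log (Z : ℝ) = 2 ^ J * (w * log 2) := by
      rw [hZ]; push_cast; rw [log_pow]; push_cast; ring
    have h2 : (1 : ℝ) ≤ w * log 2 := by
      have : (2 : ℝ) ≤ w := by exact_mod_cast hw
      have := log_two_gt_d9
      nlinarith
    rw [e1, ← log_pow]
    exact log_le_log (by positivity) (le_mul_of_one_le_right (by positivity) h2)
  have h3 : ∑ p ∈ Z.primesBelow, (1 / p : ℝ) ≤ ∑ p ∈ range (2 ^ w + 1), (1 : ℝ) +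
      (1 + ∑ j : Fin J, ∑ p ∈ primeBlock w q j, (1 / p : ℝ)) := by
    have hpos : ∀ p : ℕ, 0 ≤ (1 / p : ℝ) := fun p => by positivity
    have hle : ∀ p : ℕ, (1 / p : ℝ) ≤ 1 := fun p => by
      rcases Nat.eq_zero_or_pos p with rfl | hp
      · simp
      · exact (div_le_one (by exact_mod_cast hp)).2 (by exact_mod_cast hp)
    have hsub : Z.primesBelow ⊆ range (2 ^ w + 1) ∪ ({q} ∪
        univ.biUnion fun j : Fin J => primeBlock w q j) := by
      intro p hp
      have hp := Nat.mem_primesBelow.1 hp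
      rw [mem_union, mem_union, mem_range, mem_singleton,
        mem_biUnion]
      by_cases h4 : p < 2 ^ w + 1
      · exact Or.inl h4
      by_cases h5 : p = q
      · exact Or.inr (Or.inl h5)
      obtain ⟨j, hj, hm⟩ := exists_mem_primeBlock (w := w) hp.2 h5 (by omega) J hp.1.le
      exact Or.inr (Or.inr ⟨⟨j, hj⟩, mem_univ _, hm⟩)
    have hun : ∀ s t : Finset ℕ, ∑ p ∈ s ∪ t, (1 / p : ℝ) ≤ ∑ p ∈ s, (1 / p : ℝ) + ∑ p ∈ t, (1 / p : ℝ) :=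
      fun s t => by
        rw [← sum_union_inter]
        exact le_add_of_nonneg_right (sum_nonneg fun p _ => hpos p)
    refine (sum_le_sum_of_subset_of_nonneg hsub fun p _ _ => hpos p).trans ?_
    refine (hun _ _).trans (add_le_add (sum_le_sum fun p _ => hle p) ?_)
    refine (hun _ _).trans (add_le_add (by simpa using hle q) (le_of_eq ?_))
    exact sum_biUnion fun i _ j _ hij => disjoint_primeBlock w q fun h => hij (Fin.ext h)
  rw [sum_const, card_range, nsmul_eq_mul, mul_one] at h3
  push_cast at h3
  linarith

theorem sum_one_div_sq_primeBlocks_le (w q J : ℕ) :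
    ∑ j : Fin J, ∑ p ∈ primeBlock w q j, (1 / (p : ℝ) ^ 2) ≤ 1 := by
  classical
  rw [← sum_biUnion fun i _ j _ hij => disjoint_primeBlock w q fun h => hij (Fin.ext h)]
  set s := univ.biUnion fun j : Fin J => primeBlock w q j
  obtain ⟨N, hN⟩ := s.bddAbove
  have hmem : ∀ p ∈ s, p ∈ (N + 1).primesBelow := fun p hp => by
    obtain ⟨j, _, hj⟩ := mem_biUnion.1 hp
    exact Nat.mem_primesBelow.2 ⟨Nat.lt_succ_of_le (hN hp), (mem_primeBlock.1 hj).2.1⟩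
  have h1 : ∀ p ∈ (N + 1).primesBelow, 1 / (p : ℝ) ^ 2 ≤ 1 / ((p : ℝ) - 1) - 1 / p := fun p hp => by
    have h2 : (2 : ℝ) ≤ p := by exact_mod_cast (Nat.mem_primesBelow.1 hp).2.two_le
    have h3 : (p : ℝ) - 1 ≠ 0 := by linarith
    rw [div_sub_div _ _ h3 (by linarith), div_le_div_iff₀ (by positivity) (by nlinarith)]
    nlinarith
  exact (sum_le_sum_of_subset_of_nonneg hmem fun p _ _ => by positivity).trans
    ((sum_le_sum h1).trans (sum_primesBelow_telescope_le_one _))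

end PrimeBlocks

section Sieve

open Real

variable {σ ι : Type*} [Fintype σ] [Fintype ι] [DecidableEq σ] [DecidableEq ι]

theorem prod_le_exp_of_density {P : Finset ℕ} {g : ℕ → ℝ} (h0 : ∀ p, 0 ≤ g p)
    (h1 : ∀ p ∈ P, g p ≤ 1 / 2) {B : ℝ} (hB : ∑ p ∈ P, g p ≤ B) (b : ℕ) :
    ∏ p ∈ P, (1 - g p) + exp (2 * ∑ p ∈ P, g p) / 2 ^ (2 * b + 1) ≤
      exp (-∑ p ∈ P, g p) * exp (exp (4 * B) * (1 / 2 ^ b)) := by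
  have hV : exp (-(2 * B)) ≤ ∏ p ∈ P, (1 - g p) := by
    calc exp (-(2 * B)) ≤ exp (∑ p ∈ P, -(2 * g p)) := by
          rw [sum_neg_distrib, ← mul_sum]; exact exp_le_exp.2 (by linarith)
      _ = ∏ p ∈ P, exp (-(2 * g p)) := exp_sum _ _
      _ ≤ _ := Finset.prod_le_prod (fun p _ => (exp_pos _).le)
          fun p hp => exp_neg_two_mul_le (h0 p) (h1 p hp)
  have hV2 : ∏ p ∈ P, (1 - g p) ≤ exp (-∑ p ∈ P, g p) := by
    rw [← sum_neg_distrib, exp_sum]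
    refine Finset.prod_le_prod (fun p hp => by linarith [h1 p hp]) fun p _ => ?_
    exact one_sub_le_exp_neg _
  set V := ∏ p ∈ P, (1 - g p)
  have hV0 : 0 < V := lt_of_lt_of_le (exp_pos _) hV
  have h2 : exp (2 * ∑ p ∈ P, g p) / 2 ^ (2 * b + 1) ≤ V * (exp (4 * B) * (1 / 2 ^ b)) := by
    calc exp (2 * ∑ p ∈ P, g p) / 2 ^ (2 * b + 1) ≤ exp (2 * B) / 2 ^ b := by
          refine div_le_div₀ (exp_pos _).le (exp_le_exp.2 (by linarith)) (by positivity) ?_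
          exact pow_le_pow_right₀ one_le_two (by omega)
      _ = exp (-(2 * B)) * (exp (4 * B) * (1 / 2 ^ b)) := by
          rw [← mul_assoc, ← exp_add, div_eq_mul_one_div]; ring_nf
      _ ≤ _ := mul_le_mul_of_nonneg_right hV (by positivity)
  calc _ ≤ V * (exp (4 * B) * (1 / 2 ^ b) + 1) := by linarith
    _ ≤ V * exp (exp (4 * B) * (1 / 2 ^ b)) :=
        mul_le_mul_of_nonneg_left (add_one_le_exp _) hV0.le
    _ ≤ _ := mul_le_mul_of_nonneg_right hV2 (exp_pos _).le

theorem sum_truncated_primeBlock_le {w : ℕ} (hw : 2 ≤ w) (q j b : ℕ) :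
    ∑ u ∈ (primeBlock w q j).powerset with u.card ≤ 2 * b, ∏ p ∈ u, (p : ℝ) ≤
      ((2 ^ w : ℕ) : ℝ) ^ (2 ^ (j + 1) * (4 * b + 1)) := by
  set z : ℝ := 2 ^ (w * 2 ^ (j + 1)) with hz
  have h4 : (4 : ℝ) ≤ z := by
    rw [hz, show (4 : ℝ) = 2 ^ 2 by norm_num]
    refine pow_le_pow_right₀ one_le_two ?_
    exact hw.trans (Nat.le_mul_of_pos_right _ (by positivity))
  have hs : ∑ p ∈ primeBlock w q j, (p : ℝ) ≤ z ^ 2 := by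
    have h1 : ∀ p ∈ primeBlock w q j, (p : ℝ) ≤ z := fun p hp => by
      rw [hz]; exact_mod_cast (mem_primeBlock.1 hp).1.2
    refine (sum_le_sum h1).trans ?_
    rw [sum_const, nsmul_eq_mul, sq]
    refine mul_le_mul_of_nonneg_right ?_ (by positivity)
    have h2 : (primeBlock w q j).card ≤ 2 ^ (w * 2 ^ (j + 1)) := by
      refine (card_filter_le _ _).trans ?_
      rw [Nat.card_Ioc]; exact Nat.sub_le _ _
    rw [hz]; exact_mod_cast h2
  refine (sum_truncated_prod_le (fun p => Nat.cast_nonneg p) _ _ (by nlinarith) hs).trans ?_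
  have he : exp 1 ≤ z := by linarith [exp_one_lt_d9]
  calc (z ^ 2) ^ (2 * b) * exp 1 ≤ (z ^ 2) ^ (2 * b) * z :=
        mul_le_mul_of_nonneg_left he (by positivity)
    _ = z ^ (4 * b + 1) := by rw [← pow_mul, pow_succ]; ring_nf
    _ = _ := by rw [hz]; push_cast; rw [← pow_mul, ← pow_mul]; ring_nf

theorem card_filter_dvd_eq (c : ι → ℤ) (m : ι → σ → ℤ) (K : ℕ) {s : Finset ℕ}
    (hs : ∀ p ∈ s, p.Prime) :
    ((Fintype.piFinset fun _ : σ => range K).filter fun y => ∀ p ∈ s,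
      (p : ℤ) ∣ formProd c m fun s => (y s : ℤ)) =
    (Fintype.piFinset fun _ : σ => range K).filter fun y =>
      ((∏ p ∈ s, p : ℕ) : ℤ) ∣ formProd c m fun s => (y s : ℤ) := by
  refine filter_congr fun y _ => ?_
  simp only [Int.natCast_dvd]
  refine ⟨fun h => prod_primes_dvd _ (fun p hp => (hs p hp).prime) h,
    fun h p hp => (dvd_prod_of_mem _ hp).trans h⟩

open Classical in
/-- Upper bound sieve for systems of pairwise independent affine forms. -/
theorem exists_card_sifted_le (σ ι : Type*) [Fintype σ] [Fintype ι] [DecidableEq σ] [DecidableEq ι]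
    [Nonempty σ] [Nonempty ι] : ∃ C : ℝ, 0 < C ∧ ∃ K₀ : ℕ, ∀ K ≥ K₀, ∀ (q : ℕ) (c : ι → ℤ)
      (m : ι → σ → ℤ), (∀ p : ℕ, p.Prime → p ≠ q → PairwiseIndependent m p) →
      (((Fintype.piFinset fun _ : σ => range K).filter fun y => ∀ p : ℕ, p.Prime → p * p ≤ K →
        p ≠ q → ¬ (p : ℤ) ∣ formProd c m fun s => (y s : ℤ)).card : ℝ) ≤
      C * (K : ℝ) ^ Fintype.card σ / log K ^ Fintype.card ι := by
  set t := Fintype.card ι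
  set D := Fintype.card σ with hD
  have ht1 : 1 ≤ t := Fintype.card_pos
  set w := 2 * t with hw
  set W : ℕ := 2 ^ w with hW
  have hw2 : 2 ≤ w := by omega
  have hW4 : 4 ≤ W := by
    calc 4 = 2 ^ 2 := rfl
      _ ≤ W := Nat.pow_le_pow_right (by norm_num) hw2
  have hWt : 2 * t ≤ W := by rw [hW, hw]; exact (Nat.lt_two_pow_self).le
  set A : ℝ := exp (t * (W + 3) + t ^ 2) * exp (exp (4 * (4 * t))) + D * 2 ^ D with hA
  have hlogW : 0 < log W := log_pos (by exact_mod_cast (by omega : 1 < W))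
  refine ⟨A * (80 * log W) ^ t, by positivity, W ^ 80, fun K hK q c m hm => ?_⟩
  have hK0 : 0 < K := lt_of_lt_of_le (by positivity) hK
  have hKr : (0 : ℝ) < K := by exact_mod_cast hK0
  have hK1 : 1 < K := lt_of_lt_of_le (Nat.one_lt_pow (by norm_num) (by omega)) hK
  set a := Nat.log W K
  have ha80 : 80 ≤ a := Nat.le_log_of_pow_le (by omega) hK
  set J := Nat.log 2 (a / 40)
  have hJ1 : 40 * 2 ^ J ≤ a := by
    have : 2 ^ J ≤ a / 40 := Nat.pow_log_le_self 2 (by omega)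
    omega
  have hJ2 : a + 1 ≤ 40 * 2 ^ (J + 1) := by
    have : a / 40 < 2 ^ (J + 1) := Nat.lt_pow_succ_log_self (by norm_num) _
    omega
  have hKJ : W ^ (40 * 2 ^ J) ≤ K :=
    (Nat.pow_le_pow_right (by omega) hJ1).trans (Nat.pow_log_le_self W hK0.ne')
  have hlogK : log K ≤ 2 ^ J * (80 * log W) := by
    have h1 : K ≤ W ^ (40 * 2 ^ (J + 1)) :=
      (Nat.lt_pow_succ_log_self (by omega) K).le.trans (Nat.pow_le_pow_right (by omega) hJ2)
    have h2 : (K : ℝ) ≤ (W : ℝ) ^ (40 * 2 ^ (J + 1)) := by exact_mod_cast h1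
    have h3 := log_le_log hKr h2
    rw [log_pow] at h3
    refine h3.trans (le_of_eq ?_)
    push_cast
    rw [pow_succ]; ring
  have hlogK0 : 0 < log K := log_pos (by exact_mod_cast hK1)
  set X := Fintype.piFinset fun _ : σ => range K with hX
  set g : ℕ → ℝ := fun p => (zeroCount c m p : ℝ) / (p : ℝ) ^ D with hg
  have hg0 : ∀ p, 0 ≤ g p := fun p => by positivity
  have hg1 : ∀ p, g p ≤ 1 := fun p => by
    rcases Nat.eq_zero_or_pos p with rfl | hp
    · simp [hg, hD]
    · exact (div_le_one (by positivity)).2 (by exact_mod_cast zeroCount_le c m hp)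
  set P : Fin J → Finset ℕ := fun j => primeBlock w q j
  have hpp : ∀ j, ∀ p ∈ P j, p.Prime := fun j p hp => (mem_primeBlock.1 hp).2.1
  have hbound : ∀ j, ∀ p ∈ P j, g p ≤ t / p ∧ (t : ℝ) / p - (t : ℝ) ^ 2 * (1 / (p : ℝ) ^ 2) ≤ g p :=
    fun j p hp => zeroCount_prime_bounds c (hpp j p hp) (hm p (hpp j p hp) (mem_primeBlock.1 hp).2.2)
  have hpW : ∀ j, ∀ p ∈ P j, W ≤ p := fun j p hp => by
    refine le_trans ?_ (mem_primeBlock.1 hp).1.1.le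
    exact Nat.pow_le_pow_right (by norm_num) (Nat.le_mul_of_pos_right _ (by positivity))
  have hhalf : ∀ j, ∀ p ∈ P j, g p ≤ 1 / 2 := fun j p hp => by
    refine (hbound j p hp).1.trans ?_
    have h1 : 2 * t ≤ p := hWt.trans (hpW j p hp)
    have h2 : (2 * t : ℝ) ≤ p := by exact_mod_cast h1
    have h3 : (0 : ℝ) < p := by exact_mod_cast (hpp j p hp).pos
    rw [div_le_div_iff₀ h3 two_pos]; linarith
  have hsumg : ∀ j, ∑ p ∈ P j, g p ≤ 4 * t := fun j => by
    calc ∑ p ∈ P j, g p ≤ ∑ p ∈ P j, t * (1 / p : ℝ) :=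
          sum_le_sum fun p hp => (hbound j p hp).1.trans_eq (by ring)
      _ ≤ t * 4 := by
          rw [← mul_sum]
          exact mul_le_mul_of_nonneg_left (sum_one_div_primeBlock_le (by omega) q j) (by positivity)
      _ = _ := by ring
  have htot : (t : ℝ) * (J * log 2 - W - 3) - t ^ 2 ≤ ∑ j, ∑ p ∈ P j, g p := by
    calc (t : ℝ) * (J * log 2 - W - 3) - t ^ 2 ≤
          t * (∑ j : Fin J, ∑ p ∈ P j, (1 / p : ℝ)) -
            t ^ 2 * ∑ j : Fin J, ∑ p ∈ P j, (1 / (p : ℝ) ^ 2) := by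
          have h1 := le_sum_one_div_primeBlocks hw2 q J
          have h2 := sum_one_div_sq_primeBlocks_le w q J
          have h3 : (W : ℝ) = 2 ^ w := by rw [hW]; push_cast; rfl
          rw [h3]
          refine sub_le_sub (mul_le_mul_of_nonneg_left h1 (by positivity)) ?_
          exact mul_le_of_le_one_right (by positivity) h2
      _ = ∑ j, ∑ p ∈ P j, ((t : ℝ) / p - (t : ℝ) ^ 2 * (1 / (p : ℝ) ^ 2)) := by
          rw [mul_sum, mul_sum, ← sum_sub_distrib]
          refine sum_congr rfl fun j _ => ?_
          rw [mul_sum, mul_sum, ← sum_sub_distrib]; exact sum_congr rfl fun p _ => by ring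
      _ ≤ _ := sum_le_sum fun j _ => sum_le_sum fun p hp => (hbound j p hp).2
  have hR : ∀ u : Fin J → Finset ℕ, (∀ j, u j ⊆ P j) →
      |((X.filter fun y => ∀ j, ∀ p ∈ u j, (p : ℤ) ∣ formProd c m fun s => (y s : ℤ)).card : ℝ) -
        (K : ℝ) ^ D * ∏ j, ∏ p ∈ u j, g p| ≤
      (D * 2 ^ D * ((K : ℝ) ^ D / K)) * ∏ j, ∏ p ∈ u j, (p : ℝ) := by
    intro u hu
    set s := univ.biUnion u
    have hdisj : (↑(univ : Finset (Fin J)) : Set (Fin J)).PairwiseDisjoint u := fun i _ j _ hij =>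
      (disjoint_primeBlock w q fun h => hij (Fin.ext h)).mono (hu i) (hu j)
    have hsp : ∀ p ∈ s, p.Prime := fun p hp => by
      obtain ⟨j, _, hj⟩ := mem_biUnion.1 hp
      exact hpp j p (hu j hj)
    have e1 : (X.filter fun y => ∀ j, ∀ p ∈ u j, (p : ℤ) ∣ formProd c m fun s => (y s : ℤ)) =
        X.filter fun y => ((∏ p ∈ s, p : ℕ) : ℤ) ∣ formProd c m fun s => (y s : ℤ) := by
      rw [hX, ← card_filter_dvd_eq c m K hsp]
      ext y
      simp only [mem_filter]
      refine and_congr_right fun _ => ⟨fun h p hp => ?_, fun h j p hp =>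
        h p (mem_biUnion.2 ⟨j, mem_univ _, hp⟩)⟩
      obtain ⟨j, _, hj⟩ := mem_biUnion.1 hp
      exact h j p hj
    have hdpos : 0 < ∏ p ∈ s, p := prod_pos fun p hp => (hsp p hp).pos
    have h1 := abs_card_dvd_formProd_sub_le c m hK0 hdpos
    rw [e1, ← prod_biUnion hdisj, ← prod_biUnion hdisj]
    have e2 : (zeroCount c m (∏ p ∈ s, p) : ℝ) / ((∏ p ∈ s, p : ℕ) : ℝ) ^ Fintype.card σ =
        ∏ p ∈ s, g p := by
      rw [zeroCount_prod c m hsp, hg, prod_div_distrib, prod_pow]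
      push_cast; rfl
    rw [e2] at h1
    push_cast at h1 ⊢; exact h1
  have hmainB := card_sifted_le_of_blocks X
    (fun y (p : ℕ) => (p : ℤ) ∣ formProd c m fun s => (y s : ℤ)) P (fun j => J - (j : ℕ)) hg0 hg1
    (M := (K : ℝ) ^ D) (by positivity) fun u hu => by convert hR u hu
  have hsub : ((X.filter fun y => ∀ p : ℕ, p.Prime → p * p ≤ K →
        p ≠ q → ¬ (p : ℤ) ∣ formProd c m fun s => (y s : ℤ)).card : ℝ) ≤
      ((X.filter fun y => ∀ j, ∀ p ∈ P j, ¬ (p : ℤ) ∣ formProd c m fun s => (y s : ℤ)).card : ℝ) := by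
    refine Nat.cast_le.2 (card_le_card fun y hy => ?_)
    rw [mem_filter] at hy ⊢
    refine ⟨hy.1, fun j p hp => hy.2 p (hpp j p hp) ?_ (mem_primeBlock.1 hp).2.2⟩
    have h1 : p ≤ W ^ 2 ^ J := by
      refine (mem_primeBlock.1 hp).1.2.trans ?_
      rw [hW, ← pow_mul]
      exact Nat.pow_le_pow_right (by norm_num) (Nat.mul_le_mul_left _
        (Nat.pow_le_pow_right (by norm_num) j.2))
    calc p * p ≤ W ^ 2 ^ J * W ^ 2 ^ J := Nat.mul_le_mul h1 h1
      _ = W ^ (2 * 2 ^ J) := by rw [← pow_add]; ring_nf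
      _ ≤ W ^ (40 * 2 ^ J) := Nat.pow_le_pow_right (by omega) (by omega)
      _ ≤ K := hKJ
  have hmain1 : ∏ j, (∏ p ∈ P j, (1 - g p) +
      exp (2 * ∑ p ∈ P j, g p) / 2 ^ (2 * (J - (j : ℕ)) + 1)) ≤
      exp (t * (W + 3) + t ^ 2) * exp (exp (4 * (4 * t))) * (1 / 2 ^ J) ^ t := by
    calc _ ≤ ∏ j : Fin J, (exp (-∑ p ∈ P j, g p) *
          exp (exp (4 * (4 * t)) * (1 / 2 ^ (J - (j : ℕ))))) := by
          refine Finset.prod_le_prod (fun j _ => ?_) fun j _ =>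
            prod_le_exp_of_density hg0 (hhalf j) (hsumg j) _
          exact add_nonneg (prod_nonneg fun p _ => by linarith [hg1 p]) (by positivity)
      _ = exp (-∑ j, ∑ p ∈ P j, g p) * exp (exp (4 * (4 * t)) *
          ∑ j : Fin J, (1 / 2 ^ (J - (j : ℕ)))) := by
          rw [prod_mul_distrib, ← exp_sum, ← exp_sum, sum_neg_distrib,
            mul_sum]
      _ ≤ exp (t * (W + 3) + t ^ 2 - J * t * log 2) * exp (exp (4 * (4 * t))) := by
          refine mul_le_mul (exp_le_exp.2 (by linarith)) (exp_le_exp.2 ?_)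
            (exp_pos _).le (exp_pos _).le
          refine mul_le_of_le_one_right (exp_pos _).le ?_
          rw [Fin.sum_univ_eq_sum_range (fun j => (1 / 2 ^ (J - j) : ℝ)) J]; exact sum_one_div_two_pow_sub_le J
      _ = _ := by
          have h1 : exp (-(J * t * log 2)) = (1 / 2 ^ J) ^ t := by
            rw [one_div, inv_pow, ← pow_mul, exp_neg]
            congr 1
            rw [← exp_log (x := (2 : ℝ) ^ (J * t)) (by positivity), log_pow]
            push_cast; rfl
          rw [sub_eq_add_neg, exp_add, h1]; ring
  have hrem : ((K : ℝ) ^ D / K) * ∏ j : Fin J, ∑ u ∈ (P j).powerset with u.card ≤ 2 * (J - (j : ℕ)),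
      ∏ p ∈ u, (p : ℝ) ≤ (K : ℝ) ^ D * (1 / 2 ^ J) ^ t := by
    have h1 : ∏ j : Fin J, ∑ u ∈ (P j).powerset with u.card ≤ 2 * (J - (j : ℕ)), ∏ p ∈ u, (p : ℝ) ≤
        (W : ℝ) ^ (18 * 2 ^ J) := by
      calc _ ≤ ∏ j : Fin J, (W : ℝ) ^ (2 ^ ((j : ℕ) + 1) * (4 * (J - (j : ℕ)) + 1)) :=
            Finset.prod_le_prod (fun j _ => sum_nonneg fun u _ =>
              prod_nonneg fun p _ => Nat.cast_nonneg p)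
              fun j _ => sum_truncated_primeBlock_le hw2 q j _
        _ = (W : ℝ) ^ ∑ j ∈ range J, 2 ^ (j + 1) * (4 * (J - j) + 1) := by
            rw [prod_pow_eq_pow_sum,
              Fin.sum_univ_eq_sum_range (fun j => 2 ^ (j + 1) * (4 * (J - j) + 1)) J]
        _ ≤ _ := pow_le_pow_right₀ (by exact_mod_cast (by omega : 1 ≤ W))
            (by have := sum_block_exponents_le J; omega)
    have h2 : (W : ℝ) ^ (18 * 2 ^ J) * (2 ^ J) ^ t ≤ K := by
      have h3 : ((2 : ℕ) ^ J) ^ t ≤ W ^ 2 ^ J := by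
        rw [← pow_mul, hW, ← pow_mul]
        refine Nat.pow_le_pow_right (by norm_num) ?_
        have : J ≤ 2 ^ J := (Nat.lt_two_pow_self).le
        calc J * t ≤ 2 ^ J * t := Nat.mul_le_mul_right _ this
          _ = t * 2 ^ J := mul_comm _ _
          _ ≤ w * 2 ^ J := Nat.mul_le_mul_right _ (by omega)
      have h4 : W ^ (18 * 2 ^ J) * (2 ^ J) ^ t ≤ K :=
        calc W ^ (18 * 2 ^ J) * (2 ^ J) ^ t ≤ W ^ (18 * 2 ^ J) * W ^ 2 ^ J := Nat.mul_le_mul_left _ h3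
          _ = W ^ (19 * 2 ^ J) := by rw [← pow_add]; ring_nf
          _ ≤ W ^ (40 * 2 ^ J) := Nat.pow_le_pow_right (by omega) (by omega)
          _ ≤ K := hKJ
      exact_mod_cast h4
    calc _ ≤ ((K : ℝ) ^ D / K) * (W : ℝ) ^ (18 * 2 ^ J) := mul_le_mul_of_nonneg_left h1 (by positivity)
      _ ≤ ((K : ℝ) ^ D / K) * (K / (2 ^ J) ^ t) := by
          refine mul_le_mul_of_nonneg_left ?_ (by positivity)
          rw [le_div_iff₀ (by positivity)]; exact h2
      _ = _ := by rw [one_div, inv_pow]; field_simp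
  have hfin : (1 / 2 ^ J : ℝ) ^ t ≤ (80 * log W) ^ t / log K ^ t := by
    rw [← div_pow]
    refine pow_le_pow_left₀ (by positivity) ?_ _
    rw [div_le_div_iff₀ (by positivity) hlogK0, one_mul, mul_comm]; exact hlogK
  calc _ ≤ (K : ℝ) ^ D * (exp (t * (W + 3) + t ^ 2) * exp (exp (4 * (4 * t))) *
        (1 / 2 ^ J) ^ t) + (D * 2 ^ D) * ((K : ℝ) ^ D * (1 / 2 ^ J) ^ t) := by
        refine hsub.trans ((le_of_eq (by congr!)).trans (hmainB.trans (add_le_add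
          (mul_le_mul_of_nonneg_left hmain1 (by positivity)) ?_)))
        rw [mul_assoc]; exact mul_le_mul_of_nonneg_left hrem (by positivity)
    _ = A * (K : ℝ) ^ D * (1 / 2 ^ J) ^ t := by rw [hA]; ring
    _ ≤ A * (K : ℝ) ^ D * ((80 * log W) ^ t / log K ^ t) :=
        mul_le_mul_of_nonneg_left hfin (by positivity)
    _ = _ := by ring

end Sieve

section CubeForms

open Real

/-- The coefficients of the forms attached to pairs of cubes with common sides. -/
def cubeCoeff (Q : ℤ) {R : ℕ} (i : Bool × (Fin R → Bool)) : Bool ⊕ Fin R → ℤ :=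
  Sum.elim (fun b => if b = i.1 then Q else 0) fun j => if i.2 j then Q else 0

/-- The value of a cube form at an integer vector. -/
def cubeForm {R : ℕ} (i : Bool × (Fin R → Bool)) (x : Bool ⊕ Fin R → ℤ) : ℤ :=
  x (Sum.inl i.1) + vertexSum i.2 fun j => x (Sum.inr j)

theorem sum_cubeCoeff_mul {A : Type*} [CommRing A] (Q : ℤ) {R : ℕ} (i : Bool × (Fin R → Bool))
    (y : Bool ⊕ Fin R → A) : ∑ s, (cubeCoeff Q i s : A) * y s =
      Q * (y (Sum.inl i.1) + ∑ j, if i.2 j then y (Sum.inr j) else 0) := by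
  rw [Fintype.sum_sum_type, mul_add, mul_sum]
  congr 1
  · rw [sum_eq_single i.1]
    · simp [cubeCoeff]
    · intro b _ hb; simp [cubeCoeff, hb]
    · simp
  · refine sum_congr rfl fun j _ => ?_
    simp only [cubeCoeff, Sum.elim_inr]
    split_ifs <;> simp

theorem affineForm_cubeCoeff (Q : ℤ) {R : ℕ} (u y : Bool ⊕ Fin R → ℤ) (i : Bool × (Fin R → Bool)) :
    affineForm (fun i => cubeForm i u) (cubeCoeff Q) i y = cubeForm i fun s => u s + Q * y s := by
  have h := sum_cubeCoeff_mul Q i y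
  simp only [Int.cast_id] at h
  simp only [affineForm, Int.cast_id, h, cubeForm, vertexSum, mul_add, mul_sum]
  rw [add_add_add_comm, ← sum_add_distrib]
  congr 1
  refine sum_congr rfl fun j _ => ?_
  split_ifs <;> simp

theorem pairwiseIndependent_cubeCoeff {Q : ℤ} {R p : ℕ} (hp : p.Prime) (hQ : ¬ (p : ℤ) ∣ Q) :
    PairwiseIndependent (cubeCoeff Q (R := R)) p := by
  have := Fact.mk hp
  have hQ0 : (Q : ZMod p) ≠ 0 := fun h => hQ ((ZMod.intCast_zmod_eq_zero_iff_dvd _ _).1 h)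
  have hlin : ∀ (i : Bool × (Fin R → Bool)) (y : Bool ⊕ Fin R → ZMod p),
      linearPart (cubeCoeff Q) p i y =
        Q * (y (Sum.inl i.1) + ∑ j, if i.2 j then y (Sum.inr j) else 0) := fun i y =>
    sum_cubeCoeff_mul Q i y
  have hsingle : ∀ (i : Bool × (Fin R → Bool)) (f : Bool → ZMod p) (k : Fin R) (v : ZMod p),
      linearPart (cubeCoeff Q) p i (Sum.elim f (Pi.single k v)) =
        Q * (f i.1 + if i.2 k then v else 0) := fun i f k v => by
    rw [hlin]
    congr 2
    rw [sum_eq_single k]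
    · simp
    · intro j _ hj; simp [Pi.single_eq_of_ne hj]
    · simp
  have hnone : ∀ (i : Bool × (Fin R → Bool)) (f : Bool → ZMod p),
      linearPart (cubeCoeff Q) p i (Sum.elim f fun _ => 0) = Q * f i.1 := fun i f => by
    rw [hlin]; simp
  refine ⟨fun i v => ⟨Sum.elim (fun _ => (Q : ZMod p)⁻¹ * v) fun _ => 0, ?_⟩, fun i j hij v => ?_⟩
  · rw [hnone, mul_inv_cancel_left₀ hQ0]
  · by_cases hb : i.1 = j.1
    · obtain ⟨k, hk⟩ : ∃ k, i.2 k ≠ j.2 k := by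
        by_contra! h
        exact hij (Prod.ext hb (funext h))
      rcases hik : i.2 k with _ | _
      · have hjk : j.2 k = true := by rw [hik] at hk; exact Bool.eq_true_of_not_eq_false fun h => hk h.symm
        refine ⟨Sum.elim (fun _ => (Q : ZMod p)⁻¹ * v.1) (Pi.single k ((Q : ZMod p)⁻¹ * (v.2 - v.1))), ?_⟩
        rw [AddMonoidHom.prod_apply, hsingle, hsingle, hik, hjk]
        refine Prod.ext ?_ ?_
        · simp [mul_inv_cancel_left₀ hQ0]
        · simp only [if_true, mul_add, mul_inv_cancel_left₀ hQ0]; ring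
      · have hjk : j.2 k = false := by rw [hik] at hk; exact Bool.eq_false_of_not_eq_true fun h => hk h.symm
        refine ⟨Sum.elim (fun _ => (Q : ZMod p)⁻¹ * v.2) (Pi.single k ((Q : ZMod p)⁻¹ * (v.1 - v.2))), ?_⟩
        rw [AddMonoidHom.prod_apply, hsingle, hsingle, hik, hjk]
        refine Prod.ext ?_ ?_
        · simp only [if_true, mul_add, mul_inv_cancel_left₀ hQ0]; ring
        · simp [mul_inv_cancel_left₀ hQ0]
    · refine ⟨Sum.elim (fun b => (Q : ZMod p)⁻¹ * if b = i.1 then v.1 else v.2) fun _ => 0, ?_⟩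
      rw [AddMonoidHom.prod_apply, hnone, hnone]
      refine Prod.ext ?_ ?_
      · simp [mul_inv_cancel_left₀ hQ0]
      · simp [mul_inv_cancel_left₀ hQ0, Ne.symm hb]

theorem exists_representative (Q : ℕ) [NeZero Q] (ρ : ZMod Q) (N : ℕ) :
    ∃ u : ℤ, (u : ZMod Q) = ρ ∧ -(N : ℤ) - Q < u ∧ u ≤ -N := by
  have hQ : (0 : ℤ) < Q := by exact_mod_cast Nat.pos_of_ne_zero (NeZero.ne Q)
  refine ⟨-(N : ℤ) - ((-(N : ℤ) - ρ.val) % Q), ?_, ?_, ?_⟩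
  · have h := Int.emod_add_mul_ediv (-(N : ℤ) - ρ.val) Q
    have h2 : (-(N : ℤ) - ((-(N : ℤ) - ρ.val) % Q)) = ρ.val + Q * ((-(N : ℤ) - ρ.val) / Q) := by linarith
    rw [h2]; push_cast; simp
  · have := Int.emod_lt_of_pos (-(N : ℤ) - ρ.val) hQ
    linarith
  · have := Int.emod_nonneg (-(N : ℤ) - ρ.val) hQ.ne'
    linarith

open Classical in
/-- The number of pairs of cubes of primes in a given residue class. -/
theorem exists_card_prime_cubes_le (R : ℕ) : ∃ C : ℝ, 0 < C ∧ ∀ q : ℕ, q.Prime → ∀ a : ℕ,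
    ∃ N₀ : ℕ, ∀ N ≥ N₀, ∀ S : Set ℤ, (∀ n ∈ S, ∃ p : ℕ, p.Prime ∧ n = p ∧ N ≤ 8 * p) →
      ∀ ρ : Bool ⊕ Fin R → ZMod (q ^ a),
      (((Fintype.piFinset fun _ : Bool ⊕ Fin R => Ico (-(N : ℤ)) N).filter fun x =>
        (∀ s, (x s : ZMod (q ^ a)) = ρ s) ∧ ∀ i, cubeForm i x ∈ S).card : ℝ) ≤
      C * ((N : ℝ) / (q ^ a : ℕ)) ^ (R + 2) / log N ^ 2 ^ (R + 1) := by
  obtain ⟨C, hC, K₀, h⟩ := exists_card_sifted_le (Bool ⊕ Fin R) (Bool × (Fin R → Bool))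
  have hcσ : Fintype.card (Bool ⊕ Fin R) = R + 2 := by simp [add_comm]
  have hcι : Fintype.card (Bool × (Fin R → Bool)) = 2 ^ (R + 1) := by simp [pow_succ, mul_comm]
  rw [hcσ, hcι] at h
  refine ⟨C * 3 ^ (R + 2) * 2 ^ 2 ^ (R + 1), by positivity, fun q hq a => ?_⟩
  set Q := q ^ a
  have hQ0 : 0 < Q := pow_pos hq.pos a
  have : NeZero Q := ⟨hQ0.ne'⟩
  have hQr : (0 : ℝ) < Q := by exact_mod_cast hQ0
  refine ⟨max (Q * K₀) (max (2 * Q) (max (Q * Q) 200)), fun N hN S hS ρ => ?_⟩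
  have hN1 : Q * K₀ ≤ N := (le_max_left _ _).trans hN
  have hN' := (le_max_right _ _).trans hN
  have hN2 : 2 * Q ≤ N := (le_max_left _ _).trans hN'
  have hN'' := (le_max_right _ _).trans hN'
  have hN3 : Q * Q ≤ N := (le_max_left _ _).trans hN''
  have hN4 : 200 ≤ N := (le_max_right _ _).trans hN''
  have hNr : (0 : ℝ) < N := by exact_mod_cast (by omega : 0 < N)
  set K := 2 * N / Q + 2 with hK
  have hKN : N ≤ Q * K := by
    have := Nat.div_add_mod (2 * N) Q
    have h2 := Nat.mod_lt (2 * N) hQ0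
    rw [hK, mul_add]; omega
  have hK2 : 2 * N + Q ≤ Q * K := by
    have := Nat.div_add_mod (2 * N) Q
    have h2 := Nat.mod_lt (2 * N) hQ0
    rw [hK, mul_add]; omega
  have hKu : Q * K ≤ 3 * N := by
    have := Nat.mul_div_le (2 * N) Q
    rw [hK, mul_add]; omega
  have hKK : K₀ ≤ K := Nat.le_of_mul_le_mul_left (hN1.trans hKN) hQ0
  have hK3 : K ≤ 3 * N := (Nat.le_mul_of_pos_left K hQ0).trans hKu
  choose u hu1 hu2 hu3 using fun s => exists_representative Q (ρ s) N
  have hind : ∀ p : ℕ, p.Prime → p ≠ q → PairwiseIndependent (cubeCoeff (Q : ℤ) (R := R)) p :=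
    fun p hp hpq => pairwiseIndependent_cubeCoeff hp fun hd => hpq
      ((Nat.prime_dvd_prime_iff_eq hp hq).1 (hp.dvd_of_dvd_pow (Int.natCast_dvd_natCast.1 hd)))
  have hb := h K hKK q (fun i => cubeForm i u) (cubeCoeff Q) hind
  have hcard : ((Fintype.piFinset fun _ : Bool ⊕ Fin R => Ico (-(N : ℤ)) N).filter fun x =>
      (∀ s, (x s : ZMod Q) = ρ s) ∧ ∀ i, cubeForm i x ∈ S).card ≤
      ((Fintype.piFinset fun _ : Bool ⊕ Fin R => range K).filter fun y => ∀ p : ℕ, p.Prime →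
        p * p ≤ K → p ≠ q → ¬ (p : ℤ) ∣ formProd (fun i => cubeForm i u) (cubeCoeff Q)
          fun s => (y s : ℤ)).card := by
    have hrec : ∀ x ∈ (Fintype.piFinset fun _ : Bool ⊕ Fin R => Ico (-(N : ℤ)) N).filter fun x =>
        (∀ s, (x s : ZMod Q) = ρ s) ∧ ∀ i, cubeForm i x ∈ S, ∀ s,
        ∃ y : ℕ, x s = u s + Q * y ∧ y < K := by
      intro x hx s
      rw [mem_filter, Fintype.mem_piFinset] at hx
      have hxs := mem_Ico.1 (hx.1 s)
      have hd : (Q : ℤ) ∣ x s - u s := by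
        rw [← ZMod.intCast_zmod_eq_zero_iff_dvd]; push_cast; rw [hx.2.1 s, hu1 s, sub_self]
      obtain ⟨y, hy⟩ := hd
      have hQz : (0 : ℤ) < Q := by exact_mod_cast hQ0
      have hy0 : 0 ≤ y := by
        have : 0 ≤ (Q : ℤ) * y := by rw [← hy]; linarith [hu3 s]
        exact nonneg_of_mul_nonneg_right this hQz
      have hyK : y < K := by
        have h1 : (Q : ℤ) * y < Q * K := by
          have : (2 * N + Q : ℤ) ≤ Q * K := by exact_mod_cast hK2
          rw [← hy]; linarith [hu2 s]
        exact lt_of_mul_lt_mul_left h1 hQz.le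
      refine ⟨y.toNat, ?_, by omega⟩
      rw [Int.toNat_of_nonneg hy0, ← hy]; ring
    refine card_le_card_of_injOn (fun x s => ((x s - u s) / Q).toNat) (fun x hx => ?_)
      fun x hx x' hx' hxx => ?_
    · have hrx := hrec x hx
      choose y hy1 hy2 using hrx
      have hQz : (Q : ℤ) ≠ 0 := by exact_mod_cast hQ0.ne'
      have hye : (fun s => ((x s - u s) / Q).toNat) = y := funext fun s => by
        rw [hy1 s, add_sub_cancel_left, Int.mul_ediv_cancel_left _ hQz, Int.toNat_natCast]
      have hx := (mem_filter.1 hx).2.2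
      change (fun s => ((x s - u s) / Q).toNat) ∈ _
      rw [hye]
      refine mem_coe.2 (mem_filter.2 ⟨Fintype.mem_piFinset.2 fun s =>
        mem_range.2 (hy2 s), fun p hp hpK _ hd => ?_⟩)
      rw [formProd] at hd
      obtain ⟨i, _, hi⟩ := (Nat.prime_iff_prime_int.1 hp).exists_mem_finset_dvd hd
      rw [affineForm_cubeCoeff, ← funext hy1] at hi
      obtain ⟨p', hp', he, hle⟩ := hS _ (hx i)
      rw [he] at hi
      have hpp : p = p' := (Nat.prime_dvd_prime_iff_eq hp hp').1 (Int.natCast_dvd_natCast.1 hi)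
      subst hpp
      nlinarith
    · funext s
      obtain ⟨y, hy, _⟩ := hrec x hx s
      obtain ⟨y', hy', _⟩ := hrec x' hx' s
      have hQz : (Q : ℤ) ≠ 0 := by exact_mod_cast hQ0.ne'
      have h3 := congrFun hxx s
      simp only [hy, hy', add_sub_cancel_left, Int.mul_ediv_cancel_left _ hQz, Int.toNat_natCast] at h3
      rw [hy, hy', h3]
  refine (Nat.cast_le.2 hcard).trans (hb.trans ?_)
  have hKr : (K : ℝ) ≤ 3 * ((N : ℝ) / Q) := by
    rw [mul_div_assoc', le_div_iff₀ hQr, mul_comm]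
    exact_mod_cast hKu
  have hKl : (N : ℝ) ≤ (K : ℝ) ^ 2 := by
    have h1 : N * N ≤ N * (K * K) := by
      calc N * N ≤ (Q * K) * (Q * K) := Nat.mul_le_mul hKN hKN
        _ = (Q * Q) * (K * K) := by ring
        _ ≤ N * (K * K) := Nat.mul_le_mul_right _ hN3
    have h2 : N ≤ K * K := Nat.le_of_mul_le_mul_left h1 (by omega)
    rw [sq]; exact_mod_cast h2
  have hlogN : 0 < log N := log_pos (by exact_mod_cast (by omega : 1 < N))
  have hlogK : log N / 2 ≤ log K := by
    have := log_le_log hNr hKl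
    rw [log_pow] at this
    push_cast at this; linarith
  calc C * (K : ℝ) ^ (R + 2) / log K ^ 2 ^ (R + 1)
      ≤ C * (3 * ((N : ℝ) / Q)) ^ (R + 2) / (log N / 2) ^ 2 ^ (R + 1) := by
        refine div_le_div₀ (by positivity) (mul_le_mul_of_nonneg_left
          (pow_le_pow_left₀ (Nat.cast_nonneg _) hKr _) hC.le) (by positivity)
          (pow_le_pow_left₀ (by positivity) hlogK _)
    _ = _ := by rw [mul_pow, div_pow (log N)]; field_simp

end CubeForms

section PrimePairs

/-- The vector formed by two base points and the common sides of their cubes. -/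
def pairVec {R : ℕ} (z : ℤ × ℤ) (l : Fin R → ℤ) : Bool ⊕ Fin R → ℤ :=
  Sum.elim (fun b => if b then z.2 else z.1) l

theorem pairVec_injective {R : ℕ} {z z' : ℤ × ℤ} {l l' : Fin R → ℤ} (h : pairVec z l = pairVec z' l') :
    z = z' ∧ l = l' :=
  ⟨Prod.ext (by simpa [pairVec] using congrFun h (Sum.inl false))
    (by simpa [pairVec] using congrFun h (Sum.inl true)), funext fun i => congrFun h (Sum.inr i)⟩

open Classical in
theorem exists_sum_prime_pairs_le (R : ℕ) : ∃ C : ℝ, 0 < C ∧ ∀ q : ℕ, q.Prime → ∀ a : ℕ,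
    ∃ N₀ : ℕ, ∀ N ≥ N₀, ∀ S : Set ℤ, (∀ n ∈ S, ∃ p : ℕ, p.Prime ∧ n = p ∧ N ≤ 8 * p) →
      ∀ coll : (Bool ⊕ Fin R → ZMod (q ^ a)) → Prop,
      (∑ l ∈ symmBox N R, ((Ico (0 : ℤ) N ×ˢ Ico (0 : ℤ) N).filter fun z =>
        (∀ ω, z.1 + vertexSum ω l ∈ S) ∧ (∀ ω, z.2 + vertexSum ω l ∈ S) ∧
          coll fun s => ((pairVec z l s : ℤ) : ZMod (q ^ a))).card : ℝ) ≤
      Nat.card {ρ // coll ρ} *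
        (C * ((N : ℝ) / (q ^ a : ℕ)) ^ (R + 2) / Real.log N ^ 2 ^ (R + 1)) := by
  obtain ⟨C, hC, h⟩ := exists_card_prime_cubes_le R
  refine ⟨C, hC, fun q hq a => ?_⟩
  obtain ⟨N₀, h⟩ := h q hq a
  refine ⟨N₀, fun N hN S hS coll => ?_⟩
  have : NeZero (q ^ a) := ⟨(pow_pos hq.pos a).ne'⟩
  set Bx := (Fintype.piFinset fun _ : Bool ⊕ Fin R => Ico (-(N : ℤ)) N).filter fun x =>
    coll (fun s => (x s : ZMod (q ^ a))) ∧ ∀ i, cubeForm i x ∈ S with hBx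
  set A : (Fin R → ℤ) → Finset (ℤ × ℤ) := fun l =>
    (Ico (0 : ℤ) N ×ˢ Ico (0 : ℤ) N).filter fun z =>
        (∀ ω, z.1 + vertexSum ω l ∈ S) ∧ (∀ ω, z.2 + vertexSum ω l ∈ S) ∧
          coll fun s => ((pairVec z l s : ℤ) : ZMod (q ^ a))
  have h1 : ∑ l ∈ symmBox N R, (A l).card ≤ Bx.card := by
    rw [← card_sigma]
    refine card_le_card_of_injOn (fun y => pairVec y.2 y.1) (fun y hy => ?_)
      fun y _ y' _ h => ?_
    · obtain ⟨hl, hz⟩ := mem_sigma.1 hy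
      obtain ⟨hz1, hz2, hz3, hz4⟩ := mem_filter.1 hz
      obtain ⟨hz5, hz6⟩ := mem_product.1 hz1
      rw [mem_Ico] at hz5 hz6
      refine mem_coe.2 (mem_filter.2 ⟨Fintype.mem_piFinset.2 fun s => ?_, hz4, fun i => ?_⟩)
      · rcases s with b | j
        · rcases b with _ | _
          · simp only [pairVec, Sum.elim_inl, mem_Ico]; exact ⟨by simp; linarith, by simpa using hz5.2⟩
          · simp only [pairVec, Sum.elim_inl, mem_Ico]; exact ⟨by simp; linarith, by simpa using hz6.2⟩
        · have := mem_Ioo.1 (Fintype.mem_piFinset.1 hl j)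
          exact mem_Ico.2 ⟨this.1.le, this.2⟩
      · obtain ⟨b, ω⟩ := i
        cases b
        · simpa [cubeForm, pairVec] using hz2 ω
        · simpa [cubeForm, pairVec] using hz3 ω
    · obtain ⟨h1, h2⟩ := pairVec_injective h
      exact Sigma.ext h2 (heq_of_eq h1)
  have h2 : Bx.card = ∑ ρ ∈ univ.filter coll, ((Fintype.piFinset fun _ : Bool ⊕ Fin R =>
      Ico (-(N : ℤ)) N).filter fun x =>
        (∀ s, (x s : ZMod (q ^ a)) = ρ s) ∧ ∀ i, cubeForm i x ∈ S).card := by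
    rw [card_eq_sum_card_fiberwise (f := fun x : Bool ⊕ Fin R → ℤ => fun s =>
      (x s : ZMod (q ^ a))) (t := univ.filter coll)]
    · refine sum_congr rfl fun ρ hρ => ?_
      congr 1
      ext x
      simp only [hBx, mem_filter, funext_iff]
      constructor
      · rintro ⟨⟨h1, _, h3⟩, h4⟩
        exact ⟨h1, h4, h3⟩
      · rintro ⟨h1, h4, h3⟩
        refine ⟨⟨h1, ?_, h3⟩, h4⟩
        rw [funext h4]; exact (mem_filter.1 hρ).2
    · intro x hx
      exact mem_coe.2 (mem_filter.2 ⟨mem_univ _, (mem_filter.1 hx).2.1⟩)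
  have h3 : ((∑ l ∈ symmBox N R, (A l).card : ℕ) : ℝ) ≤ (Bx.card : ℝ) := Nat.cast_le.2 h1
  push_cast at h3
  refine h3.trans ?_
  rw [h2, Nat.cast_sum]
  refine (sum_le_sum fun ρ _ => h N hN S hS ρ).trans (le_of_eq ?_)
  rw [sum_const, nsmul_eq_mul, Nat.card_eq_fintype_card, Fintype.card_subtype]

end PrimePairs

section GoodPrimes

open Real

theorem eventually_theta_ge : ∀ᶠ n : ℕ in atTop, (n : ℝ) * log 2 * (3 / 4) ≤ Chebyshev.theta n := by
  have hlog2 : 0 < log 2 := log_pos one_lt_two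
  have h1 : ∀ᶠ x : ℝ in atTop, ‖log x‖ ≤ (log 2 / 32) * ‖x‖ :=
    isLittleO_log_id_atTop.bound (by positivity)
  have h2 : ∀ᶠ n : ℕ in atTop, ‖log √n‖ ≤ (log 2 / 32) * ‖√(n : ℝ)‖ :=
    (tendsto_sqrt_atTop.comp tendsto_natCast_atTop_atTop).eventually h1
  have h3 : ∀ᶠ n : ℕ in atTop, ‖log ((n : ℝ) + 1)‖ ≤ (log 2 / 32) * ‖(n : ℝ) + 1‖ :=
    (tendsto_atTop_add_const_right _ _ tendsto_natCast_atTop_atTop).eventually h1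
  filter_upwards [h2, h3, eventually_ge_atTop 1] with n h2 h3 hn
  have hn1 : (1 : ℝ) ≤ n := by exact_mod_cast hn
  refine le_trans ?_ (Chebyshev.theta_ge n)
  have e1 : log n = 2 * log √n := by rw [log_sqrt (by positivity)]; ring
  have h4 := (le_abs_self _).trans h2
  have h5 := (le_abs_self _).trans h3
  rw [norm_eq_abs, abs_of_nonneg (sqrt_nonneg _)] at h4
  rw [norm_eq_abs, abs_of_nonneg (by positivity)] at h5; rw [e1]
  have h6 := mul_le_mul_of_nonneg_left h4 (sqrt_nonneg n)
  have h7 := mul_self_sqrt (Nat.cast_nonneg n : (0 : ℝ) ≤ n)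
  have h8 : √(n : ℝ) * (log 2 / 32 * √n) = n * log 2 / 32 := by rw [mul_left_comm, h7]; ring
  rw [h8] at h6; nlinarith

theorem eventually_card_primes_block_ge : ∀ᶠ m : ℕ in atTop,
    ((8 ^ (m + 1) : ℕ) : ℝ) / 4 ≤ log ((8 ^ (m + 1) : ℕ) : ℝ) *
      ((Ico (8 ^ m) (8 ^ (m + 1))).filter Nat.Prime).card := by
  have ht : Tendsto (fun m : ℕ => 8 ^ (m + 1)) atTop atTop :=
    (tendsto_pow_atTop_atTop_of_one_lt (by norm_num : 1 < 8)).comp (tendsto_add_atTop_nat 1)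
  filter_upwards [ht.eventually eventually_theta_ge] with m hm
  have h1 : Chebyshev.theta ((8 ^ m : ℕ) : ℝ) ≤ log 4 * ((8 ^ m : ℕ) : ℝ) :=
    Chebyshev.theta_le_log4_mul_x (by positivity)
  have h4 : log 4 = 2 * log 2 := by rw [show (4 : ℝ) = 2 ^ 2 by norm_num, log_pow]; norm_num
  have h2 : Chebyshev.theta ((8 ^ (m + 1) : ℕ) : ℝ) ≤ Chebyshev.theta ((8 ^ m : ℕ) : ℝ) +
      ∑ p ∈ (Ico (8 ^ m) (8 ^ (m + 1))).filter Nat.Prime, log p := by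
    rw [Chebyshev.theta, Chebyshev.theta, Nat.floor_natCast, Nat.floor_natCast]
    have hsub : (Ioc 0 (8 ^ (m + 1))).filter Nat.Prime ⊆ (Ioc 0 (8 ^ m)).filter Nat.Prime ∪
        (Ico (8 ^ m) (8 ^ (m + 1))).filter Nat.Prime := by
      intro p hp
      simp only [mem_filter, mem_Ioc, mem_union, mem_Ico] at hp ⊢
      by_cases h : p ≤ 8 ^ m
      · exact Or.inl ⟨⟨hp.1.1, h⟩, hp.2⟩
      · refine Or.inr ⟨⟨by omega, lt_of_le_of_ne hp.1.2 fun he => ?_⟩, hp.2⟩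
        have h2 : 2 ∣ p := by rw [he, pow_succ]; exact Dvd.dvd.mul_left (by norm_num) _
        have h3 : p = 2 := ((Nat.prime_dvd_prime_iff_eq Nat.prime_two hp.2).1 h2).symm
        have : 8 ^ 1 ≤ 8 ^ (m + 1) := Nat.pow_le_pow_right (by norm_num) (by omega)
        omega
    refine (sum_le_sum_of_subset_of_nonneg hsub fun p _ _ => log_natCast_nonneg _).trans ?_
    rw [← sum_union_inter]
    exact le_add_of_nonneg_right (sum_nonneg fun p _ => log_natCast_nonneg _)
  have h3 : ∑ p ∈ (Ico (8 ^ m) (8 ^ (m + 1))).filter Nat.Prime, log p ≤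
      log ((8 ^ (m + 1) : ℕ) : ℝ) *
        ((Ico (8 ^ m) (8 ^ (m + 1))).filter Nat.Prime).card := by
    rw [mul_comm, ← nsmul_eq_mul]
    refine sum_le_card_nsmul _ _ _ fun p hp => ?_
    obtain ⟨h5, h6⟩ := mem_filter.1 hp
    exact log_le_log (by exact_mod_cast h6.pos) (by exact_mod_cast (mem_Ico.1 h5).2.le)
  have h5 : ((8 ^ (m + 1) : ℕ) : ℝ) = 8 * ((8 ^ m : ℕ) : ℝ) := by push_cast; ring
  have h6 := log_two_gt_d9
  have h7 : (0 : ℝ) < ((8 ^ m : ℕ) : ℝ) := by positivity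
  rw [h4] at h1; nlinarith

/-- If `∑ I n / n` converges, there are many primes with small `I p` at infinitely many scales. -/
theorem frequently_card_good_primes_ge {I : ℕ → ℝ} (hI : Summable fun n : ℕ => I n / n) {ε : ℝ}
    (hε : 0 < ε) : ∃ᶠ m : ℕ in atTop, ((8 ^ (m + 1) : ℕ) : ℝ) / 8 ≤ log ((8 ^ (m + 1) : ℕ) : ℝ) *
      ((Ico (8 ^ m) (8 ^ (m + 1))).filter fun p => p.Prime ∧ I p ≤ ε).card := by
  classical
  intro hcon
  set f : ℕ → ℝ := fun n => if n.Prime ∧ ε < I n then 1 / (n : ℝ) else 0 with hf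
  have hf0 : ∀ n, 0 ≤ f n := fun n => by simp only [hf]; split_ifs <;> positivity
  have hfs : Summable f := by
    refine (hI.norm.mul_left ε⁻¹).of_nonneg_of_le hf0 fun n => ?_
    simp only [hf]
    split_ifs with hn
    · have hn0 : (0 : ℝ) < n := by exact_mod_cast hn.1.pos
      rw [norm_div, norm_eq_abs, norm_eq_abs, abs_of_pos (hε.trans hn.2), Nat.abs_cast,
        inv_mul_eq_div, div_div, div_le_div_iff₀ hn0 (by positivity), one_mul, mul_comm (I n)]
      exact mul_le_mul_of_nonneg_left hn.2.le hn0.le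
    · positivity
  set b : ℕ → ℝ := fun m => ∑ n ∈ Ico (8 ^ m) (8 ^ (m + 1)), f n with hb
  have hbs : Summable b := by
    refine summable_of_sum_range_le (c := ∑' n, f n) (fun m => sum_nonneg fun n _ => hf0 n)
      fun M => ?_
    have : ∑ m ∈ range M, b m = ∑ n ∈ Ico 1 (8 ^ M), f n := by
      induction M with
      | zero => simp
      | succ M ih =>
        rw [sum_range_succ, ih, hb, sum_Ico_consecutive f (Nat.one_le_pow _ _ (by norm_num))
          (Nat.pow_le_pow_right (by norm_num) (Nat.le_succ M))]
    rw [this]; exact hfs.sum_le_tsum _ fun n _ => hf0 n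
  have hev : ∀ᶠ m : ℕ in atTop, (1 / (8 * log 8)) * (1 / ((m : ℝ) + 1)) ≤ b m := by
    filter_upwards [eventually_card_primes_block_ge, hcon] with m h1 h2
    rw [not_le] at h2
    set N : ℝ := ((8 ^ (m + 1) : ℕ) : ℝ) with hN
    have hN0 : 0 < N := by positivity
    set Bd := (Ico (8 ^ m) (8 ^ (m + 1))).filter fun p => p.Prime ∧ ε < I p with hBd
    have hcard : ((Ico (8 ^ m) (8 ^ (m + 1))).filter Nat.Prime).card =
        ((Ico (8 ^ m) (8 ^ (m + 1))).filter fun p => p.Prime ∧ I p ≤ ε).card + Bd.card := by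
      rw [← card_filter_add_card_filter_not (s := (Ico (8 ^ m) (8 ^ (m + 1))).filter
        Nat.Prime) (fun p => I p ≤ ε), filter_filter, filter_filter]
      simp only [not_le, hBd]
    have hlog : 0 < log N := log_pos (by
      rw [hN]; exact_mod_cast Nat.one_lt_pow (by omega) (by norm_num))
    have hBc : N / 8 ≤ log N * Bd.card := by
      rw [hcard] at h1
      push_cast at h1
      rw [mul_add] at h1; linarith
    have hbm : (Bd.card : ℝ) * (1 / N) ≤ b m := by
      have e1 : b m = ∑ p ∈ Bd, 1 / (p : ℝ) := by rw [hb, hBd, sum_filter]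
      rw [e1, ← nsmul_eq_mul]
      refine card_nsmul_le_sum _ _ _ fun p hp => ?_
      obtain ⟨h5, h6⟩ := mem_filter.1 hp
      refine one_div_le_one_div_of_le (by exact_mod_cast h6.1.pos) ?_
      rw [hN]
      exact_mod_cast (mem_Ico.1 h5).2.le
    refine le_trans ?_ hbm
    have hlogN : log N = (m + 1) * log 8 := by rw [hN]; push_cast; rw [log_pow]; push_cast; ring
    have e2 : (1 / (8 * log 8)) * (1 / ((m : ℝ) + 1)) = (N / 8) / log N * (1 / N) := by
      rw [hlogN]; field_simp
    rw [e2]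
    refine mul_le_mul_of_nonneg_right ?_ (by positivity)
    rw [div_le_iff₀ hlog, mul_comm]; exact hBc
  obtain ⟨m₀, hm₀⟩ := eventually_atTop.1 hev
  have h1 : Summable fun m : ℕ => (1 / (8 * log 8)) * (1 / ((m : ℝ) + 1)) := by
    refine (summable_nat_add_iff m₀).1 (((summable_nat_add_iff m₀).2 hbs).of_nonneg_of_le
      (fun m => by positivity) fun m => hm₀ _ (by omega))
  rw [summable_mul_left_iff (by positivity)] at h1
  refine not_summable_one_div_natCast ((summable_nat_add_iff 1).1 ?_)
  refine h1.congr fun m => ?_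
  push_cast; rfl

end GoodPrimes

section PrimeAverages

open Real

variable {κ : Measure SymbolSpace} [IsProbabilityMeasure κ]

theorem pat_map_mul_cons (K n : ℤ) {r : ℕ} (k : Fin r → ℤ) (x : SymbolSpace) :
    pat ((0 :: K :: List.ofFn k).map (n * ·)) x =
      coord x * (coord (shiftBy (n * K) x) * ∏ i, coord (shiftBy (n * k i) x)) := by
  simp only [List.map_cons, pat_cons, mul_zero, shiftBy_zero]
  rw [pat, List.map_ofFn, List.map_ofFn, List.prod_ofFn]; rfl

/-- Correlations with an eigenfunction of finite order are bounded by sums over cubes of primes. -/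
theorem DilationSystem.frequently_norm_integral_pat_pow_le (D : DilationSystem κ)
    (hErg : Ergodic shift κ) {e : SymbolSpace → ℂ} {c : ℂ} (he : IsEigenfunction κ e c) {M : ℕ}
    (hM : 0 < M) (hc : c ^ M = 1) {r : ℕ} (K : ℤ) (k : Fin r → ℤ) {ε : ℝ} (hε : 0 < ε)
    (hA : 2 * √ε ≤ ‖∫ x, (pat (0 :: K :: List.ofFn k) x : ℂ) * e x ∂κ‖) :
    ∃ᶠ m : ℕ in atTop, ∃ (S : Set ℤ) (a : ℤ → ℤ) (w : (Fin (r + 1) → ℤ) → ℤ → ℂ),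
      (∀ n ∈ S, ∃ p : ℕ, p.Prime ∧ n = p ∧ 8 ^ (m + 1) ≤ 8 * p) ∧
      (∀ n ∈ S, ((a n * n : ℤ) : ZMod M) = 1) ∧
      (∀ l n, ‖w l n‖ ≤ 1) ∧ (∀ l n, w l n ≠ 0 → ∀ ω, n + vertexSum ω l ∈ S) ∧
      (‖∫ x, (pat (0 :: K :: List.ofFn k) x : ℂ) * e x ∂κ‖ - 2 * √ε) ^ 2 ^ (r + 1) ≤
        (16 * log ((8 ^ (m + 1) : ℕ) : ℝ)) ^ 2 ^ (r + 1) /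
            (2 * ((8 ^ (m + 1) : ℕ) : ℝ)) ^ (r + 2) *
          ∑ l ∈ symmBox (8 ^ (m + 1)) (r + 1),
            ‖∫ x, (iterDeriv (r + 1) (fun i => vdcDirections K k i * l i) coord x : ℂ) *
              ∑ n ∈ Ico (0 : ℤ) (8 ^ (m + 1) : ℕ), w l n * e x ^ cubeDiff (r + 1) a l n ∂κ‖ := by
  classical
  have hT := hErg.toMeasurePreserving
  have : NeZero M := ⟨hM.ne'⟩
  obtain ⟨T, y, hy, hT1, hey⟩ := he.exists_finite_valued hErg hM hc
  set l₀ := 0 :: K :: List.ofFn k with hl₀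
  obtain ⟨t, C, hC, hl⟩ := exists_window l₀
  refine ((frequently_card_good_primes_ge (D.summable_info hT hy C) hε).and_eventually
    (eventually_ge_atTop M)).mono fun m hm => ?_
  obtain ⟨hcard, hmM⟩ := hm
  set N : ℕ := 8 ^ (m + 1) with hN
  set P := (Ico (8 ^ m) N).filter fun p => p.Prime ∧ D.info y C p ≤ ε
  set A := ‖∫ x, (pat l₀ x : ℂ) * e x ∂κ‖ - 2 * √ε with hAdef
  set S : Set ℤ := {n | ∃ p ∈ P, n = (p : ℕ)}
  set a : ℤ → ℤ := fun n => (((n : ZMod M)⁻¹).val : ℕ) with ha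
  set U : ℤ → ℂ := fun n => ∫ x, (pat (l₀.map (n * ·)) x : ℂ) * e x ^ a n ∂κ with hU
  set z : ℤ → ℂ := fun n => if n ∈ S then (starRingEnd ℂ) (U n) / ‖U n‖ else 0 with hz
  have hPp : ∀ p ∈ P, p.Prime ∧ D.info y C p ≤ ε ∧ 8 ^ m ≤ p ∧ p < N := fun p hp => by
    obtain ⟨h1, h2⟩ := mem_filter.1 hp
    exact ⟨h2.1, h2.2, mem_Ico.1 h1⟩
  have hcop : ∀ p ∈ P, p.Coprime M := fun p hp => by
    have h8 : m < 8 ^ m := Nat.lt_pow_self (by norm_num)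
    refine ((hPp p hp).1.coprime_iff_not_dvd).2 fun h => ?_
    have := Nat.le_of_dvd hM h
    have := (hPp p hp).2.2.1
    omega
  have hinv : ∀ p ∈ P, ((a p * p : ℤ) : ZMod M) = 1 := fun p hp => by
    have := ZMod.coe_mul_inv_eq_one p (hcop p hp)
    rw [ha]; push_cast; rw [ZMod.natCast_zmod_val, mul_comm]; exact this
  have hUA : ∀ p ∈ P, A ≤ ‖U p‖ := fun p hp => by
    set b : ℕ := (((p : ℤ) : ZMod M)⁻¹).val
    have hab : a p = b := rfl
    have hcb : c ^ (b * p) = c := by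
      have h1 : b * p ≡ 1 [MOD M] := by
        rw [← ZMod.natCast_eq_natCast_iff]
        have := hinv p hp
        rw [hab] at this
        exact_mod_cast this
      rw [pow_eq_pow_mod _ hc, h1, ← pow_eq_pow_mod _ hc, pow_one]
    obtain ⟨ζ, hζ, h⟩ := D.exists_dilate_eq_pow hT (hPp p hp).1 he hcb
    have h1 := D.norm_integral_pat_sub_le hT (hPp p hp).1 he hy hT1 hey hC (hPp p hp).2.1 hl hζ h 1
    simp only [pow_one, mul_one] at h1
    have h2 : (l₀.map (· + t)).map ((p : ℤ) * ·) = (l₀.map ((p : ℤ) * ·)).map (· + p * t) := by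
      rw [List.map_map, List.map_map]; exact List.map_congr_left fun k _ => by simp [mul_add]
    have h3 : ‖∫ x, (pat ((l₀.map (· + t)).map ((p : ℤ) * ·)) x : ℂ) * e x ^ b ∂κ‖ = ‖U p‖ := by
      rw [h2, norm_integral_pat_map_add hT (he.pow b)]
      simp only [hU, hab, zpow_natCast]
    have h4 := norm_integral_pat_map_add hT he l₀ t
    have h5 := (abs_norm_sub_norm_le _ _).trans h1
    rw [norm_mul, norm_mul, norm_pow, norm_neg, norm_one, one_pow, hζ, one_mul, one_mul, h3, h4] at h5
    have := (abs_le.1 h5).2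
    rw [hAdef]; linarith
  have hS1 : ∀ n ∈ S, n ∈ Ico (0 : ℤ) N := by
    rintro _ ⟨p, hp, rfl⟩
    have := (hPp p hp).2.2.2
    exact mem_Ico.2 ⟨by positivity, by exact_mod_cast this⟩
  have hz1 : ∀ n, ‖z n‖ ≤ 1 := fun n => by
    simp only [hz]
    split_ifs
    · rw [norm_div, RCLike.norm_conj, Complex.norm_real, norm_norm]; exact div_self_le_one _
    · simp
  have hzS : ∀ n, z n ≠ 0 → n ∈ S := fun n h => by
    by_contra hn
    exact h (if_neg hn)
  obtain ⟨w, hw1, hw2, hw3⟩ := exists_vanDerCorput hT he N r K measurable_coord abs_coord_le k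
    (f := fun _ => coord) (fun _ => measurable_coord) (fun _ => abs_coord_le) hS1 hz1 hzS a
  refine ⟨S, a, w, ?_, ?_, hw1, hw2, ?_⟩
  · rintro _ ⟨p, hp, rfl⟩
    refine ⟨p, (hPp p hp).1, rfl, ?_⟩
    have := (hPp p hp).2.2.1
    rw [hN, pow_succ]; omega
  · rintro _ ⟨p, hp, rfl⟩
    exact hinv p hp
  have hA0 : 0 ≤ A := sub_nonneg.2 hA
  set Ψ := multiAverage N z e a K coord k fun _ => coord with hΨ
  have hsum : ∫ x, (coord x : ℂ) * Ψ x ∂κ = ((∑ p ∈ P, ‖U p‖ : ℝ) : ℂ) := by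
    have e1 : ∀ x, (coord x : ℂ) * Ψ x = ∑ n ∈ Ico (0 : ℤ) N,
        z n * ((pat (l₀.map (n * ·)) x : ℂ) * e x ^ a n) := fun x => by
      rw [hΨ, multiAverage, mul_sum]
      refine sum_congr rfl fun n _ => ?_
      rw [hl₀, pat_map_mul_cons]; push_cast; ring
    have e2 : ∀ n, Integrable (fun x => z n * ((pat (l₀.map (n * ·)) x : ℂ) * e x ^ a n)) κ := fun n => by
      refine Integrable.const_mul ?_ _
      have : a n = ((n : ZMod M)⁻¹).val := rfl
      simp only [this, zpow_natCast]; exact (he.pow _).integrable_mul (measurable_pat _) (abs_pat_le _)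
    simp only [e1]; rw [integral_finsetSum _ fun n _ => e2 n]
    simp only [integral_const_mul]
    have e3 : ∀ n, z n * U n = if n ∈ S then (‖U n‖ : ℂ) else 0 := fun n => by
      simp only [hz]
      split_ifs
      · by_cases h : U n = 0
        · simp [h]
        · have h' : (‖U n‖ : ℂ) ≠ 0 := by simpa using h
          rw [div_mul_eq_mul_div, mul_comm, Complex.mul_conj, Complex.normSq_eq_norm_sq]; push_cast; field_simp
      · simp
    rw [sum_congr rfl fun n _ => e3 n, ← sum_filter, Complex.ofReal_sum]
    refine (sum_nbij (fun p : ℕ => (p : ℤ)) (fun p hp => ?_) (fun p _ q _ h => by simpa using h)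
      (fun n hn => ?_) fun p _ => rfl).symm
    · exact mem_filter.2 ⟨hS1 _ ⟨p, hp, rfl⟩, ⟨p, hp, rfl⟩⟩
    · obtain ⟨p, hp, rfl⟩ := (mem_filter.1 hn).2
      exact ⟨p, hp, rfl⟩
  have h1 := norm_integral_mul_sq_le abs_coord_le (measurable_multiAverage he N z a K measurable_coord k
    (f := fun _ => coord) fun _ => measurable_coord) (κ := κ) (norm_multiAverage_le he N hz1 a K
      abs_coord_le k fun _ => abs_coord_le)
  rw [← hΨ, hsum, Complex.norm_real, norm_eq_abs, sq_abs] at h1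
  have h2 : (P.card : ℝ) * A ≤ ∑ p ∈ P, ‖U p‖ := by rw [← nsmul_eq_mul]; exact card_nsmul_le_sum _ _ _ hUA
  have hL : 0 ≤ log N := log_natCast_nonneg _
  have h3 : A * N ≤ 8 * log N * ∑ p ∈ P, ‖U p‖ := by
    have := mul_le_mul_of_nonneg_right hcard hA0
    have h4 := mul_le_mul_of_nonneg_left h2 hL
    nlinarith
  have h4 : (A * N) ^ 2 ^ (r + 1) ≤ (8 * log N) ^ 2 ^ (r + 1) *
      ((2 * N : ℝ) ^ (2 ^ (r + 1) - (r + 2)) * ∑ l ∈ symmBox N (r + 1),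
          ‖∫ x, (iterDeriv (r + 1) (fun i => vdcDirections K k i * l i) coord x : ℂ) *
            ∑ n ∈ Ico (0 : ℤ) N, w l n * e x ^ cubeDiff (r + 1) a l n ∂κ‖) := by
    refine (pow_le_pow_left₀ (by positivity) h3 _).trans ?_
    rw [mul_pow]
    refine mul_le_mul_of_nonneg_left ?_ (by positivity)
    refine le_trans ?_ hw3
    rw [pow_succ' 2 r, pow_mul]; exact pow_le_pow_left₀ (sq_nonneg _) h1 _
  have hr : r + 2 ≤ 2 ^ (r + 1) := Nat.lt_two_pow_self
  rw [div_mul_eq_mul_div, le_div_iff₀ (by positivity)]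
  have h5 : (2 * (N : ℝ)) ^ 2 ^ (r + 1) = (2 * (N : ℝ)) ^ (2 ^ (r + 1) - (r + 2)) * (2 * (N : ℝ)) ^ (r + 2) := by
    rw [← pow_add, Nat.sub_add_cancel hr]
  have h6 : (0 : ℝ) < (2 * (N : ℝ)) ^ (2 ^ (r + 1) - (r + 2)) := by positivity
  refine le_of_mul_le_mul_left ?_ h6
  calc _ = A ^ 2 ^ (r + 1) * (2 * (N : ℝ)) ^ 2 ^ (r + 1) := by rw [h5]; ring
    _ = 2 ^ 2 ^ (r + 1) * (A * N) ^ 2 ^ (r + 1) := by simp only [mul_pow]; ring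
    _ ≤ _ := mul_le_mul_of_nonneg_left h4 (by positivity)
    _ = _ := by
      rw [show (16 : ℝ) * log N = 2 * (8 * log N) by ring, mul_pow 2 (8 * log N)]
      ring

end PrimeAverages

section PatternIntegrals

open Complex ComplexConjugate

variable {κ : Measure SymbolSpace} [IsProbabilityMeasure κ] {e : SymbolSpace → ℂ} {c : ℂ}

theorem integral_zpow_eq_zero (hT : MeasurePreserving shift κ κ) (he : IsEigenfunction κ e c) {j : ℤ} (hj : c ^ j ≠ 1) : ∫ x, e x ^ j ∂κ = 0 := by
  have h : ∫ x, e x ^ j ∂κ = c ^ j * ∫ x, e x ^ j ∂κ := by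
    conv_lhs => rw [← integral_comp_shiftBy hT 1]
    rw [← integral_const_mul]
    refine integral_congr_ae ?_
    filter_upwards [he.step] with x hx
    rw [hx, mul_zpow]
  by_contra h0
  exact hj (mul_right_cancel₀ h0 (by rw [one_mul]; exact h.symm))

open Classical in
/-- The mean square of an exponential sum is at most the number of coinciding frequencies. -/
theorem integral_norm_sq_sum_zpow_le (hT : MeasurePreserving shift κ κ) (he : IsEigenfunction κ e c) (s : Finset ℤ) {w : ℤ → ℂ} (hw : ∀ n, ‖w n‖ ≤ 1) (b : ℤ → ℤ) :
    ∫ x, ‖∑ n ∈ s, w n * e x ^ b n‖ ^ 2 ∂κ ≤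
      ((s ×ˢ s).filter fun z => w z.1 ≠ 0 ∧ w z.2 ≠ 0 ∧ c ^ (b z.1 - b z.2) = 1).card := by
  have h1 : ∀ x, ((‖∑ n ∈ s, w n * e x ^ b n‖ ^ 2 : ℝ) : ℂ) =
      ∑ z ∈ s ×ˢ s, w z.1 * conj (w z.2) * e x ^ (b z.1 - b z.2) := fun x => by
    rw [ofReal_pow, ← mul_conj', map_sum, sum_mul_sum, sum_product]
    refine sum_congr rfl fun n _ => sum_congr rfl fun n' _ => ?_
    rw [← he.zpow_mul_conj, map_mul]; ring
  have hInt : ∀ z : ℤ × ℤ, Integrable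
      (fun x => w z.1 * conj (w z.2) * e x ^ (b z.1 - b z.2)) κ := fun z =>
    (Integrable.of_bound (C := 1) (he.measurable_zpow _).aestronglyMeasurable (ae_of_all _ fun x => by
      rw [norm_zpow, he.norm_eq_one, one_zpow])).const_mul _
  have h2 : ((∫ x, ‖∑ n ∈ s, w n * e x ^ b n‖ ^ 2 ∂κ : ℝ) : ℂ) =
      ∑ z ∈ s ×ˢ s, w z.1 * conj (w z.2) * ∫ x, e x ^ (b z.1 - b z.2) ∂κ := by
    rw [← integral_complex_ofReal]
    simp only [h1]; rw [integral_finsetSum _ fun z _ => hInt z]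
    simp only [integral_const_mul]
  have h3 : ∫ x, ‖∑ n ∈ s, w n * e x ^ b n‖ ^ 2 ∂κ =
      ‖((∫ x, ‖∑ n ∈ s, w n * e x ^ b n‖ ^ 2 ∂κ : ℝ) : ℂ)‖ := by
    rw [norm_real, Real.norm_eq_abs, abs_of_nonneg (integral_nonneg fun _ => sq_nonneg _)]
  rw [h3, h2, card_filter, Nat.cast_sum]
  refine (norm_sum_le _ _).trans (sum_le_sum fun z _ => ?_)
  split_ifs with hz
  · rw [norm_mul, norm_mul, RCLike.norm_conj, Nat.cast_one]
    refine mul_le_one₀ (mul_le_one₀ (hw _) (norm_nonneg _) (hw _)) (norm_nonneg _) ?_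
    refine (norm_integral_le_of_norm_le_const (C := 1) (ae_of_all _ fun x => ?_)).trans (by simp)
    rw [norm_zpow, he.norm_eq_one, one_zpow]
  · rw [not_and_or, not_and_or, not_not, not_not] at hz
    rcases hz with h | h | h
    · simp [h]
    · simp [h]
    · simp [integral_zpow_eq_zero hT he h]

theorem pow_le_of_cube_sum_le {A L N B v g : ℝ} {R : ℕ} (hA : 0 ≤ A) (hN : 0 < N) (hL : 0 < L)
    (h : A ^ 2 ^ R ≤ (16 * L) ^ 2 ^ R / (2 * N) ^ (R + 1) * B) (hv : 0 ≤ v) (hg : 0 ≤ g)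
    (hB : B ^ 2 ≤ v * N ^ R * (g * (N ^ (R + 2) / L ^ 2 ^ (R + 1)))) :
    A ^ 2 ^ (R + 1) ≤ 16 ^ 2 ^ (R + 1) * (v * g) := by
  have h1 := pow_le_pow_left₀ (by positivity) h 2
  rw [← pow_mul, ← pow_succ] at h1
  refine h1.trans ?_
  rw [mul_pow _ B]
  refine (mul_le_mul_of_nonneg_left hB (by positivity)).trans ?_
  have e1 : ((16 * L) ^ 2 ^ R / (2 * N) ^ (R + 1)) ^ 2 *
      (v * N ^ R * (g * (N ^ (R + 2) / L ^ 2 ^ (R + 1)))) =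
      16 ^ 2 ^ (R + 1) * (v * g) / 4 ^ (R + 1) := by
    rw [div_pow, ← pow_mul (16 * L), ← pow_succ 2 R, mul_pow, mul_pow, mul_pow, ← pow_mul 2,
      mul_comm (R + 1) 2, pow_mul 2 2, ← pow_mul N]
    field_simp; ring
  rw [e1]; exact div_le_self (by positivity) (one_le_pow₀ (by norm_num))

/-- Uniformity of the zeroth coordinate makes pattern integrals vanish. -/
theorem DilationSystem.integral_pat_eq_zero_of_gowersAvg_le (D : DilationSystem κ)
    (hErg : Ergodic shift κ) {r : ℕ} (K : ℤ) (k : Fin r → ℤ) (hd : ∀ i, vdcDirections K k i ≠ 0)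
    (hU : ∀ ε : ℝ, 0 < ε → ∃ Ls : List ℕ, Ls.length = r + 1 ∧ (∀ L ∈ Ls, 0 < L) ∧
      gowersAvg κ Ls coord ≤ ε) : ∫ x, pat (0 :: K :: List.ofFn k) x ∂κ = 0 := by
  classical
  have hT := hErg.toMeasurePreserving
  set l₀ := 0 :: K :: List.ofFn k with hl₀
  have he : IsEigenfunction κ (fun _ => 1) 1 := ⟨measurable_const, by simp, by simp⟩
  set B := ‖∫ x, (pat l₀ x : ℂ) * (fun _ => 1 : SymbolSpace → ℂ) x ∂κ‖ with hB
  suffices hB0 : B = 0 by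
    simp only [hB, mul_one, integral_complex_ofReal, norm_real, norm_eq_zero] at hB0; exact hB0
  by_contra hne
  have hBpos : 0 < B := lt_of_le_of_ne (norm_nonneg _) (Ne.symm hne)
  have hsq : 2 * √((B / 4) ^ 2) = B / 2 := by rw [Real.sqrt_sq (by positivity)]; ring
  have hfreq := D.frequently_norm_integral_pat_pow_le hErg he one_pos (one_pow 1) K k
    (ε := (B / 4) ^ 2) (by positivity) (by rw [hsq, ← hl₀, ← hB]; linarith)
  rw [hsq, ← hl₀, ← hB] at hfreq
  obtain ⟨C, hC, hpairs⟩ := exists_sum_prime_pairs_le (r + 1)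
  obtain ⟨N₀, hpairs⟩ := hpairs 2 Nat.prime_two 0
  set v : ℝ := ∏ i, (6 * (vdcDirections K k i).natAbs : ℝ)
  set X : ℝ := (B - B / 2) ^ 2 ^ (r + 1 + 1)
  have hX0 : 0 < X := pow_pos (by linarith) _
  set Y : ℝ := 16 ^ 2 ^ (r + 1 + 1) * (v * C + 1) with hY
  have hY0 : 0 < Y := by positivity
  obtain ⟨Ls, hLs, hLpos, hLs2⟩ := hU (X / (2 * Y)) (by positivity)
  set η := gowersAvg κ Ls coord
  have hη0 : 0 ≤ η := gowersAvg_nonneg _ _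
  obtain ⟨m, ⟨S, a, w, hS, -, hw1, hw2, hw3⟩, hm⟩ := (hfreq.and_eventually
    (eventually_ge_atTop (N₀ + Ls.sum))).exists
  set N : ℕ := 8 ^ (m + 1)
  have hmN : m < N := (Nat.lt_succ_self m).trans (Nat.lt_pow_self (by norm_num))
  have hN1 : 1 < N := Nat.one_lt_pow (by omega) (by norm_num)
  have hL : 0 < Real.log N := Real.log_pos (by exact_mod_cast hN1)
  have hN0 : (0 : ℝ) < N := by positivity
  set c : (Fin (r + 1) → ℤ) → ℝ := fun l =>
    ∫ x, iterDeriv (r + 1) (fun i => vdcDirections K k i * l i) coord x ∂κ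
  set W : (Fin (r + 1) → ℤ) → ℝ := fun l => ‖∑ n ∈ Ico (0 : ℤ) N, w l n‖
  have e1 : ∀ l, ‖∫ x, (iterDeriv (r + 1) (fun i => vdcDirections K k i * l i) coord x : ℂ) *
      ∑ n ∈ Ico (0 : ℤ) N, w l n * (1 : ℂ) ^ cubeDiff (r + 1) a l n ∂κ‖ = W l * |c l| := fun l => by
    simp only [one_zpow, mul_one]
    rw [integral_mul_const, integral_complex_ofReal, norm_mul, norm_real, mul_comm]; rfl
  simp only [e1] at hw3
  have hc2 : ∑ l ∈ symmBox N (r + 1), |c l| ^ 2 ≤ v * N ^ (r + 1) * η := by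
    simp only [sq_abs]
    refine (sum_sq_integral_iterDeriv_le hT N hLpos (fun L hL => ?_) (r + 1) hLs hd measurable_coord
      abs_coord_le).trans (le_of_eq ?_)
    · have := List.single_le_sum (fun _ _ => Nat.zero_le _) L hL
      omega
    · rw [prod_mul_distrib, prod_const, card_univ, Fintype.card_fin]
  have hW2 : ∑ l ∈ symmBox N (r + 1), W l ^ 2 ≤ C * (N ^ (r + 1 + 2) / Real.log N ^ 2 ^ (r + 1 + 1)) := by
    have h1 := hpairs N (by omega) S hS (fun _ => True)
    have h2 : (Nat.card {ρ : Bool ⊕ Fin (r + 1) → ZMod (2 ^ 0) // True} : ℝ) = 1 := by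
      rw [Nat.cast_eq_one, Nat.card_eq_one_iff_unique]
      exact ⟨⟨fun x y => Subtype.ext (funext fun s => Subsingleton.elim (α := ZMod 1) _ _)⟩, ⟨⟨0, trivial⟩⟩⟩
    rw [h2, one_mul, pow_zero, Nat.cast_one, div_one, mul_div_assoc] at h1
    refine le_trans (sum_le_sum fun l _ => ?_) h1
    have h3 := integral_norm_sq_sum_zpow_le hT he (Ico (0 : ℤ) N) (hw1 l) fun _ => 0
    simp only [one_zpow, mul_one, integral_const, probReal_univ, one_smul] at h3
    refine h3.trans (Nat.cast_le.2 (card_le_card fun z hz => ?_))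
    simp only [mem_filter] at hz ⊢; exact ⟨hz.1, hw2 l _ hz.2.1, hw2 l _ hz.2.2.1, trivial⟩
  have hfin := pow_le_of_cube_sum_le (v := v * η) (g := C) (by linarith) hN0 hL hw3 (by positivity) hC.le (by
    refine (sum_mul_sq_le_sq_mul_sq _ _ _).trans ?_
    rw [mul_comm, mul_right_comm v]
    exact mul_le_mul hc2 hW2 (sum_nonneg fun _ _ => sq_nonneg _) (by positivity))
  have h5 : X ≤ Y * η := by
    have h6 : v * η * C ≤ (v * C + 1) * η := by nlinarith
    refine hfin.trans ((mul_le_mul_of_nonneg_left h6 (by positivity)).trans (le_of_eq ?_))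
    rw [hY, mul_assoc]
  have h6 := mul_le_mul_of_nonneg_left hLs2 hY0.le
  have h7 : Y * (X / (2 * Y)) = X / 2 := by field_simp
  linarith

end PatternIntegrals

section Collisions

open Polynomial

theorem pow_sub_dvd_of_not_dvd {q : ℕ} (hq : q.Prime) {b j : ℕ} {x y : ℤ} (hx : ¬ (q : ℤ) ^ b ∣ x)
    (h : (q : ℤ) ^ j ∣ x * y) : (q : ℤ) ^ (j - (b - 1)) ∣ y := by
  have h1 : q ^ j ∣ x.natAbs * y.natAbs := by rw [← Int.natAbs_mul, ← Int.natCast_dvd]; exact_mod_cast h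
  obtain ⟨d₁, d₂, hd₁, hd₂, hd⟩ := Nat.dvd_mul.1 h1
  obtain ⟨i, -, rfl⟩ := (Nat.dvd_prime_pow hq).1 ⟨d₂, hd.symm⟩
  obtain ⟨i', -, rfl⟩ := (Nat.dvd_prime_pow hq).1 (Dvd.intro_left _ hd)
  rw [← pow_add] at hd
  have hij := Nat.pow_right_injective hq.two_le hd
  have hib : i < b := by
    by_contra hb
    refine hx ?_
    rw [← Nat.cast_pow, Int.natCast_dvd]; exact (pow_dvd_pow q (not_lt.1 hb)).trans hd₁
  rw [← Nat.cast_pow, Int.natCast_dvd]; exact (pow_dvd_pow q (by omega)).trans hd₂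

theorem le_mul_of_pow_dvd_prod {q : ℕ} (hq : q.Prime) {ι : Type*} (s : Finset ι) {u : ι → ℤ} {b j : ℕ}
    (hu : ∀ i ∈ s, ¬ (q : ℤ) ^ b ∣ u i) (h : (q : ℤ) ^ j ∣ ∏ i ∈ s, u i) : j ≤ s.card * (b - 1) := by
  classical
  induction s using Finset.induction_on generalizing j with
  | empty =>
    rw [prod_empty, ← Nat.cast_pow, Int.natCast_dvd, Int.natAbs_one, Nat.dvd_one,
      Nat.pow_eq_one] at h
    have := hq.ne_one
    simp; tauto
  | insert i s hi ih =>
    rw [prod_insert hi] at h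
    have := ih (fun i hi => hu i (mem_insert_of_mem hi))
      (pow_sub_dvd_of_not_dvd hq (hu i (mem_insert_self _ _)) h)
    rw [card_insert_of_notMem hi, add_mul, one_mul]; omega

/-- A polynomial with many roots modulo a prime power, which are separated modulo a smaller power,
has all its values divisible by a large power. -/
theorem pow_dvd_eval_of_card_lt {q : ℕ} (hq : q.Prime) {b : ℕ} (d : ℕ) {j : ℕ} {P : Polynomial ℤ}
    (hP : P.natDegree ≤ d) {Y : Finset ℤ} (hY : d < Y.card)
    (hsep : ∀ x ∈ Y, ∀ y ∈ Y, x ≠ y → ¬ (q : ℤ) ^ b ∣ x - y)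
    (hroot : ∀ x ∈ Y, (q : ℤ) ^ j ∣ P.eval x) (t : ℤ) : (q : ℤ) ^ (j - d * (b - 1)) ∣ P.eval t := by
  classical
  induction d generalizing j P Y with
  | zero =>
    obtain ⟨x, hx⟩ := card_pos.1 hY
    have := hroot x hx
    rw [eq_C_of_natDegree_le_zero hP, eval_C] at this ⊢; simpa using this
  | succ d ih =>
    obtain ⟨x₀, hx₀⟩ := card_pos.1 (Nat.zero_lt_of_lt hY)
    set P₁ := P /ₘ (X - C x₀) with hP₁
    have hev : ∀ x, P.eval x = P.eval x₀ + (x - x₀) * P₁.eval x := fun x => by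
      have := congrArg (eval x) (modByMonic_add_div P (X - C x₀))
      rw [modByMonic_X_sub_C_eq_C_eval, ← hP₁, eval_add, eval_mul,
        eval_sub, eval_X, eval_C, eval_C] at this
      exact this.symm
    have h1 := ih (j := j - (b - 1)) (P := P₁) (Y := Y.erase x₀)
      (by rw [hP₁, natDegree_divByMonic _ (monic_X_sub_C x₀),
            natDegree_X_sub_C]; omega)
      (by rw [card_erase_of_mem hx₀]; omega)
      (fun x hx y hy => hsep x (mem_of_mem_erase hx) y (mem_of_mem_erase hy))
      (fun x hx => pow_sub_dvd_of_not_dvd hq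
        (hsep x (mem_of_mem_erase hx) x₀ hx₀ (ne_of_mem_erase hx)) (by
          have := dvd_sub (hroot x (mem_of_mem_erase hx)) (hroot x₀ hx₀)
          rwa [hev x, add_sub_cancel_left] at this))
    rw [hev t]
    refine dvd_add ((pow_dvd_pow _ (Nat.sub_le _ _)).trans (hroot x₀ hx₀)) (Dvd.dvd.mul_left ?_ _)
    rwa [Nat.sub_sub, show b - 1 + d * (b - 1) = (d + 1) * (b - 1) by ring] at h1

open Classical in
/-- The number of solutions of an equation between sums of inverses modulo a prime power. -/
theorem card_sum_inv_eq_le {q : ℕ} (hq : q.Prime) {a b : ℕ} (hb : b ≤ a) {Ω : Type*} [Fintype Ω]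
    (hab : 2 * Fintype.card Ω * (b - 1) < a) {ω₀ : Ω} {u sg : Ω → ℤ} (hu₀ : u ω₀ = 0)
    (hsg : IsUnit (sg ω₀)) (hu : ∀ ω, ω ≠ ω₀ → ¬ (q : ℤ) ^ b ∣ u ω) (v : ZMod (q ^ a)) :
    q ^ b * Nat.card {x : ZMod (q ^ a) // (∀ ω, IsUnit (x + u ω)) ∧
      ∑ ω, (sg ω : ZMod (q ^ a)) * (x + u ω)⁻¹ = v} ≤ Fintype.card Ω * q ^ a := by
  have : NeZero (q ^ a) := ⟨(pow_pos hq.pos a).ne'⟩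
  have : NeZero (q ^ b) := ⟨(pow_pos hq.pos b).ne'⟩
  rw [Nat.card_eq_fintype_card, Fintype.card_subtype]
  set Z := univ.filter fun x : ZMod (q ^ a) => (∀ ω, IsUnit (x + u ω)) ∧
      ∑ ω, (sg ω : ZMod (q ^ a)) * (x + u ω)⁻¹ = v
  set φ := ZMod.castHom (pow_dvd_pow q hb) (ZMod (q ^ b)) with hφ
  have hfib : ∀ y, q ^ b * (univ.filter fun x => φ x = y).card = q ^ a := fun y => by
    have := card_mul_card_fiber φ.toAddMonoidHom (ZMod.castHom_surjective (pow_dvd_pow q hb)) y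
    rwa [ZMod.card, ZMod.card] at this
  have hZle : q ^ b * Z.card ≤ (Z.image φ).card * q ^ a := by
    rw [card_eq_sum_card_image φ Z, mul_sum, ← smul_eq_mul (Z.image φ).card]
    refine sum_le_card_nsmul _ _ _ fun y _ => ?_
    exact (Nat.mul_le_mul_left _ (card_le_card fun x hx => by
      simpa using (mem_filter.1 hx).2)).trans (hfib y).le
  refine hZle.trans (Nat.mul_le_mul_right _ (not_lt.1 fun hcard => ?_))
  have hφv : ∀ x, φ x = ((x.val : ℤ) : ZMod (q ^ b)) := fun x => by
    rw [hφ, ZMod.castHom_apply, ZMod.cast_eq_val]; simp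
  have hch : ∀ y, ∃ x, y ∈ Z.image φ → x ∈ Z ∧ φ x = y := fun y => by
    by_cases hy : y ∈ Z.image φ
    · obtain ⟨x, hx⟩ := mem_image.1 hy
      exact ⟨x, fun _ => hx⟩
    · exact ⟨0, fun h => absurd h hy⟩
  choose g hg using hch
  set Y : Finset ℤ := (Z.image φ).image fun y => ((g y).val : ℤ)
  have hYc : Y.card = (Z.image φ).card := card_image_of_injOn fun y hy y' hy' h => by
    rw [← (hg y hy).2, ← (hg y' hy').2, ZMod.val_injective _ (Int.natCast_inj.1 h)]
  set P : Polynomial ℤ := C (v.val : ℤ) * ∏ ω, (X + C (u ω)) -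
    ∑ ω, C (sg ω) * ∏ ω' ∈ univ.erase ω, (X + C (u ω')) with hP
  have hdeg : ∀ s : Finset Ω, (∏ ω ∈ s, (X + C (u ω))).natDegree ≤ Fintype.card Ω :=
    fun s => (natDegree_prod_le _ _).trans (by
      simp only [natDegree_X_add_C, sum_const, smul_eq_mul, mul_one]
      exact card_le_univ s)
  have hPdeg : P.natDegree ≤ Fintype.card Ω :=
    (natDegree_sub_le _ _).trans (max_le
      ((natDegree_C_mul_le _ _).trans (hdeg _))
      (natDegree_sum_le_of_forall_le _ _ fun ω _ =>
        (natDegree_C_mul_le _ _).trans (hdeg _)))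
  have hPev : ∀ t, P.eval t = v.val * ∏ ω, (t + u ω) -
      ∑ ω, sg ω * ∏ ω' ∈ univ.erase ω, (t + u ω') := fun t => by
    simp only [hP, eval_sub, eval_mul, eval_prod,
      eval_finsetSum, eval_add, eval_X, eval_C]
  have hdvd := pow_dvd_eval_of_card_lt hq (b := b) (j := a) _ hPdeg (hYc ▸ hcard)
    (fun x hx y hy hxy hdv => hxy ?_) (fun x hx => ?_) 0
  · rw [hPev, prod_eq_zero (mem_univ ω₀) (by simp [hu₀]), mul_zero, zero_sub, dvd_neg,
      sum_eq_single ω₀ (fun ω _ hω => by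
        rw [prod_eq_zero (mem_erase.2 ⟨hω.symm, mem_univ _⟩) (by simp [hu₀]),
          mul_zero]) (by simp), hsg.dvd_mul_left] at hdvd
    simp only [zero_add] at hdvd
    have h1 := le_mul_of_pow_dvd_prod hq _ (fun ω hω => hu ω (ne_of_mem_erase hω)) hdvd
    have h2 : (univ.erase ω₀).card * (b - 1) ≤ Fintype.card Ω * (b - 1) :=
      Nat.mul_le_mul_right _ (card_le_univ _)
    rw [mul_assoc] at hab; omega
  · obtain ⟨y₁, hy₁, rfl⟩ := mem_image.1 hx
    obtain ⟨y₂, hy₂, rfl⟩ := mem_image.1 hy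
    have h1 : φ (g y₁) = φ (g y₂) := by
      rw [hφv, hφv, ← sub_eq_zero, ← Int.cast_sub, ZMod.intCast_zmod_eq_zero_iff_dvd]
      exact_mod_cast hdv
    rw [(hg y₁ hy₁).2, (hg y₂ hy₂).2] at h1; rw [h1]
  · obtain ⟨y, hy, rfl⟩ := mem_image.1 hx
    obtain ⟨-, hun, hsum⟩ := mem_filter.1 (hg y hy).1
    rw [hPev, ← Nat.cast_pow, ← ZMod.intCast_zmod_eq_zero_iff_dvd]; push_cast
    rw [ZMod.natCast_zmod_val, ZMod.natCast_zmod_val, ← hsum, sum_mul, sub_eq_zero]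
    refine sum_congr rfl fun ω _ => ?_
    rw [← mul_prod_erase _ _ (mem_univ ω), mul_assoc, ← mul_assoc _ (g y + _),
      mul_comm _ (g y + _), ZMod.mul_inv_of_unit _ (hun ω), one_mul]

/-- The sign of a subset. -/
def cubeSign {R : ℕ} (ω : Fin R → Bool) : ℤ := ∏ i, if ω i then -1 else 1

theorem cubeDiff_eq_sum {R : ℕ} (a : ℤ → ℤ) (l : Fin R → ℤ) (n : ℤ) :
    cubeDiff R a l n = ∑ ω, cubeSign ω * a (n + vertexSum ω l) := by
  induction R generalizing a n with
  | zero => simp [cubeDiff, cubeSign, vertexSum]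
  | succ R ih =>
    rw [cubeDiff, ih, ← (Fin.consEquiv fun _ => Bool).sum_comp, Fintype.sum_prod_type,
      Fintype.sum_bool, ← sum_add_distrib]
    refine sum_congr rfl fun ω _ => ?_
    have h : ∀ b, vertexSum (Fin.consEquiv (fun _ => Bool) (b, ω)) l =
        (if b then l 0 else 0) + vertexSum ω fun i => l i.succ := fun b => by
      rw [← vertexSum_cons]; exact congrArg _ (Fin.cons_self_tail l).symm
    rw [h, h]
    simp only [cubeSign, Fin.prod_univ_succ, Fin.consEquiv_apply, Fin.cons_zero, Fin.cons_succ]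
    simp only [if_true, Bool.false_eq_true, if_false, zero_add, add_comm (l 0), ← add_assoc]; ring

/-- Vertices of a cube in a ring. -/
def cubeVertex {A : Type*} [CommRing A] {R : ℕ} (ρ : Bool ⊕ Fin R → A) (b : Bool) (ω : Fin R → Bool) : A :=
  ρ (Sum.inl b) + ∑ i, if ω i then ρ (Sum.inr i) else 0

/-- Two cubes with the same sides, with unit vertices, and with the same alternating sum of the
inverses of the vertices. -/
def CubeCollision {Q R : ℕ} (ρ : Bool ⊕ Fin R → ZMod Q) : Prop :=
  (∀ b ω, IsUnit (cubeVertex ρ b ω)) ∧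
    ∑ ω, (cubeSign ω : ZMod Q) * (cubeVertex ρ false ω)⁻¹ =
      ∑ ω, (cubeSign ω : ZMod Q) * (cubeVertex ρ true ω)⁻¹

open Classical in
theorem card_cubeCollision_le {q : ℕ} (hq : q.Prime) {a b : ℕ} (hb : b ≤ a) (R : ℕ)
    (hab : 2 * 2 ^ R * (b - 1) < a) :
    q ^ b * Nat.card {ρ : Bool ⊕ Fin R → ZMod (q ^ a) // CubeCollision ρ} ≤
      2 * 2 ^ R * (q ^ a) ^ (R + 2) := by
  have : NeZero (q ^ a) := ⟨(pow_pos hq.pos a).ne'⟩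
  have : NeZero (q ^ b) := ⟨(pow_pos hq.pos b).ne'⟩
  have hΩ : Fintype.card (Fin R → Bool) = 2 ^ R := by simp
  set φ := ZMod.castHom (pow_dvd_pow q hb) (ZMod (q ^ b)) with hφ
  set V := Bool ⊕ Fin R → ZMod (q ^ a)
  have hV : Fintype.card V = (q ^ a) ^ (R + 2) := by
    simp only [V, Fintype.card_fun, ZMod.card, Fintype.card_sum, Fintype.card_bool, Fintype.card_fin]
    rw [add_comm]
  set f : (Fin R → Bool) → V →+ ZMod (q ^ b) := fun ω =>
    { toFun := fun ρ => φ (∑ i, if ω i then ρ (Sum.inr i) else 0)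
      map_zero' := by
        change φ (∑ i, if ω i then (0 : ZMod (q ^ a)) else 0) = 0
        simp
      map_add' := fun x y => by
        rw [← map_add, ← sum_add_distrib]
        refine congrArg _ (sum_congr rfl fun i _ => ?_)
        split_ifs
        · rfl
        · simp } with hf
  have hfs : ∀ ω, ω ≠ (fun _ => false) → Function.Surjective (f ω) := fun ω hω y => by
    obtain ⟨i, hi⟩ := Function.ne_iff.1 hω
    obtain ⟨x, rfl⟩ := ZMod.castHom_surjective (pow_dvd_pow q hb) y
    refine ⟨Sum.elim (fun _ => 0) (Pi.single i x), ?_⟩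
    have : (∑ j, if ω j then (Sum.elim (fun _ => 0) (Pi.single i x) : V) (Sum.inr j) else 0) = x := by
      rw [sum_eq_single i (fun j _ hj => by simp [hj]) (by simp)]
      simp [Bool.eq_true_of_not_eq_false hi]
    simp only [hf, AddMonoidHom.coe_mk, ZeroHom.coe_mk, this, hφ]
  set bad : Finset V := (univ.erase fun _ => false).biUnion fun ω =>
    univ.filter fun ρ => f ω ρ = 0
  set good : Finset V := univ.filter fun ρ => CubeCollision ρ ∧ ρ ∉ bad
  have h1 : Nat.card {ρ : V // CubeCollision ρ} ≤ bad.card + good.card := by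
    rw [Nat.card_eq_fintype_card, Fintype.card_subtype]
    refine (card_le_card fun ρ hρ => ?_).trans (card_union_le _ _)
    by_cases h : ρ ∈ bad
    · exact mem_union_left _ h
    · exact mem_union_right _ (mem_filter.2 ⟨mem_univ _, (mem_filter.1 hρ).2, h⟩)
  have h2 : q ^ b * bad.card ≤ 2 ^ R * (q ^ a) ^ (R + 2) := by
    refine (Nat.mul_le_mul_left _ card_biUnion_le).trans ?_
    rw [mul_sum]
    refine (sum_le_card_nsmul _ _ ((q ^ a) ^ (R + 2)) fun ω hω => ?_).trans ?_
    · have := card_mul_card_fiber (f ω) (hfs ω (ne_of_mem_erase hω)) 0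
      rw [ZMod.card, hV] at this; exact this.le
    · rw [smul_eq_mul, ← hΩ]; exact Nat.mul_le_mul_right _ (card_le_univ _)
  set π : V → (Fin R → ZMod (q ^ a)) × ZMod (q ^ a) := fun ρ => (fun i => ρ (Sum.inr i), ρ (Sum.inl true))
  have h3 : q ^ b * good.card ≤ 2 ^ R * (q ^ a) ^ (R + 2) := by
    rw [card_eq_sum_card_image π good, mul_sum]
    refine (sum_le_card_nsmul _ _ (2 ^ R * q ^ a) fun y hy => ?_).trans ?_
    · obtain ⟨ρ₀, hρ₀, rfl⟩ := mem_image.1 hy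
      obtain ⟨-, -, hρ₀⟩ := mem_filter.1 hρ₀
      set u : (Fin R → Bool) → ℤ := fun ω => ∑ i, if ω i then ((ρ₀ (Sum.inr i)).val : ℤ) else 0 with hu
      have hcast : ∀ ω, (u ω : ZMod (q ^ a)) = ∑ i, if ω i then ρ₀ (Sum.inr i) else 0 := fun ω => by
        simp only [hu, Int.cast_sum]
        refine sum_congr rfl fun i _ => ?_
        split_ifs <;> simp
      have key := card_sum_inv_eq_le hq hb (by rwa [hΩ]) (ω₀ := fun _ : Fin R => false) (u := u)
        (sg := cubeSign) (by simp [hu]) (by simp [cubeSign]) (fun ω hω hdvd => hρ₀ ?_)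
        (∑ ω, (cubeSign ω : ZMod (q ^ a)) * (cubeVertex ρ₀ true ω)⁻¹)
      · rw [hΩ] at key
        refine (Nat.mul_le_mul_left _ ?_).trans key
        rw [Nat.card_eq_fintype_card, Fintype.card_subtype]
        have hv : ∀ ρ : V, π ρ = π ρ₀ → (∀ ω, cubeVertex ρ false ω = ρ (Sum.inl false) + u ω) ∧
            ∀ ω, cubeVertex ρ true ω = cubeVertex ρ₀ true ω := fun ρ h => by
          obtain ⟨h1, h2⟩ := Prod.ext_iff.1 h
          have h3 : ∀ i, ρ (Sum.inr i) = ρ₀ (Sum.inr i) := congrFun h1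
          have h4 : ρ (Sum.inl true) = ρ₀ (Sum.inl true) := h2
          exact ⟨fun ω => by simp only [cubeVertex, hcast, h3], fun ω => by simp only [cubeVertex, h3, h4]⟩
        refine card_le_card_of_injOn (fun ρ => ρ (Sum.inl false)) (fun ρ hρ => ?_)
          fun ρ hρ ρ' hρ' h => ?_
        · obtain ⟨h5, h6⟩ := mem_filter.1 hρ
          obtain ⟨-, ⟨h7, h8⟩, -⟩ := mem_filter.1 h5
          obtain ⟨h9, h10⟩ := hv ρ h6
          simp only [h10, h9] at h8; exact mem_coe.2 (mem_filter.2 ⟨mem_univ _, fun ω => h9 ω ▸ h7 false ω, h8⟩)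
        · obtain ⟨h1, h2⟩ := Prod.ext_iff.1 ((mem_filter.1 hρ).2.trans (mem_filter.1 hρ').2.symm)
          funext s
          rcases s with (_ | _) | i
          · exact h
          · exact h2
          · exact congrFun h1 i
      · refine mem_biUnion.2 ⟨ω, mem_erase.2 ⟨hω, mem_univ _⟩,
          mem_filter.2 ⟨mem_univ _, ?_⟩⟩
        change φ (∑ i, if ω i then ρ₀ (Sum.inr i) else 0) = 0
        rw [← hcast, map_intCast, ZMod.intCast_zmod_eq_zero_iff_dvd]
        exact_mod_cast hdvd
    · rw [smul_eq_mul]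
      refine (Nat.mul_le_mul_right _ (card_le_univ _)).trans (le_of_eq ?_)
      rw [Fintype.card_prod, Fintype.card_fun, ZMod.card, Fintype.card_fin]; ring
  calc _ ≤ q ^ b * (bad.card + good.card) := Nat.mul_le_mul_left _ h1
    _ ≤ _ := by rw [mul_add]; linarith

end Collisions

section EigenCorrelations

open Real

variable {κ : Measure SymbolSpace} [IsProbabilityMeasure κ]

theorem exists_prime_pow_dvd_of_factorial_lt {B M : ℕ} (hM : B.factorial < M) :
    ∃ q a : ℕ, q.Prime ∧ q ^ a ∣ M ∧ B ≤ q ^ a := by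
  by_contra! h
  refine absurd (Nat.le_of_dvd B.factorial_pos ((Nat.dvd_iff_prime_pow_dvd_dvd _ _).2
    fun p k hp hk => ?_)) (not_le.2 hM)
  exact Nat.dvd_factorial (pow_pos hp.pos k) (h p k hp hk).le

theorem exists_exponent (q d T a : ℕ) (hq : 0 < q) (hd : 0 < d) (ha : 0 < a)
    (h : T ^ d ≤ q ^ a) : ∃ b ≤ a, d * (b - 1) < a ∧ T ≤ q ^ b := by
  have h1 := Nat.div_add_mod (a - 1) d
  have h2 := Nat.mod_lt (a - 1) hd
  refine ⟨(a - 1) / d + 1, ?_, ?_, ?_⟩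
  · have := Nat.div_le_self (a - 1) d
    omega
  · rw [Nat.add_sub_cancel]; omega
  · refine (Nat.pow_le_pow_iff_left hd.ne').1 (h.trans ?_)
    rw [← pow_mul]
    refine Nat.pow_le_pow_right hq ?_
    rw [add_mul, one_mul, mul_comm]; omega

/-- A coincidence of phases of cubes of primes is a collision of cubes modulo any divisor of the order. -/
theorem cubeCollision_of_zpow_eq_one {M Q : ℕ} (hQM : Q ∣ M) {c : ℂ} (hc0 : c ≠ 0) (hc : orderOf c = M) {S : Set ℤ}
    {a : ℤ → ℤ} (ha : ∀ n ∈ S, ((a n * n : ℤ) : ZMod M) = 1) {R : ℕ} {l : Fin R → ℤ} {z : ℤ × ℤ}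
    (h1 : ∀ ω, z.1 + vertexSum ω l ∈ S) (h2 : ∀ ω, z.2 + vertexSum ω l ∈ S)
    (h : c ^ (cubeDiff R a l z.1 - cubeDiff R a l z.2) = 1) :
    CubeCollision fun s => ((pairVec z l s : ℤ) : ZMod Q) := by
  have hinv : ∀ n ∈ S, (n : ZMod Q) * (a n : ZMod Q) = 1 := fun n hn => by
    have := congrArg (ZMod.castHom hQM (ZMod Q)) (ha n hn)
    rw [map_intCast, map_one] at this; rw [mul_comm]
    exact_mod_cast this
  have hinv' : ∀ n ∈ S, (n : ZMod Q)⁻¹ = a n := fun n hn => by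
    have h3 := ZMod.mul_inv_of_unit (n : ZMod Q) (IsUnit.of_mul_eq_one _ (hinv n hn))
    calc (n : ZMod Q)⁻¹ = (n * a n) * (n : ZMod Q)⁻¹ := by rw [hinv n hn, one_mul]
      _ = a n * (n * (n : ZMod Q)⁻¹) := by ring
      _ = a n := by rw [h3, mul_one]
  set ρ : Bool ⊕ Fin R → ZMod Q := fun s => ((pairVec z l s : ℤ) : ZMod Q) with hρ
  have hv : ∀ b ω, cubeVertex ρ b ω = (((if b then z.2 else z.1) + vertexSum ω l : ℤ) : ZMod Q) :=
    fun b ω => by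
      simp only [cubeVertex, hρ, pairVec, Sum.elim_inl, Sum.elim_inr, vertexSum, Int.cast_add, Int.cast_sum]
      congr 1
      refine sum_congr rfl fun i _ => ?_
      split_ifs <;> simp
  have hmem : ∀ (b : Bool) ω, (if b then z.2 else z.1) + vertexSum ω l ∈ S := fun b ω => by
    cases b
    · exact h1 ω
    · exact h2 ω
  refine ⟨fun b ω => ?_, ?_⟩
  · rw [hv]; exact IsUnit.of_mul_eq_one _ (hinv _ (hmem b ω))
  · have h : Units.mk0 c hc0 ^ (cubeDiff R a l z.1 - cubeDiff R a l z.2) = 1 :=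
      Units.ext (by push_cast; exact h)
    rw [← orderOf_dvd_iff_zpow_eq_one, ← orderOf_units, Units.val_mk0, hc] at h
    have h3 := (Int.natCast_dvd_natCast.2 hQM).trans h
    rw [← ZMod.intCast_zmod_eq_zero_iff_dvd, Int.cast_sub, sub_eq_zero, cubeDiff_eq_sum,
      cubeDiff_eq_sum] at h3
    push_cast at h3
    refine Eq.trans (sum_congr rfl fun ω _ => ?_) (h3.trans (sum_congr rfl fun ω _ => ?_))
    · rw [hv, hinv' _ (hmem false ω)]; rfl
    · rw [hv, hinv' _ (hmem true ω)]; rfl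

theorem abs_iterDeriv_le {h : SymbolSpace → ℝ} (h1 : ∀ x, |h x| ≤ 1) (r : ℕ) (j : Fin r → ℤ)
    (x : SymbolSpace) : |iterDeriv r j h x| ≤ 1 := by
  induction r generalizing h with
  | zero => exact h1 x
  | succ r ih => exact ih (abs_mulDeriv_le h1 _) _

theorem card_symmBox_le (N R : ℕ) : ((symmBox N R).card : ℝ) ≤ 2 ^ R * (N : ℝ) ^ R := by
  rw [symmBox, Fintype.card_piFinset, ← mul_pow]
  simp only [prod_const, card_univ, Fintype.card_fin]; push_cast
  refine pow_le_pow_left₀ (by positivity) ?_ R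
  have h : (Ioo (-(N : ℤ)) N).card ≤ 2 * N := by rw [Int.card_Ioo]; omega
  exact_mod_cast h

theorem DilationSystem.exists_norm_integral_pat_cons_cons_le (D : DilationSystem κ)
    (hErg : Ergodic shift κ) (r : ℕ) {δ : ℝ} (hδ : 0 < δ) :
    ∃ M₀ : ℕ, ∀ (K : ℤ) (k : Fin r → ℤ) (e : SymbolSpace → ℂ) (c : ℂ), IsEigenfunction κ e c →
      0 < orderOf c → M₀ ≤ orderOf c →
        ‖∫ x, (pat (0 :: K :: List.ofFn k) x : ℂ) * e x ∂κ‖ ≤ δ := by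
  classical
  have hT := hErg.toMeasurePreserving
  obtain ⟨C, hC, hpairs⟩ := exists_sum_prime_pairs_le (r + 1)
  set d := 2 * 2 ^ (r + 1) with hd
  have hd0 : 0 < d := by positivity
  set X : ℝ := (δ / 2) ^ 2 ^ (r + 1 + 1)
  have hX0 : 0 < X := by positivity
  set Z : ℝ := 16 ^ 2 ^ (r + 1 + 1) * (2 ^ (r + 1) * (C * d)) with hZ
  obtain ⟨T, hT0⟩ := exists_nat_gt (Z / X)
  refine ⟨(T ^ d + 2).factorial + 1, fun K k e c he hc0 hc => ?_⟩
  set M := orderOf c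
  set B := ‖∫ x, (pat (0 :: K :: List.ofFn k) x : ℂ) * e x ∂κ‖ with hB
  by_contra! hδB
  obtain ⟨q, a, hq, hqa, hBq⟩ := exists_prime_pow_dvd_of_factorial_lt (Nat.lt_of_succ_le hc)
  have ha : 0 < a := by
    rcases Nat.eq_zero_or_pos a with rfl | h
    · rw [pow_zero] at hBq; omega
    · exact h
  obtain ⟨b, hba, hab, hTb⟩ := exists_exponent q d T a hq.pos hd0 ha (by omega)
  obtain ⟨N₀, hpairs⟩ := hpairs q hq a
  have hBpos : 0 < B := hδ.trans hδB
  have hsq : 2 * √((B / 4) ^ 2) = B / 2 := by rw [sqrt_sq (by positivity)]; ring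
  have hfreq := D.frequently_norm_integral_pat_pow_le hErg he hc0 (pow_orderOf_eq_one c) K k
    (ε := (B / 4) ^ 2) (by positivity) (by rw [hsq, ← hB]; linarith)
  rw [hsq, ← hB] at hfreq
  obtain ⟨m, ⟨S, a', w, hS, ha', hw1, hw2, hw3⟩, hm⟩ := (hfreq.and_eventually
    (eventually_ge_atTop N₀)).exists
  set N : ℕ := 8 ^ (m + 1)
  have hmN : m < N := (Nat.lt_succ_self m).trans (Nat.lt_pow_self (by norm_num))
  have hN1 : 1 < N := Nat.one_lt_pow (by omega) (by norm_num)
  have hL : 0 < log N := log_pos (by exact_mod_cast hN1)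
  have hN0 : (0 : ℝ) < N := by positivity
  set I : (Fin (r + 1) → ℤ) → ℝ := fun l =>
    ‖∫ x, (iterDeriv (r + 1) (fun i => vdcDirections K k i * l i) coord x : ℂ) *
      ∑ n ∈ Ico (0 : ℤ) N, w l n * e x ^ cubeDiff (r + 1) a' l n ∂κ‖
  have hq0 : (0 : ℝ) < (q : ℝ) ^ b := by have := hq.pos; positivity
  have hsum : ∑ l ∈ symmBox N (r + 1), I l ^ 2 ≤ (C * d / (q : ℝ) ^ b) *
      (N ^ (r + 1 + 2) / log N ^ 2 ^ (r + 1 + 1)) := by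
    refine le_trans (sum_le_sum fun l _ => ?_) ((hpairs N (by omega) S hS CubeCollision).trans ?_)
    · refine (norm_integral_mul_sq_le (abs_iterDeriv_le abs_coord_le _ _) ?_ (B := N) fun x => ?_).trans
        ((integral_norm_sq_sum_zpow_le hT he (Ico (0 : ℤ) N) (hw1 l) _).trans
          (Nat.cast_le.2 (card_le_card fun z hz => ?_)))
      · exact Finset.measurable_fun_sum _ fun n _ => measurable_const.mul (he.measurable_zpow _)
      · refine (norm_sum_le _ _).trans ((sum_le_sum (g := fun _ => (1 : ℝ)) fun n _ => ?_).trans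
          (by simp))
        rw [norm_mul, norm_zpow, he.norm_eq_one, one_zpow, mul_one]; exact hw1 l n
      · simp only [mem_filter] at hz ⊢
        exact ⟨hz.1, hw2 l _ hz.2.1, hw2 l _ hz.2.2.1, cubeCollision_of_zpow_eq_one hqa he.eigenvalue_ne_zero rfl ha'
          (hw2 l _ hz.2.1) (hw2 l _ hz.2.2.1) hz.2.2.2⟩
    · have h1 := card_cubeCollision_le hq hba (r + 1) hab
      rw [← hd] at h1
      have h2 : (q : ℝ) ^ b * (Nat.card {ρ : Bool ⊕ Fin (r + 1) → ZMod (q ^ a) // CubeCollision ρ} : ℝ) ≤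
          d * ((q ^ a : ℕ) : ℝ) ^ (r + 1 + 2) := by exact_mod_cast h1
      have hQ0 : (0 : ℝ) < ((q ^ a : ℕ) : ℝ) := by exact_mod_cast pow_pos hq.pos a
      rw [← le_div_iff₀' hq0] at h2
      refine (mul_le_mul_of_nonneg_right h2 (by positivity)).trans (le_of_eq ?_)
      rw [div_pow]; field_simp
  have hfin := pow_le_of_cube_sum_le (v := 2 ^ (r + 1)) (g := C * d / (q : ℝ) ^ b) (by linarith) hN0 hL hw3
    (by positivity) (by positivity) (by
      refine sq_sum_le_card_mul_sum_sq.trans ?_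
      exact mul_le_mul (card_symmBox_le N (r + 1)) hsum (sum_nonneg fun _ _ => sq_nonneg _)
        (by positivity))
  have h5 : X ≤ Z / (q : ℝ) ^ b := by
    refine (pow_le_pow_left₀ (by positivity) (by linarith) _).trans (hfin.trans (le_of_eq ?_))
    rw [hZ]; ring
  have h6 : (T : ℝ) ≤ (q : ℝ) ^ b := by exact_mod_cast hTb
  rw [le_div_iff₀ hq0] at h5
  rw [div_lt_iff₀ hX0] at hT0; nlinarith

/-- Patterns of bounded length are almost orthogonal to eigenfunctions of large order. -/
theorem DilationSystem.exists_norm_sq_integral_pat_le (D : DilationSystem κ) (hErg : Ergodic shift κ)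
    (n : ℕ) (δ : ℝ) (hδ : 0 < δ) : ∃ M : ℕ, ∀ l : List ℤ, l.length = n → ∀ e c,
      IsEigenfunction κ e c → (∀ m : ℕ, 0 < m → m < M → c ^ m ≠ 1) →
        ‖∫ x, (pat l x : ℂ) * e x ∂κ‖ ^ 2 ≤ δ := by
  have hT := hErg.toMeasurePreserving
  have hinf : ∀ (l : List ℤ) {e : SymbolSpace → ℂ} {c : ℂ}, IsEigenfunction κ e c → orderOf c = 0 →
      ‖∫ x, (pat l x : ℂ) * e x ∂κ‖ ^ 2 ≤ δ := fun l e c he hc => by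
    rw [D.integral_pat_mul_eq_zero_of_infinite_order hErg he
      (fun n hn h => orderOf_eq_zero_iff'.1 hc n hn h) l]
    simpa using hδ.le
  match n with
  | 0 =>
    refine ⟨2, fun l hl e c he hc => ?_⟩
    rw [List.length_eq_zero_iff] at hl
    have := integral_zpow_eq_zero hT he (j := 1) (by simpa using hc 1 one_pos one_lt_two)
    simp only [zpow_one] at this
    simp [hl, pat, this, hδ.le]
  | 1 =>
    refine ⟨0, fun l hl e c he _ => ?_⟩
    obtain ⟨x, rfl⟩ := List.length_eq_one_iff.1 hl
    rcases Nat.eq_zero_or_pos (orderOf c) with h0 | h0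
    · exact hinf _ he h0
    · have h1 := norm_integral_pat_map_add hT he [0] x
      simp only [List.map_cons, List.map_nil, zero_add, ← coord_eq_pat] at h1
      rw [h1, D.integral_coord_mul_eigenfunction_eq_zero hErg he h0 (pow_orderOf_eq_one c)]; simpa using hδ.le
  | r + 2 =>
    obtain ⟨M, hM⟩ := D.exists_norm_integral_pat_cons_cons_le hErg r (sqrt_pos.2 hδ)
    refine ⟨M, fun l hl e c he hc => ?_⟩
    rcases Nat.eq_zero_or_pos (orderOf c) with h0 | h0
    · exact hinf _ he h0
    match l, hl with
    | x :: y :: t, hl =>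
      obtain rfl : t.length = r := by simpa using hl
      have h1 := hM (y - x) (fun i => t.get i - x) e c he h0
        (not_lt.1 fun h => hc _ h0 h (pow_orderOf_eq_one c))
      have h2 : (0 :: (y - x) :: List.ofFn fun i => t.get i - x).map (· + x) = x :: y :: t := by
        rw [List.map_cons, List.map_cons, List.map_ofFn, zero_add, sub_add_cancel]
        congr 2
        conv_rhs => rw [← List.ofFn_get t]
        exact congrArg _ (funext fun i => by simp)
      rw [← h2, norm_integral_pat_map_add hT he]
      calc _ ≤ √δ ^ 2 := pow_le_pow_left₀ (norm_nonneg _) h1 2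
        _ = δ := sq_sqrt hδ.le

end EigenCorrelations

section Chowla

variable {κ : Measure SymbolSpace} [IsProbabilityMeasure κ]

theorem DilationSystem.integral_pat_ofFn_eq_zero (D : DilationSystem κ) (hErg : Ergodic shift κ) (r : ℕ)
    (k : Fin (r + 1) → ℕ) (hk : StrictMono k) :
    ∫ x, pat (List.ofFn fun i => (k i : ℤ)) x ∂κ = 0 := by
  have hT := hErg.toMeasurePreserving
  have he : IsEigenfunction κ (fun _ => 1) 1 := ⟨measurable_const, by simp, by simp⟩
  set k₀ : Fin (r + 1) → ℤ := fun i => k i - k 0 with hk₀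
  have h1 : ∫ x, pat (List.ofFn fun i => (k i : ℤ)) x ∂κ = ∫ x, pat (List.ofFn k₀) x ∂κ := by
    rw [← integral_comp_shiftBy hT (k 0) (pat (List.ofFn k₀))]
    simp only [pat_shiftBy, List.map_ofFn]
    simp [hk₀, Function.comp_def]
  rw [h1]
  cases r with
  | zero =>
    have h2 := D.integral_coord_mul_eigenfunction_eq_zero hErg he one_pos (one_pow 1)
    simp only [mul_one, integral_complex_ofReal, Complex.ofReal_eq_zero] at h2
    simpa [hk₀, ← coord_eq_pat] using h2
  | succ r =>
    have h2 : List.ofFn k₀ = 0 :: k₀ 1 :: List.ofFn fun i : Fin r => k₀ i.succ.succ := by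
      rw [List.ofFn_succ, List.ofFn_succ]
      simp [hk₀]
    have hne : ∀ i j, i ≠ j → k₀ i ≠ k₀ j := fun i j hij h =>
      hij (hk.injective (by simp only [hk₀] at h; omega))
    rw [h2]
    refine D.integral_pat_eq_zero_of_gowersAvg_le hErg _ _ (fun i => ?_) fun ε hε =>
      D.exists_gowersAvg_coord_le hErg (D.exists_norm_sq_integral_pat_le hErg) r hε
    refine Fin.cases ?_ (fun i => ?_) i
    · have := hne 1 0 (by simp)
      simpa [vdcDirections, hk₀] using this
    · simp only [vdcDirections, Fin.cons_succ]
      exact sub_ne_zero.2 (hne _ _ fun h => by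
        have := congrArg Fin.val h
        simp at this)

theorem pat_liouvillePoint {r : ℕ} (k : Fin r → ℕ) {n : ℕ} (hn : 1 ≤ n) :
    pat (List.ofFn fun i => (k i : ℤ)) (shift^[n] liouvillePoint) =
      ∏ i, ((liouville (n + k i) : ℤ) : ℝ) := by
  rw [pat, List.map_ofFn, List.prod_ofFn]
  refine prod_congr rfl fun i _ => ?_
  have h : ((k i : ℤ) + n).natAbs = n + k i := by omega
  have h0 : (k i : ℤ) + n ≠ 0 := by omega
  simp [iterate_shift, coord, shiftBy, liouvillePoint, h, h0]

end Chowla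

/-- If the two-sided Liouville sequence is generic under the left shift for a Borel
probability measure `κ` (weak-* convergence of empirical measures, expressed by testing
against continuous functions) and `κ` is ergodic, then the Chowla conjecture holds for
the Liouville function. -/
theorem liouville_generic_ergodic_implies_chowla
    (κ : Measure SymbolSpace) [IsProbabilityMeasure κ]
    (hgen : ∀ f : C(SymbolSpace, ℝ),
      Tendsto
        (fun N : ℕ => (1 / (N : ℝ)) *
          ∑ n ∈ Finset.Icc 1 N, f (shift^[n] liouvillePoint))
        atTop (nhds (∫ y, f y ∂κ)))
    (hErg : Ergodic shift κ) :
    ∀ (r : ℕ) (k : Fin (r + 1) → ℕ), StrictMono k →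
      Tendsto
        (fun N : ℕ => (1 / (N : ℝ)) *
          ∑ n ∈ Finset.Icc 1 N, ∏ i, ((liouville (n + k i) : ℤ) : ℝ))
        atTop (nhds 0) := by
  intro r k hk
  obtain ⟨D⟩ := nonempty_dilationSystem hgen hErg
  have h := hgen ⟨pat (List.ofFn fun i => (k i : ℤ)), continuous_pat _⟩
  simp only [ContinuousMap.coe_mk] at h
  rw [D.integral_pat_ofFn_eq_zero hErg r k hk] at h
  refine h.congr fun N => ?_
  rw [Finset.sum_congr rfl fun n hn => pat_liouvillePoint k (Finset.mem_Icc.1 hn).1]
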